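/- Let n ≥ 1, −1 < γ < 0, 1 < p < ∞, and η ∈ (0,1). Then there exist ε₀ > 0, ρ > 0, δ ∈ (0,1) with ρ < (1−δ)^{γ+1}, B > 0 and C₁ > 0, all depending only on p, n, γ, η, with the following property. Let u be a viscosity solution of ∂_t u − |Du|^γ Δ_p^N u = f in Q₁ with osc_{Q₁} u ≤ 1 and ‖f‖_{L^∞(Q₁)} ≤ ε₀, and let k ≥ 0 be an integer. If for each i = 0,…,k there exists l_i ∈ ℝⁿ with |l_i| ≤ 2(1−δ)^i such that osc_{(x,t) ∈ Q_{ρ^i}^{(1−δ)^i}} (u(x,t) − l_i·x) ≤ η ρ^i (1−δ)^i, then there exists l_{k+1} ∈ ℝⁿ such that osc_{(x,t) ∈ Q_{ρ^{k+1}}^{(1−δ)^{k+1}}} (u(x,t) − l_{k+1}·x) ≤ η ρ^{k+1} (1−δ)^{k+1}, with |l_{k+1}| ≤ B(1−δ)^k and |l_{k+1} − l_k| ≤ C₁(1−δ)^k. -/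

import Mathlib

open Set Real RealInnerProductSpace

noncomputable section

/-- `ℝⁿ` with the Euclidean structure. -/
abbrev En (n : ℕ) : Type := EuclideanSpace ℝ (Fin n)

/-- The parabolic cylinder `Q_r := B_r(0) × (-r², 0) ⊂ ℝⁿ × ℝ`. -/
def pCyl (n : ℕ) (r : ℝ) : Set (En n × ℝ) :=
  {z | ‖z.1‖ < r ∧ z.2 ∈ Set.Ioo (-r ^ 2) (0 : ℝ)}

/-- The intrinsic cylinder `Q_r^a := B_r(0) × (-r² a^{-γ}, 0)`. -/
def iCyl (n : ℕ) (γ r a : ℝ) : Set (En n × ℝ) :=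
  {z | ‖z.1‖ < r ∧ z.2 ∈ Set.Ioo (-(r ^ 2 * a ^ (-γ))) (0 : ℝ)}

/-- Spatial gradient of a function of space and time. -/
def sGrad {n : ℕ} (φ : En n × ℝ → ℝ) (x : En n) (t : ℝ) : En n :=
  gradient (fun y => φ (y, t)) x

/-- Spatial Hessian of a function of space and time. -/
def sHess {n : ℕ} (φ : En n × ℝ → ℝ) (x : En n) (t : ℝ) : En n →L[ℝ] En n :=
  fderiv ℝ (fun y => sGrad φ y t) x

/-- The value `|q|^γ (tr H + (p-2) ⟨H q, q⟩ / |q|²)`, i.e. `|q|^γ` times the normalized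
`p`-Laplacian computed from a gradient `q ≠ 0` and a Hessian `H`. -/
def opVal {n : ℕ} (γ p : ℝ) (q : En n) (H : En n →L[ℝ] En n) : ℝ :=
  ‖q‖ ^ γ * (LinearMap.trace ℝ (En n) H.toLinearMap + (p - 2) * ⟪H q, q⟫ / ‖q‖ ^ 2)

/-- Viscosity supersolution of `∂ₜ u - |Du|^γ Δ_p^N u = f` on `Ω`. -/
def IsSupersol {n : ℕ} (γ p : ℝ) (f u : En n × ℝ → ℝ) (Ω : Set (En n × ℝ)) : Prop :=
  (∀ z ∈ Ω, ∀ φ : En n × ℝ → ℝ, ContDiff ℝ 2 φ →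
      sGrad φ z.1 z.2 ≠ 0 → φ z = u z → (∀ w ∈ Ω, φ w ≤ u w) →
      f z ≤ deriv (fun s => φ (z.1, s)) z.2
            - opVal γ p (sGrad φ z.1 z.2) (sHess φ z.1 z.2)) ∧
  (∀ z ∈ Ω, ∀ δ : ℝ, 0 < δ → ∀ φ : ℝ → ℝ,
      ContDiffOn ℝ 1 φ (Set.Ioo (z.2 - δ) (z.2 + δ)) → φ z.2 = 0 →
      (∀ t ∈ Set.Ioo (z.2 - δ) (z.2 + δ), u (z.1, z.2) ≤ u (z.1, t) - φ t) →
      (∃ ε > (0:ℝ), ∃ c : ℝ, ∀ x : En n, ‖x - z.1‖ < ε →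
          sInf ((fun t => u (x, t) - φ t) '' Set.Ioo (z.2 - δ) (z.2 + δ)) = c) →
      f z ≤ deriv φ z.2)

/-- Viscosity subsolution of `∂ₜ u - |Du|^γ Δ_p^N u = f` on `Ω`. -/
def IsSubsol {n : ℕ} (γ p : ℝ) (f u : En n × ℝ → ℝ) (Ω : Set (En n × ℝ)) : Prop :=
  (∀ z ∈ Ω, ∀ φ : En n × ℝ → ℝ, ContDiff ℝ 2 φ →
      sGrad φ z.1 z.2 ≠ 0 → φ z = u z → (∀ w ∈ Ω, u w ≤ φ w) →
      deriv (fun s => φ (z.1, s)) z.2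
            - opVal γ p (sGrad φ z.1 z.2) (sHess φ z.1 z.2) ≤ f z) ∧
  (∀ z ∈ Ω, ∀ δ : ℝ, 0 < δ → ∀ φ : ℝ → ℝ,
      ContDiffOn ℝ 1 φ (Set.Ioo (z.2 - δ) (z.2 + δ)) → φ z.2 = 0 →
      (∀ t ∈ Set.Ioo (z.2 - δ) (z.2 + δ), u (z.1, t) - φ t ≤ u (z.1, z.2)) →
      (∃ ε > (0:ℝ), ∃ c : ℝ, ∀ x : En n, ‖x - z.1‖ < ε →
          sSup ((fun t => u (x, t) - φ t) '' Set.Ioo (z.2 - δ) (z.2 + δ)) = c) →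
      deriv φ z.2 ≤ f z)

/-- Viscosity solution of `∂ₜ u - |Du|^γ Δ_p^N u = f` on `Ω`: a continuous function which is
both a viscosity supersolution and a viscosity subsolution. -/
def IsViscSol {n : ℕ} (γ p : ℝ) (f u : En n × ℝ → ℝ) (Ω : Set (En n × ℝ)) : Prop :=
  ContinuousOn u Ω ∧ IsSupersol γ p f u Ω ∧ IsSubsol γ p f u Ω

/-- Viscosity solution of the deviation equation
`∂ₜ w - |Dw+K|^γ [Δw + (p-2)⟨D²w (Dw+K), Dw+K⟩/|Dw+K|²] = f` on `Ω`; equivalently,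
`u(x,t) := w(x,t) + K·x` is a viscosity solution of `∂ₜ u - |Du|^γ Δ_p^N u = f`. -/
def IsDevSol {n : ℕ} (γ p : ℝ) (K : En n) (f w : En n × ℝ → ℝ) (Ω : Set (En n × ℝ)) : Prop :=
  IsViscSol γ p f (fun z => w z + ⟪K, z.1⟫) Ω

set_option linter.unusedSectionVars false
set_option linter.unusedVariables false

/-- `u` has second order upper expansion at `z`. -/
def SupJet {V : Type*} [NormedAddCommGroup V] [NormedSpace ℝ V] (u : V → ℝ) (z : V)
    (L : V →L[ℝ] ℝ) (B : V →L[ℝ] V →L[ℝ] ℝ) : Prop :=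
  ∀ ε > 0, ∀ᶠ w in nhds (0 : V), u (z + w) ≤ u z + L w + B w w + ε * ‖w‖ ^ 2

section C11
variable {V : Type*} [NormedAddCommGroup V] [NormedSpace ℝ V]

theorem c11_lip {f : V → ℝ} {G : V → V →L[ℝ] ℝ} {K : ℝ} (hK : 0 ≤ K)
    (hG : ∀ x h, |f (x + h) - f x - G x h| ≤ K * ‖h‖ ^ 2) (x y : V) :
    ‖G y - G x‖ ≤ 6 * K * ‖y - x‖ := by
  set r := ‖y - x‖ with hr
  rcases eq_or_lt_of_le (norm_nonneg (y - x)) with h0 | h0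
  · have : y = x := by
      rw [← sub_eq_zero]; exact norm_eq_zero.1 h0.symm
    subst this; simp [hr]
  have key : ∀ h : V, ‖h‖ = r → |(G y - G x) h| ≤ 6 * K * r ^ 2 := by
    intro h hh
    have h1 := abs_le.1 (hG y h)
    have h2 := abs_le.1 (hG x (y - x + h))
    have h3 := abs_le.1 (hG x (y - x))
    have e1 : x + (y - x + h) = y + h := by abel
    have e2 : x + (y - x) = y := by abel
    rw [e1, map_add] at h2
    rw [e2] at h3
    have n1 : ‖y - x + h‖ ≤ 2 * r := by
      calc ‖y - x + h‖ ≤ ‖y - x‖ + ‖h‖ := norm_add_le _ _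
        _ = 2 * r := by rw [hh, ← hr]; ring
    have n2 : K * ‖y - x + h‖ ^ 2 ≤ K * (2 * r) ^ 2 := by gcongr
    rw [hh] at h1
    rw [← hr] at h3
    have : (G y - G x) h = G y h - G x h := rfl
    rw [this, abs_le]
    constructor <;> nlinarith
  refine ContinuousLinearMap.opNorm_le_bound _ (by positivity) fun h => ?_
  rcases eq_or_ne h 0 with rfl | hne
  · simp
  have hp : 0 < ‖h‖ := norm_pos_iff.2 hne
  have := key ((r / ‖h‖) • h) (by
    rw [norm_smul, Real.norm_of_nonneg (by positivity)]; field_simp)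
  rw [map_smul, smul_eq_mul, abs_mul, abs_of_nonneg (by positivity : 0 ≤ r / ‖h‖)] at this
  rw [Real.norm_eq_abs]
  have h4 : r * |(G y - G x) h| ≤ r * (6 * K * r * ‖h‖) := by
    have := mul_le_mul_of_nonneg_right this hp.le
    calc r * |(G y - G x) h| = r / ‖h‖ * |(G y - G x) h| * ‖h‖ := by field_simp
      _ ≤ _ := this
      _ = _ := by ring
  exact le_of_mul_le_mul_left h4 h0

theorem c11_hasFDerivAt {f : V → ℝ} {G : V → V →L[ℝ] ℝ} {K : ℝ}
    (hG : ∀ x h, |f (x + h) - f x - G x h| ≤ K * ‖h‖ ^ 2) (x : V) :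
    HasFDerivAt f (G x) x := by
  rw [hasFDerivAt_iff_isLittleO_nhds_zero]
  refine Asymptotics.IsBigO.trans_isLittleO (g := fun h : V => ‖h‖ ^ 2) ?_ ?_
  · refine Asymptotics.IsBigO.of_bound K (Filter.Eventually.of_forall fun h => ?_)
    simpa using hG x h
  · have := Asymptotics.isLittleO_norm_pow_id (E' := V) (n := 2) (by norm_num)
    exact this

theorem c11_second {f : V → ℝ} {G : V → V →L[ℝ] ℝ} {K : ℝ}
    (hG : ∀ x h, |f (x + h) - f x - G x h| ≤ K * ‖h‖ ^ 2) (x : V)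
    {B : V →L[ℝ] V →L[ℝ] ℝ} (hB : HasFDerivAt G B x) {ε : ℝ} (hε : 0 < ε) :
    ∀ᶠ h in nhds (0 : V), |f (x + h) - f x - G x h - (1 / 2) * B h h| ≤ ε * ‖h‖ ^ 2 := by
  rw [hasFDerivAt_iff_isLittleO_nhds_zero] at hB
  have h1 := hB.def hε
  rw [Metric.eventually_nhds_iff] at h1 ⊢
  obtain ⟨r, hr, h1⟩ := h1
  refine ⟨r, hr, fun h hh => ?_⟩
  rw [dist_zero_right] at hh
  have hd : ∀ t ∈ Icc (0 : ℝ) 1, HasDerivWithinAt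
      (fun t : ℝ => f (x + t • h) - t * G x h - (1 / 2) * t ^ 2 * B h h)
      (G (x + t • h) h - G x h - t * B h h) (Icc 0 1) t := by
    intro t _
    have a1 : HasDerivAt (fun t : ℝ => x + t • h) h t := by
      simpa using ((hasDerivAt_id t).smul_const h).const_add x
    have a2 := (c11_hasFDerivAt hG (x + t • h)).comp_hasDerivAt t a1
    have a3 := ((hasDerivAt_id t).mul_const (G x h))
    have a4 := (((hasDerivAt_id t).pow 2).const_mul (1 / 2 : ℝ)).mul_const (B h h)
    refine (((a2.sub a3).sub a4).congr_deriv ?_).hasDerivWithinAt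
    simp
  have := norm_image_sub_le_of_norm_deriv_le_segment_01' (C := ε * ‖h‖ ^ 2) hd (by
    intro t ht
    have ht' : ‖t • h‖ ≤ ‖h‖ := by
      rw [norm_smul, Real.norm_of_nonneg ht.1]
      exact mul_le_of_le_one_left (norm_nonneg _) ht.2.le
    have h2 := h1 (y := t • h) (by rw [dist_zero_right]; linarith)
    have h3 := (G (x + t • h) - G x - B (t • h)).le_opNorm h
    have e : (G (x + t • h) - G x - B (t • h)) h = G (x + t • h) h - G x h - t * B h h := by
      simp
    rw [e] at h3
    calc _ ≤ _ := h3
      _ ≤ (ε * ‖h‖) * ‖h‖ := by gcongr; exact h2.trans (by gcongr)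
      _ = _ := by ring)
  simp only [one_smul, zero_smul, add_zero, Real.norm_eq_abs] at this
  convert this using 2
  ring
end C11

section LL
variable {F : Type*} [NormedAddCommGroup F] [InnerProductSpace ℝ F]

/-- sup-convolution over a set -/
def sconv (S : Set F) (a : F → ℝ) (l : ℝ) (x : F) : ℝ :=
  sSup ((fun h => a h - ‖x - h‖ ^ 2 / (2 * l)) '' S)

theorem sconv_exists {S : Set F} (hS : IsCompact S) (h0 : S.Nonempty) {a : F → ℝ}
    (ha : ContinuousOn a S) (l : ℝ) (x : F) :
    ∃ h ∈ S, sconv S a l x = a h - ‖x - h‖ ^ 2 / (2 * l) := by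
  have hc : ContinuousOn (fun h => a h - ‖x - h‖ ^ 2 / (2 * l)) S := by
    refine ha.sub (Continuous.continuousOn ?_)
    fun_prop
  obtain ⟨h, hh, he⟩ := hS.exists_sSup_image_eq h0 hc
  exact ⟨h, hh, he⟩

theorem sconv_ge {S : Set F} (hS : IsCompact S) {a : F → ℝ}
    (ha : ContinuousOn a S) (l : ℝ) (x : F) {h : F} (hh : h ∈ S) :
    a h - ‖x - h‖ ^ 2 / (2 * l) ≤ sconv S a l x := by
  have hc : ContinuousOn (fun h => a h - ‖x - h‖ ^ 2 / (2 * l)) S := by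
    refine ha.sub (Continuous.continuousOn ?_)
    fun_prop
  exact le_csSup (hS.bddAbove_image hc) (mem_image_of_mem _ hh)

theorem sconv_continuous {S : Set F} (hS : IsCompact S) {a : F → ℝ}
    (ha : ContinuousOn a S) (l : ℝ) : Continuous (sconv S a l) := by
  have : CompactSpace S := isCompact_iff_compactSpace.1 hS
  have hc : Continuous (fun p : F × S => a p.2 - ‖p.1 - (p.2 : F)‖ ^ 2 / (2 * l)) := by
    have : Continuous (fun h : S => a h) := continuousOn_iff_continuous_domRestrict.1 ha
    exact (this.comp continuous_snd).sub (by fun_prop)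
  have := (isCompact_univ (X := S)).continuous_sSup
    (f := fun (x : F) (h : S) => a h - ‖x - (h : F)‖ ^ 2 / (2 * l))
    (by simpa only [Function.HasUncurry.uncurry, id] using hc)
  convert this using 2 with x
  unfold sconv
  congr 1
  ext y
  simp

/-- infimal convolution -/
def iconv (s : F → ℝ) (d : ℝ) (x : F) : ℝ := sInf (range fun y => s y + ‖x - y‖ ^ 2 / (2 * d))

theorem cs_ineq {l d : ℝ} (hl : 0 < l) (hd : 0 < d) (v w : F) :
    ‖w - v‖ ^ 2 / (2 * (l + d)) ≤ ‖v‖ ^ 2 / (2 * d) + ‖w‖ ^ 2 / (2 * l) := by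
  have h1 : ‖w - v‖ ≤ ‖w‖ + ‖v‖ := norm_sub_le _ _
  have h2 : ‖w - v‖ ^ 2 ≤ (‖w‖ + ‖v‖) ^ 2 := by gcongr
  rw [div_add_div _ _ (by positivity) (by positivity), div_le_div_iff₀ (by positivity) (by positivity)]
  have h3 : ‖w - v‖ ^ 2 * (2 * d * (2 * l)) ≤ (‖w‖ + ‖v‖) ^ 2 * (2 * d * (2 * l)) := by gcongr
  nlinarith [sq_nonneg (‖v‖ * l - ‖w‖ * d)]

variable [FiniteDimensional ℝ F]

theorem iconv_spec {s : F → ℝ} (hs : Continuous s) {l d : ℝ} (hd : 0 < d)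
    (hld : 3 * d ≤ l) (hlow : ∀ y, -(‖y‖ ^ 2 / (2 * (l + d))) ≤ s y) (x : F) :
    ∃ y, iconv s d x = s y + ‖x - y‖ ^ 2 / (2 * d) ∧
      ∀ y', iconv s d x ≤ s y' + ‖x - y'‖ ^ 2 / (2 * d) := by
  have hc : Continuous fun y => s y + ‖x - y‖ ^ 2 / (2 * d) := by fun_prop
  have hlow2 : ∀ y, ‖x - y‖ ^ 2 / (4 * d) - ‖x‖ ^ 2 / (4 * d) ≤ s y + ‖x - y‖ ^ 2 / (2 * d) := by
    intro y
    have h1 := hlow y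
    have h2 : ‖y‖ ^ 2 / (2 * (l + d)) ≤ ‖y‖ ^ 2 / (8 * d) := by
      exact div_le_div_of_nonneg_left (by positivity) (by positivity) (by linarith)
    have h3 : ‖y‖ ≤ ‖x‖ + ‖x - y‖ := by
      have := norm_sub_le x (x - y); simpa using this
    have h4 : ‖y‖ ^ 2 ≤ 2 * ‖x‖ ^ 2 + 2 * ‖x - y‖ ^ 2 := by
      nlinarith [norm_nonneg y, sq_nonneg (‖x‖ - ‖x - y‖)]
    have h5 : ‖y‖ ^ 2 / (8 * d) ≤ (2 * ‖x‖ ^ 2 + 2 * ‖x - y‖ ^ 2) / (8 * d) := by gcongr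
    have h6 : (2 * ‖x‖ ^ 2 + 2 * ‖x - y‖ ^ 2) / (8 * d)
        = ‖x‖ ^ 2 / (4 * d) + ‖x - y‖ ^ 2 / (4 * d) := by field_simp; ring
    have h7 : ‖x - y‖ ^ 2 / (2 * d) = 2 * (‖x - y‖ ^ 2 / (4 * d)) := by field_simp; ring
    linarith
  obtain ⟨y, hy⟩ := hc.exists_forall_le' x (by
    have : Filter.Tendsto (fun y => ‖x - y‖ ^ 2 / (4 * d) - ‖x‖ ^ 2 / (4 * d))
        (Filter.cocompact F) Filter.atTop := by
      refine Filter.tendsto_atTop_add_const_right _ _ ?_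
      refine Filter.Tendsto.atTop_div_const (by positivity) ?_
      refine (Filter.tendsto_pow_atTop (by norm_num)).comp ?_
      have h := tendsto_norm_cocompact_atTop (E := F)
      have h2 : Filter.Tendsto (fun y => ‖y‖ - ‖x‖) (Filter.cocompact F) Filter.atTop :=
        Filter.tendsto_atTop_add_const_right _ _ h
      refine Filter.tendsto_atTop_mono (fun y => ?_) h2
      rw [norm_sub_rev]; exact norm_sub_norm_le _ _
    filter_upwards [this.eventually (Filter.eventually_ge_atTop (s x + ‖x - x‖ ^ 2 / (2 * d)))]
      with y hy using hy.trans (hlow2 y))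
  have hI : IsLeast (range fun y => s y + ‖x - y‖ ^ 2 / (2 * d)) (s y + ‖x - y‖ ^ 2 / (2 * d)) :=
    ⟨⟨y, rfl⟩, by rintro _ ⟨y', rfl⟩; exact hy y'⟩
  have e : iconv s d x = s y + ‖x - y‖ ^ 2 / (2 * d) := hI.csInf_eq
  exact ⟨y, e, fun y' => e ▸ hy y'⟩

/-- The Lasry-Lions regularization. -/
def LLr (S : Set F) (a : F → ℝ) (l d : ℝ) : F → ℝ := iconv (sconv S a (l + d)) d

theorem LL_spec {S : Set F} (hS : IsCompact S) (h0 : (0 : F) ∈ S) {a : F → ℝ}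
    (ha : ContinuousOn a S) (ha0 : a 0 = 0) {l d : ℝ} (hd : 0 < d) (hld : 3 * d ≤ l)
    (x : F) : ∃ y, LLr S a l d x = sconv S a (l + d) y + ‖x - y‖ ^ 2 / (2 * d) ∧
      ∀ y', LLr S a l d x ≤ sconv S a (l + d) y' + ‖x - y'‖ ^ 2 / (2 * d) := by
  refine iconv_spec (sconv_continuous hS ha _) hd hld (fun y => ?_) x
  have := sconv_ge hS ha (l + d) y h0
  rw [ha0, sub_zero] at this
  linarith

theorem LL_ge {S : Set F} (hS : IsCompact S) (h0 : (0 : F) ∈ S) {a : F → ℝ}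
    (ha : ContinuousOn a S) (ha0 : a 0 = 0) {l d : ℝ} (hd : 0 < d) (hld : 3 * d ≤ l)
    (x : F) : sconv S a l x ≤ LLr S a l d x := by
  obtain ⟨y, hy, -⟩ := LL_spec hS h0 ha ha0 hd hld x
  obtain ⟨h, hh, he⟩ := sconv_exists hS ⟨0, h0⟩ ha l x
  have h1 := sconv_ge hS ha (l + d) y hh
  have h2 := cs_ineq (by linarith : 0 < l) hd (x - y) (x - h)
  have e : x - h - (x - y) = y - h := by abel
  rw [e] at h2
  linarith

theorem LL_le {S : Set F} (hS : IsCompact S) (h0 : (0 : F) ∈ S) {a : F → ℝ}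
    (ha : ContinuousOn a S) (ha0 : a 0 = 0) {l d : ℝ} (hd : 0 < d) (hld : 3 * d ≤ l)
    {P : F → ℝ} (x0 g : F) (hP : ∀ v, P (x0 + v) ≤ P x0 + ⟪g, v⟫ + ‖v‖ ^ 2 / (2 * d))
    (hle : ∀ x, sconv S a l x ≤ P x) : LLr S a l d x0 ≤ P x0 := by
  obtain ⟨-, -, hy⟩ := LL_spec hS h0 ha ha0 hd hld x0
  have hl : 0 < l := by linarith
  specialize hy (x0 - d • g)
  obtain ⟨h, hh, he⟩ := sconv_exists hS ⟨0, h0⟩ ha (l + d) (x0 - d • g)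
  set x' := x0 - d • g with hx'
  set v : F := (d / (l + d)) • (h - x') - d • g with hv
  have h1 := sconv_ge hS ha l (x0 + v) hh
  have h2 := hle (x0 + v)
  have h3 := hP v
  have e1 : x0 + v - h = -((l / (l + d)) • (h - x')) := by
    have : (l / (l + d)) = 1 - d / (l + d) := by field_simp; ring
    rw [this, sub_smul, one_smul, hv, hx']; abel
  have e2 : ‖x0 + v - h‖ ^ 2 = (l / (l + d)) ^ 2 * ‖h - x'‖ ^ 2 := by
    rw [e1, norm_neg, norm_smul, Real.norm_of_nonneg (by positivity)]; ring
  have e3 : v + d • g = (d / (l + d)) • (h - x') := by rw [hv]; abel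
  have e4 : ‖v + d • g‖ ^ 2 = (d / (l + d)) ^ 2 * ‖h - x'‖ ^ 2 := by
    rw [e3, norm_smul, Real.norm_of_nonneg (by positivity)]; ring
  have e5 : ‖v + d • g‖ ^ 2 = ‖v‖ ^ 2 + 2 * d * ⟪g, v⟫ + d ^ 2 * ‖g‖ ^ 2 := by
    rw [norm_add_sq_real, inner_smul_right, norm_smul, Real.norm_of_nonneg hd.le,
      real_inner_comm]; ring
  have e6 : ‖x0 - x'‖ ^ 2 = d ^ 2 * ‖g‖ ^ 2 := by
    rw [hx', sub_sub_cancel, norm_smul, Real.norm_of_nonneg hd.le]; ring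
  have e7 : ‖x' - h‖ ^ 2 = ‖h - x'‖ ^ 2 := by rw [norm_sub_rev]
  rw [e2] at h1
  rw [he, e7, e6] at hy
  have e8 : ⟪g, v⟫ + ‖v‖ ^ 2 / (2 * d) = (d / (l + d)) ^ 2 * ‖h - x'‖ ^ 2 / (2 * d)
      - d ^ 2 * ‖g‖ ^ 2 / (2 * d) := by
    rw [← e4, e5]; field_simp; ring
  have e9 : (d / (l + d)) ^ 2 * ‖h - x'‖ ^ 2 / (2 * d) + (l / (l + d)) ^ 2 * ‖h - x'‖ ^ 2 / (2 * l)
      = ‖h - x'‖ ^ 2 / (2 * (l + d)) := by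
    field_simp; ring
  linarith

theorem LL_upper {S : Set F} (hS : IsCompact S) (h0 : (0 : F) ∈ S) {a : F → ℝ}
    (ha : ContinuousOn a S) (ha0 : a 0 = 0) {l d : ℝ} (hd : 0 < d) (hld : 3 * d ≤ l)
    (x : F) : ∃ g : F, ∀ h, LLr S a l d (x + h) ≤
    LLr S a l d x + ⟪g, h⟫ + ‖h‖ ^ 2 / (2 * d) := by
  obtain ⟨y, hy, -⟩ := LL_spec hS h0 ha ha0 hd hld x
  refine ⟨(1 / d) • (x - y), fun h => ?_⟩
  obtain ⟨-, -, hy'⟩ := LL_spec hS h0 ha ha0 hd hld (x + h)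
  specialize hy' y
  have e : ‖x + h - y‖ ^ 2 = ‖x - y‖ ^ 2 + 2 * ⟪x - y, h⟫ + ‖h‖ ^ 2 := by
    rw [← norm_add_sq_real]; congr 2; abel
  rw [e] at hy'
  rw [inner_smul_left, hy]
  simp only [conj_trivial]
  have : (‖x - y‖ ^ 2 + 2 * ⟪x - y, h⟫ + ‖h‖ ^ 2) / (2 * d) =
    ‖x - y‖ ^ 2 / (2 * d) + 1 / d * ⟪x - y, h⟫ + ‖h‖ ^ 2 / (2 * d) := by field_simp
  linarith

theorem LL_mid {S : Set F} (hS : IsCompact S) (h0 : (0 : F) ∈ S) {a : F → ℝ}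
    (ha : ContinuousOn a S) (ha0 : a 0 = 0) {l d : ℝ} (hd : 0 < d) (hld : 3 * d ≤ l)
    (x h : F) : 2 * LLr S a l d x - ‖h‖ ^ 2 / l ≤
    LLr S a l d (x + h) + LLr S a l d (x - h) := by
  have hl : 0 < l := by linarith
  obtain ⟨y1, hy1, -⟩ := LL_spec hS h0 ha ha0 hd hld (x + h)
  obtain ⟨y2, hy2, -⟩ := LL_spec hS h0 ha ha0 hd hld (x - h)
  obtain ⟨-, -, hy⟩ := LL_spec hS h0 ha ha0 hd hld x
  set m : F := (1 / 2 : ℝ) • (y1 + y2) with hm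
  set v : F := (1 / 2 : ℝ) • (y1 - y2) with hv
  have hv1 : y1 = m + v := by
    rw [hm, hv, ← smul_add]; rw [show y1 + y2 + (y1 - y2) = (2 : ℝ) • y1 by rw [two_smul]; abel]
    rw [smul_smul]; norm_num
  have hv2 : y2 = m - v := by
    rw [hm, hv, ← smul_sub]; rw [show y1 + y2 - (y1 - y2) = (2 : ℝ) • y2 by rw [two_smul]; abel]
    rw [smul_smul]; norm_num
  specialize hy m
  obtain ⟨k, hk, he⟩ := sconv_exists hS ⟨0, h0⟩ ha (l + d) m
  have k1 := sconv_ge hS ha (l + d) y1 hk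
  have k2 := sconv_ge hS ha (l + d) y2 hk
  have p1 : ‖y1 - k‖ ^ 2 + ‖y2 - k‖ ^ 2 = 2 * ‖m - k‖ ^ 2 + 2 * ‖v‖ ^ 2 := by
    rw [hv1, hv2, show m + v - k = (m - k) + v by abel, show m - v - k = (m - k) - v by abel,
      norm_add_sq_real (m - k), norm_sub_sq_real (m - k)]; ring
  have p2 : ‖x + h - y1‖ ^ 2 + ‖x - h - y2‖ ^ 2 = 2 * ‖x - m‖ ^ 2 + 2 * ‖h - v‖ ^ 2 := by
    rw [hv1, hv2, show x + h - (m + v) = (x - m) + (h - v) by abel,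
      show x - h - (m - v) = (x - m) - (h - v) by abel,
      norm_add_sq_real (x - m), norm_sub_sq_real (x - m)]; ring
  have q := cs_ineq hl hd (h - v) h
  rw [show h - (h - v) = v by abel] at q
  have p1' : ‖y1 - k‖ ^ 2 / (2 * (l + d)) + ‖y2 - k‖ ^ 2 / (2 * (l + d))
      = 2 * (‖m - k‖ ^ 2 / (2 * (l + d))) + 2 * (‖v‖ ^ 2 / (2 * (l + d))) := by
    rw [← add_div, p1]; ring
  have p2' : ‖x + h - y1‖ ^ 2 / (2 * d) + ‖x - h - y2‖ ^ 2 / (2 * d)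
      = 2 * (‖x - m‖ ^ 2 / (2 * d)) + 2 * (‖h - v‖ ^ 2 / (2 * d)) := by
    rw [← add_div, p2]; ring
  have p3 : ‖h‖ ^ 2 / l = 2 * (‖h‖ ^ 2 / (2 * l)) := by field_simp
  linarith

theorem LL_c11 {S : Set F} (hS : IsCompact S) (h0 : (0 : F) ∈ S) {a : F → ℝ}
    (ha : ContinuousOn a S) (ha0 : a 0 = 0) {l d : ℝ} (hd : 0 < d) (hld : 3 * d ≤ l)
    : ∃ (G : F → F →L[ℝ] ℝ) (K : ℝ), 0 ≤ K ∧ ∀ x h,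
    |LLr S a l d (x + h) - LLr S a l d x - G x h| ≤ K * ‖h‖ ^ 2 := by
  have hl : 0 < l := by linarith
  choose g hg using LL_upper hS h0 ha ha0 hd hld
  refine ⟨fun x => innerSL ℝ (g x), 1 / (2 * d) + 1 / l, by positivity, fun x h => ?_⟩
  have h1 := hg x h
  have h2 := hg x (-h)
  have h3 := LL_mid hS h0 ha ha0 hd hld x h
  rw [norm_neg, inner_neg_right, ← sub_eq_add_neg] at h2
  have e1 : (1 / (2 * d) + 1 / l) * ‖h‖ ^ 2 = ‖h‖ ^ 2 / (2 * d) + ‖h‖ ^ 2 / l := by ring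
  have e2 : 0 ≤ ‖h‖ ^ 2 / l := by positivity
  rw [e1, abs_le, innerSL_apply_apply]
  constructor <;> linarith
end LL

section Sums
variable {F : Type*} [NormedAddCommGroup F] [InnerProductSpace ℝ F] [FiniteDimensional ℝ F]

open MeasureTheory Measure in
theorem exists_good {V : Type*} [NormedAddCommGroup V] [NormedSpace ℝ V] [FiniteDimensional ℝ V]
    {Ga Gb : F → F →L[ℝ] ℝ} {Ka Kb K : NNReal} (ha : LipschitzWith Ka Ga) (hb : LipschitzWith Kb Gb)
    {D : F × F → V} (hD : LipschitzWith K D)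
    (hV : Module.finrank ℝ V = Module.finrank ℝ (F × F)) (S : Set (F × F)) (r : ℝ) (hr : 0 < r)
    (hS : Metric.ball (0 : V) r ⊆ D '' S) :
    ∃ z ∈ S, DifferentiableAt ℝ Ga z.1 ∧ DifferentiableAt ℝ Gb z.2 := by
  borelize F
  have : ProperSpace F := FiniteDimensional.proper ℝ F
  borelize V
  by_contra hcon
  push Not at hcon
  set μ : Measure F := addHaar
  have h1 := ha.ae_differentiableAt (μ := μ)
  have h2 := hb.ae_differentiableAt (μ := μ)
  have h3 : ∀ᵐ z ∂(μ.prod μ), DifferentiableAt ℝ Ga z.1 :=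
    Measure.quasiMeasurePreserving_fst.ae h1
  have h4 : ∀ᵐ z ∂(μ.prod μ), DifferentiableAt ℝ Gb z.2 :=
    Measure.quasiMeasurePreserving_snd.ae h2
  have h5 : (μ.prod μ) S = 0 := by
    refine measure_mono_null ?_ (ae_iff.1 (h3.and h4))
    intro z hz
    simp only [mem_ofPred_eq, not_and]
    exact fun h => hcon z hz h
  have h6 : μH[(Module.finrank ℝ (F × F) : ℝ)] S = 0 := by
    have : IsAddHaarMeasure (μH[(Module.finrank ℝ (F × F) : ℝ)] : Measure (F × F)) := by
      infer_instance
    exact (absolutelyContinuous_isAddHaarMeasure _ (μ.prod μ)) h5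
  have h7 := hD.hausdorffMeasure_image_le (d := (Module.finrank ℝ (F × F) : ℝ))
    (by positivity) S
  rw [h6, mul_zero] at h7
  have h8 : (μH[(Module.finrank ℝ V : ℝ)] : Measure V) (Metric.ball 0 r) = 0 := by
    rw [hV]
    exact le_antisymm ((measure_mono hS).trans h7) zero_le
  exact (Metric.isOpen_ball.measure_pos _ ⟨0, Metric.mem_ball_self hr⟩).ne' h8

theorem homog_le {V : Type*} [NormedAddCommGroup V] [NormedSpace ℝ V] {h : V → ℝ}
    (hh : ∀ (t : ℝ) v, h (t • v) = t ^ 2 * h v) (he : ∀ᶠ v in nhds (0 : V), h v ≤ 0) (v : V) :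
    h v ≤ 0 := by
  have : Filter.Tendsto (fun t : ℝ => t • v) (nhds 0) (nhds 0) := by
    have : Continuous (fun t : ℝ => t • v) := by fun_prop
    simpa using this.tendsto 0
  have h2 := (this.eventually he)
  obtain ⟨δ, hδ, h3⟩ := Metric.eventually_nhds_iff.1 h2
  have h4 := h3 (y := δ / 2) (by rw [Real.dist_eq]; rw [abs_lt]; constructor <;> linarith)
  rw [hh] at h4
  by_contra hc
  push Not at hc
  have : 0 < (δ / 2) ^ 2 * h v := by positivity
  linarith

theorem fin_dual : Module.finrank ℝ (F × F →L[ℝ] ℝ) = Module.finrank ℝ (F × F) := by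
  have := (LinearMap.toContinuousLinearMap (𝕜 := ℝ) (E := F × F) (F' := ℝ)).finrank_eq
  rw [← this]
  exact Subspace.dual_finrank_eq

theorem LL_transfer {R : ℝ} {a : F → ℝ} (ha : ContinuousOn a (Metric.closedBall 0 R))
    (ha0 : a 0 = 0) {l d : ℝ} (hd : 0 < d) (hld : 3 * d ≤ l) {G : F → F →L[ℝ] ℝ} {K : ℝ}
    (hG : ∀ x h, |LLr (Metric.closedBall 0 R) a l d (x + h) - LLr (Metric.closedBall 0 R) a l d x
      - G x h| ≤ K * ‖h‖ ^ 2) {x : F}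
    (hx : LLr (Metric.closedBall 0 R) a l d x = sconv (Metric.closedBall 0 R) a l x)
    {A : F →L[ℝ] F →L[ℝ] ℝ} (hA : HasFDerivAt G A x) {M e : ℝ} (he : 0 < e) (heR : e < R)
    (hM : ∀ h ∈ Metric.closedBall (0 : F) R, a h ≤ M) (hlM : 2 * l * M ≤ e ^ 2 / 16)
    (hxe : ‖x‖ ≤ e / 4) :
    ∃ h1, ‖h1‖ ≤ e ∧ SupJet a h1 (G x) ((1 / 2 : ℝ) • A) := by
  have hl : 0 < l := by linarith
  have hS := isCompact_closedBall (0 : F) R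
  have h0 : (0 : F) ∈ Metric.closedBall (0 : F) R := Metric.mem_closedBall_self (by linarith)
  obtain ⟨h, hh, hhe⟩ := sconv_exists hS ⟨0, h0⟩ ha l x
  have h1 := sconv_ge hS ha l x h0
  have hd1 : ‖x - h‖ ≤ e / 2 := by
    rw [hhe, ha0, sub_zero] at h1
    have h2 := hM h hh
    have h3 : ‖x - h‖ ^ 2 / (2 * l) ≤ ‖x‖ ^ 2 / (2 * l) + M := by linarith
    rw [div_le_iff₀ (by positivity)] at h3
    have e1 : (‖x‖ ^ 2 / (2 * l) + M) * (2 * l) = ‖x‖ ^ 2 + 2 * l * M := by field_simp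
    rw [e1] at h3
    have : ‖x‖ ^ 2 ≤ (e / 4) ^ 2 := by gcongr
    exact (abs_le_of_sq_le_sq' (by nlinarith) (by positivity)).2
  have hd2 : ‖h‖ ≤ e := by
    have := norm_sub_le x (x - h)
    rw [sub_sub_cancel] at this
    linarith
  refine ⟨h, hd2, fun ε hε => ?_⟩
  have hs := c11_second hG x hA hε
  have hev : ∀ᶠ w in nhds (0 : F), h + w ∈ Metric.closedBall (0 : F) R := by
    have : Filter.Tendsto (fun w : F => h + w) (nhds 0) (nhds (h + 0)) :=
      (continuous_const.add continuous_id).tendsto 0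
    refine this.eventually (Metric.closedBall_mem_nhds_of_mem ?_)
    simp; linarith
  filter_upwards [hs, hev] with w hw1 hw2
  have h2 := sconv_ge hS ha l (x + w) hw2
  have h3 := LL_ge hS h0 ha ha0 hd hld (x + w)
  rw [show x + w - (h + w) = x - h by abel] at h2
  have h4 := (abs_le.1 hw1).2
  simp only [_root_.smul_apply, smul_eq_mul]
  linarith
end Sums

section Sums2
variable {F : Type*} [NormedAddCommGroup F] [InnerProductSpace ℝ F] [FiniteDimensional ℝ F]

theorem bil_le {V : Type*} [NormedAddCommGroup V] [NormedSpace ℝ V] (B : V →L[ℝ] V →L[ℝ] ℝ)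
    (x y : V) : |B x y| ≤ ‖B‖ * ‖x‖ * ‖y‖ := by
  have := B.le_opNorm₂ x y
  rwa [Real.norm_eq_abs] at this

theorem bil_bound {V : Type*} [NormedAddCommGroup V] [NormedSpace ℝ V] (B : V →L[ℝ] V →L[ℝ] ℝ) :
    ∃ C : ℝ, 0 ≤ C ∧ ∀ x y : V, |B x y| ≤ C * ‖x‖ * ‖y‖ := ⟨‖B‖, ContinuousLinearMap.opNorm_nonneg B, bil_le B⟩

theorem lin_le {V : Type*} [NormedAddCommGroup V] [NormedSpace ℝ V] (p : V →L[ℝ] ℝ) (x : V) :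
    |p x| ≤ ‖p‖ * ‖x‖ := by
  have := p.le_opNorm x
  rwa [Real.norm_eq_abs] at this

theorem dual_ball {V : Type*} [NormedAddCommGroup V] [NormedSpace ℝ V] (p : V →L[ℝ] ℝ) {r : ℝ}
    (hp : p ∈ Metric.ball (0 : V →L[ℝ] ℝ) r) : ‖p‖ < r := by
  have h9 := Metric.mem_ball.1 hp
  rwa [dist_zero_right] at h9

theorem bil_add {V : Type*} [NormedAddCommGroup V] [NormedSpace ℝ V] (B : V →L[ℝ] V →L[ℝ] ℝ)
    (x y : V) : B (x + y) (x + y) = B x x + (B x y + B y x) + B y y := by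
  simp only [map_add, _root_.add_apply]; ring

theorem LL_le' {S : Set F} (hS : IsCompact S) (h0 : (0 : F) ∈ S) {a : F → ℝ}
    (ha : ContinuousOn a S) (ha0 : a 0 = 0) {l d : ℝ} (hd : 0 < d) (hld : 3 * d ≤ l)
    {P : F → ℝ} (x0 : F) (g : F →L[ℝ] ℝ) (hP : ∀ v, P (x0 + v) ≤ P x0 + g v + ‖v‖ ^ 2 / (2 * d))
    (hle : ∀ x, sconv S a l x ≤ P x) : LLr S a l d x0 ≤ P x0 := by
  refine LL_le hS h0 ha ha0 hd hld (P := P) x0 ((InnerProductSpace.toDual ℝ F).symm g) ?_ hle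
  intro v
  rw [InnerProductSpace.toDual_symm_apply]
  exact hP v

theorem sums_aux {C e l : ℝ} (hC : 0 ≤ C) (he : 0 < e) (hl : 0 < l)
    (h : (2 * C ^ 2 / e + C) * (2 * l) ≤ 1) (z v N : ℝ) (hv : v ^ 2 ≤ N) (hz : 0 ≤ z) (hv0 : 0 ≤ v) :
    2 * C * z * v + C * v ^ 2 - N / (2 * l) ≤ e / 2 * z ^ 2 := by
  have h1 : (2 * C ^ 2 / e + C) * v ^ 2 ≤ N / (2 * l) := by
    rw [le_div_iff₀ (by positivity)]
    calc (2 * C ^ 2 / e + C) * v ^ 2 * (2 * l) = ((2 * C ^ 2 / e + C) * (2 * l)) * v ^ 2 := by ring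
      _ ≤ 1 * v ^ 2 := by gcongr
      _ ≤ N := by linarith
  have h2 : 2 * C * z * v ≤ e / 2 * z ^ 2 + 2 * C ^ 2 / e * v ^ 2 := by
    have : 0 ≤ (e * z - 2 * C * v) ^ 2 / (2 * e) := by positivity
    have e1 : (e * z - 2 * C * v) ^ 2 / (2 * e) = e / 2 * z ^ 2 - 2 * C * z * v
      + 2 * C ^ 2 / e * v ^ 2 := by field_simp; ring
    linarith
  nlinarith

set_option maxHeartbeats 2000000 in
theorem sums {a b : F → ℝ} {R : ℝ} (ha : ContinuousOn a (Metric.closedBall 0 R))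
    (hb : ContinuousOn b (Metric.closedBall 0 R)) (ha0 : a 0 = 0) (hb0 : b 0 = 0)
    (B : (F × F) →L[ℝ] (F × F) →L[ℝ] ℝ)
    (hB : ∀ h ∈ Metric.closedBall (0 : F) R, ∀ k ∈ Metric.closedBall (0 : F) R,
      a h + b k ≤ B (h, k) (h, k)) {ε : ℝ} (hε : 0 < ε) (hεR : ε < R) :
    ∃ (h k : F) (L1 L2 : F →L[ℝ] ℝ) (A1 A2 : F →L[ℝ] F →L[ℝ] ℝ),
      ‖h‖ ≤ ε ∧ ‖k‖ ≤ ε ∧ ‖L1‖ ≤ ε ∧ ‖L2‖ ≤ ε ∧ SupJet a h L1 A1 ∧ SupJet b k L2 A2 ∧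
      ∀ x y, A1 x x + A2 y y ≤ B (x, y) (x, y) + ε * (‖x‖ ^ 2 + ‖y‖ ^ 2) := by
  have hS := isCompact_closedBall (0 : F) R
  have h0 : (0 : F) ∈ Metric.closedBall (0 : F) R := Metric.mem_closedBall_self (by linarith)
  set S := Metric.closedBall (0 : F) R with hSdef
  obtain ⟨C, hC, bilB⟩ := bil_bound B
  obtain ⟨Ma, hMa⟩ := hS.bddAbove_image ha
  obtain ⟨Mb, hMb⟩ := hS.bddAbove_image hb
  have hMa' : ∀ h ∈ S, a h ≤ Ma := fun h hh => hMa (mem_image_of_mem _ hh)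
  have hMb' : ∀ h ∈ S, b h ≤ Mb := fun h hh => hMb (mem_image_of_mem _ hh)
  have hMa0 : 0 ≤ Ma := ha0 ▸ hMa' 0 h0
  have hMb0 : 0 ≤ Mb := hb0 ▸ hMb' 0 h0
  set e := ε / 2 with he
  have hep : 0 < e := by positivity
  -- choice of parameters
  obtain ⟨l, hl, hl1, hl2, hl3⟩ : ∃ l : ℝ, 0 < l ∧ (2 * C ^ 2 / e + C) * (2 * l) ≤ 1 ∧
      2 * l * Ma ≤ ε ^ 2 / 16 ∧ 2 * l * Mb ≤ ε ^ 2 / 16 := by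
    have t1 : ∀ X Y : ℝ, 0 < Y → ∀ᶠ l in nhdsWithin (0 : ℝ) (Ioi 0), X * (2 * l) ≤ Y := by
      intro X Y hY
      have : Filter.Tendsto (fun l : ℝ => X * (2 * l)) (nhdsWithin 0 (Ioi 0)) (nhds 0) := by
        have : Continuous (fun l : ℝ => X * (2 * l)) := by fun_prop
        have h := this.tendsto 0
        simp only [mul_zero] at h
        exact h.mono_left nhdsWithin_le_nhds
      exact (this.eventually (Iio_mem_nhds hY)).mono fun l hl => le_of_lt hl
    have := (t1 (2 * C ^ 2 / e + C) 1 one_pos).and ((t1 Ma (ε ^ 2 / 16) (by positivity)).and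
      ((t1 Mb (ε ^ 2 / 16) (by positivity)).and self_mem_nhdsWithin))
    obtain ⟨l, p1, p2, p3, p4⟩ := this.exists
    exact ⟨l, p4, p1, by linarith, by linarith⟩
  obtain ⟨d, hd, hld, hd2⟩ : ∃ d : ℝ, 0 < d ∧ 3 * d ≤ l ∧ (C + e) ≤ 1 / (2 * d) := by
    refine ⟨min (l / 3) (1 / (2 * (C + e))), by positivity, ?_, ?_⟩
    · have := min_le_left (l / 3) (1 / (2 * (C + e))); linarith
    · have h2 := min_le_right (l / 3) (1 / (2 * (C + e)))
      have hpos : 0 < min (l / 3) (1 / (2 * (C + e))) := by positivity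
      rw [le_div_iff₀ (by positivity)]
      rw [le_div_iff₀ (by positivity)] at h2
      linarith
  set N : F × F → ℝ := fun z => ‖z.1‖ ^ 2 + ‖z.2‖ ^ 2 with hN
  have hN1 : ∀ z : F × F, ‖z‖ ^ 2 ≤ N z := by
    intro z
    simp only [hN]
    rcases max_cases ‖z.1‖ ‖z.2‖ with h | h
    · rw [Prod.norm_def, h.1]; nlinarith [sq_nonneg ‖z.2‖]
    · rw [Prod.norm_def, h.1]; nlinarith [sq_nonneg ‖z.1‖]
  have hN2 : ∀ z : F × F, N z ≤ 2 * ‖z‖ ^ 2 := by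
    intro z
    have h1 : ‖z.1‖ ^ 2 ≤ ‖z‖ ^ 2 := by gcongr; exact norm_fst_le z
    have h2 : ‖z.2‖ ^ 2 ≤ ‖z‖ ^ 2 := by gcongr; exact norm_snd_le z
    simp only [hN]; linarith
  set al := sconv S a l with hal
  set bl := sconv S b l with hbl
  have calc1 : Continuous al := sconv_continuous hS ha l
  have cbl1 : Continuous bl := sconv_continuous hS hb l
  have hW1 : ∀ z : F × F, al z.1 + bl z.2 ≤ B z z + e / 2 * N z := by
    intro z
    obtain ⟨h, hh, hhe⟩ := sconv_exists hS ⟨0, h0⟩ ha l z.1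
    obtain ⟨k, hk, hke⟩ := sconv_exists hS ⟨0, h0⟩ hb l z.2
    have h1 := hB h hh k hk
    set v : F × F := (h, k) - z with hv
    have hzv : ((h, k) : F × F) = z + v := by rw [hv]; abel
    rw [hzv, bil_add] at h1
    have b1 := (abs_le.1 (bilB z v)).2
    have b2 := (abs_le.1 (bilB v z)).2
    have b3 := (abs_le.1 (bilB v v)).2
    have hNv : ‖z.1 - h‖ ^ 2 / (2 * l) + ‖z.2 - k‖ ^ 2 / (2 * l) = N v / (2 * l) := by
      rw [← add_div]; simp only [hN, hv, Prod.fst_sub, Prod.snd_sub]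
      rw [norm_sub_rev z.1, norm_sub_rev z.2]
    have := sums_aux hC hep hl hl1 ‖z‖ ‖v‖ (N v) (hN1 v) (norm_nonneg _) (norm_nonneg _)
    have hz := hN1 z
    have hz2 : e / 2 * ‖z‖ ^ 2 ≤ e / 2 * N z := by gcongr
    rw [hal, hbl, hhe, hke]
    nlinarith
  set W : F × F → ℝ := fun z => al z.1 + bl z.2 - B z z - e * N z with hW
  have hWle : ∀ z, W z ≤ -(e / 2 * ‖z‖ ^ 2) := by
    intro z
    have h1 := hW1 z
    have h2 : e / 2 * ‖z‖ ^ 2 ≤ e / 2 * N z := by gcongr; exact hN1 z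
    simp only [hW]; linarith
  have hW0 : 0 ≤ W 0 := by
    have h1 := sconv_ge hS ha l 0 h0
    have h2 := sconv_ge hS hb l 0 h0
    simp only [ha0, hb0] at h1 h2
    simp only [hW, hN]
    simp at h1 h2 ⊢
    linarith
  have hWc : Continuous W := by
    simp only [hW, hN]
    fun_prop
  have hzp : ∀ p : F × F →L[ℝ] ℝ, ∃ z : F × F, (∀ w, W w - p w ≤ W z - p z) ∧
      e / 2 * ‖z‖ ≤ ‖p‖ := by
    intro p
    have hWp : Continuous (fun z => W z - p z) := hWc.sub p.continuous
    obtain ⟨z, hz⟩ := hWp.exists_forall_ge' (0 : F × F) (by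
      have := tendsto_norm_cocompact_atTop (E := F × F)
      filter_upwards [this.eventually (Filter.eventually_ge_atTop (2 * ‖p‖ / e))] with z hz
      have h1 := hWle z
      have h2 := (abs_le.1 (lin_le p z)).1
      rw [div_le_iff₀ hep] at hz
      have hp0 : p 0 = 0 := p.map_zero
      rw [hp0]
      nlinarith [norm_nonneg z, mul_le_mul_of_nonneg_right hz (norm_nonneg z)])
    refine ⟨z, hz, ?_⟩
    have h3 := hz 0
    have hp0 : p 0 = 0 := p.map_zero
    rw [hp0, sub_zero] at h3
    have h1 := hWle z
    have h2 := (abs_le.1 (lin_le p z)).1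
    rcases eq_or_lt_of_le (norm_nonneg z) with h | h
    · rw [← h, mul_zero]; exact ContinuousLinearMap.opNorm_nonneg p
    · refine le_of_mul_le_mul_right ?_ h
      nlinarith
  set aL := LLr S a l d with haL
  set bL := LLr S b l d with hbL
  have haL1 : ∀ x, al x ≤ aL x := LL_ge hS h0 ha ha0 hd hld
  have hbL1 : ∀ x, bl x ≤ bL x := LL_ge hS h0 hb hb0 hd hld
  have hNadd : ∀ z w : F × F, N (z + w) = N z + 2 * (⟪z.1, w.1⟫ + ⟪z.2, w.2⟫) + N w := by
    intro z w
    simp only [hN, Prod.fst_add, Prod.snd_add, norm_add_sq_real]; ring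
  set q : F × F → F × F →L[ℝ] ℝ := fun z => B z + B.flip z +
    (2 * e) • ((innerSL ℝ z.1).comp (ContinuousLinearMap.fst ℝ F F)
      + (innerSL ℝ z.2).comp (ContinuousLinearMap.snd ℝ F F)) with hq
  have hqadd : ∀ z w : F × F, B (z + w) (z + w) + e * N (z + w) =
      B z z + e * N z + q z w + (B w w + e * N w) := by
    intro z w
    rw [bil_add, hNadd]
    simp [hq]; ring
  have hqw : ∀ w : F × F, N w = ‖w‖ ^ 2 → B w w + e * N w ≤ ‖w‖ ^ 2 / (2 * d) := by
    intro w hw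
    have h1 := (abs_le.1 (bilB w w)).2
    have h2 : ‖w‖ ^ 2 / (2 * d) = ‖w‖ ^ 2 * (1 / (2 * d)) := by ring
    have h3 : ‖w‖ ^ 2 * (C + e) ≤ ‖w‖ ^ 2 * (1 / (2 * d)) := by gcongr
    rw [h2, hw]; nlinarith
  have hstep : ∀ (p : F × F →L[ℝ] ℝ) (c : ℝ), (∀ z, W z ≤ p z + c) →
      ∀ z, aL z.1 + bL z.2 - B z z - e * N z ≤ p z + c := by
    intro p c hp
    have s1 : ∀ z : F × F, aL z.1 ≤ B z z + e * N z + p z + c - bl z.2 := by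
      rintro ⟨x, y⟩
      refine LL_le' hS h0 ha ha0 hd hld
        (P := fun x => B (x, y) (x, y) + e * N (x, y) + p (x, y) + c - bl y) x
        ((q (x, y) + p).comp (ContinuousLinearMap.inl ℝ F F)) (fun v => ?_) (fun x' => ?_)
      · have e1 : ((x + v, y) : F × F) = (x, y) + (v, 0) := by simp
        have h2 := hqw (v, 0) (by simp [hN, Prod.norm_def])
        have h3 : ‖((v, 0) : F × F)‖ = ‖v‖ := by simp [Prod.norm_def]
        rw [h3] at h2
        have h1 := hqadd (x, y) (v, 0)
        rw [← e1] at h1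
        have h4 : p (x + v, y) = p (x, y) + p (v, 0) := by rw [e1, map_add]
        simp only [ContinuousLinearMap.comp_apply, _root_.add_apply, ContinuousLinearMap.inl_apply]
        linarith
      · have := hp (x', y)
        simp only [hW] at this
        linarith
    rintro ⟨x, y⟩
    have s2 : bL y ≤ B (x, y) (x, y) + e * N (x, y) + p (x, y) + c - aL x := by
      refine LL_le' hS h0 hb hb0 hd hld
        (P := fun y => B (x, y) (x, y) + e * N (x, y) + p (x, y) + c - aL x) y
        ((q (x, y) + p).comp (ContinuousLinearMap.inr ℝ F F)) (fun v => ?_) (fun y' => ?_)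
      · have e1 : ((x, y + v) : F × F) = (x, y) + (0, v) := by simp
        have h2 := hqw (0, v) (by simp [hN, Prod.norm_def])
        have h3 : ‖((0, v) : F × F)‖ = ‖v‖ := by simp [Prod.norm_def]
        rw [h3] at h2
        have h1 := hqadd (x, y) (0, v)
        rw [← e1] at h1
        have h4 : p (x, y + v) = p (x, y) + p (0, v) := by rw [e1, map_add]
        simp only [ContinuousLinearMap.comp_apply, _root_.add_apply, ContinuousLinearMap.inr_apply]
        linarith
      · have := s1 (x, y')
        simp only at this
        linarith
    simp only
    linarith
  obtain ⟨Ga, Ka, hKa, hGa⟩ := LL_c11 hS h0 ha ha0 hd hld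
  obtain ⟨Gb, Kb, hKb, hGb⟩ := LL_c11 hS h0 hb hb0 hd hld
  rw [← haL] at hGa
  rw [← hbL] at hGb
  set WL : F × F → ℝ := fun z => aL z.1 + bL z.2 - B z z - e * N z with hWL
  set D : F × F → F × F →L[ℝ] ℝ := fun z => (Ga z.1).comp (ContinuousLinearMap.fst ℝ F F)
    + (Gb z.2).comp (ContinuousLinearMap.snd ℝ F F) - q z with hD
  set K := Ka + Kb + C + 2 * e with hK
  have hK0 : 0 ≤ K := by positivity
  have hDc : ∀ z w, |WL (z + w) - WL z - D z w| ≤ K * ‖w‖ ^ 2 := by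
    intro z w
    have h1 := hGa z.1 w.1
    have h2 := hGb z.2 w.2
    have h3 := hqadd z w
    have h4 := bilB w w
    have h5 : Ka * ‖w.1‖ ^ 2 ≤ Ka * ‖w‖ ^ 2 := by gcongr; exact norm_fst_le w
    have h6 : Kb * ‖w.2‖ ^ 2 ≤ Kb * ‖w‖ ^ 2 := by gcongr; exact norm_snd_le w
    have h7 : e * N w ≤ e * (2 * ‖w‖ ^ 2) := by gcongr; exact hN2 w
    have h8 : 0 ≤ e * N w := by have := hN1 w; positivity
    have e1 : WL (z + w) - WL z - D z w = (aL (z.1 + w.1) - aL z.1 - Ga z.1 w.1)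
      + (bL (z.2 + w.2) - bL z.2 - Gb z.2 w.2) - (B w w + e * N w) := by
      simp only [hWL, hD, Prod.fst_add, Prod.snd_add, _root_.sub_apply, _root_.add_apply,
        ContinuousLinearMap.comp_apply, ContinuousLinearMap.coe_fst', ContinuousLinearMap.coe_snd']
      linarith
    rw [e1]
    rw [abs_le] at h1 h2 h4 ⊢
    rw [hK]
    constructor <;> nlinarith
  have hDlip : LipschitzWith (6 * K).toNNReal D := by
    refine LipschitzWith.of_dist_le_mul fun z w => ?_
    rw [Real.coe_toNNReal _ (by positivity), dist_eq_norm, dist_eq_norm]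
    exact c11_lip hK0 hDc w z
  have hGalip : LipschitzWith (6 * Ka).toNNReal Ga := by
    refine LipschitzWith.of_dist_le_mul fun z w => ?_
    rw [Real.coe_toNNReal _ (by positivity), dist_eq_norm, dist_eq_norm]
    exact c11_lip hKa hGa w z
  have hGblip : LipschitzWith (6 * Kb).toNNReal Gb := by
    refine LipschitzWith.of_dist_le_mul fun z w => ?_
    rw [Real.coe_toNNReal _ (by positivity), dist_eq_norm, dist_eq_norm]
    exact c11_lip hKb hGb w z
  -- radius
  set r := min (ε / 2) (e / 2 * min (ε / 4) (ε / (4 * (C + e)))) with hr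
  have hrp : 0 < r := by positivity
  set T : Set (F × F) := {z | ∃ p : F × F →L[ℝ] ℝ, ‖p‖ < r ∧ (∀ w, W w - p w ≤ W z - p z) ∧
      e / 2 * ‖z‖ ≤ ‖p‖} with hT
  have hTp : ∀ z (p : F × F →L[ℝ] ℝ), (∀ w, W w - p w ≤ W z - p z) →
      aL z.1 = al z.1 ∧ bL z.2 = bl z.2 ∧ D z = p ∧ ∀ w, WL w - p w ≤ WL z - p z := by
    intro z p hp
    have h1 := hstep p (W z - p z) (fun w => by linarith [hp w])
    have h2 := h1 z
    have h3 := haL1 z.1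
    have h4 := hbL1 z.2
    have h5 : WL z ≤ W z := by simp only [hWL]; linarith
    have h6 : aL z.1 + bL z.2 ≤ al z.1 + bl z.2 := by
      simp only [hWL, hW] at h5; linarith
    have h7 : ∀ w, WL w - p w ≤ WL z - p z := by
      intro w
      have := h1 w
      have h8 : W z ≤ WL z := by simp only [hWL, hW]; linarith
      simp only [hWL] at h8 ⊢
      linarith
    refine ⟨by linarith, by linarith, ?_, h7⟩
    have hf : HasFDerivAt (fun w => WL w - p w) (D z - p) z :=
      (c11_hasFDerivAt hDc z).sub p.hasFDerivAt
    have hm : IsLocalMax (fun w => WL w - p w) z := Filter.Eventually.of_forall h7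
    have := hm.hasFDerivAt_eq_zero hf
    exact sub_eq_zero.1 this
  obtain ⟨z, ⟨p, hpr, hpz, hzn⟩, hza, hzb⟩ := exists_good hGalip hGblip hDlip fin_dual T r hrp (by
    intro p hp
    obtain ⟨z, hz1, hz2⟩ := hzp p
    exact ⟨z, ⟨p, dual_ball p hp, hz1, hz2⟩, (hTp z p hz1).2.2.1⟩)
  obtain ⟨c1, c2, c3, c4⟩ := hTp z p hpz
  have hr1 : r ≤ ε / 2 := min_le_left _ _
  have hr2 : ‖z‖ ≤ min (ε / 4) (ε / (4 * (C + e))) := by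
    have : e / 2 * ‖z‖ ≤ e / 2 * min (ε / 4) (ε / (4 * (C + e))) :=
      hzn.trans (hpr.le.trans (min_le_right _ _))
    exact le_of_mul_le_mul_left this (by positivity)
  have hz4 : ‖z‖ ≤ ε / 4 := hr2.trans (min_le_left _ _)
  have hz5 : 2 * (C + e) * ‖z‖ ≤ ε / 2 := by
    have := hr2.trans (min_le_right _ _)
    rw [le_div_iff₀ (by positivity)] at this
    linarith
  obtain ⟨h1, hh1, hj1⟩ := LL_transfer ha ha0 hd hld hGa c1 hza.hasFDerivAt hε hεR hMa' hl2
    ((norm_fst_le z).trans hz4)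
  obtain ⟨k1, hk1, hj2⟩ := LL_transfer hb hb0 hd hld hGb c2 hzb.hasFDerivAt hε hεR hMb' hl3
    ((norm_snd_le z).trans hz4)
  have hGa1 : ∀ v, |Ga z.1 v| ≤ ε * ‖v‖ := by
    intro v
    have e1 : Ga z.1 v = p (v, 0) + B z (v, 0) + B (v, 0) z + 2 * e * ⟪z.1, v⟫ := by
      have : D z (v, 0) = p (v, 0) := by rw [c3]
      simp [hD, hq] at this
      linarith
    have n0 : ‖((v, 0) : F × F)‖ = ‖v‖ := by simp [Prod.norm_def]
    have n1 : |p (v, 0)| ≤ ‖p‖ * ‖v‖ := by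
      have := p.le_opNorm (v, 0); rwa [n0, Real.norm_eq_abs] at this
    have n2 := bilB z (v, 0)
    have n3 := bilB (v, 0) z
    have n4 : |⟪z.1, v⟫| ≤ ‖z‖ * ‖v‖ :=
      (abs_real_inner_le_norm _ _).trans (by gcongr; exact norm_fst_le z)
    rw [n0] at n2 n3
    have n5 : ‖p‖ * ‖v‖ ≤ ε / 2 * ‖v‖ := by gcongr; linarith
    have n6 : 2 * (C + e) * ‖z‖ * ‖v‖ ≤ ε / 2 * ‖v‖ := by gcongr
    rw [e1]
    rw [abs_le] at n1 n2 n3 n4 ⊢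
    constructor <;> nlinarith
  have hGb1 : ∀ v, |Gb z.2 v| ≤ ε * ‖v‖ := by
    intro v
    have e1 : Gb z.2 v = p (0, v) + B z (0, v) + B (0, v) z + 2 * e * ⟪z.2, v⟫ := by
      have : D z (0, v) = p (0, v) := by rw [c3]
      simp [hD, hq] at this
      linarith
    have n0 : ‖((0, v) : F × F)‖ = ‖v‖ := by simp [Prod.norm_def]
    have n1 : |p (0, v)| ≤ ‖p‖ * ‖v‖ := by
      have := p.le_opNorm (0, v); rwa [n0, Real.norm_eq_abs] at this
    have n2 := bilB z (0, v)
    have n3 := bilB (0, v) z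
    have n4 : |⟪z.2, v⟫| ≤ ‖z‖ * ‖v‖ :=
      (abs_real_inner_le_norm _ _).trans (by gcongr; exact norm_snd_le z)
    rw [n0] at n2 n3
    have n5 : ‖p‖ * ‖v‖ ≤ ε / 2 * ‖v‖ := by gcongr; linarith
    have n6 : 2 * (C + e) * ‖z‖ * ‖v‖ ≤ ε / 2 * ‖v‖ := by gcongr
    rw [e1]
    rw [abs_le] at n1 n2 n3 n4 ⊢
    constructor <;> nlinarith
  refine ⟨h1, k1, Ga z.1, Gb z.2, _, _, hh1, hk1,
    ContinuousLinearMap.opNorm_le_bound _ hε.le hGa1,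
    ContinuousLinearMap.opNorm_le_bound _ hε.le hGb1, hj1, hj2, ?_⟩
  intro x y
  set A1 := fderiv ℝ Ga z.1
  set A2 := fderiv ℝ Gb z.2
  have hfin := homog_le (V := F × F)
    (h := fun w => (1 / 2) * A1 w.1 w.1 + (1 / 2) * A2 w.2 w.2 - B w w - ε * N w) (by
      intro t v
      simp only [hN, map_smul, _root_.smul_apply, smul_eq_mul, Prod.smul_fst, Prod.smul_snd,
        norm_smul, mul_pow, Real.norm_eq_abs, sq_abs]
      ring) (by
      have s1 := c11_second hGa z.1 hza.hasFDerivAt (by positivity : 0 < e / 2)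
      have s2 := c11_second hGb z.2 hzb.hasFDerivAt (by positivity : 0 < e / 2)
      have s1' := (continuous_fst (X := F) (Y := F)).tendsto 0 |>.eventually s1
      have s2' := (continuous_snd (X := F) (Y := F)).tendsto 0 |>.eventually s2
      filter_upwards [s1', s2'] with w hw1 hw2
      have u1 := c4 (z + w)
      have u2 := hqadd z w
      have u3 : D z w = p w := by rw [c3]
      simp only [hD, _root_.sub_apply, _root_.add_apply,
        ContinuousLinearMap.comp_apply, ContinuousLinearMap.coe_fst',
        ContinuousLinearMap.coe_snd'] at u3
      simp only [hWL, map_add, Prod.fst_add, Prod.snd_add] at u1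
      have u4 := (abs_le.1 hw1).1
      have u5 := (abs_le.1 hw2).1
      have u6 : N w = ‖w.1‖ ^ 2 + ‖w.2‖ ^ 2 := rfl
      simp only [map_add] at u2
      have u7 : ε = e + e := by rw [he]; ring
      rw [u7]
      nlinarith [sq_nonneg ‖w.1‖, sq_nonneg ‖w.2‖]) (x, y)
  simp only [_root_.smul_apply, smul_eq_mul]
  simp only [hN] at hfin
  linarith
end Sums2

section Op
variable {E : Type*} [NormedAddCommGroup E] [InnerProductSpace ℝ E] [FiniteDimensional ℝ E]

/-- trace of a bilinear form -/
def trB (A : E →L[ℝ] E →L[ℝ] ℝ) : ℝ :=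
  ∑ i, A (stdOrthonormalBasis ℝ E i) (stdOrthonormalBasis ℝ E i)

theorem trB_eq (A : E →L[ℝ] E →L[ℝ] ℝ) {ι : Type*} [Fintype ι] (b : OrthonormalBasis ι ℝ E) :
    ∑ i, A (b i) (b i) = trB A := by
  let T : E →ₗ[ℝ] E :=
    { toFun := fun x => (InnerProductSpace.toDual ℝ E).symm (A x)
      map_add' := fun x y => by simp
      map_smul' := fun c x => by simp }
  have h : ∀ x y, ⟪y, T x⟫ = A x y := by
    intro x y
    rw [real_inner_comm]
    exact InnerProductSpace.toDual_symm_apply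
  have h1 := LinearMap.trace_eq_sum_inner T b
  have h2 := LinearMap.trace_eq_sum_inner T (stdOrthonormalBasis ℝ E)
  simp only [h] at h1 h2
  rw [trB, ← h1, h2]

def opB (γ p : ℝ) (q : E) (A : E →L[ℝ] E →L[ℝ] ℝ) : ℝ :=
  ‖q‖ ^ γ * (trB A + (p - 2) * A q q / ‖q‖ ^ 2)

/-- the coefficient matrix -/
def sig (γ p : ℝ) (q v : E) : E :=
  (‖q‖ ^ (γ / 2)) • (v + ((√(p - 1) - 1) * ⟪q, v⟫ / ‖q‖ ^ 2) • q)

theorem opB_eq {γ p : ℝ} (hp : 1 < p) {q : E} (hq : q ≠ 0) (A : E →L[ℝ] E →L[ℝ] ℝ)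
    {ι : Type*} [Fintype ι] (b : OrthonormalBasis ι ℝ E) :
    opB γ p q A = ∑ i, A (sig γ p q (b i)) (sig γ p q (b i)) := by
  have hn : 0 < ‖q‖ := norm_pos_iff.2 hq
  set c := √(p - 1) - 1 with hc
  have hc2 : (c + 1) ^ 2 = p - 1 := by rw [hc]; rw [sub_add_cancel, Real.sq_sqrt]; linarith
  have hr : ‖q‖ ^ (γ / 2) * ‖q‖ ^ (γ / 2) = ‖q‖ ^ γ := by
    rw [← Real.rpow_add hn]; ring_nf
  have e1 : ∀ i, A (sig γ p q (b i)) (sig γ p q (b i)) = ‖q‖ ^ γ * (A (b i) (b i)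
      + c / ‖q‖ ^ 2 * (⟪b i, q⟫ * A (b i) q) + c / ‖q‖ ^ 2 * (⟪b i, q⟫ * A.flip (b i) q)
      + c ^ 2 / ‖q‖ ^ 4 * A q q * ⟪q, b i⟫ ^ 2) := by
    intro i
    rw [← hr]
    simp only [sig, map_smul, map_add, _root_.smul_apply, _root_.add_apply, smul_eq_mul,
      ContinuousLinearMap.flip_apply, ← hc]
    rw [real_inner_comm (b i) q]
    field_simp
    ring
  have s0 : ∀ g : E →L[ℝ] ℝ, ∑ i, ⟪b i, q⟫ * g (b i) = g q := by
    intro g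
    conv_rhs => rw [← b.sum_repr' q]
    rw [map_sum]
    exact Finset.sum_congr rfl fun i _ => by rw [map_smul, smul_eq_mul]
  have s1 : ∑ i, ⟪b i, q⟫ * A (b i) q = A q q := s0 (A.flip q)
  have s2 : ∑ i, ⟪b i, q⟫ * A.flip (b i) q = A q q := s0 (A q)
  have s3 : ∑ i, ⟪q, b i⟫ ^ 2 = ‖q‖ ^ 2 := by
    have := b.sum_sq_norm_inner_right q
    rw [← this]
    refine Finset.sum_congr rfl fun i _ => ?_
    rw [real_inner_comm, Real.norm_eq_abs, sq_abs]
  simp only [e1]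
  rw [← Finset.mul_sum, Finset.sum_add_distrib, Finset.sum_add_distrib, Finset.sum_add_distrib,
    ← Finset.mul_sum, ← Finset.mul_sum, ← Finset.mul_sum, s1, s2, s3, trB_eq, opB]
  congr 1
  have : p - 2 = c ^ 2 + 2 * c := by nlinarith
  rw [this]
  field_simp
  ring

theorem opB_neg (γ p : ℝ) (q : E) (A : E →L[ℝ] E →L[ℝ] ℝ) : opB γ p (-q) A = opB γ p q A := by
  simp [opB]

theorem sig_neg (γ p : ℝ) (q v : E) : sig γ p (-q) v = sig γ p q v := by
  simp only [sig, norm_neg, inner_neg_left, smul_neg]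
  rw [← neg_smul]
  congr 3
  ring

theorem sig_continuousAt {γ p : ℝ} {q : E} (hq : q ≠ 0) (v : E) :
    ContinuousAt (fun q => sig γ p q v) q := by
  unfold sig
  have h1 : ContinuousAt (fun q : E => ‖q‖ ^ (γ / 2)) q :=
    (continuous_norm.continuousAt).rpow_const (Or.inl (norm_ne_zero_iff.2 hq))
  have h2 : ‖q‖ ^ 2 ≠ 0 := pow_ne_zero _ (norm_ne_zero_iff.2 hq)
  refine h1.smul (continuousAt_const.add (ContinuousAt.smul (ContinuousAt.div ?_ ?_ h2) continuousAt_id))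
  · fun_prop
  · fun_prop

end Op

section Doub
variable {F : Type*} [NormedAddCommGroup F] [InnerProductSpace ℝ F] [FiniteDimensional ℝ F]

theorem SupJet.shift {V : Type*} [NormedAddCommGroup V] [NormedSpace ℝ V] {a : V → ℝ} {h0 h : V}
    {c : ℝ} {l L : V →L[ℝ] ℝ} {A : V →L[ℝ] V →L[ℝ] ℝ}
    (H : SupJet (fun x => a (h0 + x) - c - l x) h L A) : SupJet a (h0 + h) (L + l) A := by
  intro ε hε
  filter_upwards [H ε hε] with w hw
  have e1 : h0 + (h + w) = h0 + h + w := by abel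
  simp only [e1, map_add] at hw
  rw [_root_.add_apply]
  linarith

/-- uniform penalization -/
theorem penal {V : Type*} [NormedAddCommGroup V] {K : Set V} (hK : IsCompact K) {G P : V → ℝ}
    (hG : ContinuousOn G K) (hP : Continuous P) (hP0 : ∀ x, 0 ≤ P x)
    (h : ∀ x ∈ K, P x = 0 → G x < 0) : ∃ j : ℝ, 0 ≤ j ∧ ∀ x ∈ K, G x < j * P x := by
  by_contra hcon
  push Not at hcon
  choose x hxK hx using fun j : ℕ => hcon j (Nat.cast_nonneg j)
  obtain ⟨y, hy, φ, hφ, hlim⟩ := hK.tendsto_subseq hxK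
  obtain ⟨M, hM⟩ := hK.bddAbove_image hG
  have hM' : ∀ j, G (x j) ≤ M := fun j => hM (mem_image_of_mem _ (hxK j))
  have hGl : Filter.Tendsto (fun j => G (x (φ j))) Filter.atTop (nhds (G y)) := by
    have h1 := hG y hy
    refine h1.tendsto.comp (tendsto_nhdsWithin_iff.2 ⟨hlim, Filter.Eventually.of_forall fun j => hxK _⟩)
  have hGy : 0 ≤ G y := by
    refine ge_of_tendsto' hGl fun j => ?_
    exact le_trans (by have := hP0 (x (φ j)); positivity) (hx (φ j))
  have hPl : Filter.Tendsto (fun j => P (x (φ j))) Filter.atTop (nhds (P y)) :=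
    (hP.tendsto y).comp hlim
  have hPy : P y ≤ 0 := by
    have h2 : Filter.Tendsto (fun j : ℕ => M / (φ j : ℝ)) Filter.atTop (nhds 0) :=
      (tendsto_const_div_atTop_nhds_zero_nat M).comp hφ.tendsto_atTop
    refine le_of_tendsto_of_tendsto hPl h2 ?_
    filter_upwards [Filter.eventually_gt_atTop 0] with j hj
    have hpos : (0 : ℝ) < φ j := by
      have := hφ.id_le j
      simp only [id] at this
      exact_mod_cast lt_of_lt_of_le hj this
    rw [le_div_iff₀ hpos]
    have := hx (φ j)
    have := hM' (φ j)
    linarith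
  have := h y hy (le_antisymm hPy (hP0 y))
  linarith

def prodSq (F : Type*) [NormedAddCommGroup F] [InnerProductSpace ℝ F] :
    F × F →L[ℝ] F × F →L[ℝ] ℝ :=
  ((innerSL ℝ (E := F)).bilinearComp (ContinuousLinearMap.fst ℝ F F) (ContinuousLinearMap.fst ℝ F F))
  + ((innerSL ℝ (E := F)).bilinearComp (ContinuousLinearMap.snd ℝ F F) (ContinuousLinearMap.snd ℝ F F))

theorem prodSq_apply (z w : F × F) : prodSq F z w = ⟪z.1, w.1⟫ + ⟪z.2, w.2⟫ := by
  rfl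

theorem prodSq_self (z : F × F) : prodSq F z z = ‖z.1‖ ^ 2 + ‖z.2‖ ^ 2 := by
  rw [prodSq_apply, real_inner_self_eq_norm_sq, real_inner_self_eq_norm_sq]

set_option maxHeartbeats 1000000 in
theorem doubling {a b : F → ℝ} {R : ℝ} (pt : F →L[ℝ] ℝ)
    (ha : ContinuousOn a (Metric.closedBall 0 R))
    (hb : ContinuousOn b (Metric.closedBall 0 R)) (ha0 : a 0 = 0) (hb0 : b 0 = 0)
    (B : (F × F) →L[ℝ] (F × F) →L[ℝ] ℝ)
    (hB : ∀ h ∈ Metric.closedBall (0 : F) R, ∀ k ∈ Metric.closedBall (0 : F) R, pt h = pt k →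
      a h + b k ≤ B (h, k) (h, k)) {ε : ℝ} (hε : 0 < ε) (hεR : ε < R) :
    ∃ (h k : F) (L1 L2 : F →L[ℝ] ℝ) (A1 A2 : F →L[ℝ] F →L[ℝ] ℝ) (lam : ℝ),
      ‖h‖ ≤ ε ∧ ‖k‖ ≤ ε ∧ (∀ v, |L1 v - lam * pt v| ≤ ε * ‖v‖) ∧ (∀ v, |L2 v + lam * pt v| ≤ ε * ‖v‖)
      ∧ SupJet a h L1 A1 ∧ SupJet b k L2 A2 ∧
      ∀ x y, pt x = 0 → pt y = 0 →
        A1 x x + A2 y y ≤ B (x, y) (x, y) + ε * (‖x‖ ^ 2 + ‖y‖ ^ 2) := by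
  have hR : 0 < R := hε.trans hεR
  have : ProperSpace F := FiniteDimensional.proper ℝ F
  set B' : (F × F) →L[ℝ] (F × F) →L[ℝ] ℝ := B + (ε / 2) • prodSq F with hB'
  have hB's : ∀ z, B' z z = B z z + ε / 2 * (‖z.1‖ ^ 2 + ‖z.2‖ ^ 2) := by
    intro z
    rw [hB', _root_.add_apply, _root_.add_apply, _root_.smul_apply, _root_.smul_apply, prodSq_self, smul_eq_mul]
  obtain ⟨C, hC, bilB⟩ := bil_bound B'
  set ρ : ℝ := min (ε / 2) (min (R / 2) (ε / (8 * (C + 1)))) with hρ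
  have hρp : 0 < ρ := by positivity
  have hρ1 : ρ ≤ ε / 2 := min_le_left _ _
  have hρ2 : ρ ≤ R / 2 := (min_le_right _ _).trans (min_le_left _ _)
  have hρ3 : ρ * (8 * (C + 1)) ≤ ε := by
    have : ρ ≤ ε / (8 * (C + 1)) := (min_le_right _ _).trans (min_le_right _ _)
    rwa [le_div_iff₀ (by positivity)] at this
  set K0 : Set (F × F) := Metric.closedBall 0 R ×ˢ Metric.closedBall 0 R with hK0
  have hK0c : IsCompact K0 := (isCompact_closedBall _ _).prod (isCompact_closedBall _ _)
  set G : F × F → ℝ := fun z => a z.1 + b z.2 - B' z z with hG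
  have hGc : ContinuousOn G K0 := by
    have h1 : ContinuousOn (fun z : F × F => a z.1) K0 :=
      ha.comp continuousOn_fst (fun z hz => hz.1)
    have h2 : ContinuousOn (fun z : F × F => b z.2) K0 :=
      hb.comp continuousOn_snd (fun z hz => hz.2)
    have h3 : Continuous (fun z : F × F => B' z z) := by fun_prop
    exact (h1.add h2).sub h3.continuousOn
  set P : F × F → ℝ := fun z => (pt z.1 - pt z.2) ^ 2 with hP
  have hPc : Continuous P := by fun_prop
  set K1 : Set (F × F) := K0 ∩ {z | ρ ≤ ‖z‖} with hK1
  have hK1c : IsCompact K1 := hK0c.inter_right (isClosed_le continuous_const continuous_norm)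
  obtain ⟨j, hj0, hj⟩ := penal hK1c (hGc.mono inter_subset_left) hPc (fun z => sq_nonneg _) (by
    rintro ⟨h, k⟩ ⟨⟨h1, h2⟩, h3⟩ h4
    have h5 : pt h = pt k := by
      have := pow_eq_zero_iff (two_ne_zero) |>.1 h4
      simp only at this; linarith
    have h6 := hB h h1 k h2 h5
    have h7 : 0 < ‖h‖ ^ 2 + ‖k‖ ^ 2 := by
      by_contra hc
      have e1 : ‖h‖ = 0 := by nlinarith [sq_nonneg ‖h‖, sq_nonneg ‖k‖]
      have e2 : ‖k‖ = 0 := by nlinarith [sq_nonneg ‖h‖, sq_nonneg ‖k‖]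
      have h3' : ρ ≤ ‖(h, k)‖ := h3
      rw [Prod.norm_def, e1, e2] at h3'
      simp at h3'
      linarith
    simp only [hG, hB's]
    nlinarith)
  obtain ⟨z, hzK, hzmax⟩ := hK0c.exists_isMaxOn (⟨0, by
    constructor <;> exact Metric.mem_closedBall_self hR.le⟩ : K0.Nonempty)
    (hGc.sub (continuous_const.mul hPc : Continuous fun z => j * P z).continuousOn)
  have hz0 : 0 ≤ G z - j * P z := by
    have := hzmax (by constructor <;> exact Metric.mem_closedBall_self hR.le : (0 : F × F) ∈ K0)
    refine le_trans ?_ this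
    simp [hG, hP, ha0, hb0]
  have hzρ : ‖z‖ < ρ := by
    by_contra hc
    push Not at hc
    have := hj z ⟨hzK, hc⟩
    linarith
  have hz1 : ‖z.1‖ < ρ := (norm_fst_le z).trans_lt hzρ
  have hz2 : ‖z.2‖ < ρ := (norm_snd_le z).trans_lt hzρ
  have hCz : C * ‖z‖ ≤ ε / 8 := by
    have h1 := mul_le_mul_of_nonneg_left hzρ.le hC
    have h2 : ρ * (8 * (C + 1)) = 8 * (C * ρ) + 8 * ρ := by ring
    linarith
  set pd : F × F →L[ℝ] ℝ := pt.comp (ContinuousLinearMap.fst ℝ F F) - pt.comp (ContinuousLinearMap.snd ℝ F F) with hpd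
  have hpda : ∀ w : F × F, pd w = pt w.1 - pt w.2 := fun w => rfl
  set B'' : (F × F) →L[ℝ] (F × F) →L[ℝ] ℝ := B' + j • (pd.smulRight pd) with hB''
  have hB''s : ∀ w v, B'' w v = B' w v + j * (pd w * pd v) := by
    intro w v
    rw [hB'', _root_.add_apply, _root_.add_apply, _root_.smul_apply, _root_.smul_apply,
      ContinuousLinearMap.smulRight_apply, _root_.smul_apply, smul_eq_mul, smul_eq_mul]
  set ll : F × F →L[ℝ] ℝ := B'' z + B''.flip z with hll
  have hlla : ∀ w, ll w = B' z w + B' w z + 2 * j * pd z * pd w := by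
    intro w
    rw [hll, _root_.add_apply, ContinuousLinearMap.flip_apply, hB''s, hB''s]; ring
  set l1 := ll.comp (ContinuousLinearMap.inl ℝ F F)
  set l2 := ll.comp (ContinuousLinearMap.inr ℝ F F)
  have hl12 : ∀ h k, ll (h, k) = l1 h + l2 k := by
    intro h k
    have : ((h, k) : F × F) = (h, 0) + (0, k) := by simp
    rw [this, map_add]; rfl
  have hin1 : ∀ h ∈ Metric.closedBall (0 : F) (R / 2), z.1 + h ∈ Metric.closedBall (0 : F) R := by
    intro h hh
    rw [mem_closedBall_zero_iff] at hh ⊢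
    have := norm_add_le z.1 h
    linarith
  have hin2 : ∀ h ∈ Metric.closedBall (0 : F) (R / 2), z.2 + h ∈ Metric.closedBall (0 : F) R := by
    intro h hh
    rw [mem_closedBall_zero_iff] at hh ⊢
    have := norm_add_le z.2 h
    linarith
  set ε2 := min (ε / 4) (R / 4)
  have hε2 : 0 < ε2 := by positivity
  have hε2a : ε2 ≤ ε / 4 := min_le_left _ _
  have hε2b : ε2 ≤ R / 4 := min_le_right _ _
  obtain ⟨h, k, L1, L2, A1, A2, q1, q2, q3, q4, q5, q6, q7⟩ := sums
    (a := fun h => a (z.1 + h) - a z.1 - l1 h) (b := fun k => b (z.2 + k) - b z.2 - l2 k) (R := R / 2)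
    ((((ha.comp (by fun_prop) hin1).sub continuousOn_const)).sub (by fun_prop))
    ((((hb.comp (by fun_prop) hin2).sub continuousOn_const)).sub (by fun_prop))
    (by simp) (by simp) B'' (by
      intro h hh k hk
      have h1 := hzmax (⟨hin1 h hh, hin2 k hk⟩ : (z.1 + h, z.2 + k) ∈ K0)
      have e1 : ((z.1 + h, z.2 + k) : F × F) = z + (h, k) := rfl
      have e2 : ∀ w, G w - j * P w = a w.1 + b w.2 - B'' w w := by
        intro w; rw [hB''s]; simp only [hG, hP, hpda]; ring
      have h1 : G (z.1 + h, z.2 + k) - j * P (z.1 + h, z.2 + k) ≤ G z - j * P z := h1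
      rw [e2, e2, e1, bil_add] at h1
      have e3 := hl12 h k
      have e4 : ll (h, k) = B'' z (h, k) + B'' (h, k) z := rfl
      have e5 : (z + (h, k)).1 = z.1 + h := rfl
      have e6 : (z + (h, k)).2 = z.2 + k := rfl
      rw [e5, e6] at h1
      linarith) hε2 (by linarith)
  refine ⟨z.1 + h, z.2 + k, L1 + l1, L2 + l2, A1, A2, 2 * j * pd z, ?_, ?_, ?_, ?_, q5.shift, q6.shift, ?_⟩
  · have := norm_add_le z.1 h; linarith
  · have := norm_add_le z.2 k; linarith
  · intro v
    have n0 : ‖((v, 0) : F × F)‖ = ‖v‖ := by simp [Prod.norm_def]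
    have e1 : l1 v = B' z (v, 0) + B' (v, 0) z + 2 * j * pd z * pt v := by
      have : l1 v = ll (v, 0) := rfl
      rw [this, hlla, hpda (v, 0)]; simp
    have b1 := bilB z (v, 0)
    have b2 := bilB (v, 0) z
    rw [n0] at b1 b2
    have b3 : |L1 v| ≤ ε / 4 * ‖v‖ := (lin_le L1 v).trans (by gcongr; linarith)
    have b4 : C * ‖z‖ * ‖v‖ ≤ ε / 8 * ‖v‖ := by
      gcongr
    rw [_root_.add_apply, e1]
    have b5 := norm_nonneg v
    have b6 : 0 ≤ ε * ‖v‖ := by positivity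
    rw [abs_le] at b1 b2 b3 ⊢
    constructor <;> linarith [b1.1, b1.2, b2.1, b2.2, b3.1, b3.2]
  · intro v
    have n0 : ‖((0, v) : F × F)‖ = ‖v‖ := by simp [Prod.norm_def]
    have e1 : l2 v = B' z (0, v) + B' (0, v) z - 2 * j * pd z * pt v := by
      have : l2 v = ll (0, v) := rfl
      rw [this, hlla, hpda (0, v)]; simp; ring
    have b1 := bilB z (0, v)
    have b2 := bilB (0, v) z
    rw [n0] at b1 b2
    have b3 : |L2 v| ≤ ε / 4 * ‖v‖ := (lin_le L2 v).trans (by gcongr; linarith)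
    have b4 : C * ‖z‖ * ‖v‖ ≤ ε / 8 * ‖v‖ := by
      gcongr
    rw [_root_.add_apply, e1]
    have b5 := norm_nonneg v
    have b6 : 0 ≤ ε * ‖v‖ := by positivity
    rw [abs_le] at b1 b2 b3 ⊢
    constructor <;> linarith [b1.1, b1.2, b2.1, b2.2, b3.1, b3.2]
  · intro x y hx hy
    have := q7 x y
    rw [hB''s, hpda, hB's] at this
    simp only [hx, hy] at this
    have h2 : ε2 * (‖x‖ ^ 2 + ‖y‖ ^ 2) ≤ ε / 4 * (‖x‖ ^ 2 + ‖y‖ ^ 2) := by gcongr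
    nlinarith [sq_nonneg ‖x‖, sq_nonneg ‖y‖]
end Doub

section Raw
variable {E : Type*} [NormedAddCommGroup E] [InnerProductSpace ℝ E] [FiniteDimensional ℝ E]

def TJet (u : E × ℝ → ℝ) (z : E × ℝ) (q : E) (θ : ℝ) (A : E →L[ℝ] E →L[ℝ] ℝ) : Prop :=
  ∀ ε > 0, ∃ C : ℝ, ∀ᶠ w in nhds (0 : E × ℝ),
    u (z + w) ≤ u z + ⟪q, w.1⟫ + θ * w.2 + A w.1 w.1 + ε * ‖w.1‖ ^ 2 + C * w.2 ^ 2

structure VisSub (γ p ε : ℝ) (u : E × ℝ → ℝ) (Ω : Set (E × ℝ)) : Prop where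
  jet : ∀ z ∈ Ω, ∀ (q : E) (θ : ℝ) (A : E →L[ℝ] E →L[ℝ] ℝ), q ≠ 0 → TJet u z q θ A →
    θ ≤ ε + 2 * opB γ p q A
  loc : ∀ z ∈ Ω, ∀ δ > 0, ∀ φ : ℝ → ℝ, ContDiffOn ℝ 1 φ (Ioo (z.2 - δ) (z.2 + δ)) → φ z.2 = 0 →
    (∃ r > 0, ∀ x : E, ‖x - z.1‖ < r → (∀ t ∈ Ioo (z.2 - δ) (z.2 + δ), u (x, t) - φ t ≤ u z) ∧
      ∃ t ∈ Ioo (z.2 - δ) (z.2 + δ), u (x, t) - φ t = u z) → deriv φ z.2 ≤ ε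

structure VisS (γ p ε : ℝ) (u : E × ℝ → ℝ) (Ω : Set (E × ℝ)) : Prop where
  opn : IsOpen Ω
  cont : ContinuousOn u Ω
  sub : VisSub γ p ε u Ω
  sup : VisSub γ p ε (fun z => -u z) Ω

theorem VisS.neg {γ p ε : ℝ} {u : E × ℝ → ℝ} {Ω : Set (E × ℝ)} (h : VisS γ p ε u Ω) :
    VisS γ p ε (fun z => -u z) Ω :=
  ⟨h.opn, h.cont.neg, h.sup, by simpa using h.sub⟩

theorem VisS.mono {γ p ε : ℝ} {u : E × ℝ → ℝ} {Ω Ω' : Set (E × ℝ)} (h : VisS γ p ε u Ω)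
    (ho : IsOpen Ω') (hs : Ω' ⊆ Ω) : VisS γ p ε u Ω' :=
  ⟨ho, h.cont.mono hs, ⟨fun z hz => h.sub.jet z (hs hz), fun z hz => h.sub.loc z (hs hz)⟩,
    ⟨fun z hz => h.sup.jet z (hs hz), fun z hz => h.sup.loc z (hs hz)⟩⟩

theorem VisS.le {γ p ε ε' : ℝ} {u : E × ℝ → ℝ} {Ω : Set (E × ℝ)} (h : VisS γ p ε u Ω)
    (he : ε ≤ ε') : VisS γ p ε' u Ω :=
  ⟨h.opn, h.cont, ⟨fun z hz q θ A hq hj => by have := h.sub.jet z hz q θ A hq hj; linarith,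
    fun z hz δ hδ φ h1 h2 h3 => (h.sub.loc z hz δ hδ φ h1 h2 h3).trans he⟩,
    ⟨fun z hz q θ A hq hj => by have := h.sup.jet z hz q θ A hq hj; linarith,
    fun z hz δ hδ φ h1 h2 h3 => (h.sup.loc z hz δ hδ φ h1 h2 h3).trans he⟩⟩

/-- the two point function -/
def D2 (u : E × ℝ → ℝ) (w : E × E × ℝ) : ℝ := u (w.1, w.2.2) - u (w.2.1, w.2.2)

variable {F : Type*} [NormedAddCommGroup F] [InnerProductSpace ℝ F] [FiniteDimensional ℝ F]

/-- from jets on the Hilbert space `F ≃ E × ℝ` to parabolic jets -/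
theorem jet_conv (T : F ≃L[ℝ] E × ℝ) (hT : ∀ f, ‖f‖ ^ 2 = ‖(T f).1‖ ^ 2 + (T f).2 ^ 2)
    {a : F → ℝ} {v : E × ℝ → ℝ} {z0 : E × ℝ} {c θ : ℝ} {q : E}
    (hav : ∀ h, a h = v (z0 + T h) - c - ⟪q, (T h).1⟫ - θ * (T h).2)
    {h : F} {L : F →L[ℝ] ℝ} {A : F →L[ℝ] F →L[ℝ] ℝ} (hJ : SupJet a h L A) {q' : E}
    (hq' : ∀ x, ⟪q', x⟫ = L (T.symm (x, 0))) :
    TJet v (z0 + T h) (q + q') (θ + L (T.symm (0, 1)))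
      (A.bilinearComp ((T.symm : E × ℝ →L[ℝ] F).comp (ContinuousLinearMap.inl ℝ E ℝ))
        ((T.symm : E × ℝ →L[ℝ] F).comp (ContinuousLinearMap.inl ℝ E ℝ))) := by
  obtain ⟨C, hC, hCA⟩ := bil_bound A
  intro ε hε
  refine ⟨C ^ 2 * (2 / ε) + C + ε / 2, ?_⟩
  have ht : Filter.Tendsto (fun w : E × ℝ => T.symm w) (nhds 0) (nhds 0) := by
    have := (T.symm.continuous).tendsto 0
    simpa using this
  filter_upwards [ht.eventually (hJ (ε / 2) (by positivity))] with w hw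
  set x : F := T.symm (w.1, 0)
  set s : F := T.symm (0, w.2)
  have e0 : T.symm w = x + s := by
    rw [← map_add]; simp
  have e1 : T (x + s) = w := by rw [← e0]; simp
  have e2 : s = w.2 • T.symm (0, 1) := by
    rw [← map_smul]; simp [s]
  have hx : ‖x‖ = ‖w.1‖ := by
    have := hT x
    simp [x] at this
    exact this
  have hs : ‖s‖ = |w.2| := by
    have := hT s
    simp only [s, ContinuousLinearEquiv.apply_symm_apply, norm_zero] at this
    rw [← abs_of_nonneg (norm_nonneg s)]
    rw [← sq_eq_sq_iff_abs_eq_abs]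
    simp only [s]; rw [this]; ring
  have hxs : ‖x + s‖ ^ 2 = ‖w.1‖ ^ 2 + w.2 ^ 2 := by rw [hT, e1]
  rw [e0, hav, hav, map_add T h, e1, hxs, bil_add, map_add L] at hw
  have b1 := (abs_le.1 (hCA x s)).2
  have b2 := (abs_le.1 (hCA s x)).2
  have b3 := (abs_le.1 (hCA s s)).2
  rw [hs] at b1 b2 b3
  rw [hx] at b1 b2
  have e3 : L s = w.2 * L (T.symm (0, 1)) := by rw [e2, map_smul, smul_eq_mul]
  have e4 := hq' w.1
  have e5 : z0 + (T h + w) = z0 + T h + w := by abel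
  rw [e5] at hw
  simp only [Prod.fst_add, Prod.snd_add, inner_add_right] at hw
  rw [inner_add_left]
  have e6 : (A.bilinearComp ((T.symm : E × ℝ →L[ℝ] F).comp (ContinuousLinearMap.inl ℝ E ℝ))
        ((T.symm : E × ℝ →L[ℝ] F).comp (ContinuousLinearMap.inl ℝ E ℝ))) w.1 w.1 = A x x := rfl
  rw [e6]
  have m1 : 2 * (C * ‖w.1‖ * |w.2|) ≤ ε / 2 * ‖w.1‖ ^ 2 + C ^ 2 * (2 / ε) * w.2 ^ 2 := by
    have : 0 ≤ (ε * ‖w.1‖ - 2 * C * |w.2|) ^ 2 / (2 * ε) := by positivity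
    have e1 : (ε * ‖w.1‖ - 2 * C * |w.2|) ^ 2 / (2 * ε) = ε / 2 * ‖w.1‖ ^ 2 - 2 * (C * ‖w.1‖ * |w.2|)
      + C ^ 2 * (2 / ε) * |w.2| ^ 2 := by field_simp; ring
    rw [sq_abs] at e1
    linarith
  have m2 : C * |w.2| * |w.2| = C * w.2 ^ 2 := by rw [mul_assoc, ← sq, sq_abs]
  rw [m2] at b3
  have m3 : C * |w.2| * ‖w.1‖ = C * ‖w.1‖ * |w.2| := by ring
  rw [m3] at b2
  have e7 : L x = ⟪q', w.1⟫ := e4.symm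
  rw [e7] at hw
  linarith

end Raw

section Raw
variable {E : Type*} [NormedAddCommGroup E] [InnerProductSpace ℝ E] [FiniteDimensional ℝ E]

theorem raw1 {Q : E × E × ℝ → ℝ} {L : E × E × ℝ →L[ℝ] ℝ}
    {B : E × E × ℝ →L[ℝ] E × E × ℝ →L[ℝ] ℝ} {w0 : E × E × ℝ} (hJ : SupJet Q w0 L B)
    {e : ℝ} (he : 0 < e) :
    ∃ C : ℝ, ∀ᶠ w in nhds (0 : E × E × ℝ), Q (w0 + w) ≤ Q w0 + L w + B (w.1, w.2.1, 0) (w.1, w.2.1, 0)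
      + e * (‖w.1‖ ^ 2 + ‖w.2.1‖ ^ 2) + C * w.2.2 ^ 2 := by
  obtain ⟨C, hC, hCB⟩ := bil_bound B
  refine ⟨C ^ 2 * (2 / e) + C + e / 2, ?_⟩
  filter_upwards [hJ (e / 2) (by positivity)] with w hw
  set x : E × E × ℝ := (w.1, w.2.1, 0)
  set s : E × E × ℝ := (0, 0, w.2.2)
  have e0 : w = x + s := by simp [x, s]
  have hs : ‖s‖ = |w.2.2| := by simp [s, Prod.norm_def]
  have hx : ‖x‖ ^ 2 ≤ ‖w.1‖ ^ 2 + ‖w.2.1‖ ^ 2 := by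
    have : ‖x‖ = max ‖w.1‖ ‖w.2.1‖ := by simp [x, Prod.norm_def]
    rw [this]
    rcases max_cases ‖w.1‖ ‖w.2.1‖ with h | h
    · rw [h.1]; nlinarith [sq_nonneg ‖w.2.1‖]
    · rw [h.1]; nlinarith [sq_nonneg ‖w.1‖]
  have hwn : ‖w‖ ^ 2 ≤ ‖w.1‖ ^ 2 + ‖w.2.1‖ ^ 2 + w.2.2 ^ 2 := by
    have : ‖w‖ = max ‖x‖ |w.2.2| := by
      rw [Prod.norm_def, Prod.norm_def]; simp [x, Prod.norm_def, max_assoc]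
    rw [this]
    rcases max_cases ‖x‖ |w.2.2| with h | h
    · rw [h.1]; nlinarith [sq_nonneg w.2.2]
    · rw [h.1, sq_abs]; nlinarith [sq_nonneg ‖w.1‖, sq_nonneg ‖w.2.1‖]
  have hB : B w w = B x x + (B x s + B s x) + B s s := by rw [e0, bil_add]
  have b1 := (abs_le.1 (hCB x s)).2
  have b2 := (abs_le.1 (hCB s x)).2
  have b3 := (abs_le.1 (hCB s s)).2
  rw [hs] at b1 b2 b3
  have m1 : 2 * (C * ‖x‖ * |w.2.2|) ≤ e / 2 * ‖x‖ ^ 2 + C ^ 2 * (2 / e) * w.2.2 ^ 2 := by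
    have : 0 ≤ (e * ‖x‖ - 2 * C * |w.2.2|) ^ 2 / (2 * e) := by positivity
    have e1 : (e * ‖x‖ - 2 * C * |w.2.2|) ^ 2 / (2 * e) = e / 2 * ‖x‖ ^ 2 - 2 * (C * ‖x‖ * |w.2.2|)
      + C ^ 2 * (2 / e) * |w.2.2| ^ 2 := by field_simp; ring
    rw [sq_abs] at e1
    linarith
  have m2 : C * |w.2.2| * |w.2.2| = C * w.2.2 ^ 2 := by rw [mul_assoc, ← sq, sq_abs]
  rw [m2] at b3
  have m3 : C * |w.2.2| * ‖x‖ = C * ‖x‖ * |w.2.2| := by ring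
  rw [m3] at b2
  have m4 : e / 2 * ‖x‖ ^ 2 ≤ e / 2 * (‖w.1‖ ^ 2 + ‖w.2.1‖ ^ 2) := by gcongr
  have m5 : e / 2 * ‖w‖ ^ 2 ≤ e / 2 * (‖w.1‖ ^ 2 + ‖w.2.1‖ ^ 2 + w.2.2 ^ 2) := by gcongr
  linarith

theorem raw_eps {γ p ε : ℝ} (hp : 1 < p) {u : E × ℝ → ℝ} {Ω : Set (E × ℝ)} (hu : VisS γ p ε u Ω)
    {x0 y0 : E} {t0 : ℝ} (hx : (x0, t0) ∈ Ω) (hy : (y0, t0) ∈ Ω) {L : E × E × ℝ →L[ℝ] ℝ}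
    {B : E × E × ℝ →L[ℝ] E × E × ℝ →L[ℝ] ℝ} (hJ : SupJet (D2 u) (x0, y0, t0) L B)
    {qx qy : E} {θ : ℝ} (hL : ∀ h k τ, L (h, k, τ) = ⟪qx, h⟫ - ⟪qy, k⟫ + θ * τ)
    {ι : Type*} [Fintype ι] (b1 b2 : OrthonormalBasis ι ℝ E) {e : ℝ} (he : 0 < e) :
    ∃ q1 q2 : E, ‖q1 - qx‖ ≤ e ∧ ‖q2 - qy‖ ≤ e ∧ (q1 ≠ 0 → q2 ≠ 0 →
      θ ≤ 2 * ε + 2 * (∑ i, B (sig γ p q1 (b1 i), sig γ p q2 (b2 i), 0)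
        (sig γ p q1 (b1 i), sig γ p q2 (b2 i), 0))
        + e * (2 + 4 * ∑ i, (‖sig γ p q1 (b1 i)‖ ^ 2 + ‖sig γ p q2 (b2 i)‖ ^ 2))) := by
  obtain ⟨C, hC⟩ := raw1 hJ he
  let F := WithLp 2 (E × ℝ)
  let T : F ≃L[ℝ] E × ℝ := WithLp.prodContinuousLinearEquiv 2 ℝ E ℝ
  have hT : ∀ f : F, ‖f‖ ^ 2 = ‖(T f).1‖ ^ 2 + (T f).2 ^ 2 := by
    intro f
    have := WithLp.prod_norm_sq_eq_of_L2 f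
    rw [this, Real.norm_eq_abs, sq_abs]; rfl
  let pt : F →L[ℝ] ℝ := (ContinuousLinearMap.snd ℝ E ℝ).comp (T : F →L[ℝ] E × ℝ)
  have hpt : ∀ f, pt f = (T f).2 := fun f => rfl
  have hΩx : ∀ᶠ w in nhds (0 : E × ℝ), (x0, t0) + w ∈ Ω := by
    have : Filter.Tendsto (fun w : E × ℝ => (x0, t0) + w) (nhds 0) (nhds (x0, t0)) := by
      have : Continuous (fun w : E × ℝ => (x0, t0) + w) := by fun_prop
      simpa using this.tendsto 0
    exact this.eventually (hu.opn.mem_nhds hx)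
  have hΩy : ∀ᶠ w in nhds (0 : E × ℝ), (y0, t0) + w ∈ Ω := by
    have : Filter.Tendsto (fun w : E × ℝ => (y0, t0) + w) (nhds 0) (nhds (y0, t0)) := by
      have : Continuous (fun w : E × ℝ => (y0, t0) + w) := by fun_prop
      simpa using this.tendsto 0
    exact this.eventually (hu.opn.mem_nhds hy)
  obtain ⟨r1, hr1, hC⟩ := Metric.eventually_nhds_iff.1 hC
  obtain ⟨r2, hr2, hΩx⟩ := Metric.eventually_nhds_iff.1 hΩx
  obtain ⟨r3, hr3, hΩy⟩ := Metric.eventually_nhds_iff.1 hΩy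
  set R := min r1 (min r2 r3) / 2 with hR
  have hRp : 0 < R := by positivity
  have hm1 := min_le_left r1 (min r2 r3)
  have hm2 := (min_le_right r1 (min r2 r3)).trans (min_le_left r2 r3)
  have hm3 := (min_le_right r1 (min r2 r3)).trans (min_le_right r2 r3)
  have hT1 : ∀ f : F, ‖(T f).1‖ ≤ ‖f‖ := by
    intro f
    refine abs_le_of_sq_le_sq' ?_ (norm_nonneg _) |>.2
    rw [hT]; nlinarith [sq_nonneg (T f).2]
  have hT2 : ∀ f : F, |(T f).2| ≤ ‖f‖ := by
    intro f
    refine abs_le_of_sq_le_sq ?_ (norm_nonneg _)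
    rw [hT]; nlinarith [sq_nonneg ‖(T f).1‖]
  have hball : ∀ f ∈ Metric.closedBall (0 : F) R, ‖T f‖ ≤ R := by
    intro f hf
    rw [mem_closedBall_zero_iff] at hf
    rw [Prod.norm_def]
    exact max_le ((hT1 f).trans hf) ((hT2 f).trans hf)
  let a : F → ℝ := fun h => u ((x0, t0) + T h) - u (x0, t0) - ⟪qx, (T h).1⟫ - θ * (T h).2
  let b : F → ℝ := fun k => -u ((y0, t0) + T k) - (-u (y0, t0)) - ⟪-qy, (T k).1⟫ - 0 * (T k).2
  have hTc : Continuous T := T.continuous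
  have hac : ContinuousOn a (Metric.closedBall 0 R) := by
    have h1 : ContinuousOn (fun h : F => u ((x0, t0) + T h)) (Metric.closedBall 0 R) := by
      refine hu.cont.comp (by fun_prop) fun f hf => ?_
      exact hΩx (by rw [dist_zero_right]; have := hball f hf; linarith)
    exact ((h1.sub continuousOn_const).sub (by fun_prop)).sub (by fun_prop)
  have hbc : ContinuousOn b (Metric.closedBall 0 R) := by
    have h1 : ContinuousOn (fun h : F => u ((y0, t0) + T h)) (Metric.closedBall 0 R) := by
      refine hu.cont.comp (by fun_prop) fun f hf => ?_
      exact hΩy (by rw [dist_zero_right]; have := hball f hf; linarith)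
    exact ((h1.neg.sub continuousOn_const).sub (by fun_prop)).sub (by fun_prop)
  let T1 : F →L[ℝ] E := (ContinuousLinearMap.fst ℝ E ℝ).comp (T : F →L[ℝ] E × ℝ)
  let M : F × F →L[ℝ] E × E × ℝ := (T1.comp (ContinuousLinearMap.fst ℝ F F)).prod
    ((T1.comp (ContinuousLinearMap.snd ℝ F F)).prod 0)
  let P1 : F × F →L[ℝ] ℝ := pt.comp (ContinuousLinearMap.fst ℝ F F)
  let BF : F × F →L[ℝ] F × F →L[ℝ] ℝ := B.bilinearComp M M + e • prodSq F + C • P1.smulRight P1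
  have hBF : ∀ f g : F, BF (f, g) (f, g) = B ((T f).1, (T g).1, 0) ((T f).1, (T g).1, 0)
      + e * (‖f‖ ^ 2 + ‖g‖ ^ 2) + C * ((T f).2 * (T f).2) := by
    intro f g
    have h1 : BF (f, g) (f, g) = B.bilinearComp M M (f, g) (f, g) + e * prodSq F (f, g) (f, g)
      + C * (P1 (f, g) * P1 (f, g)) := rfl
    rw [h1, prodSq_self]; rfl
  obtain ⟨h, k, L1, L2, A1, A2, lam, q1, q2, q3, q4, q5, q6, q7⟩ := doubling (a := a) (b := b) pt hac hbc
    (by simp [a]) (by simp [b]) BF (by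
      intro f hf g hg hfg
      rw [hpt, hpt] at hfg
      have n1 := hball f hf
      have n2 := hball g hg
      have h1 := hC (y := ((T f).1, (T g).1, (T f).2)) (by
        rw [dist_zero_right, Prod.norm_def, Prod.norm_def]
        have m1 := (hT1 f).trans (mem_closedBall_zero_iff.1 hf)
        have m2 := (hT1 g).trans (mem_closedBall_zero_iff.1 hg)
        have m3 := (hT2 f).trans (mem_closedBall_zero_iff.1 hf)
        simp only [max_lt_iff, Real.norm_eq_abs]
        refine ⟨?_, ?_, ?_⟩ <;> linarith)
      have e1 : (x0, t0) + T f = (x0 + (T f).1, t0 + (T f).2) := rfl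
      have e2 : (y0, t0) + T g = (y0 + (T g).1, t0 + (T f).2) := by rw [hfg]; rfl
      have m1 := hT1 f
      have m2 := hT1 g
      have m3 : e * (‖(T f).1‖ ^ 2 + ‖(T g).1‖ ^ 2) ≤ e * (‖f‖ ^ 2 + ‖g‖ ^ 2) := by gcongr
      rw [hBF]
      simp only [a, b, e1, e2, inner_neg_left]
      rw [hL] at h1
      simp only [D2, Prod.fst_add, Prod.snd_add] at h1
      linarith) (ε := min e (R / 2)) (by positivity) (by
        have := min_le_right e (R / 2); linarith)
  have hme := min_le_left e (R / 2)
  have hmR := min_le_right e (R / 2)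
  set j1 : E →L[ℝ] F := (T.symm : E × ℝ →L[ℝ] F).comp (ContinuousLinearMap.inl ℝ E ℝ) with hj1
  have hj1a : ∀ x, j1 x = T.symm (x, 0) := fun x => rfl
  have hptj : ∀ x, pt (j1 x) = 0 := by
    intro x; rw [hpt, hj1a]; simp
  have hTj : ∀ x, T (j1 x) = (x, 0) := by
    intro x; rw [hj1a]; simp
  have hnj : ∀ x, ‖j1 x‖ = ‖x‖ := by
    intro x
    have := hT (j1 x)
    rw [hTj] at this
    have h2 : ‖j1 x‖ ^ 2 = ‖x‖ ^ 2 := by simpa using this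
    exact (sq_eq_sq₀ (norm_nonneg _) (norm_nonneg _)).1 h2
  set v1 : E := (InnerProductSpace.toDual ℝ E).symm (L1.comp j1)
  set v2 : E := (InnerProductSpace.toDual ℝ E).symm (L2.comp j1)
  have hv1 : ∀ x, ⟪v1, x⟫ = L1 (T.symm (x, 0)) := fun x => InnerProductSpace.toDual_symm_apply
  have hv2 : ∀ x, ⟪v2, x⟫ = L2 (T.symm (x, 0)) := fun x => InnerProductSpace.toDual_symm_apply
  have hnv : ∀ v : E, (∀ x, |⟪v, x⟫| ≤ min e (R / 2) * ‖x‖) → ‖v‖ ≤ e := by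
    intro v hv
    have := hv v
    rw [real_inner_self_eq_norm_sq, abs_of_nonneg (sq_nonneg _)] at this
    rcases eq_or_lt_of_le (norm_nonneg v) with h | h
    · rw [← h]; exact he.le
    · have h2 : ‖v‖ * ‖v‖ ≤ e * ‖v‖ := by nlinarith
      exact le_of_mul_le_mul_right h2 h
  have n1 : ‖v1‖ ≤ e := hnv v1 fun x => by
    have := q3 (j1 x)
    rw [hptj, hnj] at this
    rw [hv1, ← hj1a]; simpa using this
  have n2 : ‖v2‖ ≤ e := hnv v2 fun x => by
    have := q4 (j1 x)
    rw [hptj, hnj] at this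
    rw [hv2, ← hj1a]; simpa using this
  have J1 := jet_conv T hT (a := a) (v := u) (fun h => rfl) q5 hv1
  have J2 := jet_conv T hT (a := b) (v := fun z => -u z) (fun h => rfl) q6 hv2
  have hhb : (x0, t0) + T h ∈ Ω := hΩx (by
    rw [dist_zero_right]
    have := hball h (mem_closedBall_zero_iff.2 (by linarith)); linarith)
  have hkb : (y0, t0) + T k ∈ Ω := hΩy (by
    rw [dist_zero_right]
    have := hball k (mem_closedBall_zero_iff.2 (by linarith)); linarith)
  refine ⟨qx + v1, qy - v2, by simpa using n1, by simpa using n2, fun hq1 hq2 => ?_⟩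
  have hq2' : -qy + v2 ≠ 0 := by
    intro hc; apply hq2; rw [← neg_eq_zero, ← hc]; abel
  have K1 := hu.sub.jet _ hhb _ _ _ hq1 J1
  have K2 := hu.sup.jet _ hkb _ _ _ hq2' J2
  rw [opB_eq hp hq1 _ b1] at K1
  rw [opB_eq hp hq2' _ b2] at K2
  have e3 : -qy + v2 = -(qy - v2) := by abel
  rw [e3] at K2
  simp only [sig_neg] at K2
  have hK : ∀ i, (A1.bilinearComp j1 j1) (sig γ p (qx + v1) (b1 i)) (sig γ p (qx + v1) (b1 i)) +
      (A2.bilinearComp j1 j1) (sig γ p (qy - v2) (b2 i)) (sig γ p (qy - v2) (b2 i)) ≤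
      B (sig γ p (qx + v1) (b1 i), sig γ p (qy - v2) (b2 i), 0)
        (sig γ p (qx + v1) (b1 i), sig γ p (qy - v2) (b2 i), 0) +
      2 * e * (‖sig γ p (qx + v1) (b1 i)‖ ^ 2 + ‖sig γ p (qy - v2) (b2 i)‖ ^ 2) := by
    intro i
    have := q7 (j1 (sig γ p (qx + v1) (b1 i))) (j1 (sig γ p (qy - v2) (b2 i))) (hptj _) (hptj _)
    rw [hBF, hTj, hTj, hnj, hnj] at this
    simp only [ContinuousLinearMap.bilinearComp_apply]
    have h3 : min e (R / 2) * (‖sig γ p (qx + v1) (b1 i)‖ ^ 2 + ‖sig γ p (qy - v2) (b2 i)‖ ^ 2)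
      ≤ e * (‖sig γ p (qx + v1) (b1 i)‖ ^ 2 + ‖sig γ p (qy - v2) (b2 i)‖ ^ 2) := by gcongr
    simp only at this
    linarith
  have hS := Finset.sum_le_sum fun i (_ : i ∈ Finset.univ) => hK i
  rw [Finset.sum_add_distrib, Finset.sum_add_distrib, ← Finset.mul_sum] at hS
  have p1 := (abs_le.1 (q3 (T.symm (0, 1)))).1
  have p2 := (abs_le.1 (q4 (T.symm (0, 1)))).1
  have p3 : ‖T.symm ((0 : E), (1 : ℝ))‖ = 1 := by
    have := hT (T.symm (0, 1))
    simp at this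
    rcases this with h | h
    · exact h
    · have := norm_nonneg (T.symm ((0 : E), (1 : ℝ))); linarith
  rw [p3] at p1 p2
  linarith

theorem raw {γ p ε : ℝ} (hp : 1 < p) {u : E × ℝ → ℝ} {Ω : Set (E × ℝ)} (hu : VisS γ p ε u Ω)
    {x0 y0 : E} {t0 : ℝ} (hx : (x0, t0) ∈ Ω) (hy : (y0, t0) ∈ Ω) {L : E × E × ℝ →L[ℝ] ℝ}
    {B : E × E × ℝ →L[ℝ] E × E × ℝ →L[ℝ] ℝ} (hJ : SupJet (D2 u) (x0, y0, t0) L B)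
    {qx qy : E} {θ : ℝ} (hqx : qx ≠ 0) (hqy : qy ≠ 0)
    (hL : ∀ h k τ, L (h, k, τ) = ⟪qx, h⟫ - ⟪qy, k⟫ + θ * τ)
    {ι : Type*} [Fintype ι] (b1 b2 : OrthonormalBasis ι ℝ E) :
    θ ≤ 2 * ε + 2 * (∑ i, B (sig γ p qx (b1 i), sig γ p qy (b2 i), 0)
        (sig γ p qx (b1 i), sig γ p qy (b2 i), 0)) := by
  choose q1 q2 h1 h2 h3 using fun m : ℕ => raw_eps hp hu hx hy hJ hL b1 b2
    (e := 1 / ((m : ℝ) + 1)) (by positivity)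
  have te := tendsto_one_div_add_atTop_nhds_zero_nat (𝕜 := ℝ)
  have t1 : Filter.Tendsto q1 Filter.atTop (nhds qx) := by
    rw [tendsto_iff_norm_sub_tendsto_zero]
    exact squeeze_zero (fun _ => norm_nonneg _) h1 te
  have t2 : Filter.Tendsto q2 Filter.atTop (nhds qy) := by
    rw [tendsto_iff_norm_sub_tendsto_zero]
    exact squeeze_zero (fun _ => norm_nonneg _) h2 te
  have s1 : ∀ i, Filter.Tendsto (fun m => sig γ p (q1 m) (b1 i)) Filter.atTop (nhds (sig γ p qx (b1 i))) :=
    fun i => (sig_continuousAt hqx _).tendsto.comp t1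
  have s2 : ∀ i, Filter.Tendsto (fun m => sig γ p (q2 m) (b2 i)) Filter.atTop (nhds (sig γ p qy (b2 i))) :=
    fun i => (sig_continuousAt hqy _).tendsto.comp t2
  have lim : Filter.Tendsto (fun m : ℕ => 2 * ε + 2 * (∑ i, B (sig γ p (q1 m) (b1 i), sig γ p (q2 m) (b2 i), 0)
        (sig γ p (q1 m) (b1 i), sig γ p (q2 m) (b2 i), 0))
        + (1 / ((m : ℝ) + 1)) * (2 + 4 * ∑ i, (‖sig γ p (q1 m) (b1 i)‖ ^ 2 + ‖sig γ p (q2 m) (b2 i)‖ ^ 2)))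
      Filter.atTop (nhds (2 * ε + 2 * (∑ i, B (sig γ p qx (b1 i), sig γ p qy (b2 i), 0)
        (sig γ p qx (b1 i), sig γ p qy (b2 i), 0)) + 0 * (2 + 4 * ∑ i, (‖sig γ p qx (b1 i)‖ ^ 2 + ‖sig γ p qy (b2 i)‖ ^ 2)))) := by
    refine (tendsto_const_nhds.add (tendsto_const_nhds.mul (tendsto_finsetSum _ fun i _ => ?_))).add
      (te.mul (tendsto_const_nhds.add (tendsto_const_nhds.mul (tendsto_finsetSum _ fun i _ => ?_))))
    · have hc : Continuous (fun w : E × E => B (w.1, w.2, 0) (w.1, w.2, 0)) := by fun_prop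
      exact (hc.tendsto (sig γ p qx (b1 i), sig γ p qy (b2 i))).comp ((s1 i).prodMk_nhds (s2 i))
    · exact ((s1 i).norm.pow 2).add ((s2 i).norm.pow 2)
  rw [zero_mul, add_zero] at lim
  refine ge_of_tendsto lim ?_
  filter_upwards [t1.eventually_ne hqx, t2.eventually_ne hqy] with m hm1 hm2
  exact h3 m hm1 hm2
end Raw

section Master
variable {E : Type*} [NormedAddCommGroup E] [InnerProductSpace ℝ E] [FiniteDimensional ℝ E]

theorem sig_add (γ p : ℝ) (q v w : E) : sig γ p q (v + w) = sig γ p q v + sig γ p q w := by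
  simp only [sig, inner_add_right, mul_add, add_div, add_smul, smul_add]; abel

theorem sig_smul (γ p : ℝ) (q v : E) (c : ℝ) : sig γ p q (c • v) = c • sig γ p q v := by
  simp only [sig, inner_smul_right]
  have : (√(p - 1) - 1) * (c * ⟪q, v⟫) / ‖q‖ ^ 2 = c * ((√(p - 1) - 1) * ⟪q, v⟫ / ‖q‖ ^ 2) := by ring
  rw [this]
  module

theorem sig_sub (γ p : ℝ) (q v w : E) : sig γ p q (v - w) = sig γ p q v - sig γ p q w := by
  rw [sub_eq_add_neg, ← neg_one_smul ℝ w, sig_add, sig_smul]; simp [sub_eq_add_neg]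

theorem sig_norm_sq {γ p : ℝ} (hp : 1 < p) {q : E} (hq : q ≠ 0) (v : E) :
    ‖sig γ p q v‖ ^ 2 = ‖q‖ ^ γ * (‖v‖ ^ 2 + (p - 2) * (⟪q, v⟫ / ‖q‖) ^ 2) := by
  have hn : 0 < ‖q‖ := norm_pos_iff.2 hq
  have hc2 : (√(p - 1)) ^ 2 = p - 1 := by rw [Real.sq_sqrt]; linarith
  have hr : (‖q‖ ^ (γ / 2)) ^ 2 = ‖q‖ ^ γ := by
    rw [sq, ← Real.rpow_add hn]; ring_nf
  rw [sig, norm_smul, mul_pow, Real.norm_eq_abs, sq_abs, hr, norm_add_sq_real, inner_smul_right,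
    norm_smul, mul_pow, Real.norm_eq_abs, sq_abs, real_inner_comm v q]
  congr 1
  have : p - 2 = (√(p - 1) - 1) ^ 2 + 2 * (√(p - 1) - 1) := by linear_combination -hc2
  rw [this, real_inner_comm]
  field_simp
  ring

theorem inner_div_sq_le (q v : E) : (⟪q, v⟫ / ‖q‖) ^ 2 ≤ ‖v‖ ^ 2 := by
  rcases eq_or_ne q 0 with rfl | hq
  · simp
  have hn : 0 < ‖q‖ := norm_pos_iff.2 hq
  rw [div_pow, div_le_iff₀ (by positivity), ← mul_pow, ← sq_abs]
  have := abs_real_inner_le_norm q v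
  rw [mul_comm] at this
  exact pow_le_pow_left₀ (abs_nonneg _) this 2

theorem sig_upper {γ p : ℝ} (hp : 1 < p) {q : E} (hq : q ≠ 0) (v : E) :
    ‖sig γ p q v‖ ^ 2 ≤ p * ‖q‖ ^ γ * ‖v‖ ^ 2 := by
  rw [sig_norm_sq hp hq]
  have h := inner_div_sq_le q v
  have h0 : 0 ≤ ‖q‖ ^ γ := by positivity
  have : ‖v‖ ^ 2 + (p - 2) * (⟪q, v⟫ / ‖q‖) ^ 2 ≤ p * ‖v‖ ^ 2 := by nlinarith [sq_nonneg (⟪q, v⟫ / ‖q‖)]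
  calc _ ≤ ‖q‖ ^ γ * (p * ‖v‖ ^ 2) := by gcongr
    _ = _ := by ring

theorem sig_lower {γ p : ℝ} (hp : 1 < p) {q : E} (hq : q ≠ 0) (v : E) :
    min 1 (p - 1) * ‖q‖ ^ γ * ‖v‖ ^ 2 ≤ ‖sig γ p q v‖ ^ 2 := by
  rw [sig_norm_sq hp hq]
  have h := inner_div_sq_le q v
  have h0 : 0 ≤ ‖q‖ ^ γ := by positivity
  have : min 1 (p - 1) * ‖v‖ ^ 2 ≤ ‖v‖ ^ 2 + (p - 2) * (⟪q, v⟫ / ‖q‖) ^ 2 := by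
    rcases min_cases 1 (p - 1) with h1 | h1
    · rw [h1.1]; nlinarith [sq_nonneg (⟪q, v⟫ / ‖q‖)]
    · rw [h1.1]; nlinarith [sq_nonneg (⟪q, v⟫ / ‖q‖)]
  calc _ = ‖q‖ ^ γ * (min 1 (p - 1) * ‖v‖ ^ 2) := by ring
    _ ≤ _ := by gcongr

theorem sig_surj {γ p : ℝ} (hp : 1 < p) {q : E} (hq : q ≠ 0) {e : E} (he : ‖e‖ = 1) :
    ∃ (ν : E) (c : ℝ), ‖ν‖ = 1 ∧ sig γ p q ν = c • e ∧ min 1 (p - 1) * ‖q‖ ^ γ ≤ c ^ 2 := by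
  have hn : 0 < ‖q‖ := norm_pos_iff.2 hq
  let v : E := e + ((1 / √(p - 1) - 1) * ⟪q, e⟫ / ‖q‖ ^ 2) • q
  have hsp : 0 < √(p - 1) := Real.sqrt_pos.2 (by linarith)
  have hv : sig γ p q v = (‖q‖ ^ (γ / 2)) • e := by
    simp only [sig, v, inner_add_right, inner_smul_right, real_inner_self_eq_norm_sq]
    rw [add_assoc, ← add_smul]
    have : (1 / √(p - 1) - 1) * ⟪q, e⟫ / ‖q‖ ^ 2 + (√(p - 1) - 1) * (⟪q, e⟫ + (1 / √(p - 1) - 1) * ⟪q, e⟫ / ‖q‖ ^ 2 * ‖q‖ ^ 2) / ‖q‖ ^ 2 = 0 := by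
      field_simp; ring
    rw [this, zero_smul, add_zero]
  have hv0 : v ≠ 0 := by
    intro h
    rw [h] at hv
    have h1 : sig γ p q (0 : E) = 0 := by simp [sig]
    rw [h1] at hv
    have h2 := smul_eq_zero.1 hv.symm
    rcases h2 with h2 | h2
    · have : 0 < ‖q‖ ^ (γ / 2) := by positivity
      linarith
    · rw [h2] at he; simp at he
  have hvn : 0 < ‖v‖ := norm_pos_iff.2 hv0
  refine ⟨(1 / ‖v‖) • v, (1 / ‖v‖) * ‖q‖ ^ (γ / 2), ?_, ?_, ?_⟩
  · rw [norm_smul, Real.norm_eq_abs, abs_of_pos (by positivity)]; field_simp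
  · rw [sig_smul, hv, smul_smul]
  · have h := sig_lower (γ := γ) hp hq ((1 / ‖v‖) • v)
    rw [sig_smul, hv, smul_smul, norm_smul, norm_smul, he, Real.norm_eq_abs, Real.norm_eq_abs,
      abs_of_pos (by positivity : 0 < 1 / ‖v‖), abs_of_pos (by positivity : 0 < 1 / ‖v‖ * ‖q‖ ^ (γ / 2))] at h
    have : 1 / ‖v‖ * ‖v‖ = 1 := by field_simp
    rw [this] at h
    simpa using h

theorem rpow_near {r s : ℝ} (hr : 1 / 2 ≤ r) (hs : -1 ≤ s) (hs0 : s ≤ 0) : |r ^ s - 1| ≤ 2 * |r - 1| := by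
  have h0 : 0 < r := by linarith
  rcases le_total 1 r with h | h
  · have h1 : r ^ s ≤ 1 := Real.rpow_le_one_of_one_le_of_nonpos h hs0
    have h2 : r ^ (-1 : ℝ) ≤ r ^ s := Real.rpow_le_rpow_of_exponent_le h hs
    rw [Real.rpow_neg_one] at h2
    rw [abs_of_nonpos (by linarith), abs_of_nonneg (by linarith)]
    have : 1 - r⁻¹ ≤ r - 1 := by
      have : r⁻¹ * r = 1 := inv_mul_cancel₀ h0.ne'
      nlinarith [inv_pos.2 h0, sq_nonneg (r - 1)]
    linarith
  · have h1 : 1 ≤ r ^ s := Real.one_le_rpow_of_pos_of_le_one_of_nonpos h0 h hs0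
    have h2 : r ^ s ≤ r ^ (-1 : ℝ) := Real.rpow_le_rpow_of_exponent_ge h0 h hs
    rw [Real.rpow_neg_one] at h2
    rw [abs_of_nonneg (by linarith), abs_of_nonpos (by linarith)]
    have h3 : r⁻¹ * r = 1 := inv_mul_cancel₀ h0.ne'
    have h4 : r⁻¹ ≤ 2 := by
      rw [inv_le_comm₀ h0 (by norm_num)]; linarith
    nlinarith [inv_pos.2 h0]

/-- the normalised matrix -/
theorem sig_unit (γ p : ℝ) {q : E} (hq : q ≠ 0) (v : E) : sig γ p q v =
    (‖q‖ ^ (γ / 2)) • (v + ((√(p - 1) - 1) * ⟪(1 / ‖q‖) • q, v⟫) • ((1 / ‖q‖) • q)) := by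
  have hn : 0 < ‖q‖ := norm_pos_iff.2 hq
  rw [sig, smul_smul, inner_smul_left]
  congr 3
  simp
  field_simp

theorem unit_diff {q r : E} (hq : q ≠ 0) (hr : r ≠ 0) :
    ‖(1 / ‖q‖) • q - (1 / ‖r‖) • r‖ ≤ 2 * (‖q - r‖ / ‖r‖) := by
  have hn : 0 < ‖q‖ := norm_pos_iff.2 hq
  have hm : 0 < ‖r‖ := norm_pos_iff.2 hr
  have e1 : (1 / ‖q‖) • q - (1 / ‖r‖) • r = (1 / ‖r‖) • (q - r) + (1 / ‖q‖ - 1 / ‖r‖) • q := by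
    rw [smul_sub, sub_smul]; abel
  rw [e1]
  refine (norm_add_le _ _).trans ?_
  rw [norm_smul, norm_smul, Real.norm_eq_abs, Real.norm_eq_abs, abs_of_pos (by positivity : 0 < 1 / ‖r‖)]
  have e2 : |1 / ‖q‖ - 1 / ‖r‖| * ‖q‖ = |‖r‖ - ‖q‖| / ‖r‖ := by
    have : 1 / ‖q‖ - 1 / ‖r‖ = (‖r‖ - ‖q‖) / (‖q‖ * ‖r‖) := by field_simp
    rw [this, abs_div, abs_of_pos (by positivity : 0 < ‖q‖ * ‖r‖)]; field_simp
  rw [e2]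
  have h := abs_norm_sub_norm_le r q
  rw [norm_sub_rev] at h
  have : |‖r‖ - ‖q‖| / ‖r‖ ≤ ‖q - r‖ / ‖r‖ := by gcongr
  have e3 : 1 / ‖r‖ * ‖q - r‖ = ‖q - r‖ / ‖r‖ := by ring
  linarith

theorem proj_diff {a b : E} (ha : ‖a‖ ≤ 1) (hb : ‖b‖ ≤ 1) (v : E) :
    ‖⟪a, v⟫ • a - ⟪b, v⟫ • b‖ ≤ 2 * ‖a - b‖ * ‖v‖ := by
  have e1 : ⟪a, v⟫ • a - ⟪b, v⟫ • b = ⟪a - b, v⟫ • a + ⟪b, v⟫ • (a - b) := by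
    rw [inner_sub_left, sub_smul, smul_sub]; abel
  rw [e1]
  refine (norm_add_le _ _).trans ?_
  rw [norm_smul, norm_smul]
  have h1 := norm_inner_le_norm (𝕜 := ℝ) (a - b) v
  have h2 := norm_inner_le_norm (𝕜 := ℝ) b v
  have h3 : ‖⟪a - b, v⟫‖ * ‖a‖ ≤ (‖a - b‖ * ‖v‖) * 1 := by gcongr
  have h4 : ‖⟪b, v⟫‖ * ‖a - b‖ ≤ (1 * ‖v‖) * ‖a - b‖ := by
    gcongr
    exact h2.trans (by gcongr)
  linarith

/-- Lipschitz constant of sig -/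
def Csig (p : ℝ) : ℝ := 2 * (1 + |√(p - 1) - 1|) + 4 * |√(p - 1) - 1|

theorem sig_lip {γ p : ℝ} (hγ : -1 < γ) (hγ0 : γ < 0) {q r : E} (hr : r ≠ 0)
    (h : ‖q - r‖ ≤ ‖r‖ / 2) (v : E) :
    ‖sig γ p q v - sig γ p r v‖ ≤ Csig p * ‖r‖ ^ (γ / 2) * (‖q - r‖ / ‖r‖) * ‖v‖ := by
  have hm : 0 < ‖r‖ := norm_pos_iff.2 hr
  have hqr : ‖r‖ / 2 ≤ ‖q‖ := by
    have := norm_sub_norm_le r q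
    rw [norm_sub_rev] at this; linarith
  have hn : 0 < ‖q‖ := by linarith
  have hq : q ≠ 0 := norm_pos_iff.1 hn
  rw [sig_unit γ p hq, sig_unit γ p hr]
  set a := (1 / ‖q‖) • q with ha
  set b := (1 / ‖r‖) • r with hb
  set κ := √(p - 1) - 1 with hκ
  have na : ‖a‖ = 1 := by rw [ha, norm_smul, Real.norm_eq_abs, abs_of_pos (by positivity)]; field_simp
  have nb : ‖b‖ = 1 := by rw [hb, norm_smul, Real.norm_eq_abs, abs_of_pos (by positivity)]; field_simp
  have hab : ‖a - b‖ ≤ 2 * (‖q - r‖ / ‖r‖) := unit_diff hq hr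
  have e1 : ‖q‖ ^ (γ / 2) • (v + (κ * ⟪a, v⟫) • a) - ‖r‖ ^ (γ / 2) • (v + (κ * ⟪b, v⟫) • b)
    = (‖q‖ ^ (γ / 2) - ‖r‖ ^ (γ / 2)) • (v + (κ * ⟪a, v⟫) • a)
      + ‖r‖ ^ (γ / 2) • κ • (⟪a, v⟫ • a - ⟪b, v⟫ • b) := by
    module
  rw [e1]
  refine (norm_add_le _ _).trans ?_
  rw [norm_smul, norm_smul, norm_smul, Real.norm_eq_abs, Real.norm_eq_abs, Real.norm_eq_abs,
    abs_of_pos (by positivity : 0 < ‖r‖ ^ (γ / 2))]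
  have h1 : |‖q‖ ^ (γ / 2) - ‖r‖ ^ (γ / 2)| ≤ ‖r‖ ^ (γ / 2) * (2 * (‖q - r‖ / ‖r‖)) := by
    have : ‖q‖ ^ (γ / 2) - ‖r‖ ^ (γ / 2) = ‖r‖ ^ (γ / 2) * ((‖q‖ / ‖r‖) ^ (γ / 2) - 1) := by
      rw [Real.div_rpow hn.le hm.le]
      have : 0 < ‖r‖ ^ (γ / 2) := by positivity
      field_simp
    rw [this, abs_mul, abs_of_pos (by positivity : 0 < ‖r‖ ^ (γ / 2))]
    gcongr
    refine (rpow_near (by rw [le_div_iff₀ hm]; linarith) (by linarith) (by linarith)).trans ?_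
    gcongr
    have : ‖q‖ / ‖r‖ - 1 = (‖q‖ - ‖r‖) / ‖r‖ := by field_simp
    rw [this, abs_div, abs_of_pos hm]
    gcongr
    exact abs_norm_sub_norm_le q r
  have h2 : ‖v + (κ * ⟪a, v⟫) • a‖ ≤ (1 + |κ|) * ‖v‖ := by
    refine (norm_add_le _ _).trans ?_
    rw [norm_smul, na, Real.norm_eq_abs, abs_mul]
    have := abs_real_inner_le_norm a v
    rw [na] at this
    nlinarith [abs_nonneg κ]
  have h3 := proj_diff na.le nb.le v
  have h4 : ‖⟪a, v⟫ • a - ⟪b, v⟫ • b‖ ≤ 2 * (2 * (‖q - r‖ / ‖r‖)) * ‖v‖ := h3.trans (by gcongr)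
  have h5 := mul_le_mul h1 h2 (norm_nonneg _) (by positivity)
  have h6 : ‖r‖ ^ (γ / 2) * (|κ| * ‖⟪a, v⟫ • a - ⟪b, v⟫ • b‖) ≤ ‖r‖ ^ (γ / 2) * (|κ| * (2 * (2 * (‖q - r‖ / ‖r‖)) * ‖v‖)) := by gcongr
  calc _ ≤ _ := add_le_add h5 h6
    _ = _ := by rw [Csig]; ring

end Master

section Master
variable {E : Type*} [NormedAddCommGroup E] [InnerProductSpace ℝ E] [FiniteDimensional ℝ E]

theorem half_rpow {γ m s : ℝ} (hγ : -1 < γ) (hγ0 : γ < 0) (hm : 0 < m) (hs : m / 2 ≤ s) :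
    s ^ γ ≤ 2 * m ^ γ := by
  have h1 : s ^ γ ≤ (m / 2) ^ γ := Real.rpow_le_rpow_of_nonpos (by positivity) hs hγ0.le
  have h2 : (m / 2) ^ γ = m ^ γ * 2 ^ (-γ) := by
    rw [Real.div_rpow hm.le (by norm_num), Real.rpow_neg (by norm_num)]; rfl
  have h3 : (2 : ℝ) ^ (-γ) ≤ 2 ^ (1 : ℝ) := Real.rpow_le_rpow_of_exponent_le (by norm_num) (by linarith)
  rw [Real.rpow_one] at h3
  have : 0 < m ^ γ := by positivity
  nlinarith

theorem near_norm {q r : E} (h : ‖q - r‖ ≤ ‖r‖ / 2) : ‖r‖ / 2 ≤ ‖q‖ := by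
  have := norm_sub_norm_le r q
  rw [norm_sub_rev] at this; linarith

/-- Hilbert–Schmidt bound -/
theorem hs_bound {γ p : ℝ} (hγ : -1 < γ) (hγ0 : γ < 0) {q r : E} (hr : r ≠ 0)
    (h : ‖q - r‖ ≤ ‖r‖ / 2) {v : E} (hv : ‖v‖ = 1) :
    ‖sig γ p q v - sig γ p r v‖ ^ 2 ≤ Csig p ^ 2 * ‖r‖ ^ γ * (‖q - r‖ / ‖r‖) ^ 2 := by
  have hm : 0 < ‖r‖ := norm_pos_iff.2 hr
  have h1 := sig_lip (p := p) hγ hγ0 hr h v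
  rw [hv, mul_one] at h1
  have h2 := pow_le_pow_left₀ (norm_nonneg _) h1 2
  have hr : (‖r‖ ^ (γ / 2)) ^ 2 = ‖r‖ ^ γ := by
    rw [sq, ← Real.rpow_add hm]; ring_nf
  rwa [mul_pow, mul_pow, hr] at h2

theorem Csig_nonneg (p : ℝ) : 0 ≤ Csig p := by unfold Csig; positivity

set_option maxHeartbeats 1000000 in
theorem master (E : Type*) [NormedAddCommGroup E] [InnerProductSpace ℝ E] [FiniteDimensional ℝ E]
    {γ p : ℝ} (hγ : -1 < γ) (hγ0 : γ < 0) (hp : 1 < p) :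
    ∃ c1 > 0, ∃ C2 > 0, ∃ ν0 > 0, ν0 ≤ 1 / 2 ∧ ∀ {ε : ℝ} {u : E × ℝ → ℝ} {Ω : Set (E × ℝ)}
      (hu : VisS γ p ε u Ω) {x0 y0 : E} {t0 : ℝ} (hx : (x0, t0) ∈ Ω) (hy : (y0, t0) ∈ Ω)
      {L : E × E × ℝ →L[ℝ] ℝ} {B : E × E × ℝ →L[ℝ] E × E × ℝ →L[ℝ] ℝ}
      (hJ : SupJet (D2 u) (x0, y0, t0) L B) {qx qy : E} {θ : ℝ} (hqy : qy ≠ 0)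
      (hL : ∀ h k τ, L (h, k, τ) = ⟪qx, h⟫ - ⟪qy, k⟫ + θ * τ)
      (hq : ‖qx - qy‖ ≤ ν0 * ‖qy‖) {e : E} (he : ‖e‖ = 1) {α β b : ℝ} (hα : α ≤ 0) (hβ : 0 ≤ β)
      (hb : 0 ≤ b) (hB : ∀ h k, B (h, k, 0) (h, k, 0) ≤
        1 / 2 * (α * ⟪e, h - k⟫ ^ 2 + β * (‖h - k‖ ^ 2 - ⟪e, h - k⟫ ^ 2)) + b * ‖h‖ ^ 2),
      θ ≤ 2 * ε + ‖qy‖ ^ γ * (c1 * α + C2 * (β * (‖qx - qy‖ / ‖qy‖) ^ 2 + b)) := by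
  set d : ℝ := ((Module.finrank ℝ E : ℕ) : ℝ) with hd
  set c0 := min 1 (p - 1) with hc0
  have hc0p : 0 < c0 := lt_min one_pos (by linarith)
  have hd0 : 0 ≤ d := by positivity
  set K := d * Csig p ^ 2 + 1 with hK
  have hKp : 0 < K := by positivity
  refine ⟨c0, hc0p, d * Csig p ^ 2 + 4 * d * p + 1, by positivity, min (1 / 2) (c0 / K), by positivity,
    min_le_left _ _, ?_⟩
  intro ε u Ω hu x0 y0 t0 hx hy L B hJ qx qy θ hqy hL hq e he α β b hα hβ hb hB
  have hm : 0 < ‖qy‖ := norm_pos_iff.2 hqy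
  have hq2 : ‖qx - qy‖ ≤ ‖qy‖ / 2 := by
    have : min (1 / 2) (c0 / K) * ‖qy‖ ≤ 1 / 2 * ‖qy‖ := by gcongr; exact min_le_left _ _
    linarith
  have hqxn := near_norm hq2
  have hqx : qx ≠ 0 := norm_pos_iff.1 (by linarith)
  obtain ⟨ν, c, hν, hσ, hc⟩ := sig_surj (γ := γ) hp hqy he
  let b1 := stdOrthonormalBasis ℝ E
  let O : E ≃ₗᵢ[ℝ] E := (ℝ ∙ ν)ᗮ.reflection
  have hO : ∀ v, O v = v - (2 * ⟪ν, v⟫) • ν := by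
    intro v
    simp only [O]
    rw [Submodule.reflection_orthogonal_apply, Submodule.reflection_apply,
      Submodule.starProjection_unit_singleton ℝ hν]
    module
  have R := raw hp hu hx hy hJ hqx hqy hL b1 (b1.map O)
  have hb1 : ∀ i, ‖b1 i‖ = 1 := fun i => b1.norm_eq_one i
  have hm0 : 0 < ‖qy‖ ^ γ := by positivity
  set H := Csig p ^ 2 * ‖qy‖ ^ γ * (‖qx - qy‖ / ‖qy‖) ^ 2 with hH
  have hH0 : 0 ≤ H := by positivity
  have key : ∀ i, B (sig γ p qx (b1 i), sig γ p qy (b1.map O i), 0)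
        (sig γ p qx (b1 i), sig γ p qy (b1.map O i), 0) ≤
        1 / 2 * (α * (2 * c ^ 2 * ⟪b1 i, ν⟫ ^ 2 - H) + β * H) + b * (p * (2 * ‖qy‖ ^ γ)) := by
    intro i
    refine (hB _ _).trans ?_
    have hD := hs_bound (p := p) hγ hγ0 hqy hq2 (hb1 i)
    set D := sig γ p qx (b1 i) - sig γ p qy (b1 i) with hDd
    have e1 : sig γ p qx (b1 i) - sig γ p qy (b1.map O i) = D + (2 * ⟪b1 i, ν⟫ * c) • e := by
      rw [OrthonormalBasis.map_apply, hO, sig_sub, sig_smul, hσ, real_inner_comm]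
      simp only [hDd]; module
    rw [e1]
    have e2 : ⟪e, D + (2 * ⟪b1 i, ν⟫ * c) • e⟫ = ⟪e, D⟫ + 2 * ⟪b1 i, ν⟫ * c := by
      rw [inner_add_right, inner_smul_right, real_inner_self_eq_norm_sq, he]; ring
    have e3 : ‖D + (2 * ⟪b1 i, ν⟫ * c) • e‖ ^ 2 = ‖D‖ ^ 2 + 2 * (2 * ⟪b1 i, ν⟫ * c) * ⟪e, D⟫ + (2 * ⟪b1 i, ν⟫ * c) ^ 2 := by
      rw [norm_add_sq_real, inner_smul_right, norm_smul, he, Real.norm_eq_abs, mul_one, sq_abs, real_inner_comm e D]; ring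
    have e4 : ⟪e, D⟫ ^ 2 ≤ ‖D‖ ^ 2 := by
      have := inner_div_sq_le e D
      rwa [he, div_one] at this
    rw [e2, e3]
    have e5 : ‖sig γ p qx (b1 i)‖ ^ 2 ≤ p * (2 * ‖qy‖ ^ γ) := by
      have h1 := sig_upper (γ := γ) hp hqx (b1 i)
      rw [hb1, one_pow, mul_one] at h1
      have h2 := half_rpow hγ hγ0 hm hqxn
      have : p * ‖qx‖ ^ γ ≤ p * (2 * ‖qy‖ ^ γ) := by gcongr
      linarith
    have e6 : b * ‖sig γ p qx (b1 i)‖ ^ 2 ≤ b * (p * (2 * ‖qy‖ ^ γ)) := by gcongr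
    have e7 : α * (⟪e, D⟫ + 2 * ⟪b1 i, ν⟫ * c) ^ 2 ≤ α * (2 * c ^ 2 * ⟪b1 i, ν⟫ ^ 2 - H) := by
      apply mul_le_mul_of_nonpos_left _ hα
      nlinarith [sq_nonneg (2 * ⟪e, D⟫ + 2 * ⟪b1 i, ν⟫ * c)]
    have e8 : β * (‖D‖ ^ 2 + 2 * (2 * ⟪b1 i, ν⟫ * c) * ⟪e, D⟫ + (2 * ⟪b1 i, ν⟫ * c) ^ 2 - (⟪e, D⟫ + 2 * ⟪b1 i, ν⟫ * c) ^ 2) ≤ β * H := by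
      apply mul_le_mul_of_nonneg_left _ hβ
      nlinarith [sq_nonneg ⟪e, D⟫]
    linarith
  have hS := Finset.sum_le_sum fun i (_ : i ∈ Finset.univ) => key i
  have hsum : ∑ i, (1 / 2 * (α * (2 * c ^ 2 * ⟪b1 i, ν⟫ ^ 2 - H) + β * H) + b * (p * (2 * ‖qy‖ ^ γ)))
      = α * c ^ 2 + d * (1 / 2 * (- α * H + β * H) + b * (p * (2 * ‖qy‖ ^ γ))) := by
    have h1 : ∀ i, (1 / 2 * (α * (2 * c ^ 2 * ⟪b1 i, ν⟫ ^ 2 - H) + β * H) + b * (p * (2 * ‖qy‖ ^ γ)))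
      = α * c ^ 2 * ⟪b1 i, ν⟫ ^ 2 + (1 / 2 * (- α * H + β * H) + b * (p * (2 * ‖qy‖ ^ γ))) := by
      intro i; ring
    simp only [h1]
    rw [Finset.sum_add_distrib, ← Finset.mul_sum, b1.sum_sq_inner_right, hν]
    simp [hd]
    ring
  rw [hsum] at hS
  -- the smallness
  have hsm : d * H ≤ c0 * ‖qy‖ ^ γ := by
    have r0 : ‖qx - qy‖ / ‖qy‖ ≤ min (1 / 2) (c0 / K) := by rwa [div_le_iff₀ hm]
    have r1 : ‖qx - qy‖ / ‖qy‖ ≤ 1 / 2 := r0.trans (min_le_left _ _)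
    have r2 : ‖qx - qy‖ / ‖qy‖ ≤ c0 / K := r0.trans (min_le_right _ _)
    have r3 : 0 ≤ ‖qx - qy‖ / ‖qy‖ := by positivity
    have r4 : (‖qx - qy‖ / ‖qy‖) ^ 2 ≤ c0 / K := by nlinarith
    calc d * H = (d * Csig p ^ 2) * (‖qx - qy‖ / ‖qy‖) ^ 2 * ‖qy‖ ^ γ := by rw [hH]; ring
      _ ≤ K * (c0 / K) * ‖qy‖ ^ γ := by gcongr; linarith
      _ = _ := by field_simp
  have f1 : α * c ^ 2 ≤ α * (c0 * ‖qy‖ ^ γ) := mul_le_mul_of_nonpos_left hc hα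
  have f2 : -α * (d * H) ≤ -α * (c0 * ‖qy‖ ^ γ) := mul_le_mul_of_nonneg_left hsm (by linarith)
  have f3 : θ ≤ 2 * ε + (α * (c0 * ‖qy‖ ^ γ) + β * (d * H) + 4 * d * p * b * ‖qy‖ ^ γ) := by
    linarith
  refine f3.trans ?_
  have f4 : 0 ≤ ‖qy‖ ^ γ * ((4 * d * p + 1) * (β * (‖qx - qy‖ / ‖qy‖) ^ 2) + (d * Csig p ^ 2 + 1) * b) := by positivity
  rw [hH]
  linarith

end Master

section Ex
variable {V : Type*} [NormedAddCommGroup V] [NormedSpace ℝ V]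
variable {E : Type*} [NormedAddCommGroup E] [InnerProductSpace ℝ E]

/-- second order expansion -/
def X2 (f : V → ℝ) (z : V) (l b : V → ℝ) : Prop :=
  ∃ (L : V →L[ℝ] ℝ) (B : V →L[ℝ] V →L[ℝ] ℝ), (∀ w, L w = l w) ∧ (∀ w, B w w = b w) ∧
    ∀ ε > 0, ∀ᶠ w in nhds (0 : V), |f (z + w) - f z - L w - B w w| ≤ ε * ‖w‖ ^ 2

/-- scalar second order expansion -/
def S2 (F : ℝ → ℝ) (s a b : ℝ) : Prop :=
  ∀ ε > 0, ∀ᶠ τ in nhds (0 : ℝ), |F (s + τ) - F s - a * τ - b * τ ^ 2| ≤ ε * τ ^ 2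

theorem X2.congr {f g : V → ℝ} {z : V} {l b l' b' : V → ℝ} (h : X2 f z l b) (hf : ∀ x, f x = g x)
    (hl : ∀ w, l w = l' w) (hb : ∀ w, b w = b' w) : X2 g z l' b' := by
  obtain ⟨L, B, h1, h2, h3⟩ := h
  have : f = g := funext hf
  subst this
  exact ⟨L, B, fun w => (h1 w).trans (hl w), fun w => (h2 w).trans (hb w), h3⟩

theorem X2.const (c : ℝ) (z : V) : X2 (fun _ => c) z (fun _ => 0) (fun _ => 0) :=
  ⟨0, 0, fun w => rfl, fun w => rfl, fun ε hε => Filter.Eventually.of_forall fun w => by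
    simp; positivity⟩

theorem X2.lin (T : V →L[ℝ] ℝ) (z : V) : X2 (fun x => T x) z (fun w => T w) (fun _ => 0) :=
  ⟨T, 0, fun w => rfl, fun w => rfl, fun ε hε => Filter.Eventually.of_forall fun w => by
    simp; positivity⟩

theorem X2.quad (Q : V →L[ℝ] V →L[ℝ] ℝ) (z : V) :
    X2 (fun x => Q x x) z (fun w => Q z w + Q w z) (fun w => Q w w) :=
  ⟨Q z + Q.flip z, Q, fun w => rfl, fun w => rfl, fun ε hε => Filter.Eventually.of_forall fun w => by
    have e0 := bil_add Q z w
    have : Q (z + w) (z + w) - Q z z - (Q z + Q.flip z) w - Q w w = 0 := by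
      rw [e0]; simp; ring
    show |Q (z + w) (z + w) - Q z z - (Q z + Q.flip z) w - Q w w| ≤ _
    rw [this, abs_zero]; positivity⟩

theorem X2.add {f g : V → ℝ} {z : V} {l b l' b' : V → ℝ} (h : X2 f z l b) (h' : X2 g z l' b') :
    X2 (fun x => f x + g x) z (fun w => l w + l' w) (fun w => b w + b' w) := by
  obtain ⟨L, B, h1, h2, h3⟩ := h
  obtain ⟨L', B', h1', h2', h3'⟩ := h'
  refine ⟨L + L', B + B', fun w => by simp [h1, h1'], fun w => by simp [h2, h2'], fun ε hε => ?_⟩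
  filter_upwards [h3 (ε / 2) (by positivity), h3' (ε / 2) (by positivity)] with w e1 e2
  have : f (z + w) + g (z + w) - (f z + g z) - (L + L') w - (B + B') w w
    = (f (z + w) - f z - L w - B w w) + (g (z + w) - g z - L' w - B' w w) := by
    simp; ring
  rw [this]
  refine (abs_add_le _ _).trans ?_
  linarith

theorem X2.smul {f : V → ℝ} {z : V} {l b : V → ℝ} (c : ℝ) (h : X2 f z l b) :
    X2 (fun x => c * f x) z (fun w => c * l w) (fun w => c * b w) := by
  obtain ⟨L, B, h1, h2, h3⟩ := h
  refine ⟨c • L, c • B, fun w => by simp [h1], fun w => by simp [h2], fun ε hε => ?_⟩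
  filter_upwards [h3 (ε / (|c| + 1)) (by positivity)] with w e1
  have : c * f (z + w) - c * f z - (c • L) w - (c • B) w w
    = c * (f (z + w) - f z - L w - B w w) := by
    simp; ring
  rw [this, abs_mul]
  calc |c| * _ ≤ (|c| + 1) * (ε / (|c| + 1) * ‖w‖ ^ 2) := by gcongr; linarith
    _ = _ := by field_simp

theorem X2.sub {f g : V → ℝ} {z : V} {l b l' b' : V → ℝ} (h : X2 f z l b) (h' : X2 g z l' b') :
    X2 (fun x => f x - g x) z (fun w => l w - l' w) (fun w => b w - b' w) :=
  (h.add (h'.smul (-1))).congr (fun x => by ring) (fun x => by ring) (fun x => by ring)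

theorem X2.bound {f : V → ℝ} {z : V} {l b : V → ℝ} (h : X2 f z l b) :
    ∃ C ≥ 0, ∀ᶠ w in nhds (0 : V), |f (z + w) - f z| ≤ C * ‖w‖ ∧ ∀ w, |l w| ≤ C * ‖w‖ := by
  obtain ⟨L, B, h1, h2, h3⟩ := h
  obtain ⟨C, hC, hB⟩ := bil_bound B
  refine ⟨‖L‖ + (C + 1), by positivity, ?_⟩
  filter_upwards [h3 1 one_pos, Metric.ball_mem_nhds (0 : V) one_pos] with w e1 e2
  rw [mem_ball_zero_iff] at e2
  have e3 := hB w w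
  have e4 := lin_le L w
  have hw := norm_nonneg w
  refine ⟨?_, fun v => ?_⟩
  · have : f (z + w) - f z = (f (z + w) - f z - L w - B w w) + L w + B w w := by ring
    rw [this]
    have := abs_add_three (f (z + w) - f z - L w - B w w) (L w) (B w w)
    have e5 : ‖w‖ * ‖w‖ ≤ ‖w‖ := by nlinarith
    have e6 : C * ‖w‖ * ‖w‖ ≤ C * ‖w‖ := by nlinarith
    nlinarith
  · rw [← h1]
    have := lin_le L v
    have : 0 ≤ (C + 1) * ‖v‖ := by positivity
    linarith

theorem X2.cont {f : V → ℝ} {z : V} {l b : V → ℝ} (h : X2 f z l b) :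
    Filter.Tendsto (fun w => f (z + w) - f z) (nhds 0) (nhds 0) := by
  obtain ⟨C, hC, h1⟩ := h.bound
  rw [tendsto_zero_iff_norm_tendsto_zero]
  have : Filter.Tendsto (fun w : V => C * ‖w‖) (nhds 0) (nhds (C * ‖(0 : V)‖)) :=
    (continuous_const.mul continuous_norm).tendsto _
  rw [norm_zero, mul_zero] at this
  exact squeeze_zero' (Filter.Eventually.of_forall fun w => norm_nonneg _)
    (h1.mono fun w hw => hw.1) this

theorem X2.comp {f : V → ℝ} {z : V} {l b : V → ℝ} (h : X2 f z l b) {F : ℝ → ℝ} {a c : ℝ}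
    (hF : S2 F (f z) a c) :
    X2 (fun x => F (f x)) z (fun w => a * l w) (fun w => a * b w + c * l w ^ 2) := by
  obtain ⟨C, hC, h0⟩ := h.bound
  have hc := h.cont
  obtain ⟨L, B, h1, h2, h3⟩ := h
  refine ⟨a • L, a • B + c • L.smulRight L, fun w => by simp [h1], fun w => by
    simp [h1, h2, _root_.sq], fun ε hε => ?_⟩
  obtain ⟨η, hη, hη1⟩ : ∃ η > 0, C ^ 2 * η ≤ ε / 2 := ⟨ε / (2 * (C ^ 2 + 1)), by positivity, by
    have : C ^ 2 * (ε / (2 * (C ^ 2 + 1))) = (C ^ 2 / (C ^ 2 + 1)) * (ε / 2) := by field_simp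
    rw [this]
    have : C ^ 2 / (C ^ 2 + 1) ≤ 1 := by rw [div_le_one (by positivity)]; linarith
    nlinarith⟩
  obtain ⟨ζ, hζ, hζ0, hζ1⟩ : ∃ ζ > 0, ζ ≤ 1 ∧ (|a| + |c| * (2 * C)) * ζ ≤ ε / 2 :=
    ⟨min 1 (ε / (2 * (|a| + |c| * (2 * C) + 1))), by positivity, min_le_left _ _, by
    calc (|a| + |c| * (2 * C)) * min 1 (ε / (2 * (|a| + |c| * (2 * C) + 1)))
      ≤ (|a| + |c| * (2 * C) + 1) * (ε / (2 * (|a| + |c| * (2 * C) + 1))) :=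
          mul_le_mul (by linarith) (min_le_right _ _) (by positivity) (by positivity)
      _ = ε / 2 := by field_simp⟩
  obtain ⟨CB, hCB, hB⟩ := bil_bound B
  have hsm : ∀ᶠ w in nhds (0 : V), (CB + 1) * ‖w‖ ≤ ζ := by
    filter_upwards [Metric.ball_mem_nhds (0 : V) (show 0 < ζ / (CB + 1) by positivity)] with w hw
    rw [mem_ball_zero_iff, lt_div_iff₀ (by positivity)] at hw
    linarith
  filter_upwards [h3 ζ hζ, h0, hc.eventually (hF η hη), hsm] with w e1 e2 e3 e4
  set τ := f (z + w) - f z with hτ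
  have e5 : f z + τ = f (z + w) := by rw [hτ]; ring
  rw [e5] at e3
  obtain ⟨e2, e2'⟩ := e2
  have e2' := e2' w
  rw [← h1] at e2'
  have hw := norm_nonneg w
  have g1 : τ ^ 2 ≤ C ^ 2 * ‖w‖ ^ 2 := by
    rw [← mul_pow, ← sq_abs]; exact pow_le_pow_left₀ (abs_nonneg _) e2 2
  set R := τ - L w - B w w with hR
  have g2 : |τ - L w| ≤ ζ * ‖w‖ := by
    have : τ - L w = R + B w w := by rw [hR]; ring
    rw [this]
    refine (abs_add_le _ _).trans ?_
    have := hB w w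
    have : ζ * ‖w‖ ^ 2 ≤ ‖w‖ * ‖w‖ := by nlinarith
    nlinarith
  have g3 : |τ ^ 2 - L w ^ 2| ≤ ζ * (2 * C) * ‖w‖ ^ 2 := by
    have : τ ^ 2 - L w ^ 2 = (τ - L w) * (τ + L w) := by ring
    rw [this, abs_mul]
    have h5 : |τ + L w| ≤ 2 * C * ‖w‖ := (abs_add_le _ _).trans (by linarith)
    calc _ ≤ (ζ * ‖w‖) * (2 * C * ‖w‖) := mul_le_mul g2 h5 (abs_nonneg _) (by positivity)
      _ = _ := by ring
  have g4 : F (f (z + w)) - F (f z) - (a • L) w - (a • B + c • L.smulRight L) w w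
    = (F (f (z + w)) - F (f z) - a * τ - c * τ ^ 2) + a * R + c * (τ ^ 2 - L w ^ 2) := by
    simp [hR]; ring
  rw [g4]
  refine (abs_add_three _ _ _).trans ?_
  rw [abs_mul, abs_mul]
  have k1 : |a| * |R| ≤ |a| * (ζ * ‖w‖ ^ 2) := by gcongr
  have k2 : |c| * |τ ^ 2 - L w ^ 2| ≤ |c| * (ζ * (2 * C) * ‖w‖ ^ 2) := by gcongr
  have k3 : η * τ ^ 2 ≤ ε / 2 * ‖w‖ ^ 2 := by
    calc η * τ ^ 2 ≤ η * (C ^ 2 * ‖w‖ ^ 2) := by gcongr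
      _ = (C ^ 2 * η) * ‖w‖ ^ 2 := by ring
      _ ≤ _ := by gcongr
  have k4 : ((|a| + |c| * (2 * C)) * ζ) * ‖w‖ ^ 2 ≤ ε / 2 * ‖w‖ ^ 2 := by gcongr
  linarith

theorem S2.of_deriv {F F' : ℝ → ℝ} {s c : ℝ} (h : ∀ᶠ x in nhds s, HasDerivAt F (F' x) x)
    (h' : HasDerivAt F' c s) : S2 F s (F' s) (c / 2) := by
  intro ε hε
  rw [hasDerivAt_iff_isLittleO, Asymptotics.isLittleO_iff] at h'
  have h2 := h' hε
  obtain ⟨r, hr, hb⟩ := Metric.eventually_nhds_iff.1 (h.and h2)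
  refine Metric.eventually_nhds_iff.2 ⟨r, hr, fun τ hτ => ?_⟩
  rw [dist_zero_right, Real.norm_eq_abs] at hτ
  let G : ℝ → ℝ := fun x => F (s + x) - F' s * x - c / 2 * x ^ 2
  have hG : ∀ x ∈ Icc (-|τ|) |τ|, HasDerivWithinAt G (F' (s + x) - F' s - c * x) (Icc (-|τ|) |τ|) x := by
    intro x hx
    have hx' : |x| ≤ |τ| := abs_le.2 hx
    have := (hb (y := s + x) (by rw [dist_self_add_left, Real.norm_eq_abs]; linarith)).1
    have h3 : HasDerivAt (fun y => F (s + y)) (F' (s + x)) x := by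
      have := this.comp_const_add s x
      simpa using this
    have h4 := ((h3.sub ((hasDerivAt_id x).const_mul (F' s))).sub (((hasDerivAt_id x).pow 2).const_mul (c / 2)))
    refine (h4.congr_deriv ?_).hasDerivWithinAt
    simp; ring
  have hbd : ∀ x ∈ Icc (-|τ|) |τ|, ‖F' (s + x) - F' s - c * x‖ ≤ ε * |τ| := by
    intro x hx
    have hx' : |x| ≤ |τ| := abs_le.2 hx
    have := (hb (y := s + x) (by rw [dist_self_add_left, Real.norm_eq_abs]; linarith)).2
    simp only [add_sub_cancel_left, smul_eq_mul, Real.norm_eq_abs] at this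
    rw [Real.norm_eq_abs, mul_comm c]
    exact this.trans (by gcongr)
  have := (convex_Icc (-|τ|) |τ|).norm_image_sub_le_of_norm_hasDerivWithin_le hG hbd
    (x := 0) (y := τ) ⟨by simp, by simp⟩ ⟨neg_abs_le τ, le_abs_self τ⟩
  simp only [G, Real.norm_eq_abs] at this
  have e1 : F (s + τ) - F' s * τ - c / 2 * τ ^ 2 - (F (s + 0) - F' s * 0 - c / 2 * 0 ^ 2)
    = F (s + τ) - F s - F' s * τ - c / 2 * τ ^ 2 := by simp; ring
  rw [e1] at this
  refine this.trans ?_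
  rw [sub_zero, mul_assoc, ← sq, sq_abs]

theorem S2.sq (s : ℝ) : S2 (fun x => x ^ 2) s (2 * s) 1 := fun ε hε =>
  Filter.Eventually.of_forall fun τ => by
    have : (s + τ) ^ 2 - s ^ 2 - 2 * s * τ - 1 * τ ^ 2 = 0 := by ring
    rw [this, abs_zero]; positivity

theorem X2.sq {f : V → ℝ} {z : V} {l b : V → ℝ} (h : X2 f z l b) :
    X2 (fun x => f x ^ 2) z (fun w => 2 * f z * l w) (fun w => 2 * f z * b w + l w ^ 2) :=
  (h.comp (S2.sq (f z))).congr (fun _ => rfl) (fun _ => rfl) (fun w => by ring)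

theorem X2.mul {f g : V → ℝ} {z : V} {l b l' b' : V → ℝ} (h : X2 f z l b) (h' : X2 g z l' b') :
    X2 (fun x => f x * g x) z (fun w => f z * l' w + g z * l w)
      (fun w => f z * b' w + l w * l' w + g z * b w) :=
  (((h.add h').sq.sub (h.sq.add h'.sq)).smul (1 / 2)).congr (fun x => by ring) (fun w => by ring)
    (fun w => by ring)

theorem X2.normSq (T : V →L[ℝ] E) (c : E) (z : V) :
    X2 (fun x => ‖T x - c‖ ^ 2) z (fun w => 2 * ⟪T z - c, T w⟫) (fun w => ‖T w‖ ^ 2) := by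
  let Q : V →L[ℝ] V →L[ℝ] ℝ := (innerSL ℝ : E →L[ℝ] E →L[ℝ] ℝ).bilinearComp T T
  have hQ : ∀ v w, Q v w = ⟪T v, T w⟫ := fun v w => rfl
  have h1 := X2.quad Q z
  have h2 := (X2.lin ((innerSL ℝ c).comp T) z).smul (-2)
  have h3 := X2.const (‖c‖ ^ 2) z
  refine ((h1.add h2).add h3).congr (fun x => ?_) (fun w => ?_) (fun w => ?_)
  · simp only [hQ, ContinuousLinearMap.comp_apply, innerSL_apply_apply]
    rw [norm_sub_sq_real, real_inner_self_eq_norm_sq, real_inner_comm]; ring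
  · simp only [hQ, ContinuousLinearMap.comp_apply, innerSL_apply_apply]
    rw [inner_sub_left, real_inner_comm (T z) (T w)]; ring
  · simp only [hQ]; rw [real_inner_self_eq_norm_sq]; ring

/-- local maximum gives a jet -/
theorem X2.jet {f g : V → ℝ} {z : V} {l b : V → ℝ} (h : X2 f z l b)
    (hm : ∀ᶠ w in nhds z, g w - f w ≤ g z - f z) :
    ∃ (L : V →L[ℝ] ℝ) (B : V →L[ℝ] V →L[ℝ] ℝ), (∀ w, L w = l w) ∧ (∀ w, B w w = b w) ∧
      SupJet g z L B := by
  obtain ⟨L, B, h1, h2, h3⟩ := h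
  refine ⟨L, B, h1, h2, fun ε hε => ?_⟩
  have ht : Filter.Tendsto (fun w : V => z + w) (nhds 0) (nhds z) := by
    have : Continuous (fun w : V => z + w) := by fun_prop
    simpa using this.tendsto 0
  filter_upwards [h3 ε hε, ht.eventually hm] with w e1 e2
  have := (abs_le.1 e1).2
  linarith

/-- radial functions -/
theorem X2.radial (T : V →L[ℝ] E) {z : V} (hz : T z ≠ 0) {ψ : ℝ → ℝ} {ψ1 ψ2 : ℝ}
    (hψ : S2 ψ ‖T z‖ ψ1 (ψ2 / 2)) :
    X2 (fun x => ψ ‖T x‖) z (fun w => ψ1 * ⟪(1 / ‖T z‖) • T z, T w⟫)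
      (fun w => 1 / 2 * (ψ2 * ⟪(1 / ‖T z‖) • T z, T w⟫ ^ 2 +
        ψ1 / ‖T z‖ * (‖T w‖ ^ 2 - ⟪(1 / ‖T z‖) • T z, T w⟫ ^ 2))) := by
  have hs : 0 < ‖T z‖ := norm_pos_iff.2 hz
  have h1 := X2.normSq T 0 z
  simp only [sub_zero] at h1
  have hsq : S2 Real.sqrt (‖T z‖ ^ 2) (1 / (2 * √(‖T z‖ ^ 2))) (-1 / (4 * ‖T z‖ ^ 3) / 2) := by
    refine S2.of_deriv (F' := fun x => 1 / (2 * √x)) ?_ ?_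
    · filter_upwards [lt_mem_nhds (show 0 < ‖T z‖ ^ 2 by positivity)] with x hx
      exact Real.hasDerivAt_sqrt hx.ne'
    · have := (Real.hasDerivAt_sqrt (show ‖T z‖ ^ 2 ≠ 0 by positivity))
      have h2 := ((this.const_mul 2).inv (by rw [Real.sqrt_sq hs.le]; positivity))
      rw [Real.sqrt_sq hs.le] at h2
      refine (h2.congr_deriv ?_).congr_of_eventuallyEq (Filter.Eventually.of_forall fun x => ?_)
      · field_simp; ring
      · simp
  have h2 := h1.comp hsq
  rw [Real.sqrt_sq hs.le] at h2
  have h3 := h2.comp (F := ψ) (by rw [Real.sqrt_sq hs.le]; exact hψ)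
  refine h3.congr (fun x => by rw [Real.sqrt_sq (norm_nonneg _)]) (fun w => ?_) (fun w => ?_)
  · rw [inner_smul_left, RCLike.conj_to_real]; field_simp
  · rw [inner_smul_left, RCLike.conj_to_real]; field_simp; ring

end Ex

section LG
/-- the two point maximum principle estimate -/
def Mst (E : Type*) [NormedAddCommGroup E] [InnerProductSpace ℝ E] [FiniteDimensional ℝ E]
    (γ p c1 C2 ν0 : ℝ) : Prop :=
  ∀ {ε : ℝ} {u : E × ℝ → ℝ} {Ω : Set (E × ℝ)}
      (hu : VisS γ p ε u Ω) {x0 y0 : E} {t0 : ℝ} (hx : (x0, t0) ∈ Ω) (hy : (y0, t0) ∈ Ω)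
      {L : E × E × ℝ →L[ℝ] ℝ} {B : E × E × ℝ →L[ℝ] E × E × ℝ →L[ℝ] ℝ}
      (hJ : SupJet (D2 u) (x0, y0, t0) L B) {qx qy : E} {θ : ℝ} (hqy : qy ≠ 0)
      (hL : ∀ h k τ, L (h, k, τ) = ⟪qx, h⟫ - ⟪qy, k⟫ + θ * τ)
      (hq : ‖qx - qy‖ ≤ ν0 * ‖qy‖) {e : E} (he : ‖e‖ = 1) {α β b : ℝ} (hα : α ≤ 0) (hβ : 0 ≤ β)
      (hb : 0 ≤ b) (hB : ∀ h k, B (h, k, 0) (h, k, 0) ≤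
        1 / 2 * (α * ⟪e, h - k⟫ ^ 2 + β * (‖h - k‖ ^ 2 - ⟪e, h - k⟫ ^ 2)) + b * ‖h‖ ^ 2),
      θ ≤ 2 * ε + ‖qy‖ ^ γ * (c1 * α + C2 * (β * (‖qx - qy‖ / ‖qy‖) ^ 2 + b))

variable {E : Type*} [NormedAddCommGroup E] [InnerProductSpace ℝ E] [FiniteDimensional ℝ E]

/-- difference map -/
def Zm (E : Type*) [NormedAddCommGroup E] [InnerProductSpace ℝ E] : E × E × ℝ →L[ℝ] E :=
  ContinuousLinearMap.fst ℝ E (E × ℝ) - (ContinuousLinearMap.fst ℝ E ℝ).comp (ContinuousLinearMap.snd ℝ E (E × ℝ))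
def Xm (E : Type*) [NormedAddCommGroup E] [InnerProductSpace ℝ E] : E × E × ℝ →L[ℝ] E :=
  ContinuousLinearMap.fst ℝ E (E × ℝ)
def Ym (E : Type*) [NormedAddCommGroup E] [InnerProductSpace ℝ E] : E × E × ℝ →L[ℝ] E :=
  (ContinuousLinearMap.fst ℝ E ℝ).comp (ContinuousLinearMap.snd ℝ E (E × ℝ))
def Tm (E : Type*) [NormedAddCommGroup E] [InnerProductSpace ℝ E] : E × E × ℝ →L[ℝ] ℝ :=
  (ContinuousLinearMap.snd ℝ E ℝ).comp (ContinuousLinearMap.snd ℝ E (E × ℝ))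
theorem Zm_apply (w : E × E × ℝ) : Zm E w = w.1 - w.2.1 := rfl
theorem Xm_apply (w : E × E × ℝ) : Xm E w = w.1 := rfl
theorem Ym_apply (w : E × E × ℝ) : Ym E w = w.2.1 := rfl
theorem Tm_apply (w : E × E × ℝ) : Tm E w = w.2.2 := rfl

theorem D2_contOn {u : E × ℝ → ℝ} {Ω : Set (E × ℝ)} (hu : ContinuousOn u Ω) {K : Set (E × E × ℝ)}
    (hK : ∀ w ∈ K, (w.1, w.2.2) ∈ Ω ∧ (w.2.1, w.2.2) ∈ Ω) : ContinuousOn (D2 u) K := by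
  unfold D2
  refine ContinuousOn.sub ?_ ?_
  · exact hu.comp (f := fun w : E × E × ℝ => (w.1, w.2.2)) (by fun_prop) fun w hw => (hK w hw).1
  · exact hu.comp (f := fun w : E × E × ℝ => (w.2.1, w.2.2)) (by fun_prop) fun w hw => (hK w hw).2

theorem S2_time {a k T t : ℝ} (h : t < T) :
    S2 (fun t => a * (T - t) + k / (T - t)) t (- a + k / (T - t) ^ 2) (2 * k / (T - t) ^ 3 / 2) := by
  refine S2.of_deriv (F' := fun t => - a + k / (T - t) ^ 2) ?_ ?_
  · filter_upwards [gt_mem_nhds h] with x hx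
    have h0 : T - x ≠ 0 := (sub_pos.2 hx).ne'
    have h1 : HasDerivAt (fun t => T - t) (-1) x := by simpa using (hasDerivAt_id x).const_sub T
    refine ((h1.const_mul a).add ((hasDerivAt_const x k).div h1 h0)).congr_deriv ?_
    field_simp; ring
  · have h0 : T - t ≠ 0 := (sub_pos.2 h).ne'
    have h1 : HasDerivAt (fun t => T - t) (-1) t := by simpa using (hasDerivAt_id t).const_sub T
    refine (((hasDerivAt_const t k).div (h1.pow 2) (pow_ne_zero 2 h0)).const_add (-a)).congr_deriv ?_
    simp only [Pi.pow_apply]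
    field_simp; ring

set_option maxHeartbeats 1000000 in
theorem lemG {γ p c1 C2 ν0 : ℝ} (hc1 : 0 < c1) (hC2 : 0 < C2) (hν0 : 0 < ν0) (hM : Mst E γ p c1 C2 ν0)
    {ε : ℝ} {u : E × ℝ → ℝ} {Ω : Set (E × ℝ)} (hu : VisS γ p ε u Ω)
    {xc : E} {tc Θ κ b : ℝ} (hΘ : 0 < Θ) (hκ : 0 < κ) (hb : 0 < b) (l : E)
    (hΩ : ∀ x y t, ‖x - xc‖ ≤ 1 / 4 → ‖x - y‖ ≤ κ → t ∈ Ico (tc - 1 / Θ) tc → (x, t) ∈ Ω ∧ (y, t) ∈ Ω)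
    {ω ψ ψ1 ψ2 : ℝ → ℝ}
    (hω : ∀ x y t, ‖x - xc‖ ≤ 1 / 4 → ‖x - y‖ ≤ κ → t ∈ Ico (tc - 1 / Θ) tc →
      D2 u (x, y, t) - ⟪l, x - y⟫ ≤ ω ‖x - y‖)
    (hψc : ContinuousOn ψ (Icc 0 κ)) (hψS : ∀ s ∈ Ioo 0 κ, S2 ψ s (ψ1 s) (ψ2 s / 2))
    (hψ1 : ∀ s ∈ Ioo 0 κ, 0 ≤ ψ1 s) (hψ2 : ∀ s ∈ Ioo 0 κ, ψ2 s ≤ 0)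
    (hgap : ∀ s ∈ Icc 0 κ, ω s - ψ s ≤ b) (hψ0 : 0 ≤ ψ 0)
    (hbd : ∀ x y t, ‖x - xc‖ ≤ 1 / 4 → ‖x - y‖ = κ → t ∈ Ico (tc - 1 / Θ) tc →
      D2 u (x, y, t) - ⟪l, x - y⟫ ≤ ψ κ)
    (hmain : ∀ s ∈ Ioo 0 κ, 0 < ω s - ψ s → ∀ e : E, ‖e‖ = 1 → l + ψ1 s • e ≠ 0 ∧
      64 * b * (ω s - ψ s) ≤ ν0 ^ 2 * ‖l + ψ1 s • e‖ ^ 2 ∧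
      2 * ε + b * Θ + ‖l + ψ1 s • e‖ ^ γ * (c1 * ψ2 s +
        C2 * (ψ1 s / s * (64 * b * (ω s - ψ s) / ‖l + ψ1 s • e‖ ^ 2) + 16 * b)) < 0) :
    ∀ y t, ‖xc - y‖ ≤ κ → t ∈ Ico (tc - 1 / Θ) tc →
      D2 u (xc, y, t) - ⟪l, xc - y⟫ ≤ ψ ‖xc - y‖ + b * Θ * (tc - t) := by
  intro y1 t1 hy1 ht1
  by_contra hcon
  push Not at hcon
  have ht1' : 0 < tc - t1 := sub_pos.2 ht1.2
  obtain ⟨k, hk, hk1⟩ : ∃ k > 0, k / (tc - t1) < min (b + 1)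
      (D2 u (xc, y1, t1) - ⟪l, xc - y1⟫ - (ψ ‖xc - y1‖ + b * Θ * (tc - t1))) := by
    have hpos : 0 < min (b + 1)
      (D2 u (xc, y1, t1) - ⟪l, xc - y1⟫ - (ψ ‖xc - y1‖ + b * Θ * (tc - t1))) :=
        lt_min (by positivity) (by linarith)
    refine ⟨(tc - t1) * (min (b + 1)
      (D2 u (xc, y1, t1) - ⟪l, xc - y1⟫ - (ψ ‖xc - y1‖ + b * Θ * (tc - t1))) / 2), by positivity, ?_⟩
    rw [mul_div_cancel_left₀ _ ht1'.ne']; linarith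
  obtain ⟨hk2, hk3⟩ := lt_min_iff.1 hk1
  set dl := k / (b + 1) with hdl
  have hdl0 : 0 < dl := by positivity
  have hdl1 : dl < tc - t1 := by
    rw [hdl, div_lt_iff₀ (by positivity)]; rw [div_lt_iff₀ ht1'] at hk2; linarith
  let Ψ : E × E × ℝ → ℝ := fun w => ((⟪l, Zm E w⟫ + ψ ‖Zm E w‖) + 16 * b * ‖Xm E w - xc‖ ^ 2)
    + (b * Θ * (tc - Tm E w) + k / (tc - Tm E w))
  let K : Set (E × E × ℝ) := (Metric.closedBall xc (1 / 4) ×ˢ Metric.closedBall xc (1 / 4 + κ) ×ˢ Icc (tc - 1 / Θ) (tc - dl))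
    ∩ {w | ‖Zm E w‖ ≤ κ}
  have hKc : IsCompact K := by
    refine IsCompact.inter_right ?_ (isClosed_le (Zm E).continuous.norm continuous_const)
    exact (isCompact_closedBall _ _).prod ((isCompact_closedBall _ _).prod isCompact_Icc)
  have hKm : ∀ w ∈ K, ‖w.1 - xc‖ ≤ 1 / 4 ∧ ‖w.1 - w.2.1‖ ≤ κ ∧ w.2.2 ∈ Ico (tc - 1 / Θ) tc ∧ w.2.2 ≤ tc - dl := by
    rintro w ⟨⟨h1, h2, h3⟩, h4⟩
    rw [mem_closedBall_iff_norm] at h1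
    exact ⟨h1, h4, ⟨h3.1, by have := h3.2; linarith⟩, h3.2⟩
  have hKm' : ∀ x y t, ‖x - xc‖ ≤ 1 / 4 → ‖x - y‖ ≤ κ → t ∈ Icc (tc - 1 / Θ) (tc - dl) → (x, y, t) ∈ K := by
    intro x y t h1 h2 h3
    refine ⟨⟨mem_closedBall_iff_norm.2 h1, mem_closedBall_iff_norm.2 ?_, h3⟩, h2⟩
    have : y - xc = (x - xc) - (x - y) := by abel
    show ‖y - xc‖ ≤ _
    rw [this]
    exact (norm_sub_le _ _).trans (by linarith)
  have hcont : ContinuousOn (fun w => D2 u w - Ψ w) K := by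
    refine ContinuousOn.sub (D2_contOn hu.cont fun w hw => ?_) ?_
    · obtain ⟨h1, h2, h3, h4⟩ := hKm w hw
      exact hΩ _ _ _ h1 h2 h3
    · refine ContinuousOn.add (ContinuousOn.add (ContinuousOn.add ?_ ?_) ?_) ?_
      · exact (continuous_const.inner (Zm E).continuous).continuousOn
      · refine hψc.comp (Zm E).continuous.norm.continuousOn fun w hw => ⟨norm_nonneg _, (hKm w hw).2.1⟩
      · exact (continuous_const.mul (((Xm E).continuous.sub continuous_const).norm.pow 2)).continuousOn
      · refine ContinuousOn.add (continuous_const.mul (continuous_const.sub (Tm E).continuous)).continuousOn ?_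
        refine ContinuousOn.div continuousOn_const (continuous_const.sub (Tm E).continuous).continuousOn fun w hw => ?_
        have := (hKm w hw).2.2.1.2
        rw [Tm_apply]; exact (sub_pos.2 this).ne'
  have hin1 : (xc, y1, t1) ∈ K := hKm' _ _ _ (by simp) hy1 ⟨ht1.1, by linarith⟩
  obtain ⟨⟨x0, y0, t0⟩, hw0, hmax⟩ := hKc.exists_isMaxOn ⟨_, hin1⟩ hcont
  have hpos : 0 < D2 u (x0, y0, t0) - Ψ (x0, y0, t0) := by
    have h1 : D2 u (xc, y1, t1) - Ψ (xc, y1, t1) ≤ D2 u (x0, y0, t0) - Ψ (x0, y0, t0) := hmax hin1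
    have h2 : Ψ (xc, y1, t1) = ⟪l, xc - y1⟫ + ψ ‖xc - y1‖ + b * Θ * (tc - t1) + k / (tc - t1) := by
      simp only [Ψ, Zm_apply, Xm_apply, Tm_apply, sub_self, norm_zero]; ring
    linarith
  obtain ⟨m1, m2, m3, m4⟩ := hKm _ hw0
  simp only at m1 m2 m3 m4
  have hΨ0 : Ψ (x0, y0, t0) = ((⟪l, x0 - y0⟫ + ψ ‖x0 - y0‖) + 16 * b * ‖x0 - xc‖ ^ 2)
    + (b * Θ * (tc - t0) + k / (tc - t0)) := rfl
  rw [hΨ0] at hpos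
  have ht0 : 0 < tc - t0 := sub_pos.2 m3.2
  have hkt : 0 < k / (tc - t0) := by positivity
  have hbt : 0 < b * Θ * (tc - t0) := by positivity
  have hsq : 0 ≤ 16 * b * ‖x0 - xc‖ ^ 2 := by positivity
  have hO := hω x0 y0 t0 m1 m2 m3
  have hg := hgap ‖x0 - y0‖ ⟨norm_nonneg _, m2⟩
  have hgp : 16 * b * ‖x0 - xc‖ ^ 2 < ω ‖x0 - y0‖ - ψ ‖x0 - y0‖ := by linarith
  -- strictness
  have q1 : ‖x0 - xc‖ < 1 / 4 := by
    refine lt_of_le_of_ne m1 fun h => ?_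
    rw [h] at hgp; linarith
  have q2 : ‖x0 - y0‖ < κ := by
    refine lt_of_le_of_ne m2 fun h => ?_
    have := hbd x0 y0 t0 m1 h m3
    rw [h] at hpos; linarith
  have q3 : tc - 1 / Θ < t0 := by
    refine lt_of_le_of_ne m3.1 fun h => ?_
    have : b * Θ * (tc - t0) = b := by rw [← h]; field_simp; ring
    linarith
  have q4 : t0 < tc - dl := by
    refine lt_of_le_of_ne m4 fun h => ?_
    have : k / (tc - t0) = b + 1 := by rw [h, sub_sub_cancel, hdl]; field_simp
    linarith
  have q5 : 0 < ‖x0 - y0‖ := by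
    refine lt_of_le_of_ne (norm_nonneg _) fun h => ?_
    have h2 : x0 = y0 := sub_eq_zero.1 (norm_eq_zero.1 h.symm)
    subst h2
    simp only [D2, sub_self, inner_zero_right, norm_zero] at hpos
    linarith
  set s := ‖x0 - y0‖ with hs
  have hsI : s ∈ Ioo 0 κ := ⟨q5, q2⟩
  set e : E := (1 / s) • (x0 - y0) with he
  have hen : ‖e‖ = 1 := by
    rw [he, norm_smul, Real.norm_eq_abs, abs_of_pos (by positivity), ← hs]; field_simp
  obtain ⟨n1, n2, n3⟩ := hmain s hsI (by linarith) e hen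
  -- expansion
  have hlocmax : ∀ᶠ w in nhds ((x0, y0, t0) : E × E × ℝ), D2 u w - Ψ w ≤ D2 u (x0, y0, t0) - Ψ (x0, y0, t0) := by
    have o1 : ∀ᶠ w in nhds ((x0, y0, t0) : E × E × ℝ), ‖w.1 - xc‖ < 1 / 4 :=
      (isOpen_lt (by fun_prop) (by fun_prop)).mem_nhds q1
    have o2 : ∀ᶠ w in nhds ((x0, y0, t0) : E × E × ℝ), ‖w.1 - w.2.1‖ < κ :=
      (isOpen_lt (by fun_prop) (by fun_prop)).mem_nhds q2
    have o3 : ∀ᶠ w in nhds ((x0, y0, t0) : E × E × ℝ), tc - 1 / Θ < w.2.2 :=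
      (isOpen_lt (by fun_prop) (by fun_prop)).mem_nhds q3
    have o4 : ∀ᶠ w in nhds ((x0, y0, t0) : E × E × ℝ), w.2.2 < tc - dl :=
      (isOpen_lt (by fun_prop) (by fun_prop)).mem_nhds q4
    filter_upwards [o1, o2, o3, o4] with w w1 w2 w3 w4
    exact hmax (hKm' w.1 w.2.1 w.2.2 w1.le w2.le ⟨w3.le, w4.le⟩)
  have hZ : Zm E (x0, y0, t0) = x0 - y0 := rfl
  have X1 := X2.lin ((innerSL ℝ l).comp (Zm E)) (x0, y0, t0)
  have X3 := X2.radial (Zm E) (z := (x0, y0, t0)) (by rw [hZ]; exact norm_pos_iff.1 q5) (hψS s hsI)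
  have X4 := (X2.normSq (Xm E) xc (x0, y0, t0)).smul (16 * b)
  have X5 := (X2.lin (Tm E) (x0, y0, t0)).comp (S2_time (a := b * Θ) (k := k) (T := tc) m3.2)
  have X6 := ((X1.add X3).add X4).add X5
  obtain ⟨L, B, hL, hB, hJ⟩ := X6.jet (g := D2 u) hlocmax
  simp only [hZ, ← hs, ← he, Tm_apply, Xm_apply, ContinuousLinearMap.comp_apply, innerSL_apply_apply, Zm_apply] at hL hB
  have hxΩ := hΩ x0 y0 t0 m1 m2 m3
  have hqq : (l + ψ1 s • e + (32 * b) • (x0 - xc)) - (l + ψ1 s • e) = (32 * b) • (x0 - xc) := by abel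
  have hqn : ‖(32 * b) • (x0 - xc)‖ ^ 2 ≤ 64 * b * (ω s - ψ s) := by
    rw [norm_smul, Real.norm_eq_abs, abs_of_pos (by positivity)]
    have : (32 * b * ‖x0 - xc‖) ^ 2 = 64 * b * (16 * b * ‖x0 - xc‖ ^ 2) := by ring
    rw [this]; gcongr
  have hmpos : 0 < ‖l + ψ1 s • e‖ := norm_pos_iff.2 n1
  have R := hM hu hxΩ.1 hxΩ.2 hJ (qx := l + ψ1 s • e + (32 * b) • (x0 - xc)) (qy := l + ψ1 s • e)
    (θ := -(b * Θ) + k / (tc - t0) ^ 2) n1 (by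
      intro h k' τ
      rw [hL]
      simp only [inner_add_left, inner_smul_left, inner_sub_right, RCLike.conj_to_real]
      ring) (by
      rw [hqq]
      refine abs_le_of_sq_le_sq' ?_ (by positivity) |>.2
      rw [mul_pow]; exact hqn.trans n2) hen (α := ψ2 s) (β := ψ1 s / s) (b := 16 * b) (hψ2 s hsI)
      (div_nonneg (hψ1 s hsI) q5.le) (by positivity) (by
        intro h k'
        rw [hB]
        apply le_of_eq
        simp only [zero_add, zero_pow two_ne_zero, mul_zero, add_zero])
  rw [hqq] at R
  have hfin : ψ1 s / s * (‖(32 * b) • (x0 - xc)‖ / ‖l + ψ1 s • e‖) ^ 2 ≤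
      ψ1 s / s * (64 * b * (ω s - ψ s) / ‖l + ψ1 s • e‖ ^ 2) := by
    rw [div_pow]
    have := div_nonneg (hψ1 s hsI) q5.le
    gcongr
  have hk' : 0 < k / (tc - t0) ^ 2 := by positivity
  have hmg : 0 < ‖l + ψ1 s • e‖ ^ γ := by positivity
  have : ‖l + ψ1 s • e‖ ^ γ * (c1 * ψ2 s + C2 * (ψ1 s / s * (‖(32 * b) • (x0 - xc)‖ / ‖l + ψ1 s • e‖) ^ 2 + 16 * b)) ≤
     ‖l + ψ1 s • e‖ ^ γ * (c1 * ψ2 s + C2 * (ψ1 s / s * (64 * b * (ω s - ψ s) / ‖l + ψ1 s • e‖ ^ 2) + 16 * b)) := by gcongr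
  linarith
end LG

section LG2
variable {E : Type*} [NormedAddCommGroup E] [InnerProductSpace ℝ E] [FiniteDimensional ℝ E]

/-- spatial Lipschitz bound -/
def SpL (u : E × ℝ → ℝ) (M r τ : ℝ) : Prop :=
  ∀ x y t, ‖x‖ < r → ‖y‖ < r → -τ < t → t < 0 → u (x, t) - u (y, t) ≤ M * ‖x - y‖

theorem time_lim {u : E × ℝ → ℝ} {Ω : Set (E × ℝ)} (ho : IsOpen Ω) (hu : ContinuousOn u Ω) {x : E} {t : ℝ}
    (h : (x, t) ∈ Ω) : Filter.Tendsto (fun s => u (x, s)) (nhdsWithin t (Iio t)) (nhds (u (x, t))) := by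
  have h1 : ContinuousAt u (x, t) := hu.continuousAt (ho.mem_nhds h)
  have h2 : ContinuousAt (fun s : ℝ => (x, s)) t := by fun_prop
  have h3 : ContinuousAt (fun s => u (x, s)) t := ContinuousAt.comp (f := fun s : ℝ => (x, s)) h1 h2
  exact h3.tendsto.mono_left nhdsWithin_le_nhds

theorem lemG' {γ p c1 C2 ν0 : ℝ} (hc1 : 0 < c1) (hC2 : 0 < C2) (hν0 : 0 < ν0) (hM : Mst E γ p c1 C2 ν0)
    {ε : ℝ} {u : E × ℝ → ℝ} {Ω : Set (E × ℝ)} (hu : VisS γ p ε u Ω)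
    {xc : E} {tc Θ κ b : ℝ} (hΘ : 0 < Θ) (hκ : 0 < κ) (hb : 0 < b) (l : E)
    (hΩ : ∀ x y t, ‖x - xc‖ ≤ 1 / 4 → ‖x - y‖ ≤ κ → t ∈ Icc (tc - 1 / Θ) tc → (x, t) ∈ Ω ∧ (y, t) ∈ Ω)
    {ω ψ ψ1 ψ2 : ℝ → ℝ}
    (hω : ∀ x y t, ‖x - xc‖ ≤ 1 / 4 → ‖x - y‖ ≤ κ → t ∈ Ico (tc - 1 / Θ) tc →
      D2 u (x, y, t) - ⟪l, x - y⟫ ≤ ω ‖x - y‖)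
    (hψc : ContinuousOn ψ (Icc 0 κ)) (hψS : ∀ s ∈ Ioo 0 κ, S2 ψ s (ψ1 s) (ψ2 s / 2))
    (hψ1 : ∀ s ∈ Ioo 0 κ, 0 ≤ ψ1 s) (hψ2 : ∀ s ∈ Ioo 0 κ, ψ2 s ≤ 0)
    (hgap : ∀ s ∈ Icc 0 κ, ω s - ψ s ≤ b) (hψ0 : 0 ≤ ψ 0)
    (hbd : ∀ x y t, ‖x - xc‖ ≤ 1 / 4 → ‖x - y‖ = κ → t ∈ Ico (tc - 1 / Θ) tc →
      D2 u (x, y, t) - ⟪l, x - y⟫ ≤ ψ κ)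
    (hmain : ∀ s ∈ Ioo 0 κ, 0 < ω s - ψ s → ∀ e : E, ‖e‖ = 1 → l + ψ1 s • e ≠ 0 ∧
      64 * b * (ω s - ψ s) ≤ ν0 ^ 2 * ‖l + ψ1 s • e‖ ^ 2 ∧
      2 * ε + b * Θ + ‖l + ψ1 s • e‖ ^ γ * (c1 * ψ2 s +
        C2 * (ψ1 s / s * (64 * b * (ω s - ψ s) / ‖l + ψ1 s • e‖ ^ 2) + 16 * b)) < 0) :
    ∀ y, ‖xc - y‖ ≤ κ → D2 u (xc, y, tc) - ⟪l, xc - y⟫ ≤ ψ ‖xc - y‖ := by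
  intro y hy
  have hG := lemG hc1 hC2 hν0 hM hu hΘ hκ hb l (fun x y t h1 h2 h3 => hΩ x y t h1 h2 ⟨h3.1, h3.2.le⟩)
    hω hψc hψS hψ1 hψ2 hgap hψ0 hbd hmain y
  have hΘ' : 0 < 1 / Θ := by positivity
  have h0 := hΩ xc y tc (by simp) hy ⟨by linarith, le_rfl⟩
  have t1 := time_lim hu.opn hu.cont h0.1
  have t2 := time_lim hu.opn hu.cont h0.2
  have t3 : Filter.Tendsto (fun s => (u (xc, s) - u (y, s)) - ⟪l, xc - y⟫) (nhdsWithin tc (Iio tc))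
    (nhds ((u (xc, tc) - u (y, tc)) - ⟪l, xc - y⟫)) := (t1.sub t2).sub tendsto_const_nhds
  have t4 : Filter.Tendsto (fun s => ψ ‖xc - y‖ + b * Θ * (tc - s)) (nhdsWithin tc (Iio tc))
    (nhds (ψ ‖xc - y‖ + b * Θ * (tc - tc))) := by
    have : Continuous fun s => ψ ‖xc - y‖ + b * Θ * (tc - s) := by fun_prop
    exact (this.tendsto tc).mono_left nhdsWithin_le_nhds
  rw [sub_self, mul_zero, add_zero] at t4
  refine le_of_tendsto_of_tendsto t3 t4 ?_
  have : Ico (tc - 1 / Θ) tc ∈ nhdsWithin tc (Iio tc) := Ico_mem_nhdsLT (by linarith)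
  filter_upwards [this] with s hs
  exact hG s hy hs

theorem chain {f : E → ℝ} {B : Set E} (hB : Convex ℝ B) {M κ : ℝ} (hκ : 0 < κ)
    (h : ∀ x ∈ B, ∀ y ∈ B, ‖x - y‖ ≤ κ → f x - f y ≤ M * ‖x - y‖) :
    ∀ x ∈ B, ∀ y ∈ B, f x - f y ≤ M * ‖x - y‖ := by
  intro x hx y hy
  obtain ⟨n, hn⟩ := exists_nat_ge (‖x - y‖ / κ)
  have key : ∀ k : ℕ, k ≤ n + 1 → f (x + ((k : ℝ) / (n + 1)) • (y - x)) ≥ f x - M * ((k : ℝ) / (n + 1) * ‖x - y‖) := by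
    intro k hk
    induction k with
    | zero => simp
    | succ k ih =>
      have ih := ih (by omega)
      have mem : ∀ j : ℕ, j ≤ n + 1 → x + ((j : ℝ) / (n + 1)) • (y - x) ∈ B := by
        intro j hj
        refine hB.add_smul_sub_mem hx hy ⟨by positivity, ?_⟩
        rw [div_le_one (by positivity)]; exact_mod_cast hj
      have e1 : (x + ((k : ℝ) / (n + 1)) • (y - x)) - (x + (((k + 1 : ℕ) : ℝ) / (n + 1)) • (y - x))
        = (1 / ((n : ℝ) + 1)) • (x - y) := by
        have : ((k + 1 : ℕ) : ℝ) / (n + 1) = (k : ℝ) / (n + 1) + 1 / ((n : ℝ) + 1) := by push_cast; ring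
        rw [this]; module
      have e2 : ‖(1 / ((n : ℝ) + 1)) • (x - y)‖ = 1 / ((n : ℝ) + 1) * ‖x - y‖ := by
        rw [norm_smul, Real.norm_eq_abs, abs_of_pos (by positivity)]
      have := h _ (mem k (by omega)) _ (mem (k + 1) hk) (by
        rw [e1, e2, div_mul_eq_mul_div, one_mul, div_le_iff₀ (by positivity)]
        rw [div_le_iff₀ hκ] at hn; nlinarith)
      rw [e1, e2] at this
      have e3 : M * (((k + 1 : ℕ) : ℝ) / (n + 1) * ‖x - y‖) = M * ((k : ℝ) / (n + 1) * ‖x - y‖) + M * (1 / ((n : ℝ) + 1) * ‖x - y‖) := by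
        push_cast; ring
      rw [e3]; linarith
  have := key (n + 1) le_rfl
  have e : ((n + 1 : ℕ) : ℝ) / ((n : ℝ) + 1) = 1 := by push_cast; field_simp
  rw [e, one_mul, one_smul, add_sub_cancel] at this
  linarith

theorem S2_sqrt {K s : ℝ} (hs : 0 < s) :
    S2 (fun s => K * √s) s (K / (2 * √s)) ((-(K / (4 * (s * √s)))) / 2) := by
  refine S2.of_deriv (F' := fun x => K / (2 * √x)) ?_ ?_
  · filter_upwards [lt_mem_nhds hs] with x hx
    refine ((Real.hasDerivAt_sqrt hx.ne').const_mul K).congr_deriv (by ring)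
  · have hq : 0 < √s := Real.sqrt_pos.2 hs
    have h1 := (Real.hasDerivAt_sqrt hs.ne').const_mul 2
    refine ((hasDerivAt_const s K).div h1 (by positivity)).congr_deriv ?_
    have h2 : √s ^ 2 = s := Real.sq_sqrt hs.le
    field_simp
    rw [h2]; ring

theorem S2_lip {K s : ℝ} (hs : 0 < s) :
    S2 (fun s => K * (s - s * √s / 2)) s (K * (1 - 3 / 4 * √s)) ((-(3 * K / (8 * √s))) / 2) := by
  have key : ∀ x : ℝ, 0 < x → HasDerivAt (fun s => K * (s - s * √s / 2)) (K * (1 - 3 / 4 * √x)) x := by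
    intro x hx
    have hq : 0 < √x := Real.sqrt_pos.2 hx
    have h1 := (hasDerivAt_id x).mul (Real.hasDerivAt_sqrt hx.ne')
    refine (((hasDerivAt_id x).sub (h1.div_const 2)).const_mul K).congr_deriv ?_
    have h2 : √x ^ 2 = x := Real.sq_sqrt hx.le
    simp only [id]
    field_simp
    linear_combination (4 : ℝ) * K * h2
  refine S2.of_deriv (F' := fun x => K * (1 - 3 / 4 * √x)) ?_ ?_
  · filter_upwards [lt_mem_nhds hs] with x hx using key x hx
  · have hq : 0 < √s := Real.sqrt_pos.2 hs
    refine ((((Real.hasDerivAt_sqrt hs.ne').const_mul (3 / 4)).const_sub 1).const_mul K).congr_deriv ?_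
    field_simp; ring

theorem S2_drop {a c d s : ℝ} : S2 (fun s => a * s + c * (d * s - s ^ 2)) s (a + c * (d - 2 * s)) ((-(2 * c)) / 2) :=
  fun ε hε => Filter.Eventually.of_forall fun τ => by
    have : a * (s + τ) + c * (d * (s + τ) - (s + τ) ^ 2) - (a * s + c * (d * s - s ^ 2)) - (a + c * (d - 2 * s)) * τ - (-(2 * c)) / 2 * τ ^ 2 = 0 := by ring
    rw [this, abs_zero]; positivity

end LG2

section LG3
variable {E : Type*} [NormedAddCommGroup E] [InnerProductSpace ℝ E] [FiniteDimensional ℝ E]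

/-- cylinder -/
def Cyl (E : Type*) [NormedAddCommGroup E] (r τ : ℝ) : Set (E × ℝ) := {z | ‖z.1‖ < r ∧ -τ < z.2 ∧ z.2 < 0}

theorem Cyl_open (r τ : ℝ) : IsOpen (Cyl E r τ) := by
  have h1 : IsOpen {z : E × ℝ | ‖z.1‖ < r} := isOpen_lt (by fun_prop) (by fun_prop)
  have h2 : IsOpen {z : E × ℝ | -τ < z.2} := isOpen_lt (by fun_prop) (by fun_prop)
  have h3 : IsOpen {z : E × ℝ | z.2 < 0} := isOpen_lt (by fun_prop) (by fun_prop)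
  exact h1.inter (h2.inter h3)

theorem far_lt {x y xc : E} {a κ : ℝ} (h1 : ‖x - xc‖ ≤ 1 / 4) (h2 : ‖x - y‖ ≤ κ) (hc : ‖xc‖ < a) :
    ‖x‖ < a + 1 / 4 ∧ ‖y‖ < a + 1 / 4 + κ := by
  have e1 : ‖x‖ ≤ ‖x - xc‖ + ‖xc‖ := by simpa using norm_add_le (x - xc) xc
  have e2 : ‖y‖ ≤ ‖x - y‖ + ‖x‖ := by
    have := norm_sub_le x (x - y)
    rw [sub_sub_cancel] at this; linarith
  constructor <;> linarith

set_option maxHeartbeats 1000000 in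
theorem holder_est {γ p c1 C2 ν0 : ℝ} (hγ : -1 < γ) (hγ0 : γ < 0)
    (hc1 : 0 < c1) (hC2 : 0 < C2) (hν0 : 0 < ν0) (hM : Mst E γ p c1 C2 ν0) :
    ∃ K > 0, ∀ {u : E × ℝ → ℝ}, VisS γ p 1 u (Cyl E 1 1) →
      (∀ z ∈ Cyl E 1 1, ∀ w ∈ Cyl E 1 1, u z - u w ≤ 5) →
      ∀ x y t, ‖x‖ < 1 / 2 → ‖y‖ < 1 / 2 → -(1 / 2) < t → t < 0 →
        u (x, t) - u (y, t) ≤ K * √‖x - y‖ := by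
  set g := 1 + C2 / c1 + 1 / c1 + 1 / ν0 with hg
  have g1 : 0 < C2 / c1 := by positivity
  have g2 : 0 < 1 / c1 := by positivity
  have g3 : 0 < 1 / ν0 := by positivity
  have gg : 1 ≤ g := by linarith
  set K := 1000 * g with hK
  have hKp : 0 < K := by positivity
  have hKg : 100000 * g ≤ K ^ 2 / 10 := by rw [hK]; nlinarith
  refine ⟨K, hKp, ?_⟩
  intro u hu hosc xc y tc hx hy ht ht0
  have hinΩ : ∀ x y t, ‖x - xc‖ ≤ 1 / 4 → ‖x - y‖ ≤ 1 / 8 → t ∈ Icc (tc - 1 / (4 : ℝ)) tc →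
      (x, t) ∈ Cyl E 1 1 ∧ (y, t) ∈ Cyl E 1 1 := by
    intro x y t h1 h2 h3
    have := far_lt h1 h2 hx
    have h4 := h3.1
    have h5 := h3.2
    exact ⟨⟨by simp only; linarith, by simp only; linarith, by simp only; linarith⟩,
      ⟨by simp only; linarith, by simp only; linarith, by simp only; linarith⟩⟩
  have hs8 : (5 : ℝ) ≤ K * √(1 / 8) := by
    have : (1 / 4 : ℝ) ≤ √(1 / 8) := by
      apply Real.le_sqrt_of_sq_le; norm_num
    nlinarith
  have hbig : ∀ x y t, (x, t) ∈ Cyl E 1 1 → (y, t) ∈ Cyl E 1 1 → 1 / 8 ≤ ‖x - y‖ →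
      u (x, t) - u (y, t) ≤ K * √‖x - y‖ := by
    intro x y t h1 h2 h3
    have := hosc _ h1 _ h2
    have h4 : √(1 / 8) ≤ √‖x - y‖ := Real.sqrt_le_sqrt h3
    have h5 : K * √(1 / 8) ≤ K * √‖x - y‖ := by gcongr
    linarith
  have xin : (xc, tc) ∈ Cyl E 1 1 := ⟨by simp only; linarith, by simp only; linarith, by simp only; linarith⟩
  have yin : (y, tc) ∈ Cyl E 1 1 := ⟨by simp only; linarith, by simp only; linarith, by simp only; linarith⟩
  by_cases hxy : 1 / 8 ≤ ‖xc - y‖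
  · exact hbig _ _ _ xin yin hxy
  push Not at hxy
  have key := lemG' hc1 hC2 hν0 hM hu (xc := xc) (tc := tc) (Θ := 4) (κ := 1 / 8) (b := 5) (by norm_num)
    (by norm_num) (by norm_num) 0 hinΩ (ω := fun _ => 5) (ψ := fun s => K * √s)
    (ψ1 := fun s => K / (2 * √s)) (ψ2 := fun s => -(K / (4 * (s * √s)))) ?_ (by fun_prop)
    (fun s hs => S2_sqrt hs.1) (fun s hs => by positivity) (fun s hs => by
      have := hs.1
      simp only [Left.neg_nonpos_iff]; positivity)
    (fun s hs => by have : 0 ≤ K * √s := by positivity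
                    linarith) (by simp) ?_ ?_ y hxy.le
  · simpa [D2] using key
  · intro x y t h1 h2 h3
    have := hinΩ x y t h1 h2 ⟨h3.1, h3.2.le⟩
    simpa [D2] using hosc _ this.1 _ this.2
  · intro x y t h1 h2 h3
    have h0 := hinΩ x y t h1 h2.le ⟨h3.1, h3.2.le⟩
    have := hbig _ _ _ h0.1 h0.2 h2.ge
    rw [h2] at this
    simpa [D2] using this
  · intro s hs hgap e he
    have hs0 := hs.1
    have hq : 0 < √s := Real.sqrt_pos.2 hs0
    have hq2 : √s ^ 2 = s := Real.sq_sqrt hs0.le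
    set m := K / (2 * √s) with hm
    have hm0 : 0 < m := by positivity
    have hn : ‖(0 : E) + m • e‖ = m := by
      rw [zero_add, norm_smul, he, mul_one, Real.norm_eq_abs, abs_of_pos hm0]
    rw [hn]
    have hmK : K ^ 2 / 10 ≤ m := by
      rw [hm, le_div_iff₀ (by positivity)]
      nlinarith only [hgap, hKp, hq]
    have hmg : 100000 * g ≤ m := hKg.trans hmK
    have hm1 : 1 ≤ m := by linarith
    have hp2 : K / (4 * (s * √s)) = m / (2 * s) := by rw [hm]; field_simp; norm_num
    have hgp : 5 - K * √s ≤ 5 := by linarith [mul_pos hKp hq]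
    refine ⟨?_, ?_, ?_⟩
    · rw [← norm_pos_iff, hn]; exact hm0
    · have : 40 ≤ ν0 * m := by
        have h1 : 1 ≤ ν0 * g := by
          have : ν0 * (1 / ν0) = 1 := by field_simp
          have h2 : 1 / ν0 ≤ g := by linarith
          nlinarith only [this, h2, hν0]
        have h2 : 40 * g ≤ m := by linarith
        nlinarith only [h1, h2, hν0]
      nlinarith only [this, hgp]
    · rw [hp2]
      have hmγ : m ^ γ ≤ 1 := Real.rpow_le_one_of_one_le_of_nonpos hm1 hγ0.le
      have hmγ0 : 0 < m ^ γ := Real.rpow_pos_of_pos hm0 γ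
      have hmγ1 : 1 ≤ m ^ γ * m := by
        rw [← Real.rpow_add_one hm0.ne']
        exact Real.one_le_rpow hm1 (by linarith)
      have t1 : C2 * (m / s * (64 * 5 * (5 - K * √s) / m ^ 2)) ≤ c1 * (m / (4 * s)) := by
        have h1 : 64 * 5 * (5 - K * √s) / m ^ 2 ≤ 1600 / m ^ 2 := by gcongr; linarith
        have h2 : C2 * (1600 / m ^ 2) ≤ c1 / 4 := by
          have h3 : C2 ≤ c1 * g := by
            have : c1 * (C2 / c1) = C2 := by field_simp
            have h2 : C2 / c1 ≤ g := by linarith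
            nlinarith only [this, h2, hc1]
          rw [← mul_div_assoc, div_le_div_iff₀ (by positivity) (by norm_num)]
          have h4 : c1 * g * 6400 ≤ c1 * m := by
            have : g * 6400 ≤ m := by linarith
            nlinarith only [this, hc1]
          have h5 : c1 * m ≤ c1 * m ^ 2 := by
            have : m ≤ m ^ 2 := by nlinarith only [hm1]
            gcongr
          linarith
        calc C2 * (m / s * (64 * 5 * (5 - K * √s) / m ^ 2)) ≤ C2 * (m / s * (1600 / m ^ 2)) := by gcongr
          _ = m / s * (C2 * (1600 / m ^ 2)) := by ring
          _ ≤ m / s * (c1 / 4) := by gcongr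
          _ = _ := by ring
      have t2 : c1 * -(m / (2 * s)) + C2 * (m / s * (64 * 5 * (5 - K * √s) / m ^ 2) + 16 * 5)
        ≤ - (c1 * (m / (4 * s))) + 80 * C2 := by
        have : m / (2 * s) = m / (4 * s) + m / (4 * s) := by field_simp; ring
        rw [this]; linarith
      have t3 : 2 * 1 + 5 * 4 + m ^ γ * (- (c1 * (m / (4 * s))) + 80 * C2) < 0 := by
        have h1 : m ^ γ * (80 * C2) ≤ 80 * C2 := by nlinarith only [hmγ, hC2]
        have h2 : c1 / (4 * s) ≤ m ^ γ * (c1 * (m / (4 * s))) := by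
          have : m ^ γ * (c1 * (m / (4 * s))) = (m ^ γ * m) * (c1 / (4 * s)) := by ring
          rw [this]
          have : 0 < c1 / (4 * s) := by positivity
          nlinarith only [this, hmγ1]
        have h3 : c1 * K ^ 2 / 100 ≤ c1 / (4 * s) := by
          rw [div_le_div_iff₀ (by norm_num) (by positivity)]
          have : (K * √s) ^ 2 ≤ 25 := by
            have : 0 < K * √s := by positivity
            nlinarith only [this, hgap]
          rw [mul_pow, hq2] at this
          nlinarith only [this, hc1]
        have h4 : 10000 * (c1 + C2 + 1) ≤ c1 * K ^ 2 / 100 := by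
          have h5 : c1 + C2 + 1 ≤ c1 * g := by
            have : c1 * (1 + C2 / c1 + 1 / c1) = c1 + C2 + 1 := by field_simp
            rw [← this]; gcongr; linarith
          have : c1 * (100000 * g) ≤ c1 * (K ^ 2 / 10) := by gcongr
          linarith
        linarith
      have t4 : m ^ γ * (c1 * -(m / (2 * s)) + C2 * (m / s * (64 * 5 * (5 - K * √s) / m ^ 2) + 16 * 5))
        ≤ m ^ γ * (- (c1 * (m / (4 * s))) + 80 * C2) := by gcongr
      linarith

set_option maxHeartbeats 1000000 in
theorem lip_gen {γ p c1 C2 ν0 : ℝ} (hγ0 : γ < 0)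
    (hc1 : 0 < c1) (hC2 : 0 < C2) (hν0 : 0 < ν0) (hM : Mst E γ p c1 C2 ν0) {ε ω K μ Λ : ℝ}
    (hω : 0 < ω) (hK : 6 ≤ K) (hμ : 0 < μ) (l : E)
    (hb : ∀ s, ω * K / 2 ≤ s → s ≤ ω * K → ∀ e : E, ‖e‖ = 1 → μ ≤ ‖l + s • e‖ ∧ ‖l + s • e‖ ≤ Λ)
    (h1 : 64 * ω ^ 2 ≤ ν0 ^ 2 * μ ^ 2) (h2 : 1024 * C2 * ω ^ 2 ≤ c1 * μ ^ 2) (h3 : 512 * C2 ≤ c1 * K ^ 2)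
    (h4 : 2 * ε + 4 * ω < Λ ^ γ * (c1 * ω * K ^ 2 / 8))
    {u : E × ℝ → ℝ} (hu : VisS γ p ε u (Cyl E 1 1))
    (hH : ∀ x y t, ‖x‖ < 1 → ‖y‖ < 1 → -1 < t → t < 0 →
      u (x, t) - u (y, t) - ⟪l, x - y⟫ ≤ ω * √‖x - y‖) :
      ∀ x y t, ‖x‖ < 1 / 2 → ‖y‖ < 1 / 2 → -(1 / 2) < t → t < 0 →
        u (x, t) - u (y, t) - ⟪l, x - y⟫ ≤ ω * K * ‖x - y‖ := by
  have hK0 : 0 < K := by linarith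
  have hinΩ : ∀ xc tc, ‖xc‖ < 1 / 2 → -(1 / 2) < tc → tc < 0 → ∀ x y t, ‖x - xc‖ ≤ 1 / 4 → ‖x - y‖ ≤ 1 / 8 → t ∈ Icc (tc - 1 / (4 : ℝ)) tc →
      (x, t) ∈ Cyl E 1 1 ∧ (y, t) ∈ Cyl E 1 1 := by
    intro xc tc hx ht ht0 x y t h1 h2 h3
    have := far_lt h1 h2 hx
    have h4 := h3.1
    have h5 := h3.2
    exact ⟨⟨by simp only; linarith, by simp only; linarith, by simp only; linarith⟩,
      ⟨by simp only; linarith, by simp only; linarith, by simp only; linarith⟩⟩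
  have sq8 : ∀ s : ℝ, 0 ≤ s → s ≤ 1 / 8 → √s ≤ 9 / 25 := by
    intro s _ hs
    exact Real.sqrt_le_iff.2 ⟨by norm_num, by linarith⟩
  have hloc : ∀ xc y tc, ‖xc‖ < 1 / 2 → -(1 / 2) < tc → tc < 0 → ‖xc - y‖ ≤ 1 / 8 →
      u (xc, tc) - u (y, tc) - ⟪l, xc - y⟫ ≤ ω * K * ‖xc - y‖ := by
    intro xc y tc hx ht ht0 hxy
    have hin := hinΩ xc tc hx ht ht0
    have key := lemG' hc1 hC2 hν0 hM hu (xc := xc) (tc := tc) (Θ := 4) (κ := 1 / 8) (b := ω) (by norm_num)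
      (by norm_num) hω l hin (ω := fun s => ω * √s) (ψ := fun s => ω * K * (s - s * √s / 2))
      (ψ1 := fun s => ω * K * (1 - 3 / 4 * √s)) (ψ2 := fun s => -(3 * (ω * K) / (8 * √s))) ?_ (by fun_prop)
      (fun s hs => S2_lip hs.1) (fun s hs => by
        have := sq8 s hs.1.le hs.2.le
        have : 0 ≤ 1 - 3 / 4 * √s := by linarith
        positivity) (fun s hs => by
        have := hs.1
        simp only [Left.neg_nonpos_iff]; positivity)
      (fun s hs => by
        have := sq8 s hs.1 hs.2
        have h0 : 0 ≤ s - s * √s / 2 := by nlinarith [hs.1]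
        have : 0 ≤ ω * K * (s - s * √s / 2) := by positivity
        nlinarith [Real.sqrt_nonneg s]) (by simp) ?_ ?_ y hxy
    · have : ω * K * (‖xc - y‖ - ‖xc - y‖ * √‖xc - y‖ / 2) ≤ ω * K * ‖xc - y‖ := by
        have : 0 ≤ ‖xc - y‖ * √‖xc - y‖ / 2 := by positivity
        gcongr; linarith
      simp only [D2] at key
      linarith
    · intro x y t h1 h2 h3
      have := hin x y t h1 h2 ⟨h3.1, h3.2.le⟩
      exact hH _ _ _ this.1.1 this.2.1 this.1.2.1 this.1.2.2
    · intro x y t h1 h2 h3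
      have := hin x y t h1 h2.le ⟨h3.1, h3.2.le⟩
      have h5 := hH _ _ _ this.1.1 this.2.1 this.1.2.1 this.1.2.2
      refine h5.trans ?_
      rw [h2]
      have a1 := sq8 (1 / 8) (by norm_num) le_rfl
      have a2 : √(1 / 8 : ℝ) ^ 2 = 1 / 8 := Real.sq_sqrt (by norm_num)
      have a3 : 0 < √(1 / 8 : ℝ) := Real.sqrt_pos.2 (by norm_num)
      have a4 : √(1 / 8 : ℝ) ≤ 6 * (1 / 8 - 1 / 8 * √(1 / 8) / 2) := by linarith
      rw [mul_assoc]
      have a5 : 6 * (1 / 8 - 1 / 8 * √(1 / 8 : ℝ) / 2) ≤ K * (1 / 8 - 1 / 8 * √(1 / 8) / 2) := by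
        apply mul_le_mul_of_nonneg_right hK; linarith
      gcongr
      linarith
    · intro s hs hgap e he
      have hs0 := hs.1
      have hq : 0 < √s := Real.sqrt_pos.2 hs0
      have hq2 : √s * √s = s := Real.mul_self_sqrt hs0.le
      have hq8 := sq8 s hs0.le hs.2.le
      have hωK : 0 < ω * K := by positivity
      have hbb := hb (ω * K * (1 - 3 / 4 * √s)) (by nlinarith only [hωK, hq8]) (by nlinarith only [hωK, hq]) e he
      set N := ‖l + (ω * K * (1 - 3 / 4 * √s)) • e‖ with hN
      have hN0 : 0 < N := hμ.trans_le hbb.1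
      have hss : 0 ≤ s - s * √s / 2 := by nlinarith only [hs0, hq8]
      have hgp : ω * √s - ω * K * (s - s * √s / 2) ≤ ω * √s := by
        have : 0 ≤ ω * K * (s - s * √s / 2) := by positivity
        linarith
      have hgp1 : ω * √s ≤ ω := by nlinarith only [hω, hq8]
      have hsK : K * √s < 2 := by
        have e1 : s - s * √s / 2 = √s * (√s * (1 - √s / 2)) := by
          rw [mul_comm √s (1 - √s / 2), ← mul_assoc, mul_comm √s (1 - √s / 2), mul_assoc, hq2]; ring
        have e2 : 0 < ω * √s * (1 - K * (√s * (1 - √s / 2))) := by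
          rw [e1] at hgap
          have : ω * √s * (1 - K * (√s * (1 - √s / 2))) = ω * √s - ω * K * (√s * (√s * (1 - √s / 2))) := by ring
          rw [this]; exact hgap
        have e3 : 0 < 1 - K * (√s * (1 - √s / 2)) := by
          by_contra hh
          push Not at hh
          have : 0 < ω * √s := by positivity
          nlinarith only [this, hh, e2]
        have e4 : K * (√s / 2) ≤ K * (√s * (1 - √s / 2)) := by
          gcongr; nlinarith only [hq, hq8]
        linarith
      have hμN : μ ^ 2 ≤ N ^ 2 := by gcongr; exact hbb.1
      refine ⟨?_, ?_, ?_⟩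
      · rw [← norm_pos_iff]; exact hN0
      · have : 64 * ω * (ω * √s - ω * K * (s - s * √s / 2)) ≤ 64 * ω * ω := by gcongr; linarith
        have h6 : ν0 ^ 2 * μ ^ 2 ≤ ν0 ^ 2 * N ^ 2 := by gcongr
        linarith
      · have t1 : C2 * (ω * K * (1 - 3 / 4 * √s) / s * (64 * ω * (ω * √s - ω * K * (s - s * √s / 2)) / N ^ 2))
          ≤ c1 * (ω * K / (16 * √s)) := by
          have a1 : ω * K * (1 - 3 / 4 * √s) / s ≤ ω * K / s := by
            have : ω * K * (1 - 3 / 4 * √s) ≤ ω * K := by nlinarith only [hωK, hq]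
            gcongr
          have a2 : 64 * ω * (ω * √s - ω * K * (s - s * √s / 2)) / N ^ 2 ≤ 64 * ω * (ω * √s) / μ ^ 2 := by
            gcongr
          have a3 : 0 ≤ 64 * ω * (ω * √s - ω * K * (s - s * √s / 2)) / N ^ 2 := by
            have := hgap.le
            positivity
          calc _ ≤ C2 * (ω * K / s * (64 * ω * (ω * √s) / μ ^ 2)) := by gcongr
            _ = (64 * C2 * ω ^ 2 / μ ^ 2) * (ω * K / √s) := by
              rw [div_mul_div_comm, ← mul_div_assoc, div_mul_div_comm]
              rw [div_eq_div_iff (by positivity) (by positivity)]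
              linear_combination (64 * C2 * ω ^ 3 * K * μ ^ 2) * hq2
            _ ≤ (c1 / 16) * (ω * K / √s) := by
              have : 64 * C2 * ω ^ 2 / μ ^ 2 ≤ c1 / 16 := by
                rw [div_le_iff₀ (by positivity)]; linarith
              exact mul_le_mul_of_nonneg_right this (by positivity)
            _ = _ := by field_simp
        have t2 : C2 * (16 * ω) ≤ c1 * (ω * K / (16 * √s)) := by
          rw [← mul_div_assoc, le_div_iff₀ (by positivity)]
          have : C2 * (16 * ω) * (16 * √s) * K ≤ c1 * (ω * K) * K := by
            calc C2 * (16 * ω) * (16 * √s) * K = 256 * (C2 * ω) * (K * √s) := by ring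
              _ ≤ 256 * (C2 * ω) * 2 := by gcongr
              _ = ω * (512 * C2) := by ring
              _ ≤ ω * (c1 * K ^ 2) := by gcongr
              _ = _ := by ring
          exact le_of_mul_le_mul_right this hK0
        have t3 : c1 * -(3 * (ω * K) / (8 * √s)) = - (4 * (c1 * (ω * K / (16 * √s)))) - 2 * (c1 * (ω * K / (16 * √s))) := by
          field_simp; ring
        have t4 : c1 * ω * K ^ 2 / 8 ≤ 4 * (c1 * (ω * K / (16 * √s))) := by
          have : 4 * (c1 * (ω * K / (16 * √s))) = c1 * ω * K / (4 * √s) := by field_simp; norm_num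
          rw [this, div_le_div_iff₀ (by norm_num) (by positivity)]
          calc c1 * ω * K ^ 2 * (4 * √s) = c1 * ω * K * 4 * (K * √s) := by ring
            _ ≤ c1 * ω * K * 4 * 2 := by gcongr
            _ = _ := by ring
        have t5 : c1 * -(3 * (ω * K) / (8 * √s)) + C2 * (ω * K * (1 - 3 / 4 * √s) / s * (64 * ω * (ω * √s - ω * K * (s - s * √s / 2)) / N ^ 2) + 16 * ω)
          ≤ - (c1 * ω * K ^ 2 / 8) := by
          rw [t3, mul_add C2]; linarith
        have t6 : Λ ^ γ ≤ N ^ γ := Real.rpow_le_rpow_of_nonpos hN0 hbb.2 hγ0.le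
        have t7 : 0 < N ^ γ := Real.rpow_pos_of_pos hN0 γ
        have t8 : N ^ γ * (c1 * -(3 * (ω * K) / (8 * √s)) + C2 * (ω * K * (1 - 3 / 4 * √s) / s * (64 * ω * (ω * √s - ω * K * (s - s * √s / 2)) / N ^ 2) + 16 * ω))
          ≤ N ^ γ * (- (c1 * ω * K ^ 2 / 8)) := by gcongr
        have t9 : Λ ^ γ * (c1 * ω * K ^ 2 / 8) ≤ N ^ γ * (c1 * ω * K ^ 2 / 8) := by gcongr
        linarith
  intro x y t hx hy ht ht0
  have := chain (f := fun x => u (x, t) - ⟪l, x⟫) (convex_ball (0 : E) (1 / 2)) (M := ω * K) (κ := 1 / 8) (by norm_num)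
    (fun x hx y hy hxy => by
      have := hloc x y t (by simpa using hx) ht ht0 hxy
      rw [inner_sub_right] at this
      linarith) x (by simpa using hx) y (by simpa using hy)
  rw [inner_sub_right]
  linarith

end LG3

section LG4
variable {E : Type*} [NormedAddCommGroup E] [InnerProductSpace ℝ E] [FiniteDimensional ℝ E]

set_option maxHeartbeats 1000000 in
theorem drop_est {γ p c1 C2 ν0 : ℝ} (hγ0 : γ < 0)
    (hc1 : 0 < c1) (hC2 : 0 < C2) (hν0 : 0 < ν0) (hM : Mst E γ p c1 C2 ν0) {ε M θ κ Θ τ : ℝ}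
    (hM0 : 0 < M) (hθ : 0 < θ) (hθM : θ ≤ M / 4) (hκ : 0 < κ) (hκ8 : κ ≤ 1 / 8) (hΘ : 0 < Θ)
    (hτ : 1 / Θ < τ) (hτ1 : τ ≤ 1)
    (h1 : 4 * κ ≤ ν0) (h2 : 96 * C2 * κ ^ 2 ≤ c1)
    (h3 : 2 * ε + θ * κ * Θ < M ^ γ * (c1 * θ / (2 * κ)))
    {u : E × ℝ → ℝ} (hu : VisS γ p ε u (Cyl E 1 1)) (hL : SpL u M 1 1)
    (hd : ∀ x y t, ‖x‖ < 1 / 2 → ‖x - y‖ = κ → -τ < t → t < 0 → u (x, t) - u (y, t) ≤ (M - θ) * κ) :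
    SpL u (M - θ / 2) (1 / 4) (τ - 1 / Θ) := by
  have hloc : ∀ xc y tc, ‖xc‖ < 1 / 4 → -(τ - 1 / Θ) < tc → tc < 0 → ‖xc - y‖ ≤ κ →
      u (xc, tc) - u (y, tc) ≤ (M - θ / 2) * ‖xc - y‖ := by
    intro xc y tc hx ht ht0 hxy
    have hin : ∀ x y t, ‖x - xc‖ ≤ 1 / 4 → ‖x - y‖ ≤ κ → t ∈ Icc (tc - 1 / Θ) tc →
        ‖x‖ < 1 / 2 ∧ ‖y‖ < 1 ∧ -τ < t ∧ t < 0 := by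
      intro x y t h1 h2 h3
      have := far_lt h1 h2 hx
      have h4 := h3.1
      have h5 := h3.2
      refine ⟨?_, ?_, ?_, ?_⟩ <;> linarith
    have hb : 0 < θ * κ := by positivity
    set A := 1 / (2 * κ) with hA
    have hA0 : 0 < A := by positivity
    have hAκ : A * κ = 1 / 2 := by rw [hA]; field_simp
    have hgapf : ∀ s, M * s - ((M - θ) * s + θ * A * (κ * s - s ^ 2)) = θ * s * (1 / 2 + A * s) := by
      intro s
      linear_combination (-(θ * s)) * hAκ
    have hgap1 : ∀ s, 0 ≤ s → s ≤ κ → θ * s * (1 / 2 + A * s) ≤ θ * s := by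
      intro s hs hs2
      have : A * s ≤ 1 / 2 := by rw [← hAκ]; gcongr
      have h0 : 0 ≤ θ * s := by positivity
      nlinarith only [this, h0]
    have hp1 : ∀ s, 0 ≤ s → s ≤ κ → M / 2 ≤ (M - θ) + θ * A * (κ - 2 * s) ∧ (M - θ) + θ * A * (κ - 2 * s) ≤ M := by
      intro s hs hs2
      have e : θ * A * (κ - 2 * s) = θ / 2 - 2 * (θ * (A * s)) := by linear_combination θ * hAκ
      have : A * s ≤ 1 / 2 := by rw [← hAκ]; gcongr
      have h0 : 0 ≤ A * s := by positivity
      rw [e]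
      constructor
      · nlinarith only [this, hθ, hθM]
      · nlinarith only [h0, hθ, hθM]
    have key := lemG' hc1 hC2 hν0 hM hu (xc := xc) (tc := tc) (Θ := Θ) (κ := κ) (b := θ * κ) hΘ hκ hb 0
      (fun x y t a1 a2 a3 => by
        have := hin x y t a1 a2 a3
        have ha := hκ8
        have : -τ ≥ -1 := by linarith
        exact ⟨⟨by simp only; linarith, by simp only; linarith, by simp only; linarith⟩,
          ⟨by simp only; linarith, by simp only; linarith, by simp only; linarith⟩⟩)
      (ω := fun s => M * s) (ψ := fun s => (M - θ) * s + θ * A * (κ * s - s ^ 2))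
      (ψ1 := fun s => (M - θ) + θ * A * (κ - 2 * s)) (ψ2 := fun s => -(2 * (θ * A))) ?_ (by fun_prop)
      (fun s hs => S2_drop) (fun s hs => by have := (hp1 s hs.1.le hs.2.le).1; linarith)
      (fun s hs => by simp only [Left.neg_nonpos_iff]; positivity)
      (fun s hs => by
        have e1 := hgapf s
        have e2 := hgap1 s hs.1 hs.2
        have e3 : θ * s ≤ θ * κ := by have := hs.2; gcongr
        linarith) (by simp) ?_ ?_ y hxy
    · have e1 := hgapf ‖xc - y‖
      have e2 : 0 ≤ θ * ‖xc - y‖ * (A * ‖xc - y‖) := by positivity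
      simp only [D2, inner_zero_left, sub_zero] at key
      linarith
    · intro x y t a1 a2 a3
      have := hin x y t a1 a2 ⟨a3.1, a3.2.le⟩
      simp only [D2, inner_zero_left, sub_zero]
      exact hL _ _ _ (by linarith) this.2.1 (by linarith) this.2.2.2
    · intro x y t a1 a2 a3
      have := hin x y t a1 a2.le ⟨a3.1, a3.2.le⟩
      simp only [D2, inner_zero_left, sub_zero]
      have h5 := hd x y t this.1 a2 this.2.2.1 this.2.2.2
      linarith
    · intro s hs hgap e he
      have hgap2 := hgapf s
      have hg1 := hgap1 s hs.1.le hs.2.le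
      have hg3 : θ * s ≤ θ * κ := by have := hs.2; gcongr
      have hp := hp1 s hs.1.le hs.2.le
      have hs0 := hs.1
      rw [hgap2]
      set N := (M - θ) + θ * A * (κ - 2 * s) with hN
      have hN0 : 0 < N := by linarith
      have hn : ‖(0 : E) + N • e‖ = N := by
        rw [zero_add, norm_smul, he, mul_one, Real.norm_eq_abs, abs_of_pos hN0]
      rw [hn]
      have hg0 : 0 ≤ θ * s * (1 / 2 + A * s) := by positivity
      refine ⟨?_, ?_, ?_⟩
      · rw [← norm_pos_iff, hn]; exact hN0
      · have a1 : 64 * (θ * κ) * (θ * s * (1 / 2 + A * s)) ≤ 64 * (θ * κ) * (θ * κ) :=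
          mul_le_mul_of_nonneg_left (by linarith) (by positivity)
        have a2 : 8 * (θ * κ) ≤ ν0 * N := by
          calc 8 * (θ * κ) = 4 * κ * (2 * θ) := by ring
            _ ≤ ν0 * N := by gcongr; linarith
        have a3 : (8 * (θ * κ)) ^ 2 ≤ (ν0 * N) ^ 2 := by gcongr
        nlinarith only [a1, a3]
      · have t1 : N / s * (64 * (θ * κ) * (θ * s * (1 / 2 + A * s)) / N ^ 2) ≤ 32 * θ * κ := by
          calc N / s * (64 * (θ * κ) * (θ * s * (1 / 2 + A * s)) / N ^ 2) ≤ N / s * (64 * (θ * κ) * (θ * s) / N ^ 2) := by gcongr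
            _ = 64 * θ * κ * (θ / N) := by field_simp
            _ ≤ 64 * θ * κ * (1 / 2) := by
              have : θ / N ≤ 1 / 2 := by rw [div_le_div_iff₀ hN0 (by norm_num)]; linarith
              gcongr
            _ = _ := by ring
        have t2 : C2 * (N / s * (64 * (θ * κ) * (θ * s * (1 / 2 + A * s)) / N ^ 2) + 16 * (θ * κ)) ≤ c1 * (θ * A) := by
          calc _ ≤ C2 * (32 * θ * κ + 16 * (θ * κ)) := by gcongr
            _ = θ * (96 * C2 * κ ^ 2) * A := by
              have : θ * (96 * C2 * κ ^ 2) * A = θ * (96 * C2 * κ) * (A * κ) := by ring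
              rw [this, hAκ]; ring
            _ ≤ θ * c1 * A := by gcongr
            _ = _ := by ring
        have t3 : c1 * -(2 * (θ * A)) + C2 * (N / s * (64 * (θ * κ) * (θ * s * (1 / 2 + A * s)) / N ^ 2) + 16 * (θ * κ)) ≤ - (c1 * θ / (2 * κ)) := by
          have : c1 * θ / (2 * κ) = c1 * (θ * A) := by rw [hA]; field_simp
          rw [this]; linarith
        have t6 : M ^ γ ≤ N ^ γ := Real.rpow_le_rpow_of_nonpos hN0 hp.2 hγ0.le
        have t7 : 0 < N ^ γ := Real.rpow_pos_of_pos hN0 γ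
        have t8 := mul_le_mul_of_nonneg_left t3 t7.le
        have t9 : M ^ γ * (c1 * θ / (2 * κ)) ≤ N ^ γ * (c1 * θ / (2 * κ)) := by gcongr
        linarith
  intro x y t hx hy ht ht0
  exact chain (f := fun x => u (x, t)) (convex_ball (0 : E) (1 / 4)) (M := M - θ / 2) (κ := κ) hκ
    (fun x hx y hy hxy => hloc x y t (by simpa using hx) ht ht0 hxy) x (by simpa using hx) y (by simpa using hy)

theorem opB_scale (γ p : ℝ) {q : E} (hq : q ≠ 0) (A : E →L[ℝ] E →L[ℝ] ℝ) {a b : ℝ} (ha : 0 < a) :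
    opB γ p (a • q) (b • A) = a ^ γ * b * opB γ p q A := by
  have hn : 0 < ‖q‖ := norm_pos_iff.2 hq
  have h1 : trB (b • A) = b * trB A := by
    simp [trB, Finset.mul_sum]
  rw [opB, opB, h1, norm_smul, Real.norm_eq_abs, abs_of_pos ha, Real.mul_rpow ha.le hn.le]
  simp only [_root_.smul_apply, map_smul, smul_eq_mul]
  field_simp

/-- affine change of variables -/
def aff (z0 : E × ℝ) (r s : ℝ) (z : E × ℝ) : E × ℝ := (z0.1 + r • z.1, z0.2 + s * z.2)

theorem scale_sub {γ p ε : ℝ} {u : E × ℝ → ℝ} {Ω Ω' : Set (E × ℝ)} (hu : VisSub γ p ε u Ω) (z0 : E × ℝ)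
    {c r s : ℝ} (hc : 0 < c) (hr : 0 < r) (hs : s = r ^ 2 * (c * r) ^ γ)
    (hΩ : ∀ z ∈ Ω', aff z0 r s z ∈ Ω) : VisSub γ p (c * s * ε) (fun z => c * u (aff z0 r s z)) Ω' := by
  have hs0 : 0 < s := by rw [hs]; positivity
  constructor
  · intro z hz q θ A hq hJ
    have hJ' : TJet u (aff z0 r s z) ((1 / (c * r)) • q) (θ / (c * s)) ((1 / (c * r ^ 2)) • A) := by
      intro e he
      obtain ⟨C, hC⟩ := hJ (e * (c * r ^ 2)) (by positivity)
      refine ⟨C / (c * s ^ 2), ?_⟩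
      have ht : Filter.Tendsto (fun w : E × ℝ => ((1 / r) • w.1, w.2 / s)) (nhds 0) (nhds 0) := by
        have : Continuous (fun w : E × ℝ => ((1 / r) • w.1, w.2 / s)) := by fun_prop
        have := this.tendsto 0
        have e0 : (((1 / r) • (0 : E × ℝ).1, (0 : E × ℝ).2 / s) : E × ℝ) = 0 := by simp
        rwa [e0] at this
      filter_upwards [ht.eventually hC] with w hw
      have e1 : aff z0 r s (z + ((1 / r) • w.1, w.2 / s)) = aff z0 r s z + w := by
        simp only [aff]
        refine Prod.ext ?_ ?_
        · simp [smul_smul, mul_inv_cancel₀ hr.ne', add_assoc]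
        · simp only [Prod.snd_add]; field_simp; ring
      rw [e1] at hw
      simp only [inner_smul_right, map_smul, _root_.smul_apply, smul_eq_mul, norm_smul, Real.norm_eq_abs,
        abs_of_pos (show 0 < 1 / r by positivity)] at hw
      simp only [inner_smul_left, RCLike.conj_to_real, _root_.smul_apply, smul_eq_mul]
      have h2 : u (aff z0 r s z + w) ≤ (c * u (aff z0 r s z) + 1 / r * ⟪q, w.1⟫ + θ * (w.2 / s) + 1 / r * (1 / r * A w.1 w.1)
          + e * (c * r ^ 2) * (1 / r * ‖w.1‖) ^ 2 + C * (w.2 / s) ^ 2) / c := by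
        rw [le_div_iff₀ hc]; linarith
      refine h2.trans (le_of_eq ?_)
      field_simp
    have := hu.jet _ (hΩ z hz) _ _ _ (smul_ne_zero (by positivity) hq) hJ'
    rw [opB_scale γ p hq A (by positivity)] at this
    have e : (1 / (c * r)) ^ γ * (1 / (c * r ^ 2)) = 1 / (c * s) := by
      rw [Real.div_rpow zero_le_one (by positivity), Real.one_rpow, hs]
      have : 0 < (c * r) ^ γ := by positivity
      field_simp
    rw [e, div_le_iff₀ (by positivity)] at this
    refine this.trans (le_of_eq ?_)
    field_simp
  · intro z hz δ hδ φ hφ hφ0 ⟨R, hR, hx⟩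
    set T := (aff z0 r s z).2 with hT
    have hTe : T = z0.2 + s * z.2 := rfl
    have hmap : ∀ t ∈ Ioo (T - s * δ) (T + s * δ), (t - z0.2) / s ∈ Ioo (z.2 - δ) (z.2 + δ) := by
      intro t ht
      rw [hTe] at ht
      constructor
      · rw [lt_div_iff₀ hs0]; linarith [ht.1]
      · rw [div_lt_iff₀ hs0]; linarith [ht.2]
    have hTz : (T - z0.2) / s = z.2 := by rw [hTe]; field_simp; ring
    have hd := hu.loc _ (hΩ z hz) (s * δ) (by positivity) (fun t => φ ((t - z0.2) / s) / c) ?_ ?_ ⟨r * R, by positivity, ?_⟩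
    · have h1 : DifferentiableAt ℝ φ z.2 := by
        have := (hφ.differentiableOn (by norm_num)).differentiableAt (Ioo_mem_nhds (a := z.2 - δ) (b := z.2 + δ) (x := z.2) (by linarith) (by linarith))
        exact this
      have h2 : HasDerivAt (fun t => (t - z0.2) / s) (1 / s) T := ((hasDerivAt_id T).sub_const _).div_const s
      have h3 : HasDerivAt (fun t => φ ((t - z0.2) / s) / c) (deriv φ z.2 * (1 / s) / c) T := by
        have h4 : HasDerivAt φ (deriv φ z.2) ((T - z0.2) / s) := by rw [hTz]; exact h1.hasDerivAt
        exact (h4.comp T h2).div_const c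
      rw [h3.deriv] at hd
      have : deriv φ z.2 * (1 / s) / c = deriv φ z.2 / (c * s) := by field_simp
      rw [this, div_le_iff₀ (by positivity)] at hd
      linarith
    · refine ContDiffOn.div_const ?_ c
      exact hφ.comp (by fun_prop) (fun t ht => hmap t ht)
    · show φ ((T - z0.2) / s) / c = 0
      rw [hTz, hφ0, zero_div]
    · intro x hxx
      set x' := (1 / r) • (x - z0.1) with hx'
      have ex : z0.1 + r • x' = x := by
        rw [hx', smul_smul, mul_one_div_cancel hr.ne', one_smul]; abel
      have e1 : x - (aff z0 r s z).1 = r • (x' - z.1) := by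
        rw [aff, ← ex]; module
      have e2 : ‖x' - z.1‖ < R := by
        rw [e1, norm_smul, Real.norm_eq_abs, abs_of_pos hr] at hxx
        exact lt_of_mul_lt_mul_left hxx hr.le
      obtain ⟨g1, t, g2, g3⟩ := hx x' e2
      have ea : ∀ t, aff z0 r s (x', t) = (x, z0.2 + s * t) := fun t => by simp only [aff, ex]
      constructor
      · intro t ht
        have := g1 _ (hmap t ht)
        rw [ea, mul_div_cancel₀ _ hs0.ne', add_sub_cancel] at this
        have h2 : u (x, t) ≤ (φ ((t - z0.2) / s) + c * u (aff z0 r s z)) / c := by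
          rw [le_div_iff₀ hc]; linarith
        rw [add_div, mul_div_cancel_left₀ _ hc.ne'] at h2
        linarith
      · refine ⟨z0.2 + s * t, ?_, ?_⟩
        · constructor
          · show T - s * δ < _
            rw [hTe]; nlinarith [g2.1]
          · show _ < T + s * δ
            rw [hTe]; nlinarith [g2.2]
        · rw [ea] at g3
          have : (z0.2 + s * t - z0.2) / s = t := by field_simp; ring
          rw [this]
          have h2 : u (x, z0.2 + s * t) = (φ t + c * u (aff z0 r s z)) / c := by
            rw [eq_div_iff hc.ne']; linarith
          rw [h2]; field_simp; ring

theorem scale {γ p ε : ℝ} {u : E × ℝ → ℝ} {Ω Ω' : Set (E × ℝ)} (hu : VisS γ p ε u Ω) (z0 : E × ℝ)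
    {c r s : ℝ} (hc : 0 < c) (hr : 0 < r) (hs : s = r ^ 2 * (c * r) ^ γ) (ho : IsOpen Ω')
    (hΩ : ∀ z ∈ Ω', aff z0 r s z ∈ Ω) : VisS γ p (c * s * ε) (fun z => c * u (aff z0 r s z)) Ω' := by
  refine ⟨ho, ?_, scale_sub hu.sub z0 hc hr hs hΩ, ?_⟩
  · refine continuousOn_const.mul (hu.cont.comp ?_ hΩ)
    unfold aff; fun_prop
  · have := scale_sub hu.sup z0 hc hr hs hΩ
    simpa using this

/-- gradient preserving scaling -/
theorem scaleL {γ p ε : ℝ} {u : E × ℝ → ℝ} {Ω Ω' : Set (E × ℝ)} (hu : VisS γ p ε u Ω) (z0 : E × ℝ)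
    {r : ℝ} (hr : 0 < r) (ho : IsOpen Ω')
    (hΩ : ∀ z ∈ Ω', aff z0 r (r ^ 2) z ∈ Ω) : VisS γ p (r * ε) (fun z => (1 / r) * u (aff z0 r (r ^ 2) z)) Ω' := by
  have := scale hu z0 (c := 1 / r) (r := r) (s := r ^ 2) (by positivity) hr (by
    rw [one_div_mul_cancel hr.ne', Real.one_rpow, mul_one]) ho hΩ
  have e : 1 / r * r ^ 2 * ε = r * ε := by field_simp
  rwa [e] at this

end LG4

section LG5
variable {E : Type*} [NormedAddCommGroup E] [InnerProductSpace ℝ E] [FiniteDimensional ℝ E]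

set_option maxHeartbeats 1000000 in
theorem lip_est {γ p c1 C2 ν0 : ℝ} (hγ : -1 < γ) (hγ0 : γ < 0)
    (hc1 : 0 < c1) (hC2 : 0 < C2) (hν0 : 0 < ν0) (hM : Mst E γ p c1 C2 ν0) :
    ∃ L ≥ 1, ∀ {u : E × ℝ → ℝ}, VisS γ p 1 u (Cyl E 1 1) →
      (∀ z ∈ Cyl E 1 1, ∀ w ∈ Cyl E 1 1, u z - u w ≤ 5) → SpL u L (1 / 4) (1 / 8) := by
  obtain ⟨K0, hK0, hH⟩ := holder_est (E := E) hγ hγ0 hc1 hC2 hν0 hM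
  set ω := 2 * K0 + 1 with hω
  have hω1 : 1 ≤ ω := by linarith
  set K := 6 + 16 / ν0 + 4096 * C2 / c1 + (16 + 32 * ω) / c1 with hK
  have k1 : 0 < 16 / ν0 := by positivity
  have k2 : 0 < 4096 * C2 / c1 := by positivity
  have k3 : 0 < (16 + 32 * ω) / c1 := by positivity
  have hK6 : 6 ≤ K := by linarith
  have hωK : 1 ≤ ω * K := by nlinarith only [hω1, hK6]
  have hν : 16 ≤ ν0 * K := by
    have : ν0 * (16 / ν0) = 16 := by field_simp
    have h2 : 16 / ν0 ≤ K := by linarith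
    nlinarith only [this, h2, hν0]
  have hC : 4096 * C2 ≤ c1 * K := by
    have : c1 * (4096 * C2 / c1) = 4096 * C2 := by field_simp
    have h2 : 4096 * C2 / c1 ≤ K := by linarith
    nlinarith only [this, h2, hc1]
  have hC' : 4096 * C2 ≤ c1 * K ^ 2 := by nlinarith only [hC, hK6, hc1, hC2]
  refine ⟨ω * K, hωK, ?_⟩
  intro u hu hosc
  have hv := scaleL hu (0 : E × ℝ) (r := 1 / 2) (by norm_num) (Cyl_open (E := E) 1 1) (by
    rintro z ⟨h1, h2, h3⟩
    refine ⟨?_, ?_, ?_⟩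
    · simp only [aff, Prod.fst_zero, zero_add, norm_smul, Real.norm_eq_abs]
      rw [abs_of_pos (by norm_num)]; linarith
    · simp only [aff, Prod.snd_zero]; linarith
    · simp only [aff, Prod.snd_zero]; linarith)
  have key := lip_gen hγ0 hc1 hC2 hν0 hM (ε := 1 / 2 * 1) (ω := ω) (K := K) (μ := ω * K / 2) (Λ := ω * K)
    (by linarith) hK6 (by positivity) 0 (by
      intro s h1 h2 e he
      have hs : 0 ≤ s := by linarith
      rw [zero_add, norm_smul, he, mul_one, Real.norm_eq_abs, abs_of_nonneg hs]
      exact ⟨h1, h2⟩) (by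
      have : 16 * ω ≤ ν0 * (ω * K) := by nlinarith only [hν, hω1]
      have h2 : (16 * ω) ^ 2 ≤ (ν0 * (ω * K)) ^ 2 := by gcongr
      nlinarith only [h2]) (by
      have : ω ^ 2 * (4096 * C2) ≤ ω ^ 2 * (c1 * K ^ 2) := by gcongr
      nlinarith only [this]) (by linarith) (by
      have h1 : (ω * K) ^ (-1 : ℝ) ≤ (ω * K) ^ γ := Real.rpow_le_rpow_of_exponent_le hωK hγ.le
      rw [Real.rpow_neg_one] at h1
      have h2 : (ω * K)⁻¹ * (c1 * ω * K ^ 2 / 8) ≤ (ω * K) ^ γ * (c1 * ω * K ^ 2 / 8) := by gcongr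
      have h3 : (ω * K)⁻¹ * (c1 * ω * K ^ 2 / 8) = c1 * K / 8 := by field_simp
      have h4 : 16 + 32 * ω < c1 * K := by
        have e1 : c1 * ((16 + 32 * ω) / c1) = 16 + 32 * ω := by field_simp
        have h2 : (16 + 32 * ω) / c1 < K := by linarith
        nlinarith only [e1, h2, hc1]
      linarith) hv (by
      intro x y t hx hy ht ht0
      simp only [aff, Prod.fst_zero, Prod.snd_zero, zero_add, inner_zero_left, sub_zero]
      have := hH hu hosc ((1 / 2 : ℝ) • x) ((1 / 2 : ℝ) • y) ((1 / 2) ^ 2 * t)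
        (by rw [norm_smul, Real.norm_eq_abs, abs_of_pos (by norm_num)]; linarith)
        (by rw [norm_smul, Real.norm_eq_abs, abs_of_pos (by norm_num)]; linarith)
        (by linarith) (by linarith)
      have e1 : √‖(1 / 2 : ℝ) • x - (1 / 2 : ℝ) • y‖ ≤ √‖x - y‖ := by
        apply Real.sqrt_le_sqrt
        rw [← smul_sub, norm_smul, Real.norm_eq_abs, abs_of_pos (by norm_num)]
        linarith [norm_nonneg (x - y)]
      have e2 : K0 * √‖(1 / 2 : ℝ) • x - (1 / 2 : ℝ) • y‖ ≤ K0 * √‖x - y‖ := by gcongr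
      have e3 := Real.sqrt_nonneg ‖x - y‖
      rw [hω]
      linarith)
  intro x y t hx hy ht ht0
  have := key ((2 : ℝ) • x) ((2 : ℝ) • y) (4 * t)
    (by rw [norm_smul, Real.norm_eq_abs, abs_of_pos (by norm_num)]; linarith)
    (by rw [norm_smul, Real.norm_eq_abs, abs_of_pos (by norm_num)]; linarith)
    (by linarith) (by linarith)
  simp only [aff, Prod.fst_zero, Prod.snd_zero, zero_add, inner_zero_left, sub_zero, smul_smul, ← smul_sub] at this
  rw [norm_smul] at this
  norm_num at this
  have e1 : 1 / 4 * (4 * t) = t := by ring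
  rw [e1] at this
  linarith

set_option maxHeartbeats 1000000 in
theorem lip_flat {γ p c1 C2 ν0 : ℝ} (hγ : -1 < γ) (hγ0 : γ < 0)
    (hc1 : 0 < c1) (hC2 : 0 < C2) (hν0 : 0 < ν0) (hM : Mst E γ p c1 C2 ν0)
    {m0 m1 L : ℝ} (hm0 : 0 < m0) (hm1 : 0 < m1) (hL : m0 ≤ L) :
    ∃ ε > 0, ∀ {u : E × ℝ → ℝ} {l : E}, VisS γ p ε u (Cyl E 1 1) → SpL u L 1 1 → m0 ≤ ‖l‖ → ‖l‖ ≤ L →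
      (∀ x y t, ‖x‖ < 1 → ‖y‖ < 1 → -1 < t → t < 0 → u (x, t) - u (y, t) - ⟪l, x - y⟫ ≤ ε) →
      ∀ x y t, ‖x‖ < 1 / 2 → ‖y‖ < 1 / 2 → -(1 / 2) < t → t < 0 →
        u (x, t) - u (y, t) - ⟪l, x - y⟫ ≤ m1 * ‖x - y‖ := by
  have hL0 : 0 < L := by linarith
  have hΛ : 0 < (2 * L) ^ γ := by positivity
  set K := 6 + 512 * C2 / c1 + 56 / (c1 * (2 * L) ^ γ) with hK
  have k2 : 0 < 512 * C2 / c1 := by positivity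
  have k3 : 0 < 56 / (c1 * (2 * L) ^ γ) := by positivity
  have hK6 : 6 ≤ K := by linarith
  have hK0 : 0 < K := by linarith
  have hC : 512 * C2 ≤ c1 * K := by
    have : c1 * (512 * C2 / c1) = 512 * C2 := by field_simp
    have h2 : 512 * C2 / c1 ≤ K := by linarith
    nlinarith only [this, h2, hc1]
  have hC' : 512 * C2 ≤ c1 * K ^ 2 := by nlinarith only [hC, hK6, hc1, hC2]
  have hD : 56 ≤ c1 * (2 * L) ^ γ * K := by
    have : c1 * (2 * L) ^ γ * (56 / (c1 * (2 * L) ^ γ)) = 56 := by field_simp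
    have h2 : 56 / (c1 * (2 * L) ^ γ) ≤ K := by linarith
    have h3 : 0 < c1 * (2 * L) ^ γ := by positivity
    nlinarith only [this, h2, h3]
  have hD' : 56 ≤ c1 * (2 * L) ^ γ * K ^ 2 := by
    have : c1 * (2 * L) ^ γ * K ≤ c1 * (2 * L) ^ γ * K ^ 2 := by
      gcongr; nlinarith only [hK6]
    linarith
  -- choose ω
  obtain ⟨ω, hω, w1, w2, w3, w4⟩ : ∃ ω > 0, ω * K ≤ m1 ∧ ω * K ≤ m0 / 2 ∧ 64 * ω ^ 2 ≤ ν0 ^ 2 * (m0 / 2) ^ 2 ∧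
      1024 * C2 * ω ^ 2 ≤ c1 * (m0 / 2) ^ 2 := by
    have hX : 0 < c1 * (m0 / 2) ^ 2 / (1024 * C2) := by positivity
    refine ⟨min (min (m1 / K) (m0 / 2 / K)) (min (ν0 * (m0 / 2) / 8) √(c1 * (m0 / 2) ^ 2 / (1024 * C2))), ?_, ?_, ?_, ?_, ?_⟩
    · have := Real.sqrt_pos.2 hX
      refine lt_min (lt_min ?_ ?_) (lt_min ?_ this) <;> positivity
    · have : min (min (m1 / K) (m0 / 2 / K)) (min (ν0 * (m0 / 2) / 8) √(c1 * (m0 / 2) ^ 2 / (1024 * C2))) ≤ m1 / K :=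
        (min_le_left _ _).trans (min_le_left _ _)
      rwa [le_div_iff₀ hK0] at this
    · have : min (min (m1 / K) (m0 / 2 / K)) (min (ν0 * (m0 / 2) / 8) √(c1 * (m0 / 2) ^ 2 / (1024 * C2))) ≤ m0 / 2 / K :=
        (min_le_left _ _).trans (min_le_right _ _)
      rwa [le_div_iff₀ hK0] at this
    · have : min (min (m1 / K) (m0 / 2 / K)) (min (ν0 * (m0 / 2) / 8) √(c1 * (m0 / 2) ^ 2 / (1024 * C2))) ≤ ν0 * (m0 / 2) / 8 :=
        (min_le_right _ _).trans (min_le_left _ _)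
      have h2 := pow_le_pow_left₀ (le_min (le_min (by positivity) (by positivity)) (le_min (by positivity) (by positivity))) this 2
      linarith
    · have : min (min (m1 / K) (m0 / 2 / K)) (min (ν0 * (m0 / 2) / 8) √(c1 * (m0 / 2) ^ 2 / (1024 * C2))) ≤ √(c1 * (m0 / 2) ^ 2 / (1024 * C2)) :=
        (min_le_right _ _).trans (min_le_right _ _)
      have h2 := pow_le_pow_left₀ (le_min (le_min (by positivity) (by positivity)) (le_min (by positivity) (by positivity))) this 2
      rw [Real.sq_sqrt hX.le, le_div_iff₀ (by positivity)] at h2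
      linarith
  refine ⟨min ω (ω ^ 2 / (2 * L)), lt_min hω (by positivity), ?_⟩
  intro u l hu hLip hl0 hl1 hflat
  have key := lip_gen hγ0 hc1 hC2 hν0 hM (ε := min ω (ω ^ 2 / (2 * L))) (ω := ω) (K := K) (μ := m0 / 2) (Λ := 2 * L)
    hω hK6 (by positivity) l (by
      intro s h1 h2 e he
      have hs : 0 ≤ s := by
        have : 0 < ω * K := by positivity
        linarith
      have hn : ‖s • e‖ = s := by rw [norm_smul, he, mul_one, Real.norm_eq_abs, abs_of_nonneg hs]
      have a1 := norm_add_le l (s • e)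
      have a2 := norm_sub_le (l + s • e) (s • e)
      rw [add_sub_cancel_right] at a2
      rw [hn] at a1 a2
      constructor <;> linarith) w3 w4 hC' (by
      have := min_le_left ω (ω ^ 2 / (2 * L))
      have h2 : ω * 56 ≤ ω * (c1 * (2 * L) ^ γ * K ^ 2) := by gcongr
      have h3 : (2 * L) ^ γ * (c1 * ω * K ^ 2 / 8) = ω * (c1 * (2 * L) ^ γ * K ^ 2) / 8 := by ring
      rw [h3]; linarith) hu (by
      intro x y t hx hy ht ht0
      have h1 := hflat x y t hx hy ht ht0
      have h2 := hLip x y t hx hy ht ht0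
      have h3 : -⟪l, x - y⟫ ≤ L * ‖x - y‖ := by
        have := (abs_le.1 (abs_real_inner_le_norm l (x - y))).1
        have h4 : ‖l‖ * ‖x - y‖ ≤ L * ‖x - y‖ := by gcongr
        linarith
      set d := ‖x - y‖ with hd
      have hd0 : 0 ≤ d := norm_nonneg _
      set X := u (x, t) - u (y, t) - ⟪l, x - y⟫ with hX
      have h5 : X ≤ 2 * L * d := by linarith
      have h6 : X ≤ ω ^ 2 / (2 * L) := h1.trans (min_le_right _ _)
      by_cases hX0 : X ≤ 0
      · have : 0 ≤ ω * √d := by positivity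
        linarith
      push Not at hX0
      apply le_of_sq_le_sq ?_ (by positivity)
      rw [mul_pow, Real.sq_sqrt hd0]
      calc X ^ 2 = X * X := sq X
        _ ≤ (ω ^ 2 / (2 * L)) * (2 * L * d) := by gcongr
        _ = _ := by field_simp)
  intro x y t hx hy ht ht0
  have h1 := key x y t hx hy ht ht0
  have : ω * K * ‖x - y‖ ≤ m1 * ‖x - y‖ := by gcongr
  linarith

end LG5

section P6
variable {E : Type*} [NormedAddCommGroup E] [InnerProductSpace ℝ E] [FiniteDimensional ℝ E]

theorem J1 {γ p ε : ℝ} (hp : 1 < p) {u : E × ℝ → ℝ} {Ω : Set (E × ℝ)} (hu : VisSub γ p ε u Ω) {z : E × ℝ} (hz : z ∈ Ω)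
    {f : E × ℝ → ℝ} {l b : E × ℝ → ℝ} (hf : X2 f z l b) (hm : ∀ᶠ w in nhds z, u w - f w ≤ u z - f z)
    {q : E} {θ g : ℝ} (hq : q ≠ 0) {b1 : E → ℝ} (hl : ∀ w, l w = ⟪q, w.1⟫ + θ * w.2) (hb : ∀ w, b w = b1 w.1 + g * w.2 ^ 2)
    {D : ℝ} (hD : ∀ v, b1 v ≤ D * ‖v‖ ^ 2) (hD0 : 0 ≤ D) :
    θ ≤ ε + 2 * (Module.finrank ℝ E * (D * p)) * ‖q‖ ^ γ := by
  obtain ⟨L, B, h1, h2, h3⟩ := hf.jet hm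
  let A : E →L[ℝ] E →L[ℝ] ℝ := B.bilinearComp (ContinuousLinearMap.inl ℝ E ℝ) (ContinuousLinearMap.inl ℝ E ℝ)
  have hA : ∀ v, A v v = b1 v := by
    intro v
    have : A v v = B (v, 0) (v, 0) := rfl
    rw [this, h2, hb]; simp
  have hT : TJet u z q θ A := by
    intro e he
    refine ⟨g + e, ?_⟩
    filter_upwards [h3 e he] with w hw
    rw [h1, h2, hl, hb] at hw
    have : ‖w‖ ^ 2 ≤ ‖w.1‖ ^ 2 + w.2 ^ 2 := by
      rw [Prod.norm_def]
      rcases max_cases ‖w.1‖ ‖w.2‖ with h | h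
      · rw [h.1]; nlinarith [sq_nonneg w.2]
      · rw [h.1, Real.norm_eq_abs, sq_abs]; nlinarith [sq_nonneg ‖w.1‖]
    have h5 : e * ‖w‖ ^ 2 ≤ e * (‖w.1‖ ^ 2 + w.2 ^ 2) := by gcongr
    rw [hA]; linarith
  have := hu.jet z hz q θ A hq hT
  rw [opB_eq hp hq A (stdOrthonormalBasis ℝ E)] at this
  have h5 : ∑ i, A (sig γ p q (stdOrthonormalBasis ℝ E i)) (sig γ p q (stdOrthonormalBasis ℝ E i))
      ≤ ∑ i : Fin (Module.finrank ℝ E), D * (p * ‖q‖ ^ γ) := by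
    apply Finset.sum_le_sum
    intro i _
    rw [hA]
    refine (hD _).trans ?_
    have := sig_upper (γ := γ) hp hq (stdOrthonormalBasis ℝ E i)
    rw [(stdOrthonormalBasis ℝ E).norm_eq_one i, one_pow, mul_one] at this
    gcongr
  rw [Finset.sum_const, Finset.card_univ, Fintype.card_fin, nsmul_eq_mul] at h5
  linarith

theorem X2_time {G G' : ℝ → ℝ} {G2 : ℝ} {z : E × ℝ} (hG : ∀ t, HasDerivAt G (G' t) t) (hG2 : HasDerivAt G' G2 z.2) :
    X2 (fun w : E × ℝ => G w.2) z (fun w => G' z.2 * w.2) (fun w => G2 / 2 * w.2 ^ 2) := by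
  have h := (X2.lin (ContinuousLinearMap.snd ℝ E ℝ) z).comp (F := G) (a := G' z.2) (c := G2 / 2)
    (S2.of_deriv (Filter.Eventually.of_forall hG) hG2)
  exact h.congr (fun x => rfl) (fun w => rfl) (fun w => by simp)

/-- constancy from superlinear modulus -/
theorem const_of_super {f : E → ℝ} {B : Set E} (hB : Convex ℝ B) {c β : ℝ} (hc : 0 < c) (hβ : 1 < β)
    (h : ∀ x ∈ B, ∀ y ∈ B, ‖x - y‖ ≤ 1 / 2 → f x - f y ≤ c * ‖x - y‖ ^ β) : ∀ x ∈ B, ∀ y ∈ B, f x ≤ f y := by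
  intro x hx y hy
  have key : ∀ M > 0, f x - f y ≤ M * ‖x - y‖ := by
    intro M hM
    have hb : 0 < β - 1 := by linarith
    refine chain hB (M := M) (κ := min (1 / 2) ((M / c) ^ (1 / (β - 1)))) (lt_min (by norm_num) (by positivity)) ?_ x hx y hy
    intro a ha b hb' hab
    have h1 := h a ha b hb' (hab.trans (min_le_left _ _))
    refine h1.trans ?_
    rcases eq_or_lt_of_le (norm_nonneg (a - b)) with h0 | h0
    · rw [← h0, Real.zero_rpow (by linarith)]; simp
    have h2 : ‖a - b‖ ^ (β - 1) ≤ M / c := by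
      have := Real.rpow_le_rpow h0.le (hab.trans (min_le_right _ _)) hb.le
      rw [← Real.rpow_mul (by positivity), one_div_mul_cancel hb.ne', Real.rpow_one] at this
      exact this
    have h3 : ‖a - b‖ ^ β = ‖a - b‖ ^ (β - 1) * ‖a - b‖ := by
      rw [← Real.rpow_add_one h0.ne']; ring_nf
    rw [h3, ← mul_assoc]
    rw [le_div_iff₀ hc] at h2
    gcongr; linarith
  by_contra hcon
  push Not at hcon
  have h1 := key ((f x - f y) / (2 * (‖x - y‖ + 1))) (by have := norm_nonneg (x - y); apply div_pos <;> linarith)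
  have h2 : (f x - f y) / (2 * (‖x - y‖ + 1)) * ‖x - y‖ ≤ (f x - f y) / 2 := by
    have h0 := norm_nonneg (x - y)
    rw [div_mul_eq_mul_div, div_le_div_iff₀ (by linarith) (by norm_num)]
    nlinarith
  linarith

theorem X2_pow (y : E) {z : E × ℝ} (hz : z.1 ≠ y) (c β : ℝ) (hβ : 2 ≤ β) (hc : 0 < c) :
    ∃ b1 : E → ℝ, X2 (fun w : E × ℝ => c * (‖w.1 - y‖ ^ 2) ^ (β / 2)) z
      (fun w => ⟪(c * β * ‖z.1 - y‖ ^ (β - 2)) • (z.1 - y), w.1⟫) (fun w => b1 w.1) ∧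
      ∀ v, b1 v ≤ (c * β * (β - 1) / 2 * ‖z.1 - y‖ ^ (β - 2)) * ‖v‖ ^ 2 := by
  set s := ‖z.1 - y‖ ^ 2 with hs
  have hd : 0 < ‖z.1 - y‖ := norm_pos_iff.2 (sub_ne_zero.2 hz)
  have hs0 : 0 < s := by positivity
  have hp : ∀ e : ℝ, s ^ e = ‖z.1 - y‖ ^ (2 * e) := by
    intro e
    rw [hs, ← Real.rpow_natCast, ← Real.rpow_mul hd.le]; norm_num
  have hS : S2 (fun s => c * s ^ (β / 2)) s (c * (β / 2 * s ^ (β / 2 - 1))) (c * (β / 2 * ((β / 2 - 1) * s ^ (β / 2 - 1 - 1))) / 2) := by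
    refine S2.of_deriv (F' := fun s => c * (β / 2 * s ^ (β / 2 - 1))) ?_ ?_
    · filter_upwards [lt_mem_nhds hs0] with x hx
      exact (Real.hasDerivAt_rpow_const (Or.inl hx.ne')).const_mul c
    · exact ((Real.hasDerivAt_rpow_const (Or.inl hs0.ne')).const_mul _).const_mul c
  have h1 := (X2.normSq (ContinuousLinearMap.fst ℝ E ℝ) y z).comp hS
  have e1 : s ^ (β / 2 - 1) = ‖z.1 - y‖ ^ (β - 2) := by rw [hp]; ring_nf
  have e2 : s ^ (β / 2 - 1 - 1) * s = ‖z.1 - y‖ ^ (β - 2) := by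
    rw [← Real.rpow_add_one hs0.ne', hp]; ring_nf
  set P := ‖z.1 - y‖ ^ (β - 2) with hP
  have hP0 : 0 < P := by positivity
  rw [e1] at h1
  refine ⟨fun v => c * (β / 2 * P) * ‖v‖ ^ 2 +
      c * (β / 2 * ((β / 2 - 1) * s ^ (β / 2 - 1 - 1))) / 2 * (2 * ⟪z.1 - y, v⟫) ^ 2, ?_, ?_⟩
  · refine h1.congr (fun x => rfl) (fun w => ?_) (fun w => rfl)
    rw [inner_smul_left, RCLike.conj_to_real]
    simp only [ContinuousLinearMap.coe_fst']; ring
  · intro v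
    have hcs : ⟪z.1 - y, v⟫ ^ 2 ≤ s * ‖v‖ ^ 2 := by
      have := abs_real_inner_le_norm (z.1 - y) v
      rw [hs, ← mul_pow, ← sq_abs]
      gcongr
    have hQ : 0 ≤ c * (β / 2 * ((β / 2 - 1) * s ^ (β / 2 - 1 - 1))) := by
      have : 0 ≤ β / 2 - 1 := by linarith
      positivity
    have h3 : c * (β / 2 * ((β / 2 - 1) * s ^ (β / 2 - 1 - 1))) * ⟪z.1 - y, v⟫ ^ 2
      ≤ c * (β / 2 * ((β / 2 - 1) * s ^ (β / 2 - 1 - 1))) * (s * ‖v‖ ^ 2) := by gcongr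
    have h4 : c * (β / 2 * ((β / 2 - 1) * s ^ (β / 2 - 1 - 1))) * (s * ‖v‖ ^ 2)
      = c * (β / 2 * (β / 2 - 1)) * ‖v‖ ^ 2 * P := by rw [← e2]; ring
    rw [h4] at h3
    nlinarith only [h3]

end P6

section P6b
variable {E : Type*} [NormedAddCommGroup E] [InnerProductSpace ℝ E] [FiniteDimensional ℝ E]

set_option maxHeartbeats 1000000 in
theorem timeA {γ p ε : ℝ} (hγ : -1 < γ) (hγ0 : γ < 0) (hp : 1 < p) {u : E × ℝ → ℝ} (hu : VisS γ p ε u (Cyl E 1 1))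
    {A : ℝ} (hA : 0 < A) (hL : SpL u A 1 1) {s0 T tb : ℝ} (hs0 : -1 < s0) (hT : T < 0) (htb : tb ∈ Ioo s0 T)
    {G G' G'' : ℝ → ℝ} (hG : ∀ t, HasDerivAt G (G' t) t) (hG' : ∀ t, HasDerivAt G' (G'' t) t)
    {β : ℝ} (hβ : β = (γ + 2) / (γ + 1))
    (hΛ : ∀ t ∈ Ioo s0 T, ε + Module.finrank ℝ E * p * (β - 1) * (2 ^ β * β * A) ^ (γ + 1) < G' t)
    {a : ℝ} (ha : 0 < a) (hmax : ∀ t ∈ Icc s0 T, u (0, t) - G t ≤ u (0, tb) - G tb - a * (t - tb) ^ 2)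
    (hs : u (0, s0) - G s0 ≤ u (0, tb) - G tb - 2 * A) (hTT : u (0, T) - G T ≤ u (0, tb) - G tb - 2 * A) : False := by
  have hg1 : 0 < γ + 1 := by linarith
  have hβe : (β - 1) * (γ + 1) = 1 := by rw [hβ]; field_simp; ring
  have hβ2 : 2 ≤ β := by rw [hβ, le_div_iff₀ hg1]; linarith
  have hn0 : ‖(0 : E)‖ < 1 := by simp
  have hc : 0 < (2 : ℝ) ^ β * A := by positivity
  have hGc : Continuous G := continuous_iff_continuousAt.2 fun t => (hG t).continuousAt
  have hpos : 0 ≤ (Module.finrank ℝ E : ℝ) * p * (β - 1) * (2 ^ β * β * A) ^ (γ + 1) := by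
    have : 0 ≤ β - 1 := by linarith
    positivity
  have hmain : ∀ y : E, ‖y‖ < 1 / 4 → ∃ t ∈ Ioo s0 T, ∀ x s, ‖x - y‖ ≤ 1 / 2 → s ∈ Icc s0 T →
      u (x, s) - 2 ^ β * A * ‖x - y‖ ^ β - G s ≤ u (y, t) - G t := by
    intro y hy
    let K : Set (E × ℝ) := Metric.closedBall y (1 / 2) ×ˢ Icc s0 T
    have hKc : IsCompact K := (isCompact_closedBall _ _).prod isCompact_Icc
    have hbn : ∀ x : E, ‖x - y‖ ≤ 1 / 2 → ‖x‖ < 3 / 4 := by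
      intro x hx
      have := norm_add_le (x - y) y
      rw [sub_add_cancel] at this; linarith
    have hKs : K ⊆ Cyl E 1 1 := by
      rintro ⟨x, t⟩ ⟨h1, h2⟩
      rw [Metric.mem_closedBall, dist_eq_norm] at h1
      exact ⟨by have := hbn x h1; simp only; linarith, by have := h2.1; simp only at this ⊢; linarith,
        by have := h2.2; simp only at this ⊢; linarith⟩
    let F : E × ℝ → ℝ := fun w => 2 ^ β * A * (‖w.1 - y‖ ^ 2) ^ (β / 2) + G w.2
    have hpw : ∀ x : E, (‖x - y‖ ^ 2) ^ (β / 2) = ‖x - y‖ ^ β := by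
      intro x
      rw [← Real.rpow_natCast, ← Real.rpow_mul (norm_nonneg _)]; congr 1; push_cast; ring
    have hFc : Continuous F := by
      have : Continuous fun w : E × ℝ => (‖w.1 - y‖ ^ 2) ^ (β / 2) :=
        Continuous.rpow_const (by fun_prop) fun x => Or.inr (by linarith)
      exact (continuous_const.mul this).add (hGc.comp continuous_snd)
    have hytb : (y, tb) ∈ K := ⟨by simp, htb.1.le, htb.2.le⟩
    obtain ⟨⟨x, t⟩, hz, hzm⟩ := hKc.exists_isMaxOn ⟨_, hytb⟩ ((hu.cont.mono hKs).sub hFc.continuousOn)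
    have hM : ∀ x' t', ‖x' - y‖ ≤ 1 / 2 → t' ∈ Icc s0 T → u (x', t') - F (x', t') ≤ u (x, t) - F (x, t) := by
      intro x' t' h1 h2
      exact hzm (show (x', t') ∈ K from ⟨by rw [Metric.mem_closedBall, dist_eq_norm]; exact h1, h2⟩)
    have hx1 : ‖x - y‖ ≤ 1 / 2 := by have := hz.1; rwa [Metric.mem_closedBall, dist_eq_norm] at this
    have ht : t ∈ Icc s0 T := hz.2
    have hx3 := hbn x hx1
    have hFy : ∀ s, F (y, s) = G s := by
      intro s
      simp only [F]; rw [hpw, sub_self, norm_zero, Real.zero_rpow (by linarith)]; ring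
    have hFx : ∀ x s, F (x, s) = 2 ^ β * A * ‖x - y‖ ^ β + G s := by
      intro x s
      simp only [F]; rw [hpw]
    have hend : ∀ s, -1 < s → s < 0 → u (0, s) - G s ≤ u (0, tb) - G tb - 2 * A → u (x, s) - F (x, s) < u (y, tb) - F (y, tb) := by
      intro s h1 h2 h3
      have e1 := hL x 0 s (by linarith) hn0 h1 h2
      have e2 := hL 0 y tb hn0 (by linarith) (by linarith [htb.1]) (by linarith [htb.2])
      rw [hFy, hFx]
      rw [sub_zero] at e1
      rw [zero_sub, norm_neg] at e2
      have : 0 ≤ 2 ^ β * A * ‖x - y‖ ^ β := by positivity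
      nlinarith only [this, e1, e2, h3, hy, hx3, hA]
    have hMy := hM y tb (by simp) ⟨htb.1.le, htb.2.le⟩
    have ht1 : s0 < t := by
      rcases eq_or_lt_of_le ht.1 with h | h
      · exfalso
        have := hend s0 hs0 (by linarith [htb.1, htb.2]) hs
        rw [← h] at hMy; linarith
      · exact h
    have ht2 : t < T := by
      rcases eq_or_lt_of_le ht.2 with h | h
      · exfalso
        have := hend T (by linarith [htb.1, htb.2]) hT hTT
        rw [h] at hMy; linarith
      · exact h
    have hx2 : ‖x - y‖ < 1 / 2 := by
      rcases eq_or_lt_of_le hx1 with h | h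
      · exfalso
        have h1 := hM y t (by simp) ht
        have h2 := hL x y t (by linarith) (by linarith) (by linarith) (by linarith)
        rw [hFy, hFx, h] at h1
        rw [h] at h2
        have : (2 : ℝ) ^ β * A * (1 / 2) ^ β = A := by
          rw [mul_right_comm, ← Real.mul_rpow (by norm_num) (by norm_num)]; norm_num
        linarith
      · exact h
    by_cases hxy : x = y
    · refine ⟨t, ⟨ht1, ht2⟩, fun x' s h1 h2 => ?_⟩
      have := hM x' s h1 h2
      rw [hxy, hFy, hFx] at this
      linarith
    · exfalso
      have hd : 0 < ‖x - y‖ := norm_pos_iff.2 (sub_ne_zero.2 hxy)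
      obtain ⟨b1, hX, hb1⟩ := X2_pow (z := (x, t)) y hxy (2 ^ β * A) β hβ2 hc
      have hX2 := hX.add (X2_time (z := (x, t)) hG (hG' t))
      have hq : (2 ^ β * A * β * ‖x - y‖ ^ (β - 2)) • (x - y) ≠ 0 :=
        smul_ne_zero (by positivity) (sub_ne_zero.2 hxy)
      have hloc : ∀ᶠ w in nhds ((x, t) : E × ℝ), u w - F w ≤ u (x, t) - F (x, t) := by
        have ho : IsOpen (Metric.ball y (1 / 2) ×ˢ Ioo s0 T) := Metric.isOpen_ball.prod isOpen_Ioo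
        have hm : ((x, t) : E × ℝ) ∈ Metric.ball y (1 / 2) ×ˢ Ioo s0 T :=
          ⟨by rw [Metric.mem_ball, dist_eq_norm]; exact hx2, ht1, ht2⟩
        filter_upwards [ho.mem_nhds hm] with w hw
        have := hw.1
        rw [Metric.mem_ball, dist_eq_norm] at this
        exact hM w.1 w.2 this.le ⟨hw.2.1.le, hw.2.2.le⟩
      have hJ := J1 hp hu.sub (hKs hz) hX2 hloc hq (θ := G' t) (g := G'' t / 2) (b1 := b1)
        (fun w => rfl) (fun w => rfl) hb1 (by have : 0 ≤ β - 1 := by linarith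
                                              positivity)
      have hl := hΛ t ⟨ht1, ht2⟩
      rw [norm_smul, Real.norm_eq_abs, abs_of_pos (by positivity)] at hJ
      simp only at hJ
      set d := ‖x - y‖ with hdd
      have e1 : 2 ^ β * A * β * d ^ (β - 2) * d = (2 ^ β * β * A) * d ^ (β - 1) := by
        have : d ^ (β - 1) = d ^ (β - 2) * d := by rw [← Real.rpow_add_one hd.ne']; ring_nf
        rw [this]; ring
      have e2 : d ^ (β - 2) * (d ^ (β - 1)) ^ γ = 1 := by
        rw [← Real.rpow_mul hd.le, ← Real.rpow_add hd]
        rw [show β - 2 + (β - 1) * γ = 0 by linarith, Real.rpow_zero]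
      rw [e1, Real.mul_rpow (by positivity) (by positivity)] at hJ
      have e3 : (2 ^ β * β * A) ^ (γ + 1) = (2 ^ β * β * A) ^ γ * (2 ^ β * β * A) := Real.rpow_add_one (by positivity) _
      rw [e3] at hl
      have e4 : 2 * (↑(Module.finrank ℝ E) * (2 ^ β * A * β * (β - 1) / 2 * d ^ (β - 2) * p)) * ((2 ^ β * β * A) ^ γ * (d ^ (β - 1)) ^ γ)
        = ↑(Module.finrank ℝ E) * p * (β - 1) * ((2 ^ β * β * A) ^ γ * (2 ^ β * β * A)) * (d ^ (β - 2) * (d ^ (β - 1)) ^ γ) := by ring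
      rw [e4, e2] at hJ
      linarith
  choose! τ hτ1 hτ2 using hmain
  have hconst := const_of_super (f := fun y => u (y, τ y) - G (τ y)) (convex_ball (0 : E) (1 / 4)) hc (β := β) (by linarith) (by
    intro x hx y hy hxy
    rw [Metric.mem_ball, dist_zero_right] at hx hy
    have := hτ2 y hy x (τ x) hxy ⟨(hτ1 x hx).1.le, (hτ1 x hx).2.le⟩
    linarith)
  have hself : ∀ y : E, ‖y‖ < 1 / 4 → ∀ t ∈ Icc s0 T, u (y, t) - G t ≤ u (y, τ y) - G (τ y) := by
    intro y hy t ht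
    have := hτ2 y hy y t (by simp) ht
    rwa [sub_self, norm_zero, Real.zero_rpow (by linarith), mul_zero, sub_zero] at this
  have h00 : ‖(0 : E)‖ < 1 / 4 := by simp
  have hm0 : u (0, τ 0) - G (τ 0) = u (0, tb) - G tb := by
    apply le_antisymm
    · have := hmax (τ 0) ⟨(hτ1 0 h00).1.le, (hτ1 0 h00).2.le⟩
      have h2 : 0 ≤ a * (τ 0 - tb) ^ 2 := by positivity
      linarith
    · exact hself 0 h00 tb ⟨htb.1.le, htb.2.le⟩
  have hmy : ∀ y : E, ‖y‖ < 1 / 4 → u (y, τ y) - G (τ y) = u (0, tb) - G tb := by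
    intro y hy
    have hy' : y ∈ Metric.ball (0 : E) (1 / 4) := by rwa [Metric.mem_ball, dist_zero_right]
    have h0' : (0 : E) ∈ Metric.ball (0 : E) (1 / 4) := by rwa [Metric.mem_ball, dist_zero_right]
    rw [← hm0]
    exact le_antisymm (hconst y hy' 0 h0') (hconst 0 h0' y hy')
  set δ := min (tb - s0) (T - tb) with hδ
  have hδ0 : 0 < δ := lt_min (by linarith [htb.1]) (by linarith [htb.2])
  have hδ1 : δ ≤ tb - s0 := min_le_left _ _
  have hδ2 : δ ≤ T - tb := min_le_right _ _
  have hdG : deriv G = G' := funext fun t => (hG t).deriv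
  have hC1 : ContDiff ℝ 1 (fun t => G t - G tb) := by
    refine ContDiff.sub ?_ contDiff_const
    rw [contDiff_one_iff_deriv, hdG]
    exact ⟨fun t => (hG t).differentiableAt, continuous_iff_continuousAt.2 fun t => (hG' t).continuousAt⟩
  have hfin := hu.sub.loc (0, tb) ⟨by simp, by linarith [htb.1], by linarith [htb.2]⟩ δ hδ0 (fun t => G t - G tb) hC1.contDiffOn (by simp)
    ⟨min (1 / 4) (a * δ ^ 2 / A), lt_min (by norm_num) (by positivity), by
      intro x hx
      simp only [sub_zero] at hx
      have hx1 := hx.trans_le (min_le_left _ _)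
      have hx2 := hx.trans_le (min_le_right _ _)
      refine ⟨fun t ht => ?_, τ x, ?_, ?_⟩
      · have := hself x hx1 t ⟨by linarith [ht.1], by linarith [ht.2]⟩
        rw [hmy x hx1] at this; linarith
      · have h1 := hτ1 x hx1
        have h2 := hL x 0 (τ x) (by linarith) hn0 (by linarith [h1.1]) (by linarith [h1.2])
        have h3 := hmax (τ x) ⟨h1.1.le, h1.2.le⟩
        have h4 := hmy x hx1
        rw [sub_zero] at h2
        rw [lt_div_iff₀ hA] at hx2
        have h5 : a * (τ x - tb) ^ 2 < a * δ ^ 2 := by linarith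
        have h6 := abs_lt_of_sq_lt_sq (lt_of_mul_lt_mul_left h5 ha.le) hδ0.le
        rw [abs_lt] at h6
        exact ⟨by simp only; linarith [h6.1], by simp only; linarith [h6.2]⟩
      · have := hmy x hx1
        linarith⟩
  have hd : deriv (fun t => G t - G tb) tb = G' tb := ((hG tb).sub_const _).deriv
  simp only at hfin
  rw [hd] at hfin
  linarith [hΛ tb htb]
end P6b

theorem wall {D t1 T : ℝ} (hD : 0 < D) (h : t1 < T) (R : ℝ) : ∃ g g' g'' : ℝ → ℝ, (∀ t, HasDerivAt g (g' t) t) ∧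
    (∀ t, HasDerivAt g' (g'' t) t) ∧ (∀ t, 0 ≤ g t) ∧ (∀ t, 0 ≤ g' t) ∧ g t1 ≤ D ∧ R ≤ g T := by
  set N := |R| / (D * (T - t1)) with hN
  have hT : 0 < T - t1 := by linarith
  have hN0 : 0 ≤ N := by positivity
  have h0 : ∀ t, HasDerivAt (fun t => exp (N * (t - t1))) (exp (N * (t - t1)) * N) t := by
    intro t
    have := (((hasDerivAt_id t).sub_const t1).const_mul N).exp
    simpa using this
  refine ⟨fun t => D * exp (N * (t - t1)), fun t => D * (exp (N * (t - t1)) * N), fun t => D * (exp (N * (t - t1)) * N * N),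
    fun t => (h0 t).const_mul D, fun t => ((h0 t).mul_const N).const_mul D, fun t => by positivity, fun t => by positivity, by simp, ?_⟩
  have h1 := Real.add_one_le_exp (N * (T - t1))
  have h2 : D * (N * (T - t1)) = |R| := by rw [hN]; field_simp
  have h3 : D * (N * (T - t1) + 1) ≤ D * exp (N * (T - t1)) := by gcongr
  have h4 := le_abs_self R
  show R ≤ D * exp (N * (T - t1))
  linarith

section P6c
variable {E : Type*} [NormedAddCommGroup E] [InnerProductSpace ℝ E] [FiniteDimensional ℝ E]

theorem SpL.neg {u : E × ℝ → ℝ} {M r τ : ℝ} (h : SpL u M r τ) : SpL (fun z => -u z) M r τ := by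
  intro x y t h1 h2 h3 h4
  have := h y x t h2 h1 h3 h4
  rw [norm_sub_rev] at this
  simp only; linarith

theorem SpL.mono {u : E × ℝ → ℝ} {M r τ M' r' τ' : ℝ} (h : SpL u M r τ) (hM : M ≤ M') (hr : r' ≤ r) (hτ : τ' ≤ τ) :
    SpL u M' r' τ' := by
  intro x y t h1 h2 h3 h4
  have := h x y t (by linarith) (by linarith) (by linarith) h4
  have h5 : M * ‖x - y‖ ≤ M' * ‖x - y‖ := by gcongr
  linarith

theorem time0a {γ p ε : ℝ} (hγ : -1 < γ) (hγ0 : γ < 0) (hp : 1 < p) (hε : 0 ≤ ε) {u : E × ℝ → ℝ} (hu : VisS γ p ε u (Cyl E 1 1))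
    {A : ℝ} (hA : 0 < A) (hL : SpL u A 1 1) {β : ℝ} (hβ : β = (γ + 2) / (γ + 1)) {s0 t1 : ℝ} (hs0 : -1 < s0) (hst : s0 < t1) (ht1 : t1 < 0) :
    u (0, t1) - u (0, s0) ≤ 7 * A + ε + Module.finrank ℝ E * p * (β - 1) * (2 ^ β * β * A) ^ (γ + 1) := by
  by_contra hcon
  push Not at hcon
  have hg1 : 0 < γ + 1 := by linarith
  have hβ1 : 0 ≤ β - 1 := by rw [hβ, sub_nonneg, le_div_iff₀ hg1]; linarith
  have hP : 0 ≤ Module.finrank ℝ E * p * (β - 1) * (2 ^ β * β * A) ^ (γ + 1) := by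
    have : 0 ≤ β := by linarith
    positivity
  set P := Module.finrank ℝ E * p * (β - 1) * (2 ^ β * β * A) ^ (γ + 1) with hPd
  set Λ := ε + P + 3 * A with hΛ
  have hΛ0 : 0 < Λ := by positivity
  set D := u (0, t1) - u (0, s0) - 4 * A - Λ with hD
  have hD0 : 0 < D := by rw [hD, hΛ]; linarith
  obtain ⟨g, g', g'', d1, d2, g0, g1, g2, g3⟩ := wall hD0 (show t1 < t1 / 2 by linarith) (u (0, t1 / 2) - u (0, s0))
  set T := t1 / 2 with hT
  have hTt : t1 < T := by rw [hT]; linarith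
  have hT0 : T < 0 := by rw [hT]; linarith
  have hgc : Continuous g := continuous_iff_continuousAt.2 fun t => (d1 t).continuousAt
  have hcu : ContinuousOn (fun t => u ((0 : E), t) - Λ * (t - s0) - g t) (Icc s0 T) := by
    refine ContinuousOn.sub (ContinuousOn.sub (hu.cont.comp (f := fun t : ℝ => ((0 : E), t)) (by fun_prop) ?_) (by fun_prop)) hgc.continuousOn
    intro t ht
    exact ⟨by simp, by simp only; linarith [ht.1], by simp only; linarith [ht.2]⟩
  obtain ⟨tb, htb, hm⟩ := isCompact_Icc.exists_isMaxOn ⟨s0, le_rfl, by linarith⟩ hcu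
  have hm' : ∀ t ∈ Icc s0 T, u (0, t) - Λ * (t - s0) - g t ≤ u (0, tb) - Λ * (tb - s0) - g tb := fun t ht => hm ht
  have v1 := hm' t1 ⟨hst.le, hTt.le⟩
  have e1 : Λ * (t1 - s0) ≤ Λ * 1 := by gcongr; linarith
  have vs : u (0, s0) - Λ * (s0 - s0) - g s0 ≤ u (0, tb) - Λ * (tb - s0) - g tb - 4 * A := by
    have := g0 s0
    rw [sub_self, mul_zero]; linarith
  have vT : u (0, T) - Λ * (T - s0) - g T ≤ u (0, tb) - Λ * (tb - s0) - g tb - 4 * A := by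
    have : 0 ≤ Λ * (T - s0) := mul_nonneg hΛ0.le (by linarith)
    linarith
  have n1 : tb ≠ s0 := by rintro rfl; linarith
  have n2 : tb ≠ T := by rintro h; rw [h] at vT; linarith
  have hio : tb ∈ Ioo s0 T := ⟨lt_of_le_of_ne htb.1 (Ne.symm n1), lt_of_le_of_ne htb.2 n2⟩
  refine timeA hγ hγ0 hp hu hA hL hs0 hT0 hio (G := fun t => Λ * (t - s0) + A * (t - tb) ^ 2 + g t)
    (G' := fun t => Λ + A * (2 * (t - tb)) + g' t) (G'' := fun t => A * 2 + g'' t) ?_ ?_ hβ ?_ hA ?_ ?_ ?_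
  · intro t
    have a1 := ((hasDerivAt_id t).sub_const s0).const_mul Λ
    have a2 := (((hasDerivAt_id t).sub_const tb).pow 2).const_mul A
    have := (a1.add a2).add (d1 t)
    exact this.congr_deriv (by simp)
  · intro t
    have a2 := ((((hasDerivAt_id t).sub_const tb).const_mul 2).const_mul A).const_add Λ
    have := a2.add (d2 t)
    exact this.congr_deriv (by simp)
  · intro t ht
    rw [← hPd]
    have h1 := g1 t
    have h2 : A * (-1) ≤ A * (t - tb) := by
      gcongr; linarith [ht.1, hio.2]
    rw [hΛ]; linarith
  · intro t ht
    have := hm' t ht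
    simp only [sub_self]; linarith
  · have h2 : 0 ≤ A * (s0 - tb) ^ 2 := by positivity
    simp only [sub_self] at vs ⊢; linarith
  · have h2 : 0 ≤ A * (T - tb) ^ 2 := by positivity
    simp only [sub_self] at vT ⊢; linarith

/-- time oscillation bound -/
theorem time0 (E : Type*) [NormedAddCommGroup E] [InnerProductSpace ℝ E] [FiniteDimensional ℝ E]
    {γ p : ℝ} (hγ : -1 < γ) (hγ0 : γ < 0) (hp : 1 < p) : ∃ C ≥ 1, ∀ {ε A : ℝ} {u : E × ℝ → ℝ}, 0 ≤ ε → 0 < A →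
    VisS γ p ε u (Cyl E 1 1) → SpL u A 1 1 → ∀ s t, -1 < s → s < 0 → -1 < t → t < 0 →
    u (0, t) - u (0, s) ≤ C * (A ^ (γ + 1) + A + ε) := by
  set β := (γ + 2) / (γ + 1) with hβ
  have hg1 : 0 < γ + 1 := by linarith
  have hβ1 : 0 ≤ β - 1 := by rw [hβ, sub_nonneg, le_div_iff₀ hg1]; linarith
  have hβ0 : 0 ≤ β := by linarith
  have hP : 0 ≤ Module.finrank ℝ E * p * (β - 1) * (2 ^ β * β) ^ (γ + 1) := by positivity
  refine ⟨7 + Module.finrank ℝ E * p * (β - 1) * (2 ^ β * β) ^ (γ + 1), by linarith, ?_⟩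
  intro ε A u hε hA hu hL s t hs hs0 ht ht0
  have hAg : 0 < A ^ (γ + 1) := by positivity
  have hbd : ∀ w, VisS γ p ε w (Cyl E 1 1) → SpL w A 1 1 → ∀ s t, -1 < s → s < t → t < 0 → w (0, t) - w (0, s) ≤
     (7 + Module.finrank ℝ E * p * (β - 1) * (2 ^ β * β) ^ (γ + 1)) * (A ^ (γ + 1) + A + ε) := by
    intro w hw hLw s t h1 h2 h3
    have := time0a hγ hγ0 hp hε hw hA hLw hβ h1 h2 h3
    rw [Real.mul_rpow (by positivity) hA.le] at this
    set P := Module.finrank ℝ E * p * (β - 1) * (2 ^ β * β) ^ (γ + 1)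
    have e1 : ↑(Module.finrank ℝ E) * p * (β - 1) * ((2 ^ β * β) ^ (γ + 1) * A ^ (γ + 1)) = P * A ^ (γ + 1) := by ring
    rw [e1] at this
    have e2 : 0 ≤ P * (A + ε) := by positivity
    nlinarith only [this, e2, hε, hA, hAg]
  rcases lt_trichotomy s t with h | h | h
  · exact hbd u hu hL s t hs h ht0
  · rw [h, sub_self]; positivity
  · have := hbd _ hu.neg hL.neg t s ht h hs0
    linarith

set_option maxHeartbeats 1000000 in
theorem time1a {γ p ε : ℝ} (hγ : -1 < γ) (hγ0 : γ < 0) (hp : 1 < p) (hε : 0 ≤ ε) {u : E × ℝ → ℝ} (hu : VisS γ p ε u (Cyl E 1 1))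
    {A : ℝ} (hA : 0 < A) {l : E} (hl : 16 * A ≤ ‖l‖) (hf : ∀ x t, ‖x‖ < 1 → -1 < t → t < 0 → |u (x, t) - u (0, t) - ⟪l, x⟫| ≤ A)
    {s0 t1 : ℝ} (hs0 : -1 < s0) (hst : s0 < t1) (ht1 : t1 < 0) :
    u (0, t1) - u (0, s0) ≤ 3 * A + ε + 32 * (Module.finrank ℝ E * p) * A * ‖l‖ ^ γ := by
  by_contra hcon
  push Not at hcon
  have hl0 : 0 < ‖l‖ := by linarith
  have hP : 0 ≤ 32 * (Module.finrank ℝ E * p) * A * ‖l‖ ^ γ := by positivity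
  set P := 32 * (Module.finrank ℝ E * p) * A * ‖l‖ ^ γ with hPd
  set Λ := ε + P + A with hΛ
  have hΛ0 : 0 < Λ := by positivity
  set D := u (0, t1) - u (0, s0) - 2 * A - Λ with hD
  have hD0 : 0 < D := by rw [hD, hΛ]; linarith
  obtain ⟨g, g', g'', d1, d2, g0, g1, g2, g3⟩ := wall hD0 (show t1 < t1 / 2 by linarith) (u (0, t1 / 2) - u (0, s0))
  set T := t1 / 2 with hT
  have hTt : t1 < T := by rw [hT]; linarith
  have hT0 : T < 0 := by rw [hT]; linarith
  set G : ℝ → ℝ := fun t => Λ * (t - s0) + g t with hGd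
  have hG : ∀ t, HasDerivAt G (Λ + g' t) t := by
    intro t
    have := (((hasDerivAt_id t).sub_const s0).const_mul Λ).add (d1 t)
    exact this.congr_deriv (by simp)
  have hG' : ∀ t, HasDerivAt (fun t => Λ + g' t) (g'' t) t := fun t => (d2 t).const_add Λ
  have hGc : Continuous G := continuous_iff_continuousAt.2 fun t => (hG t).continuousAt
  let K : Set (E × ℝ) := Metric.closedBall 0 (1 / 2) ×ˢ Icc s0 T
  have hKc : IsCompact K := (isCompact_closedBall _ _).prod isCompact_Icc
  have hKs : K ⊆ Cyl E 1 1 := by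
    rintro ⟨x, t⟩ ⟨h1, h2⟩
    rw [Metric.mem_closedBall, dist_zero_right] at h1
    exact ⟨by simp only at h1 ⊢; linarith, by have := h2.1; simp only at this ⊢; linarith,
      by have := h2.2; simp only at this ⊢; linarith⟩
  let F : E × ℝ → ℝ := fun w => ⟪l, w.1⟫ + 8 * A * ‖w.1 - 0‖ ^ 2 + G w.2
  have hFc : Continuous F := by fun_prop
  have hyt : ((0 : E), t1) ∈ K := ⟨by simp, hst.le, hTt.le⟩
  obtain ⟨⟨x, t⟩, hz, hzm⟩ := hKc.exists_isMaxOn ⟨_, hyt⟩ ((hu.cont.mono hKs).sub hFc.continuousOn)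
  have hM : ∀ x' t', ‖x'‖ ≤ 1 / 2 → t' ∈ Icc s0 T → u (x', t') - F (x', t') ≤ u (x, t) - F (x, t) := by
    intro x' t' h1 h2
    exact hzm (show (x', t') ∈ K from ⟨by rw [Metric.mem_closedBall, dist_zero_right]; exact h1, h2⟩)
  have hx1 : ‖x‖ ≤ 1 / 2 := by have := hz.1; rwa [Metric.mem_closedBall, dist_zero_right] at this
  have ht : t ∈ Icc s0 T := hz.2
  have hF : ∀ x t, F (x, t) = ⟪l, x⟫ + 8 * A * ‖x‖ ^ 2 + G t := fun x t => by simp [F]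
  have v1 := hM 0 t1 (by simp) ⟨hst.le, hTt.le⟩
  rw [hF, hF, inner_zero_right, norm_zero] at v1
  have e1 : Λ * (t1 - s0) ≤ Λ * 1 := by gcongr; linarith
  have hG1 : G t1 ≤ Λ + D := by simp only [hGd]; linarith
  have hfx := hf x t (by linarith) (by linarith [ht.1]) (by linarith [ht.2])
  rw [abs_le] at hfx
  have hsq : 0 ≤ 8 * A * ‖x‖ ^ 2 := by positivity
  have ht1' : s0 < t := by
    rcases eq_or_lt_of_le ht.1 with h | h
    · exfalso
      rw [← h] at v1 hfx
      have : 0 ≤ G s0 := by simp only [hGd, sub_self, mul_zero, zero_add]; exact g0 s0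
      linarith [hfx.2]
    · exact h
  have ht2 : t < T := by
    rcases eq_or_lt_of_le ht.2 with h | h
    · exfalso
      rw [h] at v1 hfx
      have : g T ≤ G T := by
        have : 0 ≤ Λ * (T - s0) := mul_nonneg hΛ0.le (by linarith)
        simp only [hGd]; linarith
      linarith [hfx.2]
    · exact h
  have hx2 : ‖x‖ < 1 / 2 := by
    rcases eq_or_lt_of_le hx1 with h | h
    · exfalso
      have h1 := hM 0 t (by simp) ht
      rw [hF, hF, inner_zero_right, norm_zero, h] at h1
      linarith [hfx.2]
    · exact h
  have hX := ((X2.lin ((innerSL ℝ l).comp (ContinuousLinearMap.fst ℝ E ℝ)) ((x, t) : E × ℝ)).add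
    ((X2.normSq (ContinuousLinearMap.fst ℝ E ℝ) 0 ((x, t) : E × ℝ)).smul (8 * A))).add (X2_time (z := (x, t)) hG (hG' t))
  have hqn : ‖(l + (16 * A) • x) - l‖ ≤ ‖l‖ / 2 := by
    rw [add_sub_cancel_left, norm_smul, Real.norm_eq_abs, abs_of_pos (by positivity)]
    nlinarith only [hx1, hl, hA]
  have hq2 := near_norm hqn
  have hq : l + (16 * A) • x ≠ 0 := by
    rw [← norm_pos_iff]; linarith
  have hloc : ∀ᶠ w in nhds ((x, t) : E × ℝ), u w - F w ≤ u (x, t) - F (x, t) := by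
    have ho : IsOpen (Metric.ball (0 : E) (1 / 2) ×ˢ Ioo s0 T) := Metric.isOpen_ball.prod isOpen_Ioo
    have hm : ((x, t) : E × ℝ) ∈ Metric.ball (0 : E) (1 / 2) ×ˢ Ioo s0 T :=
      ⟨by rw [Metric.mem_ball, dist_zero_right]; exact hx2, ht1', ht2⟩
    filter_upwards [ho.mem_nhds hm] with w hw
    have := hw.1
    rw [Metric.mem_ball, dist_zero_right] at this
    exact hM w.1 w.2 this.le ⟨hw.2.1.le, hw.2.2.le⟩
  have hJ := J1 hp hu.sub (hKs hz) hX hloc hq (θ := Λ + g' t) (g := g'' t / 2) (b1 := fun v => 8 * A * ‖v‖ ^ 2)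
        (fun w => by
          rw [inner_add_left, inner_smul_left, RCLike.conj_to_real]
          simp; ring) (fun w => by simp) (D := 8 * A) (fun v => le_rfl) (by positivity)
  have h4 := half_rpow hγ hγ0 hl0 hq2
  have h5 : 2 * (↑(Module.finrank ℝ E) * (8 * A * p)) * ‖l + (16 * A) • x‖ ^ γ ≤ 2 * (↑(Module.finrank ℝ E) * (8 * A * p)) * (2 * ‖l‖ ^ γ) := by
    gcongr
  have h6 : 2 * (↑(Module.finrank ℝ E) * (8 * A * p)) * (2 * ‖l‖ ^ γ) = P := by rw [hPd]; ring
  have := g1 t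
  linarith

theorem time1 {γ p ε : ℝ} (hγ : -1 < γ) (hγ0 : γ < 0) (hp : 1 < p) (hε : 0 ≤ ε) {u : E × ℝ → ℝ} (hu : VisS γ p ε u (Cyl E 1 1))
    {A : ℝ} (hA : 0 < A) {l : E} (hl : 16 * A ≤ ‖l‖) (hf : ∀ x t, ‖x‖ < 1 → -1 < t → t < 0 → |u (x, t) - u (0, t) - ⟪l, x⟫| ≤ A)
    {s t : ℝ} (hs : -1 < s) (hs0 : s < 0) (ht : -1 < t) (ht0 : t < 0) :
    u (0, t) - u (0, s) ≤ 3 * A + ε + 32 * (Module.finrank ℝ E * p) * A * ‖l‖ ^ γ := by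
  rcases lt_trichotomy s t with h | h | h
  · exact time1a hγ hγ0 hp hε hu hA hl hf hs h ht0
  · rw [h, sub_self]; positivity
  · have := time1a hγ hγ0 hp hε hu.neg hA (l := -l) (by rwa [norm_neg]) (by
      intro x t h1 h2 h3
      have := hf x t h1 h2 h3
      rw [← abs_neg] at this
      rw [inner_neg_left]
      convert this using 2; ring) ht h hs0
    rw [norm_neg] at this
    linarith
end P6c

section P5
variable {E : Type*} [NormedAddCommGroup E] [InnerProductSpace ℝ E] [FiniteDimensional ℝ E]

theorem sig_symm (γ p : ℝ) (q v w : E) : ⟪sig γ p q v, w⟫ = ⟪v, sig γ p q w⟫ := by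
  unfold sig
  simp only [inner_smul_left, inner_smul_right, inner_add_left, inner_add_right, RCLike.conj_to_real]
  rw [real_inner_comm q v]; ring

theorem sum_sig_sq (γ p : ℝ) (q y : E) {ι : Type*} [Fintype ι] (b : OrthonormalBasis ι ℝ E) :
    ∑ i, ⟪y, sig γ p q (b i)⟫ ^ 2 = ‖sig γ p q y‖ ^ 2 := by
  rw [← b.sum_sq_norm_inner_left]
  apply Finset.sum_congr rfl
  intro i _
  rw [← sig_symm, Real.norm_eq_abs, sq_abs]

/-- second order test function for the expansion of a slope deficit -/
def Pex (M r : ℝ) (z0 v c : E) (e G : ℝ → ℝ) (w : E × E × ℝ) : ℝ :=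
  M * ‖w.1 - w.2.1‖ - e w.2.2 * ((r ^ 2 - ‖w.2.1 - w.2.2 • v - c‖ ^ 2) ^ 2 * (1 - ‖w.1 - w.2.1 - z0‖ ^ 2 / r ^ 2)) + G w.2.2

set_option maxHeartbeats 1000000 in
theorem exp_jet {γ p ε : ℝ} (hp : 1 < p) {u : E × ℝ → ℝ} {Ω : Set (E × ℝ)} (hu : VisS γ p ε u Ω)
    {x y : E} {t : ℝ} (hx : (x, t) ∈ Ω) (hy : (y, t) ∈ Ω) {M r N : ℝ} {z0 v c : E} {e e'' G G' G'' : ℝ → ℝ}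
    (he : ∀ t, HasDerivAt e (-(N * e t)) t)
    (hG : ∀ t, HasDerivAt G (G' t) t) (hG2 : ∀ t, HasDerivAt G' (G'' t) t) (hxy : x - y ≠ 0)
    (hm : ∀ᶠ w in nhds (x, y, t), D2 u w - Pex M r z0 v c e G w ≤ D2 u (x, y, t) - Pex M r z0 v c e G (x, y, t))
    {y' z' : E} {ρ χ : ℝ} (hy' : y' = y - t • v - c) (hz' : z' = x - y - z0) (hρ : ρ = r ^ 2 - ‖y'‖ ^ 2) (hχ : χ = 1 - ‖z'‖ ^ 2 / r ^ 2)
    {qx qy : E} (hqx : qx = (M / ‖x - y‖) • (x - y) + (2 * e t * ρ ^ 2 / r ^ 2) • z') (hqy : qy = qx - (4 * e t * ρ * χ) • y')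
    (hqx0 : qx ≠ 0) (hqy0 : qy ≠ 0) {ι : Type*} [Fintype ι] (b : OrthonormalBasis ι ℝ E) :
    N * e t * ρ ^ 2 * χ - 4 * e t * ρ * χ * ⟪y', v⟫ + G' t ≤ 2 * ε + 2 * ∑ i,
      (M / (2 * ‖x - y‖) * ‖sig γ p qx (b i) - sig γ p qy (b i)‖ ^ 2
       - e t * (χ * (4 * ⟪y', sig γ p qy (b i)⟫ ^ 2 - 2 * ρ * ‖sig γ p qy (b i)‖ ^ 2)
         + 8 * ρ / r ^ 2 * ⟪y', sig γ p qy (b i)⟫ * ⟪z', sig γ p qx (b i) - sig γ p qy (b i)⟫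
         - ρ ^ 2 / r ^ 2 * ‖sig γ p qx (b i) - sig γ p qy (b i)‖ ^ 2)) - 2 * ∑ i, M / (2 * ‖x - y‖) *
        ⟪(1 / ‖x - y‖) • (x - y), sig γ p qx (b i) - sig γ p qy (b i)⟫ ^ 2 := by
  have hn : 0 < ‖x - y‖ := norm_pos_iff.2 hxy
  let w0 : E × E × ℝ := (x, y, t)
  let R : E × E × ℝ →L[ℝ] E := Ym E - (Tm E).smulRight v
  have hR : ∀ w, R w = w.2.1 - w.2.2 • v := fun w => rfl
  have X1 := X2.radial (Zm E) (z := w0) (show Zm E w0 ≠ 0 from hxy) (ψ := fun s => M * s) (ψ1 := M) (ψ2 := 0)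
    (S2.of_deriv (F' := fun _ => M) (Filter.Eventually.of_forall fun s => by simpa using (hasDerivAt_id s).const_mul M)
      (hasDerivAt_const _ _))
  have Xρ := (X2.const (r ^ 2) w0).sub (X2.normSq R c w0)
  have Xχ := (X2.const 1 w0).sub ((X2.normSq (Zm E) z0 w0).smul (1 / r ^ 2))
  have Xe := (X2.lin (Tm E) w0).comp (S2.of_deriv (Filter.Eventually.of_forall he) (((he t).const_mul N).neg))
  have XG := (X2.lin (Tm E) w0).comp (S2.of_deriv (Filter.Eventually.of_forall hG) (hG2 t))
  have XX := (X1.sub (Xe.mul (Xρ.sq.mul Xχ))).add XG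
  have hval : ∀ w, Pex M r z0 v c e G w = M * ‖Zm E w‖ - e (Tm E w) * ((r ^ 2 - ‖R w - c‖ ^ 2) ^ 2 * (1 - 1 / r ^ 2 * ‖Zm E w - z0‖ ^ 2)) + G (Tm E w) := by
    intro w
    rw [Pex, hR, Zm_apply, Tm_apply]; ring
  obtain ⟨L, B, h1, h2, h3⟩ := XX.jet (g := D2 u) (by
    filter_upwards [hm] with w hw
    rw [hval, hval] at hw
    exact hw)
  have eR : R w0 - c = y' := by rw [hR, hy']
  have eZ : Zm E w0 - z0 = z' := by rw [Zm_apply, hz']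
  have eZ0 : Zm E w0 = x - y := rfl
  have eT : Tm E w0 = t := rfl
  have eρ : r ^ 2 - ‖y'‖ ^ 2 = ρ := hρ.symm
  have eχ : 1 - 1 / r ^ 2 * ‖z'‖ ^ 2 = χ := by rw [hχ]; ring
  have hraw := raw hp hu hx hy h3 (qx := qx) (qy := qy)
    (θ := N * e t * ρ ^ 2 * χ - 4 * e t * ρ * χ * ⟪y', v⟫ + G' t) hqx0 hqy0 ?_ b b
  · refine hraw.trans ?_
    rw [add_sub_assoc, ← mul_sub, ← Finset.sum_sub_distrib]
    gcongr with i
    apply le_of_eq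
    rw [h2]
    simp only [eR, eZ, eT]
    simp only [eρ, eχ, eZ0, Zm_apply, Tm_apply, hR, zero_smul, sub_zero]
    field_simp
    ring
  · intro h k τ
    rw [h1]
    simp only [eR, eZ, eT]
    simp only [eρ, eχ, eZ0, Zm_apply, Tm_apply, hR]
    rw [hqy, hqx]
    simp only [inner_sub_left, inner_add_left, inner_smul_left, inner_sub_right, inner_smul_right, RCLike.conj_to_real]
    ring
end P5

section P5
variable {E : Type*} [NormedAddCommGroup E] [InnerProductSpace ℝ E] [FiniteDimensional ℝ E]

set_option maxHeartbeats 2000000 in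
theorem exp_pt (E : Type*) [NormedAddCommGroup E] [InnerProductSpace ℝ E] [FiniteDimensional ℝ E]
    {γ p m0 L κ r V : ℝ} (hγ : -1 < γ) (hγ0 : γ < 0) (hp : 1 < p) (hm0 : 0 < m0) (hL : m0 ≤ L) (hκ : 0 < κ)
    (hr : 0 < r) (hr1 : r ≤ 1) (hrκ : r ≤ κ / 2) (hV : 0 ≤ V) : ∃ N ≥ 0, ∀ {ε : ℝ} {u : E × ℝ → ℝ} {Ω : Set (E × ℝ)} (hu : VisS γ p ε u Ω)
    {x y : E} {t : ℝ} (hx : (x, t) ∈ Ω) (hy : (y, t) ∈ Ω) {M : ℝ} (hM : m0 ≤ M) (hML : M ≤ L) {z0 v c : E} (hz0 : ‖z0‖ = κ) (hv : ‖v‖ ≤ V)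
    {e G G' G'' : ℝ → ℝ}
    (he : ∀ t, HasDerivAt e (-(N * e t)) t) (he0 : 0 < e t) (he1 : e t ≤ 1) (he2 : e t ≤ m0 / 32)
    (hG : ∀ t, HasDerivAt G (G' t) t) (hG2 : ∀ t, HasDerivAt G' (G'' t) t) (hGe : 2 * ε < G' t)
    (hm : ∀ᶠ w in nhds (x, y, t), D2 u w - Pex M r z0 v c e G w ≤ D2 u (x, y, t) - Pex M r z0 v c e G (x, y, t))
    (hy' : ‖y - t • v - c‖ < r) (hz' : ‖x - y - z0‖ < r), False := by
  obtain ⟨Γ, hΓ⟩ : ∃ Γ, Γ = 2 * m0 ^ γ := ⟨_, rfl⟩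
  have hΓ0 : 0 < Γ := by rw [hΓ]; positivity
  obtain ⟨K, hK⟩ : ∃ K, K = 8 * Csig p * √Γ / m0 := ⟨_, rfl⟩
  have hCs := Csig_nonneg p
  have hK0 : 0 ≤ K := by rw [hK]; positivity
  obtain ⟨k0, hk0⟩ : ∃ k0, k0 = √(p * Γ) := ⟨_, rfl⟩
  have hk00 : 0 ≤ k0 := by rw [hk0]; positivity
  have hL0 : 0 < L := by linarith
  obtain ⟨K3, hK3⟩ : ∃ K3, K3 = L / κ * K ^ 2 + 8 * k0 * K + K ^ 2 := ⟨_, rfl⟩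
  have hK30 : 0 ≤ K3 := by rw [hK3]; positivity
  obtain ⟨μ0, hμ0⟩ : ∃ μ0, μ0 = min 1 (p - 1) * (2 * L) ^ γ := ⟨_, rfl⟩
  have hmin : 0 < min 1 (p - 1) := lt_min one_pos (by linarith)
  have hμ00 : 0 < μ0 := by rw [hμ0]; positivity
  obtain ⟨n, hn⟩ : ∃ n : ℝ, n = Module.finrank ℝ E := ⟨_, rfl⟩
  have hn0 : 0 ≤ n := by rw [hn]; positivity
  obtain ⟨C', hC'⟩ : ∃ C', C' = 4 * V + 4 * n * p * Γ + 8 * μ0 := ⟨_, rfl⟩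
  refine ⟨2 * n * K3 + C' ^ 2 / (32 * μ0 * r ^ 2), by positivity, ?_⟩
  intro ε u Ω hu x y t hx hy M hM hML z0 v c hz0 hv e G G' G'' he he0 he1 he2 hG hG2 hGe hm hy' hz'
  obtain ⟨N, hN⟩ : ∃ N, N = 2 * n * K3 + C' ^ 2 / (32 * μ0 * r ^ 2) := ⟨_, rfl⟩
  rw [← hN] at he
  obtain ⟨Y, hY⟩ : ∃ Y, Y = y - t • v - c := ⟨_, rfl⟩
  obtain ⟨Z, hZ⟩ : ∃ Z, Z = x - y - z0 := ⟨_, rfl⟩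
  rw [← hY] at hy'
  rw [← hZ] at hz'
  obtain ⟨ρ, hρ⟩ : ∃ ρ, ρ = r ^ 2 - ‖Y‖ ^ 2 := ⟨_, rfl⟩
  obtain ⟨χ, hχ⟩ : ∃ χ, χ = 1 - ‖Z‖ ^ 2 / r ^ 2 := ⟨_, rfl⟩
  have hρ0 : 0 < ρ := by rw [hρ]; nlinarith only [hy', norm_nonneg Y]
  have hρr : ρ ≤ r ^ 2 := by rw [hρ]; nlinarith only [sq_nonneg ‖Y‖]
  have hr2 : r ^ 2 ≤ 1 := pow_le_one₀ hr.le hr1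
  have hρ1 : ρ ≤ 1 := hρr.trans hr2
  have hχ0 : 0 < χ := by
    rw [hχ, sub_pos, div_lt_one (by positivity)]; nlinarith only [hz', norm_nonneg Z]
  have hχ1 : χ ≤ 1 := by rw [hχ]; have : 0 ≤ ‖Z‖ ^ 2 / r ^ 2 := by positivity
                         linarith
  obtain ⟨s, hs⟩ : ∃ s, s = e t := ⟨_, rfl⟩
  rw [← hs] at he0 he1 he2
  have hzn : κ / 2 ≤ ‖x - y‖ := by
    have := norm_sub_norm_le z0 (z0 - (x - y))
    rw [sub_sub_cancel, norm_sub_rev z0, ← hZ, hz0] at this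
    linarith
  have hzp : 0 < ‖x - y‖ := by linarith
  obtain ⟨qx, hqx⟩ : ∃ qx, qx = (M / ‖x - y‖) • (x - y) + (2 * s * ρ ^ 2 / r ^ 2) • Z := ⟨_, rfl⟩
  obtain ⟨qy, hqy⟩ : ∃ qy, qy = qx - (4 * s * ρ * χ) • Y := ⟨_, rfl⟩
  have hMz : ‖(M / ‖x - y‖) • (x - y)‖ = M := by
    rw [norm_smul, Real.norm_eq_abs, abs_of_nonneg (div_nonneg (by linarith) hzp.le)]; field_simp
  have hρρ : ρ ^ 2 / r ^ 2 ≤ 1 := by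
    rw [div_le_one (by positivity)]; nlinarith only [hρ0, hρr, hρ1]
  have d1 : ‖(2 * s * ρ ^ 2 / r ^ 2) • Z‖ ≤ m0 / 8 := by
    rw [norm_smul, Real.norm_eq_abs, abs_of_pos (by positivity)]
    have : 2 * s * ρ ^ 2 / r ^ 2 = 2 * s * (ρ ^ 2 / r ^ 2) := by ring
    rw [this]
    have h1 : 2 * s * (ρ ^ 2 / r ^ 2) * ‖Z‖ ≤ 2 * s * 1 * 1 := by
      gcongr; linarith
    linarith
  have d2 : ‖(4 * s * ρ * χ) • Y‖ ≤ 4 * s * ρ * χ := by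
    rw [norm_smul, Real.norm_eq_abs, abs_of_pos (by positivity)]
    exact mul_le_of_le_one_right (by positivity) (by linarith)
  have d3 : 4 * s * ρ * χ ≤ m0 / 8 := by
    have : 4 * s * ρ * χ ≤ 4 * s * 1 * 1 := by gcongr
    linarith
  have hqxM : 3 / 4 * M ≤ ‖qx‖ ∧ ‖qx‖ ≤ 5 / 4 * M := by
    have h1 := norm_sub_norm_le ((M / ‖x - y‖) • (x - y)) ((M / ‖x - y‖) • (x - y) - qx)
    have h2 := norm_sub_norm_le qx ((M / ‖x - y‖) • (x - y))
    have h3 : qx - (M / ‖x - y‖) • (x - y) = (2 * s * ρ ^ 2 / r ^ 2) • Z := by rw [hqx]; abel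
    rw [sub_sub_cancel, norm_sub_rev _ qx, h3] at h1
    rw [h3] at h2
    constructor <;> linarith
  have e1 : qx - qy = (4 * s * ρ * χ) • Y := by rw [hqy]; abel
  have d4 : ‖qx - qy‖ ≤ 4 * s * ρ * χ := by rw [e1]; exact d2
  have hqyM : M / 2 ≤ ‖qy‖ ∧ ‖qy‖ ≤ 2 * M := by
    have h1 := norm_sub_norm_le qx qy
    have h2 := norm_sub_norm_le qy qx
    rw [norm_sub_rev] at h2
    constructor <;> linarith [hqxM.1, hqxM.2]
  have hM0 : 0 < M := by linarith
  have hqx0 : qx ≠ 0 := norm_pos_iff.1 (by linarith [hqxM.1])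
  have hqy0 : qy ≠ 0 := norm_pos_iff.1 (by linarith [hqyM.1])
  have g1 : ‖qx‖ ^ γ ≤ Γ := by rw [hΓ]; exact half_rpow hγ hγ0 hm0 (by linarith [hqxM.1])
  have g2 : ‖qy‖ ^ γ ≤ Γ := by rw [hΓ]; exact half_rpow hγ hγ0 hm0 (by linarith [hqyM.1])
  have g3 : (2 * L) ^ γ ≤ ‖qy‖ ^ γ := Real.rpow_le_rpow_of_nonpos (norm_pos_iff.2 hqy0) (by linarith [hqyM.2]) hγ0.le
  have hJ := exp_jet hp hu hx hy he hG hG2 (norm_pos_iff.1 hzp) hm hY hZ hρ hχ (by rw [← hs]; exact hqx) (by rw [← hs]; exact hqy) hqx0 hqy0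
    (e'' := fun _ => 0) (stdOrthonormalBasis ℝ E)
  rw [← hs] at hJ
  have hsum2 : 0 ≤ ∑ i, M / (2 * ‖x - y‖) * ⟪(1 / ‖x - y‖) • (x - y), sig γ p qx (stdOrthonormalBasis ℝ E i) - sig γ p qy (stdOrthonormalBasis ℝ E i)⟫ ^ 2 := by
    apply Finset.sum_nonneg; intro i _; positivity
  have hbd : ∑ i, (M / (2 * ‖x - y‖) * ‖sig γ p qx (stdOrthonormalBasis ℝ E i) - sig γ p qy (stdOrthonormalBasis ℝ E i)‖ ^ 2
       - s * (χ * (4 * ⟪Y, sig γ p qy (stdOrthonormalBasis ℝ E i)⟫ ^ 2 - 2 * ρ * ‖sig γ p qy (stdOrthonormalBasis ℝ E i)‖ ^ 2)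
         + 8 * ρ / r ^ 2 * ⟪Y, sig γ p qy (stdOrthonormalBasis ℝ E i)⟫ * ⟪Z, sig γ p qx (stdOrthonormalBasis ℝ E i) - sig γ p qy (stdOrthonormalBasis ℝ E i)⟫
         - ρ ^ 2 / r ^ 2 * ‖sig γ p qx (stdOrthonormalBasis ℝ E i) - sig γ p qy (stdOrthonormalBasis ℝ E i)‖ ^ 2)) ≤
      ∑ i, (s * χ * (2 * p * Γ * ρ + K3 * ρ ^ 2) - 4 * s * χ * ⟪Y, sig γ p qy (stdOrthonormalBasis ℝ E i)⟫ ^ 2) := by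
    apply Finset.sum_le_sum
    intro i _
    have hb1 : ‖stdOrthonormalBasis ℝ E i‖ = 1 := (stdOrthonormalBasis ℝ E).norm_eq_one i
    have h1 := hs_bound (p := p) hγ hγ0 hqx0 (q := qy) (by rw [norm_sub_rev]; linarith [hqxM.1]) hb1
    have h2 := sig_upper (γ := γ) hp hqy0 (stdOrthonormalBasis ℝ E i)
    rw [hb1, one_pow, mul_one] at h2
    set k := sig γ p qy (stdOrthonormalBasis ℝ E i) with hk
    rw [norm_sub_rev] at h1
    set ζ := sig γ p qx (stdOrthonormalBasis ℝ E i) - k with hζ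
    have k1 : ‖k‖ ^ 2 ≤ p * Γ := h2.trans (by gcongr)
    have k2 : ‖k‖ ≤ k0 := by rw [hk0]; exact Real.le_sqrt_of_sq_le k1
    have z1 : ‖ζ‖ ^ 2 ≤ (K * (s * ρ * χ)) ^ 2 := by
      refine h1.trans ?_
      have : ‖qy - qx‖ / ‖qx‖ ≤ 8 * s * ρ * χ / m0 := by
        rw [div_le_div_iff₀ (norm_pos_iff.2 hqx0) hm0, norm_sub_rev]
        have a1 : ‖qx - qy‖ * m0 ≤ (4 * s * ρ * χ) * m0 := by gcongr
        have a2 : (4 * s * ρ * χ) * m0 ≤ (4 * s * ρ * χ) * (2 * ‖qx‖) := by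
          gcongr; linarith [hqxM.1]
        linarith
      have h3 : Csig p ^ 2 * ‖qx‖ ^ γ * (‖qy - qx‖ / ‖qx‖) ^ 2 ≤ Csig p ^ 2 * Γ * (8 * s * ρ * χ / m0) ^ 2 := by
        gcongr
      refine h3.trans (le_of_eq ?_)
      rw [hK]
      have := Real.sq_sqrt hΓ0.le
      rw [show (8 * Csig p * √Γ / m0 * (s * ρ * χ)) ^ 2 = 64 * Csig p ^ 2 * √Γ ^ 2 / m0 ^ 2 * (s * ρ * χ) ^ 2 by ring, this]
      ring
    have z2 : ‖ζ‖ ≤ K * (s * ρ * χ) := abs_le_of_sq_le_sq' z1 (by positivity) |>.2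
    have sχ : s * χ ≤ 1 := mul_le_one₀ he1 hχ0.le hχ1
    have z3 : ‖ζ‖ ^ 2 ≤ s * χ * (K ^ 2 * ρ ^ 2) := by
      refine z1.trans ?_
      have : (K * (s * ρ * χ)) ^ 2 = (s * χ) * (s * χ) * (K ^ 2 * ρ ^ 2) := by ring
      rw [this]
      have : (s * χ) * (s * χ) ≤ s * χ * 1 := by gcongr
      rw [mul_one] at this
      gcongr
    have t1 : M / (2 * ‖x - y‖) * ‖ζ‖ ^ 2 ≤ s * χ * (L / κ * K ^ 2 * ρ ^ 2) := by
      have a1 : M / (2 * ‖x - y‖) ≤ L / κ := by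
        rw [div_le_div_iff₀ (by positivity) hκ]
        have : M * κ ≤ L * κ := by gcongr
        have : L * κ ≤ L * (2 * ‖x - y‖) := by gcongr; linarith
        linarith
      have a2 : M / (2 * ‖x - y‖) * ‖ζ‖ ^ 2 ≤ L / κ * (s * χ * (K ^ 2 * ρ ^ 2)) := by gcongr
      linarith
    have t2 : s * χ * (2 * ρ * ‖k‖ ^ 2) ≤ s * χ * (2 * ρ * (p * Γ)) := by gcongr
    have t3 : -(s * (8 * ρ / r ^ 2 * ⟪Y, k⟫ * ⟪Z, ζ⟫)) ≤ s * χ * (8 * k0 * K * ρ ^ 2) := by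
      have c1 : |⟪Y, k⟫| ≤ r * k0 := (abs_real_inner_le_norm Y k).trans (by gcongr)
      have c2 : |⟪Z, ζ⟫| ≤ r * (K * (s * ρ * χ)) := (abs_real_inner_le_norm Z ζ).trans (by gcongr)
      have c3 : |⟪Y, k⟫ * ⟪Z, ζ⟫| ≤ (r * k0) * (r * (K * (s * ρ * χ))) := by
        rw [abs_mul]; gcongr
      have c4 := neg_le_of_abs_le c3
      have c5 : s * (8 * ρ / r ^ 2) * (-(⟪Y, k⟫ * ⟪Z, ζ⟫)) ≤ s * (8 * ρ / r ^ 2) * ((r * k0) * (r * (K * (s * ρ * χ)))) := by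
        gcongr; linarith
      have c6 : s * (8 * ρ / r ^ 2) * ((r * k0) * (r * (K * (s * ρ * χ)))) = s * (s * χ * (8 * k0 * K * ρ ^ 2)) := by
        field_simp
      have c7 : s * (s * χ * (8 * k0 * K * ρ ^ 2)) ≤ 1 * (s * χ * (8 * k0 * K * ρ ^ 2)) := by gcongr
      linarith
    have t4 : s * (ρ ^ 2 / r ^ 2 * ‖ζ‖ ^ 2) ≤ s * χ * (K ^ 2 * ρ ^ 2) := by
      have : s * (ρ ^ 2 / r ^ 2 * ‖ζ‖ ^ 2) ≤ 1 * (1 * (s * χ * (K ^ 2 * ρ ^ 2))) := by gcongr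
      linarith
    have e3 : s * χ * (2 * p * Γ * ρ + K3 * ρ ^ 2) = s * χ * (2 * ρ * (p * Γ)) + s * χ * (L / κ * K ^ 2 * ρ ^ 2)
      + s * χ * (8 * k0 * K * ρ ^ 2) + s * χ * (K ^ 2 * ρ ^ 2) := by rw [hK3]; ring
    rw [e3]
    linarith
  have hsig := sig_lower (γ := γ) hp hqy0 Y
  have hrhs : ∑ i, (s * χ * (2 * p * Γ * ρ + K3 * ρ ^ 2) - 4 * s * χ * ⟪Y, sig γ p qy (stdOrthonormalBasis ℝ E i)⟫ ^ 2)
      = n * (s * χ * (2 * p * Γ * ρ + K3 * ρ ^ 2)) - 4 * s * χ * ‖sig γ p qy Y‖ ^ 2 := by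
    rw [Finset.sum_sub_distrib, Finset.sum_const, Finset.card_univ, Fintype.card_fin, nsmul_eq_mul, ← hn, ← Finset.mul_sum, sum_sig_sq]
  rw [hrhs] at hbd
  have hgood : μ0 * (r ^ 2 - ρ) ≤ ‖sig γ p qy Y‖ ^ 2 := by
    refine le_trans ?_ hsig
    rw [hρ, hμ0, sub_sub_cancel]
    gcongr
  have hgs : s * χ * (μ0 * (r ^ 2 - ρ)) ≤ s * χ * ‖sig γ p qy Y‖ ^ 2 := by gcongr
  have hYv : s * χ * (ρ * ⟪Y, v⟫) ≤ s * χ * (ρ * V) := by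
    have : ⟪Y, v⟫ ≤ V := (real_inner_le_norm Y v).trans (by nlinarith only [hy', hv, hr1, norm_nonneg Y, norm_nonneg v])
    gcongr
  have hfin : s * χ * ((C' ^ 2 / (32 * μ0 * r ^ 2)) * ρ ^ 2 - C' * ρ + 8 * μ0 * r ^ 2) < 0 := by
    rw [hN] at hJ
    rw [hC'] at hJ ⊢
    have hid : s * χ * (((4 * V + 4 * n * p * Γ + 8 * μ0) ^ 2 / (32 * μ0 * r ^ 2)) * ρ ^ 2 - (4 * V + 4 * n * p * Γ + 8 * μ0) * ρ + 8 * μ0 * r ^ 2)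
      = (2 * n * K3 + (4 * V + 4 * n * p * Γ + 8 * μ0) ^ 2 / (32 * μ0 * r ^ 2)) * s * ρ ^ 2 * χ - 4 * (s * χ * (ρ * V)) + 8 * (s * χ * (μ0 * (r ^ 2 - ρ)))
        - 2 * (n * (s * χ * (2 * p * Γ * ρ + K3 * ρ ^ 2))) := by ring
    rw [hid]
    linarith
  have hsχ : 0 < s * χ := by positivity
  have hneg := neg_of_mul_neg_right hfin hsχ.le
  have h32 : 0 < 32 * μ0 * r ^ 2 := by positivity
  have hsq : (32 * μ0 * r ^ 2) * ((C' ^ 2 / (32 * μ0 * r ^ 2)) * ρ ^ 2 - C' * ρ + 8 * μ0 * r ^ 2) = (C' * ρ - 16 * μ0 * r ^ 2) ^ 2 := by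
    field_simp; ring
  have := mul_neg_of_pos_of_neg h32 hneg
  rw [hsq] at this
  linarith [sq_nonneg (C' * ρ - 16 * μ0 * r ^ 2)]
end P5

section P5
variable {E : Type*} [NormedAddCommGroup E] [InnerProductSpace ℝ E] [FiniteDimensional ℝ E]

set_option maxHeartbeats 2000000 in
/-- propagation of a slope deficit -/
theorem expand (E : Type*) [NormedAddCommGroup E] [InnerProductSpace ℝ E] [FiniteDimensional ℝ E]
    {γ p m0 L κ θ T : ℝ} (hγ : -1 < γ) (hγ0 : γ < 0) (hp : 1 < p) (hm0 : 0 < m0) (hL : m0 ≤ L) (hκ : 0 < κ)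
    (hκ1 : κ ≤ 1 / 8) (hθ : 0 < θ) (hθL : θ ≤ L) (hT : 0 < T) : ∃ d > 0, ∃ ε > 0, ∀ {u : E × ℝ → ℝ} {M te : ℝ} {z0 xe : E},
    VisS γ p ε u (Cyl E 1 1) → SpL u M 1 1 → m0 ≤ M → M ≤ L → ‖z0‖ = κ → ‖xe‖ < 1 / 2 → -1 < te → te ≤ -T →
    u (xe + z0, te) - u (xe, te) ≤ (M - θ) * κ → ∀ ys t1, ‖ys‖ < 1 / 2 → -(T / 2) ≤ t1 → t1 < 0 →
    u (ys + z0, t1) - u (ys, t1) ≤ M * κ - d := by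
  have hL0 : 0 < L := by linarith
  obtain ⟨r, hr⟩ : ∃ r, r = θ * κ / (8 * L) := ⟨_, rfl⟩
  have hr0 : 0 < r := by rw [hr]; positivity
  have hrκ : r ≤ κ / 8 := by
    rw [hr, div_le_div_iff₀ (by positivity) (by norm_num)]; nlinarith only [hθL, hκ]
  have h4L : 4 * L * r = θ * κ / 2 := by rw [hr]; field_simp; ring
  obtain ⟨N, hN0, hN⟩ := exp_pt E hγ hγ0 hp hm0 hL hκ hr0 (by linarith) (by linarith) (show 0 ≤ 2 / T by positivity)
  obtain ⟨β, hβ⟩ : ∃ β, β = min (min 1 (m0 / 32)) (θ * κ / 8) := ⟨_, rfl⟩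
  have hβ0 : 0 < β := by rw [hβ]; exact lt_min (lt_min one_pos (by positivity)) (by positivity)
  have hβ1 : β ≤ 1 := by rw [hβ]; exact (min_le_left _ _).trans (min_le_left _ _)
  have hβ2 : β ≤ m0 / 32 := by rw [hβ]; exact (min_le_left _ _).trans (min_le_right _ _)
  have hβ3 : β ≤ θ * κ / 8 := by rw [hβ]; exact min_le_right _ _
  obtain ⟨d0, hd0⟩ : ∃ d0, d0 = β * exp (-N) * r ^ 4 := ⟨_, rfl⟩
  have hd00 : 0 < d0 := by rw [hd0]; positivity
  refine ⟨d0 / 2, by positivity, d0 / 12, by positivity, ?_⟩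
  intro u M te z0 xe hu hS hM hML hz0 hxe hte hteT hdef ys t1 hys ht1 ht10
  by_contra hcon
  push Not at hcon
  have hM0 : 0 < M := by linarith
  obtain ⟨Te, hTe⟩ : ∃ Te, Te = t1 + min (-t1 / 2) (T / 16) := ⟨_, rfl⟩
  have hTe1 : t1 < Te := by
    have : 0 < min (-t1 / 2) (T / 16) := lt_min (by linarith) (by linarith)
    linarith
  have hTe0 : Te < 0 := by have := min_le_left (-t1 / 2) (T / 16); linarith
  have hTe2 : Te - t1 ≤ T / 16 := by have := min_le_right (-t1 / 2) (T / 16); linarith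
  have htt : T / 2 ≤ t1 - te := by linarith
  have htt0 : 0 < t1 - te := by linarith
  obtain ⟨g, g', g'', dg1, dg2, g0, g1, g2, g3⟩ := wall (show 0 < d0 / 4 by positivity) hTe1 2
  obtain ⟨G, hGd⟩ : ∃ G : ℝ → ℝ, G = fun t => d0 / 4 * (t - te) + g t := ⟨_, rfl⟩
  have hG : ∀ t, HasDerivAt G (d0 / 4 + g' t) t := by
    intro t
    rw [hGd]
    exact ((((hasDerivAt_id t).sub_const te).const_mul (d0 / 4)).add (dg1 t)).congr_deriv (by simp)
  have hG' : ∀ t, HasDerivAt (fun t => d0 / 4 + g' t) (g'' t) t := fun t => (dg2 t).const_add _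
  have hG0 : ∀ t, te ≤ t → 0 ≤ G t := by
    intro t ht
    have := g0 t
    have : 0 ≤ d0 / 4 * (t - te) := mul_nonneg (by positivity) (by linarith)
    simp only [hGd]; linarith
  obtain ⟨e, hed⟩ : ∃ e : ℝ → ℝ, e = fun t => β * exp (-(N * (t - te))) := ⟨_, rfl⟩
  have he : ∀ t, HasDerivAt e (-(N * e t)) t := by
    intro t
    rw [hed]
    have := ((((hasDerivAt_id t).sub_const te).const_mul N).neg.exp).const_mul β
    refine this.congr_deriv ?_
    simp; ring
  have he0 : ∀ t, 0 < e t := fun t => by rw [hed]; positivity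
  have heβ : ∀ t, te ≤ t → e t ≤ β := by
    intro t ht
    simp only [hed]
    have : exp (-(N * (t - te))) ≤ 1 := by
      rw [Real.exp_le_one_iff]
      have : 0 ≤ N * (t - te) := mul_nonneg hN0 (by linarith)
      linarith
    exact mul_le_of_le_one_right hβ0.le this
  have heN : β * exp (-N) ≤ e t1 := by
    simp only [hed]
    have : N * (t1 - te) ≤ N * 1 := by gcongr; linarith
    gcongr; linarith
  obtain ⟨v, hv⟩ : ∃ v, v = (1 / (t1 - te)) • (ys - xe) := ⟨_, rfl⟩
  have hvn : ‖v‖ ≤ 2 / T := by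
    rw [hv, norm_smul, Real.norm_eq_abs, abs_of_pos (by positivity), one_div_mul_eq_div, div_le_div_iff₀ htt0 hT]
    have : ‖ys - xe‖ ≤ 1 := (norm_sub_le _ _).trans (by linarith)
    nlinarith only [this, htt, hT]
  obtain ⟨c, hc⟩ : ∃ c, c = xe - te • v := ⟨_, rfl⟩
  have hξ : ∀ t, te ≤ t → t ≤ Te → ‖t • v + c‖ ≤ 5 / 8 := by
    intro t h1 h2
    have e1 : t • v + c = (1 - (t - te) / (t1 - te)) • xe + ((t - te) / (t1 - te)) • ys := by
      rw [hc, hv, div_eq_mul_one_div (t - te)]; module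
    obtain ⟨lm, hlm⟩ : ∃ lm, lm = (t - te) / (t1 - te) := ⟨_, rfl⟩
    have l0 : 0 ≤ lm := by rw [hlm]; exact div_nonneg (by linarith) htt0.le
    have l1 : lm ≤ 9 / 8 := by rw [hlm, div_le_iff₀ htt0]; linarith
    rw [e1, ← hlm]
    refine (norm_add_le _ _).trans ?_
    rw [norm_smul, norm_smul, Real.norm_eq_abs, Real.norm_eq_abs, abs_of_nonneg l0]
    have a1 : |1 - lm| * ‖xe‖ ≤ |1 - lm| * (1 / 2) := by gcongr
    have a2 : lm * ‖ys‖ ≤ lm * (1 / 2) := by gcongr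
    rcases abs_cases (1 - lm) with h | h <;> linarith
  let K : Set (E × E × ℝ) := {w | ‖w.2.1 - w.2.2 • v - c‖ ≤ r ∧ ‖w.1 - w.2.1 - z0‖ ≤ r ∧ te ≤ w.2.2 ∧ w.2.2 ≤ Te}
  have hKb : ∀ x y t, (x, y, t) ∈ K → ‖x‖ < 1 ∧ ‖y‖ < 1 ∧ -1 < t ∧ t < 0 := by
    rintro x y t ⟨h1, h2, h3, h4⟩
    simp only at h1 h2 h3 h4
    have hh := hξ t h3 h4
    have hy : ‖y‖ ≤ r + 5 / 8 := by
      have := norm_add_le (y - t • v - c) (t • v + c)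
      rw [show y - t • v - c + (t • v + c) = y by abel] at this
      linarith
    have hx : ‖x‖ ≤ r + ‖y‖ + κ := by
      have a1 := norm_add_le (x - y - z0) (y + z0)
      have a2 := norm_add_le y z0
      rw [show x - y - z0 + (y + z0) = x by abel] at a1
      linarith
    exact ⟨by linarith, by linarith, by linarith, by linarith⟩
  have cc1 : Continuous fun w : E × E × ℝ => ‖w.2.1 - w.2.2 • v - c‖ := by fun_prop
  have cc2 : Continuous fun w : E × E × ℝ => ‖w.1 - w.2.1 - z0‖ := by fun_prop
  have cc3 : Continuous fun w : E × E × ℝ => w.2.2 := by fun_prop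
  have hKc : IsCompact K := by
    have hcl : IsClosed K := by
      exact (isClosed_le cc1 continuous_const).inter ((isClosed_le cc2 continuous_const).inter
        ((isClosed_le continuous_const cc3).inter (isClosed_le cc3 continuous_const)))
    refine IsCompact.of_isClosed_subset ((isCompact_closedBall (0 : E) 1).prod ((isCompact_closedBall (0 : E) 1).prod (isCompact_Icc (a := te) (b := Te)))) hcl ?_
    rintro ⟨x, y, t⟩ hw
    have := hKb x y t hw
    refine ⟨?_, ?_, hw.2.2.1, hw.2.2.2⟩
    · rw [Metric.mem_closedBall, dist_zero_right]; exact this.1.le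
    · rw [Metric.mem_closedBall, dist_zero_right]; exact this.2.1.le
  have hgc : Continuous G := continuous_iff_continuousAt.2 fun t => (hG t).continuousAt
  have hec : Continuous e := continuous_iff_continuousAt.2 fun t => (he t).continuousAt
  have hPc : Continuous (Pex M r z0 v c e G) := by
    unfold Pex; fun_prop
  have hDc : ContinuousOn (D2 u) K := D2_contOn hu.cont (fun w hw => by
    obtain ⟨x, y, t⟩ := w
    have := hKb x y t hw
    exact ⟨⟨this.1, this.2.2⟩, ⟨this.2.1, this.2.2⟩⟩)
  have hyt : t1 • v + c = ys := by
    rw [hc, hv, show t1 • (1 / (t1 - te)) • (ys - xe) + (xe - te • (1 / (t1 - te)) • (ys - xe)) = xe + ((t1 - te) * (1 / (t1 - te))) • (ys - xe) by module,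
      mul_one_div_cancel htt0.ne', one_smul]; abel
  have hw1 : (ys + z0, ys, t1) ∈ K := by
    refine ⟨?_, ?_, by simp only; linarith, hTe1.le⟩
    · simp only
      rw [show ys - t1 • v - c = 0 by rw [sub_sub, hyt, sub_self], norm_zero]; exact hr0.le
    · simp only
      rw [show ys + z0 - ys - z0 = 0 by abel, norm_zero]; exact hr0.le
  obtain ⟨⟨x, y, t⟩, hz, hzm⟩ := hKc.exists_isMaxOn ⟨_, hw1⟩ (hDc.sub hPc.continuousOn)
  have hmx : ∀ w ∈ K, D2 u w - Pex M r z0 v c e G w ≤ D2 u (x, y, t) - Pex M r z0 v c e G (x, y, t) := fun w hw => hzm hw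
  have hpos : 0 < D2 u (x, y, t) - Pex M r z0 v c e G (x, y, t) := by
    refine lt_of_lt_of_le ?_ (hmx _ hw1)
    simp only [Pex, D2]
    rw [show ys - t1 • v - c = 0 by rw [sub_sub, hyt, sub_self], show ys + z0 - ys - z0 = 0 by abel,
      show ys + z0 - ys = z0 by abel, norm_zero, hz0]
    have a1 : G t1 ≤ d0 / 2 := by
      simp only [hGd]
      have : d0 / 4 * (t1 - te) ≤ d0 / 4 * 1 := by gcongr; linarith
      linarith
    have a2 : d0 ≤ e t1 * r ^ 4 := by rw [hd0]; gcongr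
    have a3 : e t1 * ((r ^ 2 - 0 ^ 2) ^ 2 * (1 - 0 ^ 2 / r ^ 2)) = e t1 * r ^ 4 := by ring
    rw [a3]; linarith
  have hb := hKb x y t hz
  obtain ⟨hk1, hk2, hk3, hk4⟩ := hz
  simp only at hk1 hk2 hk3 hk4
  have hDL : D2 u (x, y, t) ≤ M * ‖x - y‖ := hS x y t hb.1 hb.2.1 hb.2.2.1 hb.2.2.2
  have hGt := hG0 t hk3
  obtain ⟨ρ, hρ⟩ : ∃ ρ, ρ = r ^ 2 - ‖y - t • v - c‖ ^ 2 := ⟨_, rfl⟩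
  obtain ⟨χ, hχ⟩ : ∃ χ, χ = 1 - ‖x - y - z0‖ ^ 2 / r ^ 2 := ⟨_, rfl⟩
  have hPv : Pex M r z0 v c e G (x, y, t) = M * ‖x - y‖ - e t * (ρ ^ 2 * χ) + G t := by rw [hρ, hχ]; rfl
  have hρ0 : 0 ≤ ρ := by rw [hρ]; nlinarith only [hk1, norm_nonneg (y - t • v - c), hr0]
  have hχ0 : 0 ≤ χ := by
    rw [hχ, sub_nonneg, div_le_one (by positivity)]; nlinarith only [hk2, norm_nonneg (x - y - z0)]
  have hχ1 : χ ≤ 1 := by rw [hχ]; have : 0 ≤ ‖x - y - z0‖ ^ 2 / r ^ 2 := by positivity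
                         linarith
  have hρ1 : ρ ≤ 1 := by
    rw [hρ]
    have : r ^ 2 ≤ 1 := pow_le_one₀ hr0.le (by linarith)
    nlinarith only [this, sq_nonneg ‖y - t • v - c‖]
  have hprod : e t * (ρ ^ 2 * χ) ≤ β := by
    have : e t * (ρ ^ 2 * χ) ≤ β * (1 ^ 2 * 1) := by
      have := heβ t hk3
      have := (he0 t).le
      gcongr
    linarith
  rw [hPv] at hpos
  have l1 : ‖y - t • v - c‖ < r := by
    rcases eq_or_lt_of_le hk1 with h | h
    · rw [h, sub_self] at hρ
      rw [hρ] at hpos; simp at hpos; linarith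
    · exact h
  have l2 : ‖x - y - z0‖ < r := by
    rcases eq_or_lt_of_le hk2 with h | h
    · rw [h, div_self (by positivity), sub_self] at hχ
      rw [hχ] at hpos; simp at hpos; linarith
    · exact h
  have l3 : te < t := by
    rcases eq_or_lt_of_le hk3 with h | h
    · exfalso
      rw [← h] at hk1 hpos hprod hGt
      have ey : y - te • v - c = y - xe := by rw [hc]; abel
      rw [ey] at hk1
      have hxz : ‖xe + z0‖ < 1 := by
        have := norm_add_le xe z0
        linarith
      have s1 := hS x (xe + z0) te hb.1 hxz hte (by linarith)
      have s2 := hS xe y te (by linarith) hb.2.1 hte (by linarith)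
      have n1 : ‖x - (xe + z0)‖ ≤ 2 * r := by
        have := norm_add_le (x - y - z0) (y - xe)
        rw [show x - y - z0 + (y - xe) = x - (xe + z0) by abel] at this
        linarith
      have n2 : ‖xe - y‖ ≤ r := by rw [norm_sub_rev]; exact hk1
      have n3 : κ - r ≤ ‖x - y‖ := by
        have := norm_sub_norm_le z0 (z0 - (x - y))
        rw [sub_sub_cancel, norm_sub_rev z0, hz0] at this
        linarith
      have m1 : M * ‖x - (xe + z0)‖ ≤ M * (2 * r) := by gcongr
      have m2 : M * ‖xe - y‖ ≤ M * r := by gcongr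
      have m3 : M * (κ - r) ≤ M * ‖x - y‖ := by gcongr
      have m4 : 4 * M * r ≤ 4 * L * r := by gcongr
      have m5 : D2 u (x, y, te) = u (x, te) - u (y, te) := rfl
      have : 0 < θ * κ := by positivity
      linarith
    · exact h
  have l4 : t < Te := by
    rcases eq_or_lt_of_le hk4 with h | h
    · exfalso
      have : 2 ≤ G t := by
        rw [h] at hk3 ⊢
        have : 0 ≤ d0 / 4 * (Te - te) := mul_nonneg (by positivity) (by linarith)
        simp only [hGd]; linarith
      linarith
    · exact h
  refine hN hu (x := x) (y := y) (t := t) ⟨hb.1, hb.2.2⟩ ⟨hb.2.1, hb.2.2⟩ hM hML hz0 hvn (c := c) (e := e) (G := G) he (he0 t) ((heβ t hk3).trans hβ1)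
    ((heβ t hk3).trans hβ2) hG hG' ?_ ?_ l1 l2
  · have := g1 t
    linarith
  · have ho : IsOpen {w : E × E × ℝ | ‖w.2.1 - w.2.2 • v - c‖ < r ∧ ‖w.1 - w.2.1 - z0‖ < r ∧ te < w.2.2 ∧ w.2.2 < Te} :=
      (isOpen_lt cc1 continuous_const).inter ((isOpen_lt cc2 continuous_const).inter
        ((isOpen_lt continuous_const cc3).inter (isOpen_lt cc3 continuous_const)))
    filter_upwards [ho.mem_nhds (show (x, y, t) ∈ _ from ⟨l1, l2, l3, l4⟩)] with w hw
    exact hmx w ⟨hw.1.le, hw.2.1.le, hw.2.2.1.le, hw.2.2.2.le⟩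
end P5

section P7
variable {E : Type*} [NormedAddCommGroup E] [InnerProductSpace ℝ E] [FiniteDimensional ℝ E]

theorem aff_in {x0 : E} {r R τ : ℝ} (hr : 0 < r) (hx : ‖x0‖ + r ≤ R) (hτ : r ^ 2 ≤ τ) :
    ∀ z ∈ Cyl E 1 1, aff (x0, 0) r (r ^ 2) z ∈ Cyl E R τ := by
  rintro ⟨x, t⟩ ⟨h1, h2, h3⟩
  dsimp only at h1 h2 h3
  have a1 := norm_add_le x0 (r • x)
  rw [norm_smul, Real.norm_of_nonneg hr.le] at a1
  refine ⟨?_, ?_, ?_⟩ <;> simp only [aff]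
  · nlinarith
  · nlinarith [pow_pos hr 2]
  · nlinarith [pow_pos hr 2]

theorem SpL.resc {u : E × ℝ → ℝ} {M R τ : ℝ} (h : SpL u M R τ) {x0 : E} {r : ℝ} (hr : 0 < r) (hx : ‖x0‖ + r ≤ R)
    (hτ : r ^ 2 ≤ τ) : SpL (fun z => (1 / r) * u (aff (x0, 0) r (r ^ 2) z)) M 1 1 := by
  intro x y t hx1 hy1 ht ht0
  have i1 := aff_in hr hx hτ (x, t) ⟨hx1, ht, ht0⟩
  have i2 := aff_in hr hx hτ (y, t) ⟨hy1, ht, ht0⟩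
  have := h _ _ _ i1.1 i2.1 i1.2.1 i1.2.2
  simp only [aff] at this ⊢
  rw [show x0 + r • x - (x0 + r • y) = r • (x - y) by module, norm_smul, Real.norm_of_nonneg hr.le] at this
  rw [← mul_sub, one_div, inv_mul_le_iff₀ hr]
  linarith

/-- oscillation in time at a small scale -/
theorem time_osc {γ p : ℝ} {C : ℝ} (hC : ∀ {ε A : ℝ} {u : E × ℝ → ℝ}, 0 ≤ ε → 0 < A → VisS γ p ε u (Cyl E 1 1) →
      SpL u A 1 1 → ∀ s t, -1 < s → s < 0 → -1 < t → t < 0 → u (0, t) - u (0, s) ≤ C * (A ^ (γ + 1) + A + ε))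
    {u : E × ℝ → ℝ} {ε M R τ : ℝ} (hε : 0 ≤ ε) (hM : 0 < M) (hu : VisS γ p ε u (Cyl E R τ)) (h : SpL u M R τ) {x0 : E} {r : ℝ}
    (hr : 0 < r) (hx : ‖x0‖ + r ≤ R) (hτ : r ^ 2 ≤ τ) {s t : ℝ} (hs : -r ^ 2 < s) (hs0 : s < 0) (ht : -r ^ 2 < t) (ht0 : t < 0) :
    u (x0, t) - u (x0, s) ≤ r * (C * (M ^ (γ + 1) + M + r * ε)) := by
  have h2 := pow_pos hr 2
  have v := scaleL hu (x0, 0) hr (Cyl_open 1 1) (aff_in hr hx hτ)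
  have := hC (by positivity) hM v (h.resc hr hx hτ) (s / r ^ 2) (t / r ^ 2) (by rw [lt_div_iff₀ h2]; linarith) (by rw [div_lt_iff₀ h2]; linarith)
    (by rw [lt_div_iff₀ h2]; linarith) (by rw [div_lt_iff₀ h2]; linarith)
  simp only [aff, smul_zero, add_zero, zero_add] at this
  rw [mul_div_cancel₀ _ h2.ne', mul_div_cancel₀ _ h2.ne', ← mul_sub, one_div, inv_mul_le_iff₀ hr] at this
  exact this

theorem norm_shift {e v : E} (he : ‖e‖ = 1) {s : ℝ} (hs : 0 < s) : ‖s • e + v‖ ≤ s + ⟪e, v⟫ + ‖v‖ ^ 2 / (2 * s) := by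
  have h1 : ‖s • e + v‖ ^ 2 = s ^ 2 + 2 * s * ⟪e, v⟫ + ‖v‖ ^ 2 := by
    rw [norm_add_sq_real, norm_smul, he, Real.norm_of_nonneg hs.le, real_inner_smul_left]; ring
  have h2 : 2 * s * ‖s • e + v‖ ≤ s ^ 2 + ‖s • e + v‖ ^ 2 := by nlinarith [sq_nonneg (s - ‖s • e + v‖)]
  have h3 : s + ⟪e, v⟫ + ‖v‖ ^ 2 / (2 * s) = (2 * s ^ 2 + 2 * s * ⟪e, v⟫ + ‖v‖ ^ 2) / (2 * s) := by field_simp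
  rw [h3, le_div_iff₀ (by positivity)]
  nlinarith

/-- almost maximal slope in one direction gives flatness at one time -/
theorem flatA {g : E → ℝ} {M κ θ lam : ℝ} (hM : ∀ x y, ‖x‖ < 1 → ‖y‖ < 1 → g x - g y ≤ M * ‖x - y‖) {e : E} (he : ‖e‖ = 1)
    (hM0 : 0 ≤ M) (hκ : 0 < κ) {j : ℕ} (hj : j * κ = 1 / 8) (hl : lam ≤ 1 / 4)
    (h : ∀ x, ‖x‖ < 1 / 2 → (M - θ) * κ ≤ g x - g (x + κ • e)) {x y : E} (hx : ‖x‖ < lam) (hy : ‖y‖ < lam) :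
    g x - g y - ⟪M • (-e), x - y⟫ ≤ 16 * M * lam ^ 2 + θ / 8 := by
  have hs : ∀ i : ℕ, i * κ ≤ 1 / 8 → i * ((M - θ) * κ) ≤ g y - g (y + (i * κ) • e) ∧ ‖y + (i * κ) • e‖ < 1 / 2 := by
    have hn : ∀ i : ℕ, i * κ ≤ 1 / 8 → ‖y + (i * κ) • e‖ < 1 / 2 := by
      intro i hi
      have := norm_add_le y ((i * κ) • e)
      rw [norm_smul, he, Real.norm_of_nonneg (by positivity)] at this
      linarith
    intro i hi
    refine ⟨?_, hn i hi⟩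
    induction i with
    | zero => simp
    | succ i ih =>
      push_cast at hi ⊢
      have hi' : (i : ℝ) * κ ≤ 1 / 8 := by linarith
      have a1 := ih hi'
      have a2 := h _ (hn i hi')
      rw [show y + (i * κ) • e + κ • e = y + ((i + 1) * κ) • e by module] at a2
      linarith
  obtain ⟨h1, h2⟩ := hs j hj.le
  rw [hj] at h1 h2
  have h3 := hM x (y + (1 / 8 : ℝ) • e) (by linarith) (by linarith)
  have h4 := norm_shift (v := y - x) he (s := 1 / 8) (by norm_num)
  rw [show x - (y + (1 / 8 : ℝ) • e) = -((1 / 8 : ℝ) • e + (y - x)) by module, norm_neg] at h3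
  have h5 := mul_le_mul_of_nonneg_left h4 hM0
  have h6 : ‖y - x‖ ≤ 2 * lam := by linarith [norm_sub_le y x]
  have h7 : ‖y - x‖ ^ 2 ≤ 4 * lam ^ 2 := by nlinarith [norm_nonneg (y - x)]
  have h8 : ⟪M • (-e), x - y⟫ = M * ⟪e, y - x⟫ := by
    rw [real_inner_smul_left, inner_neg_left, ← inner_neg_right, neg_sub]
  have h9 : (j : ℝ) * ((M - θ) * κ) = (M - θ) / 8 := by rw [mul_comm (M - θ), ← mul_assoc, hj]; ring
  rw [h8]
  rw [h9] at h1
  have h10 := mul_le_mul_of_nonneg_left h7 hM0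
  norm_num at h5
  linarith

set_option maxHeartbeats 2000000 in
/-- dichotomy: the Lipschitz constant drops or the function is flat -/
theorem dich {γ p c1 C2 ν0 : ℝ} (hγ : -1 < γ) (hγ0 : γ < 0) (hp : 1 < p)
    (hc1 : 0 < c1) (hC2 : 0 < C2) (hν0 : 0 < ν0) (hM : Mst E γ p c1 C2 ν0)
    {m0 L ε' : ℝ} (hm0 : 0 < m0) (hL : m0 ≤ L) (hL1 : 1 ≤ L) (hε' : 0 < ε') (hε1 : ε' ≤ 1) :
    ∃ lam > 0, lam ≤ 1 / 4 ∧ ∃ d > 0, ∃ ε > 0, ∀ {u : E × ℝ → ℝ} {M : ℝ}, VisS γ p ε u (Cyl E 1 1) → SpL u M 1 1 →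
      m0 ≤ M → M ≤ L → (∃ r > 0, r = d ∧ r ≤ 1 / 4 ∧ SpL u (M - d) r (r ^ 2)) ∨
      ∃ e : E, ‖e‖ = 1 ∧ ∀ x y t, ‖x‖ < lam → ‖y‖ < lam → -lam ^ 2 < t → t < 0 →
        u (x, t) - u (y, t) - ⟪M • e, x - y⟫ ≤ ε' * lam := by
  obtain ⟨C, hC1, hC⟩ := time0 E hγ hγ0 hp
  obtain ⟨lam, hlam⟩ : ∃ l, l = ε' / (64 * L) := ⟨_, rfl⟩
  have hlam0 : 0 < lam := by rw [hlam]; positivity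
  have hlamL : 64 * L * lam = ε' := by rw [hlam]; field_simp
  have hlam4 : lam ≤ 1 / 4 := by nlinarith
  obtain ⟨K, hK⟩ : ∃ K, K = C * (L ^ (γ + 1) + L + 1) := ⟨_, rfl⟩
  have hLg : 0 < L ^ (γ + 1) := rpow_pos_of_pos (by linarith) _
  have hK0 : 0 < K := by rw [hK]; positivity
  obtain ⟨r, hr⟩ : ∃ r, r = min lam (ε' * lam / (4 * K)) := ⟨_, rfl⟩
  have hr0 : 0 < r := by rw [hr]; positivity
  have hrl : r ≤ lam := by rw [hr]; exact min_le_left _ _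
  have hrK : r * K ≤ ε' * lam / 4 := by
    have : r ≤ ε' * lam / (4 * K) := by rw [hr]; exact min_le_right _ _
    rw [le_div_iff₀ (by positivity)] at this
    linarith
  obtain ⟨T, hT⟩ : ∃ T, T = r ^ 2 / 2 := ⟨_, rfl⟩
  have hT0 : 0 < T := by rw [hT]; positivity
  have hT1 : T ≤ 1 / 8 := by rw [hT]; nlinarith
  have hLγ : 0 < L ^ γ := rpow_pos_of_pos (by linarith) _
  obtain ⟨k0, hk0, hk1, hk2, hk3, hk4⟩ : ∃ k0 > 0, k0 ≤ 1 ∧ 4 * k0 ≤ ν0 ∧ 96 * C2 * k0 ≤ c1 ∧ 16 * k0 ≤ T * (L ^ γ * c1) := by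
    refine ⟨min (min 1 (ν0 / 4)) (min (c1 / (96 * C2)) (T * (L ^ γ * c1) / 16)), by positivity, ?_, ?_, ?_, ?_⟩
    · exact (min_le_left _ _).trans (min_le_left _ _)
    · have := (min_le_left (min 1 (ν0 / 4)) (min (c1 / (96 * C2)) (T * (L ^ γ * c1) / 16))).trans (min_le_right _ _)
      linarith
    · have := (min_le_right (min 1 (ν0 / 4)) (min (c1 / (96 * C2)) (T * (L ^ γ * c1) / 16))).trans (min_le_left _ _)
      rw [le_div_iff₀ (by positivity)] at this
      linarith
    · have := (min_le_right (min 1 (ν0 / 4)) (min (c1 / (96 * C2)) (T * (L ^ γ * c1) / 16))).trans (min_le_right _ _)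
      linarith
  obtain ⟨j, hj⟩ := exists_nat_gt (1 / (8 * k0))
  have hj0 : (0 : ℝ) < j := lt_trans (by positivity) hj
  have hj1 : (1 : ℝ) ≤ j := by exact_mod_cast hj0
  obtain ⟨κ, hκ⟩ : ∃ κ : ℝ, κ = 1 / (8 * j) := ⟨_, rfl⟩
  have hκ0 : 0 < κ := by rw [hκ]; positivity
  have hjκ : j * κ = 1 / 8 := by rw [hκ]; field_simp
  have hκ8 : κ ≤ 1 / 8 := by nlinarith
  have hκk : κ ≤ k0 := by
    rw [div_lt_iff₀ (by positivity)] at hj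
    rw [hκ, div_le_iff₀ (by positivity)]
    linarith
  have hκsq : κ ^ 2 ≤ k0 := by nlinarith
  obtain ⟨θ, hθ⟩ : ∃ θ, θ = ε' * lam := ⟨_, rfl⟩
  have hθ0 : 0 < θ := by rw [hθ]; positivity
  have hθL : θ ≤ L := by rw [hθ]; nlinarith
  obtain ⟨d1, hd1, ε1, hε1', hexp⟩ := expand E hγ hγ0 hp hm0 hL hκ0 hκ8 hθ0 hθL hT0
  obtain ⟨θ2, hθ2⟩ : ∃ θ2, θ2 = min (d1 / κ) (m0 / 4) := ⟨_, rfl⟩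
  have hθ20 : 0 < θ2 := by rw [hθ2]; positivity
  have hθ2d : θ2 * κ ≤ d1 := by
    rw [← le_div_iff₀ hκ0, hθ2]; exact min_le_left _ _
  have hθ2m : θ2 ≤ m0 / 4 := by rw [hθ2]; exact min_le_right _ _
  obtain ⟨ε, hε, hεa, hεb, hεc⟩ : ∃ ε > 0, ε ≤ ε1 ∧ ε ≤ 1 ∧ 2 * ε < L ^ γ * (c1 * θ2 / (4 * κ)) := by
    have h1 : 0 < L ^ γ * (c1 * θ2 / (4 * κ)) := by positivity
    refine ⟨min (min ε1 1) (L ^ γ * (c1 * θ2 / (4 * κ)) / 4), by positivity, ?_, ?_, ?_⟩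
    · exact (min_le_left _ _).trans (min_le_left _ _)
    · exact (min_le_left _ _).trans (min_le_right _ _)
    · have := min_le_right (min ε1 1) (L ^ γ * (c1 * θ2 / (4 * κ)) / 4)
      linarith
  refine ⟨lam, hlam0, hlam4, min (θ2 / 2) (r / 4), by positivity, ε, hε, ?_⟩
  intro u M hu hLip hmM hML
  have hM0 : 0 < M := by linarith
  by_cases hA : ∃ e : E, ‖e‖ = 1 ∧ ∀ x t, ‖x‖ < 1 / 2 → -1 < t → t ≤ -T → (M - θ) * κ ≤ u (x, t) - u (x + κ • e, t)
  · right
    obtain ⟨e, he, hA⟩ := hA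
    refine ⟨-e, by rw [norm_neg, he], ?_⟩
    have key : ∀ x y t, ‖x‖ < lam → ‖y‖ < lam → -1 < t → t ≤ -T → u (x, t) - u (y, t) - ⟪M • (-e), x - y⟫ ≤ ε' * lam / 2 := by
      intro x y t hx hy ht htT
      have := flatA (g := fun x => u (x, t)) (fun x y hx hy => hLip x y t hx hy ht (by linarith)) he hM0.le hκ0 hjκ hlam4
        (fun x hx => hA x t hx ht htT) hx hy
      have e1 : M * lam ^ 2 ≤ L * lam ^ 2 := mul_le_mul_of_nonneg_right hML (by positivity)
      have e2 : 64 * (L * lam ^ 2) = ε' * lam := by rw [← hlamL]; ring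
      linarith
    intro x y t hx hy ht ht0
    have hlam1 : lam ^ 2 ≤ 1 / 16 := by nlinarith
    rcases le_or_gt t (-T) with h | h
    · have := key x y t hx hy (by linarith) h
      linarith [mul_pos hε' hlam0]
    · have hbd : ∀ x, ‖x‖ < lam → ∀ s t, -r ^ 2 < s → s < 0 → -r ^ 2 < t → t < 0 → u (x, t) - u (x, s) ≤ ε' * lam / 4 := by
        intro x hx s t hs hs0 ht ht0
        refine (time_osc (fun a b => hC a b) hε.le hM0 hu hLip hr0 (by linarith) (by nlinarith) hs hs0 ht ht0).trans ?_
        refine le_trans ?_ hrK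
        rw [hK]
        have : M ^ (γ + 1) ≤ L ^ (γ + 1) := rpow_le_rpow hM0.le hML (by linarith)
        have : r * ε ≤ 1 := by nlinarith
        gcongr
      have b1 := hbd x hx (-T) t (by linarith) (by linarith) (by linarith) ht0
      have b2 := hbd y hy t (-T) (by linarith) ht0 (by linarith) (by linarith)
      have b3 := key x y (-T) hx hy (by linarith) le_rfl
      linarith
  · left
    push Not at hA
    have hdr := drop_est hγ0 hc1 hC2 hν0 hM (ε := ε) (M := M) (θ := θ2) (κ := κ) (Θ := 4 / T) (τ := T / 2) hM0 hθ20 (by linarith) hκ0 hκ8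
      (by positivity) (by rw [one_div_div]; linarith) (by linarith) (by linarith) (by nlinarith) ?_ hu hLip ?_
    · rw [one_div_div] at hdr
      have m1 := min_le_left (θ2 / 2) (r / 4)
      have m2 := min_le_right (θ2 / 2) (r / 4)
      have m0 : 0 < min (θ2 / 2) (r / 4) := by positivity
      refine ⟨_, m0, rfl, by linarith, hdr.mono (by linarith) (by linarith) ?_⟩
      nlinarith
    · have a1 : L ^ γ ≤ M ^ γ := rpow_le_rpow_of_nonpos hM0 hML hγ0.le
      have a2 : θ2 * κ * (4 / T) ≤ L ^ γ * (c1 * θ2 / (4 * κ)) := by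
        rw [mul_div_assoc', mul_div_assoc', div_le_div_iff₀ hT0 (by positivity)]
        have : 16 * κ ^ 2 ≤ T * (L ^ γ * c1) := by linarith
        nlinarith [mul_le_mul_of_nonneg_left this hθ20.le]
      have a3 : L ^ γ * (c1 * θ2 / (2 * κ)) = 2 * (L ^ γ * (c1 * θ2 / (4 * κ))) := by field_simp; ring
      have a4 : L ^ γ * (c1 * θ2 / (2 * κ)) ≤ M ^ γ * (c1 * θ2 / (2 * κ)) := mul_le_mul_of_nonneg_right a1 (by positivity)
      linarith
    · intro x y t hx hxy ht ht0
      obtain ⟨xe, te, hx1, hx2, hx3, hx4⟩ := hA (κ⁻¹ • (y - x)) (by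
        rw [norm_smul, norm_inv, Real.norm_of_nonneg hκ0.le, norm_sub_rev, hxy, inv_mul_cancel₀ hκ0.ne'])
      rw [smul_smul, mul_inv_cancel₀ hκ0.ne', one_smul] at hx4
      have := hexp ((hu.le hεa).neg) hLip.neg hmM hML (z0 := y - x) (by rw [norm_sub_rev, hxy]) hx1 hx2 hx3 (by linarith) x t hx ht.le ht0
      rw [show x + (y - x) = y by abel] at this
      linarith
end P7

section P8
variable {E : Type*} [NormedAddCommGroup E] [InnerProductSpace ℝ E] [FiniteDimensional ℝ E]

def FlatAt (u : E × ℝ → ℝ) (l : E) (r a : ℝ) : Prop :=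
  ∀ z ∈ Cyl E r (r ^ 2), ∀ z' ∈ Cyl E r (r ^ 2), (u z - ⟪l, z.1⟫) - (u z' - ⟪l, z'.1⟫) ≤ a * r

theorem FlatAt.resc {u : E × ℝ → ℝ} {l : E} {s r a : ℝ} (hs : 0 < s)
    (h : FlatAt (fun z => (1 / s) * u (aff (0, 0) s (s ^ 2) z)) l (r / s) a) : FlatAt u l r a := by
  have hs2 := pow_pos hs 2
  have hin : ∀ z ∈ Cyl E r (r ^ 2), ((1 / s) • z.1, z.2 / s ^ 2) ∈ Cyl E (r / s) ((r / s) ^ 2) := by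
    rintro ⟨x, t⟩ ⟨h1, h2, h3⟩
    dsimp only at h1 h2 h3
    refine ⟨?_, ?_, ?_⟩
    · dsimp only
      rw [norm_smul, Real.norm_of_nonneg (by positivity), one_div_mul_eq_div]
      gcongr
    · dsimp only
      rw [div_pow, ← neg_div]
      gcongr
    · dsimp only
      exact div_neg_of_neg_of_pos h3 hs2
  have hev : ∀ z : E × ℝ, aff (0, 0) s (s ^ 2) ((1 / s) • z.1, z.2 / s ^ 2) = z := by
    rintro ⟨x, t⟩
    simp only [aff, zero_add, smul_smul]
    rw [mul_one_div_cancel hs.ne', one_smul, mul_div_cancel₀ _ hs2.ne']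
  intro z hz z' hz'
  have := h _ (hin z hz) _ (hin z' hz')
  simp only [hev, real_inner_smul_right] at this
  rw [← mul_sub, ← mul_sub, ← mul_sub, one_div, inv_mul_le_iff₀ hs, ← mul_assoc, mul_comm s a, mul_assoc, mul_div_cancel₀ _ hs.ne'] at this
  exact this

theorem flat_of {u : E × ℝ → ℝ} {l : E} {r a A K : ℝ} (hr : 0 < r)
    (h1 : ∀ x t, ‖x‖ < 1 → -1 < t → t < 0 → |u (x, t) - u (0, t) - ⟪l, x⟫| ≤ A)
    (h2 : ∀ s t, -1 < s → s < 0 → -1 < t → t < 0 → u (0, t) - u (0, s) ≤ K) (ha : 2 * A + K ≤ a) : FlatAt u l 1 a := by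
  rintro ⟨x, t⟩ ⟨a1, a2, a3⟩ ⟨y, s⟩ ⟨b1, b2, b3⟩
  dsimp only at *
  rw [one_pow] at a2 b2
  have c1 := abs_le.1 (h1 x t a1 a2 a3)
  have c2 := abs_le.1 (h1 y s b1 b2 b3)
  have := h2 s t b2 b3 a2 a3
  linarith [c1.2, c2.1]

/-- flat at one scale gives flat at all smaller scales -/
theorem flatF {γ p c1 C2 ν0 : ℝ} (hγ : -1 < γ) (hγ0 : γ < 0) (hp : 1 < p)
    (hc1 : 0 < c1) (hC2 : 0 < C2) (hν0 : 0 < ν0) (hM : Mst E γ p c1 C2 ν0)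
    {m0 L a : ℝ} (hm0 : 0 < m0) (hL : m0 ≤ L) (ha : 0 < a) :
    ∃ ε > 0, ∀ {u : E × ℝ → ℝ} {l : E}, VisS γ p ε u (Cyl E 1 1) → SpL u L 1 1 → m0 ≤ ‖l‖ → ‖l‖ ≤ L →
      (∀ x y t, ‖x‖ < 1 → ‖y‖ < 1 → -1 < t → t < 0 → u (x, t) - u (y, t) - ⟪l, x - y⟫ ≤ ε) →
      ∀ r, 0 < r → r ≤ 1 / 2 → FlatAt u l r a := by
  obtain ⟨K, hK⟩ : ∃ K, K = 5 + 32 * (Module.finrank ℝ E * p) * m0 ^ γ := ⟨_, rfl⟩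
  have hmγ : 0 < m0 ^ γ := rpow_pos_of_pos hm0 _
  have hp0 : 0 < p := by linarith
  have hK0 : 0 < K := by rw [hK]; positivity
  obtain ⟨m1, hm1⟩ : ∃ m1, m1 = min (m0 / 16) (a / (2 * K)) := ⟨_, rfl⟩
  have hm10 : 0 < m1 := by rw [hm1]; positivity
  have hm1a : 16 * m1 ≤ m0 := by
    have : m1 ≤ m0 / 16 := by rw [hm1]; exact min_le_left _ _
    linarith
  have hm1b : m1 * K ≤ a / 2 := by
    have : m1 ≤ a / (2 * K) := by rw [hm1]; exact min_le_right _ _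
    rw [le_div_iff₀ (by positivity)] at this
    linarith
  obtain ⟨ε0, hε0, hF⟩ := lip_flat hγ hγ0 hc1 hC2 hν0 hM hm0 hm10 hL
  refine ⟨min ε0 (a / 2), by positivity, ?_⟩
  intro u l hu hLip hl hlL hf r hr hr2
  have hε : min ε0 (a / 2) ≤ ε0 := min_le_left _ _
  have hε2 : min ε0 (a / 2) ≤ a / 2 := min_le_right _ _
  have hε3 : 0 < min ε0 (a / 2) := by positivity
  generalize min ε0 (a / 2) = ε at *
  have h1 := hF (hu.le hε) hLip hl hlL (fun x y t a b c d => (hf x y t a b c d).trans hε)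
  refine FlatAt.resc hr ?_
  rw [div_self hr.ne']
  have v := scaleL hu (0, 0) hr (Cyl_open 1 1) (aff_in hr (by rw [norm_zero]; linarith) (by nlinarith))
  have hfl : ∀ x t, ‖x‖ < 1 → -1 < t → t < 0 → |(1 / r) * u (aff (0, 0) r (r ^ 2) (x, t)) - (1 / r) * u (aff (0, 0) r (r ^ 2) (0, t)) - ⟪l, x⟫| ≤ m1 := by
    intro x t hx ht ht0
    have i1 := aff_in (x0 := (0 : E)) (R := 1 / 2) (τ := 1 / 2) hr (by rw [norm_zero]; linarith) (by nlinarith) (x, t) ⟨hx, ht, ht0⟩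
    have i2 := aff_in (x0 := (0 : E)) (R := 1 / 2) (τ := 1 / 2) hr (by rw [norm_zero]; linarith) (by nlinarith) (0, t) ⟨by simp, ht, ht0⟩
    have j1 := h1 _ _ _ i1.1 i2.1 i1.2.1 i1.2.2
    have j2 := h1 _ _ _ i2.1 i1.1 i1.2.1 i1.2.2
    simp only [aff, zero_add, smul_zero, sub_zero, zero_sub, inner_neg_right, norm_neg, real_inner_smul_right, norm_smul, Real.norm_of_nonneg hr.le] at j1 j2 ⊢
    have e1 : m1 * (r * ‖x‖) ≤ r * m1 := by nlinarith [mul_pos hr hm10]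
    rw [show 1 / r * u (r • x, r ^ 2 * t) - 1 / r * u (0, r ^ 2 * t) - ⟪l, x⟫ = (u (r • x, r ^ 2 * t) - u (0, r ^ 2 * t) - r * ⟪l, x⟫) / r by field_simp,
      abs_le, le_div_iff₀ hr, div_le_iff₀ hr]
    constructor <;> linarith
  refine flat_of (K := 3 * m1 + r * ε + 32 * (Module.finrank ℝ E * p) * m1 * ‖l‖ ^ γ) hr hfl
    (fun s t hs hs0 ht ht0 => time1 hγ hγ0 hp (by positivity) v hm10 (by linarith) hfl hs hs0 ht ht0) ?_
  have g1 : ‖l‖ ^ γ ≤ m0 ^ γ := rpow_le_rpow_of_nonpos hm0 hl hγ0.le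
  have g2 : 32 * (Module.finrank ℝ E * p) * m1 * ‖l‖ ^ γ ≤ 32 * (Module.finrank ℝ E * p) * m1 * m0 ^ γ :=
    mul_le_mul_of_nonneg_left g1 (by positivity)
  have g3 : m1 * K = 5 * m1 + 32 * (Module.finrank ℝ E * p) * m1 * m0 ^ γ := by rw [hK]; ring
  have g4 : r * ε ≤ a / 2 := by nlinarith
  linarith

/-- the conclusion for all functions of Lipschitz constant at most `M` -/
def Good (E : Type*) [NormedAddCommGroup E] [InnerProductSpace ℝ E] [FiniteDimensional ℝ E] (γ p a L M : ℝ) : Prop :=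
  ∃ r0 > 0, r0 ≤ 1 / 2 ∧ ∃ ε > 0, ∀ {u : E × ℝ → ℝ} {M' : ℝ}, M' ≤ M → VisS γ p ε u (Cyl E 1 1) → SpL u M' 1 1 →
    ∀ r, 0 < r → r ≤ r0 → ∃ l : E, ‖l‖ ≤ L ∧ FlatAt u l r a

theorem good_base {γ p a L : ℝ} (hγ : -1 < γ) (hγ0 : γ < 0) (hp : 1 < p) (hL : 0 ≤ L) (ha : 0 < a) :
    ∃ m0 > 0, m0 ≤ 1 ∧ Good E γ p a L m0 := by
  obtain ⟨C, hC1, hC⟩ := time0 E hγ hγ0 hp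
  obtain ⟨b, hb⟩ : ∃ b, b = a / (8 * C) := ⟨_, rfl⟩
  have hC0 : 0 < C := by linarith
  have hb0 : 0 < b := by rw [hb]; positivity
  have hbC : 8 * C * b = a := by rw [hb]; field_simp
  have hg : 0 < γ + 1 := by linarith
  obtain ⟨m0, hm0⟩ : ∃ m0, m0 = min (min 1 b) (b ^ (1 / (γ + 1))) := ⟨_, rfl⟩
  have hm00 : 0 < m0 := by rw [hm0]; positivity
  have hm01 : m0 ≤ 1 := by rw [hm0]; exact (min_le_left _ _).trans (min_le_left _ _)
  have hm0b : m0 ≤ b := by rw [hm0]; exact (min_le_left _ _).trans (min_le_right _ _)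
  have hm0c : m0 ^ (γ + 1) ≤ b := by
    have : m0 ≤ b ^ (1 / (γ + 1)) := by rw [hm0]; exact min_le_right _ _
    have := rpow_le_rpow hm00.le this hg.le
    rwa [← rpow_mul hb0.le, one_div_mul_cancel hg.ne', rpow_one] at this
  refine ⟨m0, hm00, hm01, 1 / 2, by norm_num, le_rfl, b, hb0, ?_⟩
  intro u M' hM' hu hLip r hr hr2
  refine ⟨0, by simpa using hL, FlatAt.resc hr ?_⟩
  rw [div_self hr.ne']
  have v := scaleL hu (0, 0) hr (Cyl_open 1 1) (aff_in hr (by rw [norm_zero]; linarith) (by nlinarith))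
  have hS := (hLip.mono hM' le_rfl le_rfl).resc (x0 := 0) hr (by rw [norm_zero]; linarith) (by nlinarith)
  refine flat_of (A := m0) (K := C * (m0 ^ (γ + 1) + m0 + r * b)) hr ?_ (fun s t hs hs0 ht ht0 => hC (by positivity) hm00 v hS s t hs hs0 ht ht0) ?_
  · intro x t hx ht ht0
    have j1 := hS x 0 t hx (by simp) ht ht0
    have j2 := hS 0 x t (by simp) hx ht ht0
    rw [zero_sub, norm_neg] at j2
    rw [sub_zero] at j1
    rw [inner_zero_left, sub_zero, abs_le]
    constructor <;> nlinarith
  · have : m0 ^ (γ + 1) + m0 + r * b ≤ 3 * b := by nlinarith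
    have := mul_le_mul_of_nonneg_left this hC0.le
    nlinarith

set_option maxHeartbeats 1000000 in
theorem good_all {γ p c1 C2 ν0 : ℝ} (hγ : -1 < γ) (hγ0 : γ < 0) (hp : 1 < p)
    (hc1 : 0 < c1) (hC2 : 0 < C2) (hν0 : 0 < ν0) (hM : Mst E γ p c1 C2 ν0)
    {L a : ℝ} (hL1 : 1 ≤ L) (ha : 0 < a) : Good E γ p a L L := by
  obtain ⟨m0, hm0, hm01, hG⟩ := good_base (E := E) (L := L) hγ hγ0 hp (by linarith) ha
  have hL : m0 ≤ L := by linarith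
  obtain ⟨εF, hεF, hF⟩ := flatF hγ hγ0 hp hc1 hC2 hν0 hM hm0 hL ha
  obtain ⟨lam, hlam, hlam4, d, hd, εD, hεD, hD⟩ := dich hγ hγ0 hp hc1 hC2 hν0 hM hm0 hL hL1 (ε' := min εF 1) (by positivity) (min_le_right _ _)
  have step : ∀ M, m0 ≤ M → Good E γ p a L M → Good E γ p a L (min (M + d) L) := by
    rintro M hmM ⟨r0, hr0, hr02, ε, hε, hg⟩
    refine ⟨min (min r0 (r0 * d)) (lam / 2), by positivity, ((min_le_left _ _).trans (min_le_left _ _)).trans hr02, min (min ε εF) εD, by positivity, ?_⟩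
    intro u M' hM' hu hLip r hr hrr
    have e1 : min (min ε εF) εD ≤ ε := (min_le_left _ _).trans (min_le_left _ _)
    have e2 : min (min ε εF) εD ≤ εF := (min_le_left _ _).trans (min_le_right _ _)
    have e3 : min (min ε εF) εD ≤ εD := min_le_right _ _
    have e4 : 0 < min (min ε εF) εD := by positivity
    have r1 : r ≤ r0 := (hrr.trans (min_le_left _ _)).trans (min_le_left _ _)
    have r2 : r ≤ r0 * d := (hrr.trans (min_le_left _ _)).trans (min_le_right _ _)
    have r3 : r ≤ lam / 2 := hrr.trans (min_le_right _ _)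
    have hM1 : M' ≤ M + d := hM'.trans (min_le_left _ _)
    have hM2 : M' ≤ L := hM'.trans (min_le_right _ _)
    generalize min (min ε εF) εD = ε2 at *
    rcases le_or_gt M' M with h | h
    · exact hg h (hu.le e1) hLip r hr r1
    rcases hD (hu.le e3) hLip (by linarith) hM2 with ⟨s, hs, hsd, hs4, hS⟩ | ⟨e, he, hfl⟩
    · subst hsd
      have v := scaleL hu (0, 0) hs (Cyl_open 1 1) (aff_in hs (by rw [norm_zero]; linarith) (by nlinarith))
      obtain ⟨l, hl, hfl⟩ := hg (M' := M' - s) (by linarith) (v.le (by nlinarith)) (hS.resc hs (by rw [norm_zero]; linarith) le_rfl) (r / s) (by positivity)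
        (by rw [div_le_iff₀ hs]; exact r2)
      exact ⟨l, hl, hfl.resc hs⟩
    · have v := scaleL hu (0, 0) hlam (Cyl_open 1 1) (aff_in hlam (by rw [norm_zero]; linarith) (by nlinarith))
      have hln : ‖M' • e‖ = M' := by rw [norm_smul, he, mul_one, Real.norm_of_nonneg (by linarith)]
      refine ⟨M' • e, by rw [hln]; exact hM2, FlatAt.resc hlam ?_⟩
      refine hF (v.le (by nlinarith)) ((hLip.mono hM2 le_rfl le_rfl).resc hlam (by rw [norm_zero]; linarith) (by nlinarith)) (by rw [hln]; linarith)
        (by rw [hln]; exact hM2) ?_ (r / lam) (by positivity) (by rw [div_le_iff₀ hlam]; linarith)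
      intro x y t hx hy ht ht0
      have i1 := aff_in (x0 := (0 : E)) hlam (by rw [norm_zero, zero_add]) le_rfl (x, t) ⟨hx, ht, ht0⟩
      have i2 := aff_in (x0 := (0 : E)) hlam (by rw [norm_zero, zero_add]) le_rfl (y, t) ⟨hy, ht, ht0⟩
      have := hfl _ _ _ i1.1 i2.1 i1.2.1 i1.2.2
      simp only [aff, zero_add] at this ⊢
      rw [← smul_sub, real_inner_smul_right] at this
      rw [show 1 / lam * u (lam • x, lam ^ 2 * t) - 1 / lam * u (lam • y, lam ^ 2 * t) - ⟪M' • e, x - y⟫ =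
        (u (lam • x, lam ^ 2 * t) - u (lam • y, lam ^ 2 * t) - lam * ⟪M' • e, x - y⟫) / lam by field_simp, div_le_iff₀ hlam]
      exact this.trans (mul_le_mul_of_nonneg_right (min_le_left _ _) hlam.le)
  have all : ∀ N : ℕ, Good E γ p a L (min (m0 + N * d) L) := by
    intro N
    induction N with
    | zero => simpa [min_eq_left hL] using hG
    | succ N ih =>
      have := step _ (le_min (by nlinarith [mul_nonneg (Nat.cast_nonneg (α := ℝ) N) hd.le]) hL) ih
      have e : min (min (m0 + N * d) L + d) L = min (m0 + (N + 1 : ℕ) * d) L := by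
        push_cast
        rcases le_total (m0 + N * d) L with h | h
        · rw [min_eq_left h]; congr 1; ring
        · rw [min_eq_right h, min_eq_right (by linarith), min_eq_right (by linarith)]
      rwa [e] at this
  obtain ⟨N, hN⟩ := exists_nat_gt (L / d)
  have := all N
  rw [div_lt_iff₀ hd] at hN
  rwa [min_eq_right (by linarith)] at this

theorem main0 (E : Type*) [NormedAddCommGroup E] [InnerProductSpace ℝ E] [FiniteDimensional ℝ E]
    {γ p a : ℝ} (hγ : -1 < γ) (hγ0 : γ < 0) (hp : 1 < p) (ha : 0 < a) :
    ∃ L ≥ 1, ∃ r0 > 0, r0 ≤ 1 / 4 ∧ ∃ ε > 0, ∀ {u : E × ℝ → ℝ}, VisS γ p ε u (Cyl E 1 1) →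
      (∀ z ∈ Cyl E 1 1, ∀ z' ∈ Cyl E 1 1, u z - u z' ≤ 5) → ∃ l : E, ‖l‖ ≤ L ∧ FlatAt u l r0 a := by
  obtain ⟨c1, hc1, C2, hC2, ν0, hν0, hν1, hM⟩ := master E hγ hγ0 hp
  obtain ⟨L, hL, hLip⟩ := lip_est hγ hγ0 hc1 hC2 hν0 hM
  obtain ⟨r0, hr0, hr02, ε, hε, hG⟩ := good_all hγ hγ0 hp hc1 hC2 hν0 hM hL ha
  refine ⟨L, hL, r0 / 4, by positivity, by linarith, min ε 1, by positivity, ?_⟩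
  intro u hu hosc
  have e1 : min ε 1 ≤ ε := min_le_left _ _
  have e2 : min ε 1 ≤ 1 := min_le_right _ _
  have e3 : 0 < min ε 1 := by positivity
  generalize min ε 1 = ε2 at *
  have hS := hLip (hu.le e2) hosc
  have v := scaleL hu (0, 0) (r := 1 / 4) (by norm_num) (Cyl_open 1 1) (aff_in (by norm_num) (by rw [norm_zero]; norm_num) (by norm_num))
  obtain ⟨l, hl, hf⟩ := hG le_rfl (v.le (by linarith)) (hS.resc (r := 1 / 4) (by norm_num) (by rw [norm_zero]; norm_num) (by norm_num)) r0 hr0 le_rfl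
  refine ⟨l, hl, FlatAt.resc (s := 1 / 4) (by norm_num) ?_⟩
  rwa [show r0 / 4 / (1 / 4) = r0 by ring]
end P8

section P9
variable {n : ℕ}

theorem sub_of_super {γ p : ℝ} {f u : En n × ℝ → ℝ} {Ω : Set (En n × ℝ)} (h : IsSupersol γ p f u Ω) :
    IsSubsol γ p (fun z => -f z) (fun z => -u z) Ω := by
  obtain ⟨h1, h2⟩ := h
  constructor
  · intro z hz φ hφ hg hφz hw
    have hgr : ∀ x t, sGrad (fun w => -φ w) x t = -sGrad φ x t := by
      intro x t
      simp only [sGrad, gradient, fderiv_fun_neg, map_neg]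
    have hH : sHess (fun w => -φ w) z.1 z.2 = -sHess φ z.1 z.2 := by
      simp only [sHess, hgr, fderiv_fun_neg]
    have := h1 z hz (fun w => -φ w) hφ.neg (by rw [hgr]; simpa using hg) (by simp [hφz]) (fun w hw' => by have := hw w hw'; linarith)
    rw [hgr, hH] at this
    have e : opVal γ p (-sGrad φ z.1 z.2) (-sHess φ z.1 z.2) = -opVal γ p (sGrad φ z.1 z.2) (sHess φ z.1 z.2) := by
      simp only [opVal, norm_neg, ContinuousLinearMap.toLinearMap_neg, map_neg, _root_.neg_apply, inner_neg_left, inner_neg_right]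
      ring
    rw [e, deriv.fun_neg] at this
    linarith
  · intro z hz δ hδ φ hφ hφ0 hw hs
    obtain ⟨ε, hε, c, hc⟩ := hs
    have := h2 z hz δ hδ (fun t => -φ t) hφ.neg (by simp [hφ0]) (fun t ht => by have := hw t ht; linarith) ⟨ε, hε, -c, fun x hx => by
      rw [← hc x hx, ← Real.sInf_neg, ← Set.image_neg_eq_neg, Set.image_image]
      congr 2
      ext t; ring⟩
    rw [deriv.fun_neg] at this
    linarith

theorem trace_S {E : Type*} [NormedAddCommGroup E] [InnerProductSpace ℝ E] [FiniteDimensional ℝ E] (A : E →L[ℝ] E →L[ℝ] ℝ) :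
    ∃ S : E →L[ℝ] E, (∀ h k, ⟪S h, k⟫ = A h k + A k h) ∧ LinearMap.trace ℝ E S.toLinearMap = 2 * trB A := by
  have b := stdOrthonormalBasis ℝ E
  refine ⟨∑ i, (A.flip (b i) + A (b i)).smulRight (b i), ?_, ?_⟩
  · intro h k
    simp only [_root_.sum_apply, ContinuousLinearMap.smulRight_apply, sum_inner, real_inner_smul_left, _root_.add_apply, ContinuousLinearMap.flip_apply]
    conv_rhs => rw [← b.sum_repr' k]
    simp only [map_sum, map_smul, _root_.sum_apply, _root_.smul_apply, smul_eq_mul, ← Finset.sum_add_distrib]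
    exact Finset.sum_congr rfl fun i _ => by ring
  · rw [LinearMap.trace_eq_sum_inner _ b, ← trB_eq A b, Finset.mul_sum]
    refine Finset.sum_congr rfl fun i _ => ?_
    simp [inner_sum, real_inner_smul_right, b.inner_eq_ite]
    ring

set_option maxHeartbeats 1000000 in
theorem conv_sub {γ p ε : ℝ} {f u : En n × ℝ → ℝ} (h : IsSubsol γ p f u (Cyl (En n) 1 1))
    (hosc : ∀ z ∈ Cyl (En n) 1 1, ∀ w ∈ Cyl (En n) 1 1, u z - u w ≤ 1) (hf : ∀ z ∈ Cyl (En n) 1 1, f z ≤ ε) :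
    VisSub γ p ε u (Cyl (En n) 1 1) := by
  obtain ⟨h1, h2⟩ := h
  constructor
  · intro z hz q θ A hq hT
    obtain ⟨S, hS, hSt⟩ := trace_S A
    have key : ∀ e > 0, θ ≤ ε + 2 * opB γ p q A + e * (2 * ‖q‖ ^ γ * (n + (p - 2))) := by
      intro e he
      obtain ⟨C, hC⟩ := hT e he
      rw [Metric.eventually_nhds_iff_ball] at hC
      obtain ⟨r, hr, hC⟩ := hC
      obtain ⟨P, hP⟩ : ∃ P : En n × ℝ → ℝ, P = fun w => u z + ⟪q, w.1⟫ + θ * w.2 + A w.1 w.1 + e * ‖w.1‖ ^ 2 + C * w.2 ^ 2 := ⟨_, rfl⟩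
      have hPd : ContDiff ℝ 2 P := by
        rw [hP]
        have : ContDiff ℝ 2 fun w : En n × ℝ => ‖w.1‖ ^ 2 := contDiff_fst.norm_sq ℝ
        have : ContDiff ℝ 2 fun w : En n × ℝ => A w.1 w.1 := (A.contDiff.comp contDiff_fst).clm_apply contDiff_fst
        have : ContDiff ℝ 2 fun w : En n × ℝ => ⟪q, w.1⟫ := contDiff_const.inner ℝ contDiff_fst
        fun_prop
      obtain ⟨D, hD⟩ := ((isCompact_closedBall (0 : En n × ℝ) 4).image hPd.continuous).bddBelow
      obtain ⟨K, hK⟩ : ∃ K, K = (1 + |D - u z|) / r ^ 4 := ⟨_, rfl⟩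
      have hKr : K * r ^ 4 = 1 + |D - u z| := by rw [hK]; field_simp
      have hK0 : 0 ≤ K := by rw [hK]; positivity
      obtain ⟨φ, hφ⟩ : ∃ φ : En n × ℝ → ℝ, φ = fun w => P (w - z) + K * (‖w.1 - z.1‖ ^ 2 + (w.2 - z.2) ^ 2) ^ 2 := ⟨_, rfl⟩
      have hφd : ContDiff ℝ 2 φ := by
        rw [hφ]
        have : ContDiff ℝ 2 fun w : En n × ℝ => ‖w.1 - z.1‖ ^ 2 := (contDiff_fst.sub contDiff_const).norm_sq ℝ
        have : ContDiff ℝ 2 fun w : En n × ℝ => P (w - z) := hPd.comp (contDiff_id.sub contDiff_const)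
        fun_prop
      have hgr : ∀ y, sGrad φ y z.2 = q + S (y - z.1) + (2 * e) • (y - z.1) + (4 * K * ‖y - z.1‖ ^ 2) • (y - z.1) := by
        intro y
        have hh : HasFDerivAt (fun y : En n => y - z.1) (ContinuousLinearMap.id ℝ (En n)) y := (hasFDerivAt_id y).sub_const z.1
        have hn := hh.norm_sq
        have hA := (A.hasFDerivAt.comp y hh).clm_apply hh
        have hq := (innerSL ℝ q).hasFDerivAt.comp y hh
        have hall := (((hq.const_add (u z)).add hA).add (hn.const_mul e)).add ((hn.pow 2).const_mul K)
        have hg : HasGradientAt (fun y => φ (y, z.2)) (q + S (y - z.1) + (2 * e) • (y - z.1) + (4 * K * ‖y - z.1‖ ^ 2) • (y - z.1)) y := by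
          rw [hasGradientAt_iff_hasFDerivAt]
          refine (hall.congr_fderiv ?_).congr_of_eventuallyEq (Filter.Eventually.of_forall fun y => ?_)
          · ext k
            simp [inner_add_left, real_inner_smul_left, hS]
            ring
          · simp [hφ, hP]
        exact hg.gradient
      have hg0 : sGrad φ z.1 z.2 = q := by rw [hgr]; simp
      have hH : sHess φ z.1 z.2 = S + (2 * e) • ContinuousLinearMap.id ℝ (En n) := by
        unfold sHess
        have hh : HasFDerivAt (fun y : En n => y - z.1) (ContinuousLinearMap.id ℝ (En n)) z.1 := (hasFDerivAt_id z.1).sub_const z.1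
        have hn := hh.norm_sq
        have hall := (((S.hasFDerivAt.comp z.1 hh).const_add q).add (hh.const_smul (2 * e))).add ((hn.const_mul (4 * K)).smul hh)
        have : HasFDerivAt (fun y => sGrad φ y z.2) (S + (2 * e) • ContinuousLinearMap.id ℝ (En n)) z.1 := by
          refine (hall.congr_fderiv ?_).congr_of_eventuallyEq (Filter.Eventually.of_forall fun y => ?_)
          · ext k
            simp
          · simp [hgr]
        exact this.fderiv
      have hdt : deriv (fun s => φ (z.1, s)) z.2 = θ := by
        have hh : HasDerivAt (fun s : ℝ => s - z.2) 1 z.2 := (hasDerivAt_id z.2).sub_const z.2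
        have := (((hh.const_mul θ).const_add (u z)).add ((hh.pow 2).const_mul C)).add (((hh.pow 2).pow 2).const_mul K)
        have : HasDerivAt (fun s => φ (z.1, s)) θ z.2 := by
          refine (this.congr_deriv (by simp)).congr_of_eventuallyEq (Filter.Eventually.of_forall fun y => ?_)
          simp [hφ, hP]
        exact this.deriv
      have hφz : φ z = u z := by simp [hφ, hP]
      have hup : ∀ w ∈ Cyl (En n) 1 1, u w ≤ φ w := by
        intro w hw
        rcases lt_or_ge ‖w - z‖ r with hlt | hge
        · have := hC (w - z) (by simpa using hlt)
          rw [show z + (w - z) = w by abel] at this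
          have e2 : 0 ≤ K * (‖w.1 - z.1‖ ^ 2 + (w.2 - z.2) ^ 2) ^ 2 := by positivity
          simp only [hφ, hP]
          linarith
        · have e1 := hosc w hw z hz
          have e2 : ‖w - z‖ ≤ 4 := by
            rw [Prod.norm_def, max_le_iff, Prod.fst_sub, Prod.snd_sub, Real.norm_eq_abs, abs_le]
            have := norm_sub_le w.1 z.1
            have a1 := hw.1
            have a2 := hw.2
            have a3 := hz.1
            have a4 := hz.2
            refine ⟨by linarith, by linarith, by linarith⟩
          have e3 : D ≤ P (w - z) := hD ⟨w - z, by simpa using e2, rfl⟩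
          have e4 : r ^ 2 ≤ ‖w.1 - z.1‖ ^ 2 + (w.2 - z.2) ^ 2 := by
            rw [Prod.norm_def, le_max_iff, Prod.fst_sub, Prod.snd_sub, Real.norm_eq_abs] at hge
            rcases hge with h | h
            · nlinarith [sq_nonneg (w.2 - z.2)]
            · rw [← sq_abs (w.2 - z.2)]; nlinarith [sq_nonneg ‖w.1 - z.1‖]
          have e5 : r ^ 4 ≤ (‖w.1 - z.1‖ ^ 2 + (w.2 - z.2) ^ 2) ^ 2 := by
            calc r ^ 4 = (r ^ 2) ^ 2 := by ring
              _ ≤ _ := pow_le_pow_left₀ (by positivity) e4 2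
          have e6 := mul_le_mul_of_nonneg_left e5 hK0
          have e7 := neg_abs_le (D - u z)
          simp only [hφ]
          linarith
      have hfin := h1 z hz φ hφd (by rw [hg0]; exact hq) hφz hup
      rw [hg0, hH, hdt] at hfin
      have hq0 : 0 < ‖q‖ := norm_pos_iff.2 hq
      have hop : opVal γ p q (S + (2 * e) • ContinuousLinearMap.id ℝ (En n)) = 2 * opB γ p q A + e * (2 * ‖q‖ ^ γ * (n + (p - 2))) := by
        have t1 : LinearMap.trace ℝ (En n) (S + (2 * e) • ContinuousLinearMap.id ℝ (En n)).toLinearMap = 2 * trB A + 2 * e * n := by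
          rw [ContinuousLinearMap.toLinearMap_add, map_add, hSt, ContinuousLinearMap.toLinearMap_smul, map_smul, show (ContinuousLinearMap.id ℝ (En n)).toLinearMap = LinearMap.id from rfl, LinearMap.trace_id]
          simp
        have t2 : ⟪(S + (2 * e) • ContinuousLinearMap.id ℝ (En n)) q, q⟫ = 2 * A q q + 2 * e * ‖q‖ ^ 2 := by
          simp [inner_add_left, real_inner_smul_left, hS]
          ring
        unfold opVal opB
        rw [t1, t2]
        field_simp
        ring
      rw [hop] at hfin
      linarith [hf z hz]
    by_contra hcon
    push Not at hcon
    obtain ⟨Y, hY⟩ : ∃ Y, Y = 2 * ‖q‖ ^ γ * (n + (p - 2)) := ⟨_, rfl⟩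
    rw [← hY] at key
    have hg : 0 < θ - (ε + 2 * opB γ p q A) := by linarith
    obtain ⟨g, hgd⟩ : ∃ g, g = θ - (ε + 2 * opB γ p q A) := ⟨_, rfl⟩
    rw [← hgd] at hg
    have k1 := key (g / (2 * (|Y| + 1))) (by positivity)
    have k2 : g / (2 * (|Y| + 1)) * Y ≤ g / 2 := by
      rw [div_mul_eq_mul_div, div_le_div_iff₀ (by positivity) (by norm_num)]
      nlinarith [le_abs_self Y, abs_nonneg Y]
    linarith
  · rintro z hz δ hδ φ hφ hφ0 ⟨r, hr, hx⟩
    refine (h2 z hz δ hδ φ hφ hφ0 (fun t ht => (hx z.1 (by simpa using hr)).1 t ht) ⟨r, hr, u z, ?_⟩).trans (hf z hz)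
    intro x hxr
    obtain ⟨a1, t, ht, a2⟩ := hx x hxr
    refine IsGreatest.csSup_eq ⟨⟨t, ht, a2⟩, ?_⟩
    rintro _ ⟨s, hs, rfl⟩
    exact a1 s hs

theorem conv {γ p ε : ℝ} {f u : En n × ℝ → ℝ} (h : IsViscSol γ p f u (Cyl (En n) 1 1))
    (hosc : ∀ z ∈ Cyl (En n) 1 1, ∀ w ∈ Cyl (En n) 1 1, u z - u w ≤ 1) (hf : ∀ z ∈ Cyl (En n) 1 1, |f z| ≤ ε) :
    VisS γ p ε u (Cyl (En n) 1 1) :=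
  ⟨Cyl_open 1 1, h.1, conv_sub h.2.2 hosc fun z hz => (le_abs_self _).trans (hf z hz),
    conv_sub (sub_of_super h.2.1) (fun z hz w hw => by have := hosc w hw z hz; linarith) fun z hz => (neg_le_abs _).trans (hf z hz)⟩
end P9

theorem pCyl_one (n : ℕ) : pCyl n 1 = Cyl (En n) 1 1 := by
  ext z
  simp only [pCyl, Cyl, Set.mem_ofPred_eq, Set.mem_Ioo, one_pow]

set_option maxHeartbeats 1000000 in
theorem rescaled {n : ℕ} {γ p η L ρ ε : ℝ} (hγ : -1 < γ) (hγ0 : γ < 0) (hη : 0 < η) (hη1 : η < 1) (hρ : 0 < ρ) (hρ4 : ρ ≤ 1 / 4) (hε : 0 < ε)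
    (hmain : ∀ {u : En n × ℝ → ℝ}, VisS γ p ε u (Cyl (En n) 1 1) →
      (∀ z ∈ Cyl (En n) 1 1, ∀ z' ∈ Cyl (En n) 1 1, u z - u z' ≤ 5) → ∃ l : En n, ‖l‖ ≤ L ∧ FlatAt u l ρ (η / 2))
    {u : En n × ℝ → ℝ} (hu : VisS γ p ε u (Cyl (En n) 1 1)) {r a : ℝ} (hr : 0 < r) (hr1 : r ≤ 1) (ha : 0 < a) (ha1 : a ≤ 1) (hra : r ≤ a) {l : En n}
    (hl : ‖l‖ ≤ 2 * a) (hosc : ∀ z ∈ iCyl n γ r a, ∀ w ∈ iCyl n γ r a, (u z - ⟪l, z.1⟫) - (u w - ⟪l, w.1⟫) ≤ η * r * a) :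
    ∃ l' : En n, (∀ z ∈ iCyl n γ (r * ρ) (a * (1 / 2)), ∀ w ∈ iCyl n γ (r * ρ) (a * (1 / 2)),
      (u z - ⟪l', z.1⟫) - (u w - ⟪l', w.1⟫) ≤ η * (r * ρ) * (a * (1 / 2))) ∧ ‖l'‖ ≤ L * a := by
  obtain ⟨s, hs⟩ : ∃ s, s = r ^ 2 * a ^ (-γ) := ⟨_, rfl⟩
  obtain ⟨c, hc⟩ : ∃ c, c = 1 / (r * a) := ⟨_, rfl⟩
  have hag : 0 < a ^ (-γ) := rpow_pos_of_pos ha _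
  have hs0 : 0 < s := by rw [hs]; positivity
  have hc0 : 0 < c := by rw [hc]; positivity
  have hcra : c * (r * a) = 1 := by rw [hc]; field_simp
  have hag1 : a ^ (-γ) ≤ 1 := rpow_le_one ha.le ha1 (by linarith)
  have hs1 : s ≤ 1 := by rw [hs]; nlinarith [pow_le_one₀ (n := 2) hr.le hr1, pow_pos hr 2]
  have hsc : s = r ^ 2 * (c * r) ^ γ := by
    rw [hs, show c * r = a⁻¹ by rw [hc]; field_simp, inv_rpow ha.le, rpow_neg ha.le]
  have hin1 : ∀ z ∈ Cyl (En n) 1 1, aff (0, 0) r s z ∈ Cyl (En n) 1 1 ∧ aff (0, 0) r s z ∈ iCyl n γ r a := by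
    rintro ⟨x, t⟩ ⟨b1, b2, b3⟩
    dsimp only at b1 b2 b3
    have a1 : ‖r • x‖ < r := by rw [norm_smul, Real.norm_of_nonneg hr.le]; nlinarith
    have a2 : -s < s * t := by nlinarith
    have a3 : s * t < 0 := by nlinarith
    refine ⟨⟨?_, ?_, ?_⟩, ?_, ?_, ?_⟩ <;> simp only [aff, zero_add]
    · linarith
    · linarith
    · exact a3
    · exact a1
    · rw [← hs]; exact a2
    · exact a3
  have hcs : c * s * ε ≤ ε := by
    have h1 : c * s ≤ 1 := by
      have e1 : a ^ (-γ) * a ≤ 1 := by nlinarith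
      have e2 : a ^ (-(γ + 1)) = a ^ (-γ) / a := by
        rw [show -(γ + 1) = -γ - 1 by ring, rpow_sub ha, rpow_one]
      have e3 : c * s = r * (a ^ (-γ) / a) := by rw [hc, hs]; field_simp
      rw [e3, mul_div_assoc', div_le_one ha]
      nlinarith
    nlinarith
  have hv := (scale hu (0, 0) hc0 hr hsc (Cyl_open 1 1) fun z hz => (hin1 z hz).1).le hcs
  obtain ⟨l0, hl0, hfl⟩ := hmain hv (by
    intro z hz w hw
    have i1 := (hin1 z hz).2
    have i2 := (hin1 w hw).2
    have := hosc _ i1 _ i2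
    have j1 := real_inner_le_norm l ((aff (0, 0) r s z).1 - (aff (0, 0) r s w).1)
    have j2 := norm_sub_le (aff (0, 0) r s z).1 (aff (0, 0) r s w).1
    have j3 : ‖(aff (0, 0) r s z).1 - (aff (0, 0) r s w).1‖ ≤ 2 * r := by linarith [i1.1, i2.1]
    have j4 : ‖l‖ * ‖(aff (0, 0) r s z).1 - (aff (0, 0) r s w).1‖ ≤ (2 * a) * (2 * r) :=
      mul_le_mul hl j3 (norm_nonneg _) (by positivity)
    rw [inner_sub_right] at j1
    have j5 : η * r * a ≤ r * a := by nlinarith [mul_pos hr ha]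
    have j6 : u (aff (0, 0) r s z) - u (aff (0, 0) r s w) ≤ 5 * (r * a) := by linarith
    have j7 := mul_le_mul_of_nonneg_left j6 hc0.le
    rw [← mul_sub]
    linarith [show c * (5 * (r * a)) = 5 * (c * (r * a)) by ring])
  refine ⟨a • l0, ?_, by rw [norm_smul, Real.norm_of_nonneg ha.le, mul_comm]; exact mul_le_mul_of_nonneg_right hl0 ha.le⟩
  have hin : ∀ z ∈ iCyl n γ (r * ρ) (a * (1 / 2)), ((1 / r) • z.1, z.2 / s) ∈ Cyl (En n) ρ (ρ ^ 2) := by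
    rintro ⟨x, t⟩ ⟨b1, b2, b3⟩
    dsimp only at b1 b2 b3
    refine ⟨?_, ?_, ?_⟩ <;> dsimp only
    · rw [norm_smul, Real.norm_of_nonneg (by positivity), one_div_mul_eq_div, div_lt_iff₀ hr]
      linarith
    · rw [lt_div_iff₀ hs0]
      rw [mul_rpow ha.le (by norm_num)] at b2
      have h2 : ((1 / 2 : ℝ)) ^ (-γ) ≤ 1 := rpow_le_one (by norm_num) (by norm_num) (by linarith)
      have h3 : (r * ρ) ^ 2 * (a ^ (-γ) * (1 / 2) ^ (-γ)) ≤ ρ ^ 2 * s := by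
        rw [hs, show (r * ρ) ^ 2 * (a ^ (-γ) * (1 / 2 : ℝ) ^ (-γ)) = (ρ ^ 2 * (r ^ 2 * a ^ (-γ))) * (1 / 2 : ℝ) ^ (-γ) by ring]
        exact mul_le_of_le_one_right (by positivity) h2
      linarith
    · exact div_neg_of_neg_of_pos b3 hs0
  have hev : ∀ z : En n × ℝ, aff (0, 0) r s ((1 / r) • z.1, z.2 / s) = z := by
    rintro ⟨x, t⟩
    simp only [aff, zero_add, smul_smul]
    rw [mul_one_div_cancel hr.ne', one_smul, mul_div_cancel₀ _ hs0.ne']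
  intro z hz w hw
  have := hfl _ (hin z hz) _ (hin w hw)
  simp only [hev, real_inner_smul_right] at this
  have e1 : 1 / r = c * a := by rw [hc]; field_simp
  rw [e1] at this
  simp only [real_inner_smul_left]
  have e2 : c * ((u z - a * ⟪l0, z.1⟫) - (u w - a * ⟪l0, w.1⟫)) ≤ c * (η * (r * ρ) * (a * (1 / 2))) := by
    rw [show c * (η * (r * ρ) * (a * (1 / 2))) = c * (r * a) * (η / 2 * ρ) by ring, hcra]
    linarith
  exact le_of_mul_le_mul_left e2 hc0

/-- **Corollary 3.3 (iteration / improvement of flatness).** For `-1 < γ < 0`, `1 < p < ∞`,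
`η ∈ (0,1)`, there exist `ε₀ > 0`, `ρ > 0`, `δ ∈ (0,1)` with `ρ < (1-δ)^{γ+1}`, `B > 0`,
`C₁ > 0`, all depending only on `p, n, γ, η`, such that: if `u` is a viscosity solution with
`osc_{Q₁} u ≤ 1` and `‖f‖_∞ ≤ ε₀`, and if for `i = 0,…,k` there are `l i` with
`|l i| ≤ 2(1-δ)^i` and `osc_{Q_{ρ^i}^{(1-δ)^i}} (u - l i · x) ≤ η ρ^i (1-δ)^i`, then there
is `l'` with `osc_{Q_{ρ^{k+1}}^{(1-δ)^{k+1}}} (u - l'·x) ≤ η ρ^{k+1} (1-δ)^{k+1}`,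
`|l'| ≤ B (1-δ)^k` and `|l' - l k| ≤ C₁ (1-δ)^k`. -/
theorem iteration_improvement
    (n : ℕ) (hn : 1 ≤ n) (γ p η : ℝ) (hγ : γ ∈ Set.Ioo (-1 : ℝ) 0) (hp : 1 < p)
    (hη : η ∈ Set.Ioo (0 : ℝ) 1) :
    ∃ ε₀ : ℝ, 0 < ε₀ ∧ ∃ ρ : ℝ, 0 < ρ ∧ ∃ δ ∈ Set.Ioo (0 : ℝ) 1,
      ρ < (1 - δ) ^ (γ + 1) ∧ ∃ B : ℝ, 0 < B ∧ ∃ C₁ : ℝ, 0 < C₁ ∧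
      ∀ (u f : En n × ℝ → ℝ),
        IsViscSol γ p f u (pCyl n 1) →
        (∀ z ∈ pCyl n 1, ∀ w ∈ pCyl n 1, u z - u w ≤ 1) →
        (∀ z ∈ pCyl n 1, |f z| ≤ ε₀) →
        ∀ (k : ℕ) (l : ℕ → En n),
          (∀ i ≤ k, ‖l i‖ ≤ 2 * (1 - δ) ^ i ∧
            ∀ z ∈ iCyl n γ (ρ ^ i) ((1 - δ) ^ i), ∀ w ∈ iCyl n γ (ρ ^ i) ((1 - δ) ^ i),
              (u z - ⟪l i, z.1⟫) - (u w - ⟪l i, w.1⟫) ≤ η * ρ ^ i * (1 - δ) ^ i) →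
          ∃ l' : En n,
            (∀ z ∈ iCyl n γ (ρ ^ (k+1)) ((1 - δ) ^ (k+1)),
              ∀ w ∈ iCyl n γ (ρ ^ (k+1)) ((1 - δ) ^ (k+1)),
               (u z - ⟪l', z.1⟫) - (u w - ⟪l', w.1⟫) ≤ η * ρ ^ (k+1) * (1 - δ) ^ (k+1)) ∧
            ‖l'‖ ≤ B * (1 - δ) ^ k ∧ ‖l' - l k‖ ≤ C₁ * (1 - δ) ^ k := by
  obtain ⟨hγ1, hγ0⟩ := hγ
  obtain ⟨hη0, hη1⟩ := hη
  obtain ⟨L, hL, ρ, hρ, hρ4, ε, hε, hmain⟩ := main0 (En n) (a := η / 2) hγ1 hγ0 hp (by linarith)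
  refine ⟨ε, hε, ρ, hρ, 1 / 2, ⟨by norm_num, by norm_num⟩, ?_, L, by linarith, L + 2, by linarith, ?_⟩
  · rw [show (1 : ℝ) - 1 / 2 = 1 / 2 by norm_num]
    have : (1 / 2 : ℝ) ^ (1 : ℝ) ≤ (1 / 2 : ℝ) ^ (γ + 1) :=
      rpow_le_rpow_of_exponent_ge (by norm_num) (by norm_num) (by linarith)
    rw [rpow_one] at this
    linarith
  intro u f hu hosc hf k l hk
  rw [show (1 : ℝ) - 1 / 2 = 1 / 2 by norm_num] at *
  rw [pCyl_one] at hu hosc hf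
  obtain ⟨hl, hk⟩ := hk k le_rfl
  obtain ⟨l', h1, h2⟩ := rescaled hγ1 hγ0 hη0 hη1 hρ hρ4 hε hmain (conv hu hosc hf) (r := ρ ^ k) (a := (1 / 2) ^ k) (by positivity)
    (pow_le_one₀ hρ.le (by linarith)) (by positivity) (pow_le_one₀ (by norm_num) (by norm_num)) (pow_le_pow_left₀ hρ.le (by linarith) k) hl hk
  refine ⟨l', ?_, h2, ?_⟩
  · rw [pow_succ, pow_succ]; exact h1
  · have := norm_sub_le l' (l k)
    linarith
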